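/- Let α > 0, κ₁, κ_{−1} ∈ ℝ, and let g(j) be a sequence of real numbers given for j ≥ 2 by g(j) = (κ₁ + (−1)^j κ_{−1}) j^{-1} (log j)^{−α} + g̃₁(j) + (−1)^j g̃_{−1}(j), where the error sequences g̃₁, g̃_{−1} satisfy g̃_{±1}^{(m)}(j) = o(j^{−1−m} ⟨log j⟩^{−α}) as j → ∞ for all m = 0, 1, …, N(α). Then the eigenvalues of the Hankel operator G with matrix elements g(j) satisfy λ_n^±(G) = b^± n^{−α} + o(n^{−α}) as n → ∞, where b^± = τ(α) ((κ₁)_±^{1/α} + (κ_{−1})_±^{1/α})^α. -/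

import Mathlib

noncomputable section
open MeasureTheory Filter Asymptotics Set

/-- Lebesgue measure restricted to `(0, ∞)`. -/
abbrev muP : Measure ℝ := volume.restrict (Set.Ioi (0:ℝ))

/-- The Hilbert space `L²((0,∞))`. -/
abbrev HSp := Lp ℂ 2 muP

/-- The Hilbert space `L²(ℝ)`. -/
abbrev HLine := Lp ℂ 2 (volume : Measure ℝ)

/-- The Hilbert space `ℓ²(ℤ₊)`. -/
abbrev ellTwo := lp (fun _ : ℕ => ℂ) 2

/-- `H` is the Hankel operator with kernel `h` : `(Hu)(t) = ∫₀^∞ h(t+s) u(s) ds`. -/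
def IsHankel (h : ℝ → ℂ) (H : HSp →L[ℂ] HSp) : Prop :=
  ∀ u : HSp, ∀ᵐ t ∂muP, (H u : ℝ → ℂ) t = ∫ s in Set.Ioi (0:ℝ), h (t + s) * (u : ℝ → ℂ) s

/-- `G` is the discrete Hankel operator with matrix elements `g` :
`(Gu)(j) = ∑ₖ g(j+k) u(k)`. -/
def IsHankelD (g : ℕ → ℂ) (G : ellTwo →L[ℂ] ellTwo) : Prop :=
  ∀ u : ellTwo, ∀ j : ℕ, (G u : ℕ → ℂ) j = ∑' k : ℕ, g (j + k) * (u : ℕ → ℂ) k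

/-- `λₙ⁺(K)`, the `n`-th positive eigenvalue (non-increasing, with multiplicity) of a compact
self-adjoint operator `K`, expressed through the Courant–Fischer max-min principle
(the value is `0` if `K` has fewer than `n` positive eigenvalues). -/
def posEig {E : Type*} [NormedAddCommGroup E] [InnerProductSpace ℂ E]
    (K : E →L[ℂ] E) (n : ℕ) : ℝ :=
  ⨆ V : {V : Submodule ℂ E // Module.finrank ℂ V = n},
    ⨅ x : {x : E // x ∈ V.1 ∧ ‖x‖ = 1}, (@inner ℂ E _ (K x.1) x.1).re

/-- `λₙ⁻(K) = λₙ⁺(-K)`. -/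
def negEig {E : Type*} [NormedAddCommGroup E] [InnerProductSpace ℂ E]
    (K : E →L[ℂ] E) (n : ℕ) : ℝ := posEig (-K) n

/-- `sₙ(K)`, the `n`-th singular value of a compact operator `K`, via the max–min principle. -/
def singVal {E : Type*} [NormedAddCommGroup E] [InnerProductSpace ℂ E]
    (K : E →L[ℂ] E) (n : ℕ) : ℝ :=
  ⨆ V : {V : Submodule ℂ E // Module.finrank ℂ V = n},
    ⨅ x : {x : E // x ∈ V.1 ∧ ‖x‖ = 1}, ‖K x.1‖

/-- `N(α) = [α] + 1` if `α ≥ 1/2`, and `N(α) = 0` if `α < 1/2`. -/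
def Nal (α : ℝ) : ℕ := if α < 1/2 then 0 else Nat.floor α + 1

/-- The constant `τ(α) = 2^{-α} π^{1-2α} B(1/(2α), 1/2)^α`. -/
def tauC (α : ℝ) : ℝ :=
  (2:ℝ) ^ (-α) * Real.pi ^ (1 - 2*α) *
    (Real.Gamma (1/(2*α)) * Real.Gamma (1/2) / Real.Gamma (1/(2*α) + 1/2)) ^ α

/-- Iterated differences of a sequence: `g⁽⁰⁾ = g`, `g⁽ᵐ⁾(j) = g⁽ᵐ⁻¹⁾(j+1) - g⁽ᵐ⁻¹⁾(j)`. -/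
def iterDiff {E : Type*} [Sub E] (g : ℕ → E) : ℕ → ℕ → E
  | 0 => g
  | m + 1 => fun j => iterDiff g m (j + 1) - iterDiff g m j

/-- The standard function `v(x) = √π / √(cosh πx)`. -/
def vStd (x : ℝ) : ℝ := Real.sqrt Real.pi / Real.sqrt (Real.cosh (Real.pi * x))

/-- The Fourier transform `(Φw)(ξ) = (2π)^{-1/2} ∫ e^{-ixξ} w(x) dx`. -/
def fou (w : ℝ → ℂ) (ξ : ℝ) : ℂ :=
  (((2 * Real.pi) ^ (-(1:ℝ)/2) : ℝ) : ℂ) * ∫ x : ℝ, Complex.exp (-(Complex.I * x * ξ)) * w x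

/-- `h ∈ L^∞_loc((0,∞))`. -/
def LinftyLoc {E : Type*} [NormedAddCommGroup E] (h : ℝ → E) : Prop :=
  AEStronglyMeasurable h muP ∧
    ∀ K : Set ℝ, IsCompact K → K ⊆ Set.Ioi 0 → ∃ C, ∀ᵐ t ∂muP, t ∈ K → ‖h t‖ ≤ C

/-- The quadratic-form characterization of the pseudodifferential operator
`A = v(X) s(D) v(X)` on `L²(ℝ)`:  `⟪g, A f⟫ = ∫ conj((Φ(v·g))(ξ)) s(ξ) (Φ(v·f))(ξ) dξ`
for all `f, g` represented by smooth compactly supported functions. -/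
def IsVSDV (v : ℝ → ℝ) (s : ℝ → ℂ) (A : HLine →L[ℂ] HLine) : Prop :=
  ∀ (f g : HLine) (F G : ℝ → ℂ),
    ContDiff ℝ (⊤ : ℕ∞) F → HasCompactSupport F → ContDiff ℝ (⊤ : ℕ∞) G → HasCompactSupport G →
    (f : ℝ → ℂ) =ᵐ[volume] F → (g : ℝ → ℂ) =ᵐ[volume] G →
    (@inner ℂ HLine _ g (A f)) =
      ∫ ξ : ℝ, (starRingEnd ℂ) (fou (fun x => (v x : ℂ) * G x) ξ) * s ξ *
        fou (fun x => (v x : ℂ) * F x) ξ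

namespace HankelEig

variable {E : Type*} [NormedAddCommGroup E] [InnerProductSpace ℂ E]

/-- The quadratic form `q` is at most `l ‖u‖²` on the orthogonal complement of a subspace of
dimension at most `x`. -/
def UB (q : E → ℝ) (x l : ℝ) : Prop :=
  ∃ W : Submodule ℂ E, FiniteDimensional ℂ W ∧ (Module.finrank ℂ W : ℝ) ≤ x ∧
    ∀ u ∈ Wᗮ, q u ≤ l * ‖u‖ ^ 2

lemma UB.mono {q q' : E → ℝ} {x x' l l' : ℝ} (h : UB q x l) (hq : ∀ u, q' u ≤ q u)
    (hx : x ≤ x') (hl : l ≤ l') : UB q' x' l' := by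
  obtain ⟨W, hW, hd, hu⟩ := h
  exact ⟨W, hW, hd.trans hx, fun u hW => (hq u).trans ((hu u hW).trans (by gcongr))⟩

lemma UB.of_le {q : E → ℝ} {l : ℝ} (h : ∀ u, q u ≤ l * ‖u‖ ^ 2) : UB q 0 l :=
  ⟨⊥, inferInstance, by simp, fun u _ => h u⟩

lemma UB.add {q q' : E → ℝ} {x x' l l' : ℝ} (h : UB q x l) (h' : UB q' x' l') :
    UB (fun u => q u + q' u) (x + x') (l + l') := by
  obtain ⟨W, hW, hd, hu⟩ := h
  obtain ⟨W', hW', hd', hu'⟩ := h'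
  refine ⟨W ⊔ W', inferInstance, ?_, fun u hU => ?_⟩
  · have := Submodule.finrank_add_le_finrank_add_finrank W W'
    have h2 : (Module.finrank ℂ ↥(W ⊔ W') : ℝ) ≤ Module.finrank ℂ W + Module.finrank ℂ W' := by
      exact_mod_cast this
    linarith
  · have h1 := hu u (Submodule.orthogonal_le le_sup_left hU)
    have h2 := hu' u (Submodule.orthogonal_le le_sup_right hU)
    linarith

lemma orthonormal_snoc {m : ℕ} {v : Fin m → E} (hv : Orthonormal ℂ v) {u : E} (hu : ‖u‖ = 1)
    (huv : ∀ i, inner ℂ (v i) u = 0) : Orthonormal ℂ (Fin.snoc v u : Fin (m + 1) → E) := by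
  refine ⟨fun i => ?_, fun i j hij => ?_⟩
  · refine Fin.lastCases ?_ (fun i => ?_) i
    · simpa using hu
    · simpa using hv.1 i
  · revert hij
    refine Fin.lastCases ?_ (fun i => ?_) i <;> refine Fin.lastCases ?_ (fun j => ?_) j
    · simp
    · intro _
      simpa using inner_eq_zero_symm.1 (huv j)
    · intro _
      simpa using huv i
    · intro hij
      simpa using hv.2 (fun h => hij (by rw [h]))

/-- Greedy selection: if orthonormal families on which `q > l` have at most `x` members, then
`q ≤ l` off a subspace of dimension at most `x`. -/
lemma UB.of_orthonormal {q : E → ℝ} {x l : ℝ} (hq : ∀ (c : ℂ) u, q (c • u) = ‖c‖ ^ 2 * q u)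
    (h : ∀ (m : ℕ) (v : Fin m → E), Orthonormal ℂ v → (∀ i, l < q (v i)) → (m : ℝ) ≤ x) :
    UB q x l := by
  classical
  let P : ℕ → Prop := fun m => ∃ v : Fin m → E, Orthonormal ℂ v ∧ ∀ i, l < q (v i)
  have hP0 : P 0 := ⟨Fin.elim0, ⟨fun i => i.elim0, fun i => i.elim0⟩, fun i => i.elim0⟩
  have hPb : ∀ m, P m → m ≤ ⌊x⌋₊ := by
    rintro m ⟨v, hv, hl⟩
    exact Nat.le_floor (h m v hv hl)
  obtain ⟨m, hm⟩ : ∃ m, m = Nat.findGreatest P ⌊x⌋₊ := ⟨_, rfl⟩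
  obtain ⟨v, hv, hl⟩ : P m := hm ▸ Nat.findGreatest_spec (P := P) (Nat.zero_le ⌊x⌋₊) hP0
  have hmax : ¬ P (m + 1) := fun hP => by
    have := Nat.le_findGreatest (hPb _ hP) hP
    omega
  refine ⟨Submodule.span ℂ (Set.range v), FiniteDimensional.span_of_finite ℂ (Set.finite_range v),
    ?_, fun u hu => ?_⟩
  · rw [finrank_span_eq_card hv.linearIndependent]
    simpa using h m v hv hl
  · by_contra! hlt
    have hu0 : u ≠ 0 := by
      rintro rfl
      have := hq 0 0
      simp only [smul_zero, norm_zero] at this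
      norm_num at this hlt
      linarith
    have hn : ‖u‖ ≠ 0 := norm_ne_zero_iff.2 hu0
    refine hmax ⟨Fin.snoc v (((‖u‖⁻¹ : ℝ) : ℂ) • u), orthonormal_snoc hv ?_ ?_, fun i => ?_⟩
    · rw [norm_smul, Complex.norm_real, norm_inv, norm_norm, inv_mul_cancel₀ hn]
    · intro i
      rw [inner_smul_right, (Submodule.mem_orthogonal _ u).1 hu _ (Submodule.subset_span ⟨i, rfl⟩),
        mul_zero]
    · refine Fin.lastCases ?_ (fun i => ?_) i
      · rw [Fin.snoc_last, hq, Complex.norm_real, norm_inv, norm_norm, inv_pow, inv_mul_eq_div,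
          lt_div_iff₀ (by positivity)]
        exact hlt
      · simpa using hl i

lemma UB.of_trace {q : E → ℝ} {τ l : ℝ} (hl : 0 < l)
    (hq : ∀ (c : ℂ) u, q (c • u) = ‖c‖ ^ 2 * q u)
    (h : ∀ (m : ℕ) (v : Fin m → E), Orthonormal ℂ v → ∑ i, q (v i) ≤ τ) :
    UB q (τ / l) l := by
  refine UB.of_orthonormal hq fun m v hv hlv => ?_
  rw [le_div_iff₀ hl]
  calc (m : ℝ) * l = ∑ _i : Fin m, l := by simp
    _ ≤ ∑ i, q (v i) := Finset.sum_le_sum fun i _ => (hlv i).le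
    _ ≤ τ := h m v hv

lemma UB.of_sq_trace {q : E → ℝ} {Q l : ℝ} (hl : 0 < l)
    (hq : ∀ (c : ℂ) u, q (c • u) = ‖c‖ ^ 2 * q u)
    (h : ∀ (m : ℕ) (v : Fin m → E), Orthonormal ℂ v → ∑ i, q (v i) ^ 2 ≤ Q) :
    UB q (Q / l ^ 2) l := by
  refine UB.of_orthonormal hq fun m v hv hlv => ?_
  rw [le_div_iff₀ (by positivity)]
  calc (m : ℝ) * l ^ 2 = ∑ _i : Fin m, l ^ 2 := by simp
    _ ≤ ∑ i, q (v i) ^ 2 := Finset.sum_le_sum fun i _ => by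
        have := (hlv i).le
        gcongr
    _ ≤ Q := h m v hv

/-- `q` is homogeneous, with `∑ q (v i) ≤ τ` along orthonormal families. -/
def Tr (q : E → ℝ) (τ : ℝ) : Prop :=
  (∀ (c : ℂ) u, q (c • u) = ‖c‖ ^ 2 * q u) ∧
    ∀ (m : ℕ) (v : Fin m → E), Orthonormal ℂ v → ∑ i, q (v i) ≤ τ

lemma Tr.add {q q' : E → ℝ} {τ τ' : ℝ} (h : Tr q τ) (h' : Tr q' τ') :
    Tr (fun u => q u + q' u) (τ + τ') :=
  ⟨fun c u => by simp only [h.1, h'.1]; ring, fun m v hv => by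
    rw [Finset.sum_add_distrib]
    exact add_le_add (h.2 m v hv) (h'.2 m v hv)⟩

/-- `q` is at most a form of rank at most `x` plus a form of trace at most `τ`. -/
def FT (q : E → ℝ) (x τ : ℝ) : Prop :=
  ∃ q₁ q₂ : E → ℝ, (∀ u, q u ≤ q₁ u + q₂ u) ∧ UB q₁ x 0 ∧ Tr q₂ τ

lemma FT.add {q q' : E → ℝ} {x x' τ τ' : ℝ} (h : FT q x τ) (h' : FT q' x' τ') :
    FT (fun u => q u + q' u) (x + x') (τ + τ') := by
  obtain ⟨q₁, q₂, hq, h₁, h₂⟩ := h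
  obtain ⟨r₁, r₂, hr, k₁, k₂⟩ := h'
  refine ⟨fun u => q₁ u + r₁ u, fun u => q₂ u + r₂ u, fun u => ?_, ?_, h₂.add k₂⟩
  · have := hq u
    have := hr u
    linarith
  · simpa using h₁.add k₁

lemma FT.sum {ι : Type*} (s : Finset ι) {q : ι → E → ℝ} {x τ : ι → ℝ}
    (h : ∀ i ∈ s, FT (q i) (x i) (τ i)) :
    FT (fun u => ∑ i ∈ s, q i u) (∑ i ∈ s, x i) (∑ i ∈ s, τ i) := by
  classical
  induction s using Finset.induction_on with
  | empty =>
    refine ⟨fun _ => 0, fun _ => 0, by simp, ?_, by simp, by simp⟩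
    simpa using UB.of_le (E := E) (q := fun _ => 0) (l := 0) (by simp)
  | insert a s ha ih =>
    simp only [Finset.sum_insert ha]
    exact (h a (by simp)).add (ih fun i hi => h i (by simp [hi]))

lemma FT.toUB {q : E → ℝ} {x τ l : ℝ} (h : FT q x τ) (hl : 0 < l) : UB q (x + τ / l) l := by
  obtain ⟨q₁, q₂, hq, h₁, h₂⟩ := h
  exact (h₁.add (UB.of_trace hl h₂.1 h₂.2)).mono hq le_rfl (by simp)

/-- A form `q u = ∑ Re (c_r ⟪u, a_r⟫ ⟪b_r, u⟫)` of finite nuclear norm. -/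
lemma Tr.of_nuclear {ι : Type*} (s : Finset ι) (c : ι → ℂ) (a b : ι → E) :
    Tr (fun u => ∑ r ∈ s, (c r * inner ℂ u (a r) * inner ℂ (b r) u).re)
      (∑ r ∈ s, ‖c r‖ * ‖a r‖ * ‖b r‖) := by
  refine ⟨fun z u => ?_, fun m v hv => ?_⟩
  · rw [Finset.mul_sum]
    refine Finset.sum_congr rfl fun r _ => ?_
    rw [inner_smul_left, inner_smul_right, ← Complex.re_ofReal_mul]
    congr 1
    push_cast
    rw [← Complex.conj_mul' z]
    ring
  · rw [Finset.sum_comm]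
    refine Finset.sum_le_sum fun r _ => ?_
    have h1 : ∑ i, ‖inner ℂ (v i) (a r)‖ ^ 2 ≤ ‖a r‖ ^ 2 := by
      simpa using hv.sum_inner_products_le (s := Finset.univ) (x := a r)
    have h2 : ∑ i, ‖inner ℂ (v i) (b r)‖ ^ 2 ≤ ‖b r‖ ^ 2 := by
      simpa using hv.sum_inner_products_le (s := Finset.univ) (x := b r)
    calc ∑ i, (c r * inner ℂ (v i) (a r) * inner ℂ (b r) (v i)).re
        ≤ ∑ i, ‖c r‖ * (‖inner ℂ (v i) (a r)‖ * ‖inner ℂ (v i) (b r)‖) := by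
          refine Finset.sum_le_sum fun i _ => (Complex.re_le_norm _).trans ?_
          rw [norm_mul, norm_mul, norm_inner_symm (b r), mul_assoc]
      _ = ‖c r‖ * ∑ i, ‖inner ℂ (v i) (a r)‖ * ‖inner ℂ (v i) (b r)‖ := by rw [Finset.mul_sum]
      _ ≤ ‖c r‖ * (‖a r‖ * ‖b r‖) := by
          gcongr
          refine abs_le_of_sq_le_sq' ?_ (by positivity) |>.2
          calc _ ≤ (∑ i, ‖inner ℂ (v i) (a r)‖ ^ 2) * ∑ i, ‖inner ℂ (v i) (b r)‖ ^ 2 :=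
                Finset.sum_mul_sq_le_sq_mul_sq _ _ _
            _ ≤ ‖a r‖ ^ 2 * ‖b r‖ ^ 2 := by gcongr
            _ = _ := by ring
      _ = _ := by ring

/-- A form with Hilbert–Schmidt matrix `M` in an orthonormal family `b`. -/
lemma UB.of_hilbertSchmidt {ι : Type*} [Fintype ι] (M : ι → ι → ℂ) {b : ι → E}
    (hb : Orthonormal ℂ b) {l Q : ℝ} (hl : 0 < l) (hQ : ∑ i, ∑ j, ‖M i j‖ ^ 2 ≤ Q) :
    UB (fun u => (∑ i, ∑ j, M i j * inner ℂ u (b i) * inner ℂ (b j) u).re) (Q / l ^ 2) l := by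
  refine UB.of_sq_trace hl (fun z u => ?_) fun m v hv => ?_
  · rw [← Complex.re_ofReal_mul, Finset.mul_sum]
    congr 1
    refine Finset.sum_congr rfl fun i _ => ?_
    rw [Finset.mul_sum]
    refine Finset.sum_congr rfl fun j _ => ?_
    rw [inner_smul_left, inner_smul_right]
    push_cast
    rw [← Complex.conj_mul' z]
    ring
  · let y : ι → E := fun i => ∑ j, (starRingEnd ℂ) (M i j) • b j
    have hy : ∀ i u, inner ℂ (y i) u = ∑ j, M i j * inner ℂ (b j) u := by
      intro i u
      simp only [y, sum_inner, inner_smul_left, Complex.conj_conj]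
    have hyn : ∀ i, ‖y i‖ ^ 2 = ∑ j, ‖M i j‖ ^ 2 := by
      intro i
      have := hb.inner_sum (fun j => (starRingEnd ℂ) (M i j)) (fun j => (starRingEnd ℂ) (M i j))
        Finset.univ
      have h2 : ((‖y i‖ ^ 2 : ℝ) : ℂ) = ((∑ j, ‖M i j‖ ^ 2 : ℝ) : ℂ) := by
        push_cast
        refine ((inner_self_eq_norm_sq_to_K (𝕜 := ℂ) (y i)).symm.trans this).trans
          (Finset.sum_congr rfl fun j _ => ?_)
        rw [Complex.conj_conj, Complex.mul_conj']
      exact_mod_cast h2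
    have key : ∀ u : E, ‖u‖ = 1 →
        (∑ i, ∑ j, M i j * inner ℂ u (b i) * inner ℂ (b j) u).re ^ 2
          ≤ ∑ i, ‖inner ℂ (y i) u‖ ^ 2 := by
      intro u hu
      have e1 : ∑ i, ∑ j, M i j * inner ℂ u (b i) * inner ℂ (b j) u
          = ∑ i, inner ℂ u (b i) * inner ℂ (y i) u := by
        refine Finset.sum_congr rfl fun i _ => ?_
        rw [hy, Finset.mul_sum]
        exact Finset.sum_congr rfl fun j _ => by ring
      have e2 : ∑ i, ‖inner ℂ (b i) u‖ ^ 2 ≤ 1 := by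
        have := hb.sum_inner_products_le (s := Finset.univ) (x := u)
        rwa [hu, one_pow] at this
      rw [e1]
      have e3 : |(∑ i, inner ℂ u (b i) * inner ℂ (y i) u).re|
          ≤ ∑ i, ‖inner ℂ (b i) u‖ * ‖inner ℂ (y i) u‖ := by
        refine (Complex.abs_re_le_norm _).trans ((norm_sum_le _ _).trans ?_)
        refine Finset.sum_le_sum fun i _ => ?_
        rw [norm_mul, norm_inner_symm]
      calc _ ≤ (∑ i, ‖inner ℂ (b i) u‖ * ‖inner ℂ (y i) u‖) ^ 2 := by
            rw [← sq_abs]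
            gcongr
        _ ≤ (∑ i, ‖inner ℂ (b i) u‖ ^ 2) * ∑ i, ‖inner ℂ (y i) u‖ ^ 2 :=
            Finset.sum_mul_sq_le_sq_mul_sq _ _ _
        _ ≤ 1 * ∑ i, ‖inner ℂ (y i) u‖ ^ 2 := by gcongr
        _ = _ := one_mul _
    calc _ ≤ ∑ k, ∑ i, ‖inner ℂ (y i) (v k)‖ ^ 2 :=
          Finset.sum_le_sum fun k _ => key _ (hv.1 k)
      _ = ∑ i, ∑ k, ‖inner ℂ (v k) (y i)‖ ^ 2 := by
          rw [Finset.sum_comm]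
          simp_rw [norm_inner_symm]
      _ ≤ ∑ i, ‖y i‖ ^ 2 := Finset.sum_le_sum fun i _ => by
          simpa using hv.sum_inner_products_le (s := Finset.univ) (x := y i)
      _ ≤ Q := by
          simpa only [hyn] using hQ

/-- A form depending only on finitely many functionals. -/
lemma UB.of_finite {ι : Type*} (s : Finset ι) (a : ι → E) {q : E → ℝ}
    (h : ∀ u, (∀ i ∈ s, inner ℂ (a i) u = 0) → q u ≤ 0) : UB q s.card 0 := by
  classical
  refine ⟨Submodule.span ℂ (s.image a : Finset E), inferInstance, ?_, fun u hu => ?_⟩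
  · exact_mod_cast (finrank_span_finset_le_card _).trans Finset.card_image_le
  · rw [zero_mul]
    refine h u fun i hi => (Submodule.mem_orthogonal _ u).1 hu _ (Submodule.subset_span ?_)
    simpa using ⟨i, hi, rfl⟩

/-- The quadratic form `q` is at least `l ‖u‖²` on a subspace of dimension at least `y`. -/
def LB (q : E → ℝ) (y l : ℝ) : Prop :=
  ∃ V : Submodule ℂ E, FiniteDimensional ℂ V ∧ y ≤ (Module.finrank ℂ V : ℝ) ∧
    ∀ u ∈ V, l * ‖u‖ ^ 2 ≤ q u

lemma finrank_inf_orthogonal (V W : Submodule ℂ E) [FiniteDimensional ℂ V]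
    [FiniteDimensional ℂ W] :
    Module.finrank ℂ V ≤ Module.finrank ℂ ↥(V ⊓ Wᗮ) + Module.finrank ℂ W := by
  let P : V →ₗ[ℂ] W := (W.orthogonalProjectionOnto : E →L[ℂ] W).toLinearMap ∘ₗ V.subtype
  have h1 := LinearMap.finrank_range_add_finrank_ker P
  have h2 : Module.finrank ℂ (LinearMap.range P) ≤ Module.finrank ℂ W := Submodule.finrank_le _
  have h3 : Module.finrank ℂ (LinearMap.ker P) ≤ Module.finrank ℂ ↥(V ⊓ Wᗮ) := by
    rw [← Submodule.finrank_map_subtype_eq]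
    refine Submodule.finrank_mono ?_
    rintro _ ⟨x, hx, rfl⟩
    refine ⟨x.2, ?_⟩
    have hx' : W.orthogonalProjectionOnto (x : E) = 0 := hx
    exact Submodule.orthogonalProjectionOnto_eq_zero_iff.1 hx'
  omega

lemma LB.sub {q q' : E → ℝ} {x y l l' : ℝ} (h : LB q y l) (h' : UB q' x l') :
    LB (fun u => q u - q' u) (y - x) (l - l') := by
  obtain ⟨V, hV, hd, hu⟩ := h
  obtain ⟨W, hW, hd', hu'⟩ := h'
  refine ⟨V ⊓ Wᗮ, inferInstance, ?_, fun u hU => ?_⟩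
  · have h2 : (Module.finrank ℂ V : ℝ) ≤ Module.finrank ℂ ↥(V ⊓ Wᗮ) + Module.finrank ℂ W := by
      exact_mod_cast finrank_inf_orthogonal V W
    linarith
  · have h1 := hu u hU.1
    have h2 := hu' u hU.2
    linarith

lemma LB.mono {q q' : E → ℝ} {y y' l l' : ℝ} (h : LB q y l) (hq : ∀ u, q u ≤ q' u)
    (hy : y' ≤ y) (hl : l' ≤ l) : LB q' y' l' := by
  obtain ⟨V, hV, hd, hu⟩ := h
  exact ⟨V, hV, hy.trans hd, fun u hU => le_trans (by gcongr) ((hu u hU).trans (hq u))⟩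

lemma abs_re_inner_le (K : E →L[ℂ] E) {x : E} (hx : ‖x‖ = 1) :
    |(inner ℂ (K x) x).re| ≤ ‖K‖ := by
  refine (Complex.abs_re_le_norm _).trans ((norm_inner_le_norm _ _).trans ?_)
  simpa [hx] using K.le_opNorm x

lemma bddBelow_form (K : E →L[ℂ] E) (V : Submodule ℂ E) :
    BddBelow (Set.range fun x : {x : E // x ∈ V ∧ ‖x‖ = 1} => (inner ℂ (K x.1) x.1).re) := by
  refine ⟨-‖K‖, ?_⟩
  rintro _ ⟨x, rfl⟩
  exact (abs_le.1 (abs_re_inner_le K x.2.2)).1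

lemma norm_normalize {u : E} (hu : u ≠ 0) : ‖((‖u‖⁻¹ : ℝ) : ℂ) • u‖ = 1 := by
  rw [norm_smul, Complex.norm_real, norm_inv, norm_norm, inv_mul_cancel₀ (norm_ne_zero_iff.2 hu)]

lemma posEig_le (K : E →L[ℂ] E) {n : ℕ} {x l : ℝ} (hl : 0 ≤ l) (hx : x < n)
    (h : UB (fun u => (inner ℂ (K u) u).re) x l) : posEig K n ≤ l := by
  obtain ⟨W, hW, hd, hu⟩ := h
  refine Real.iSup_le (fun V => ?_) hl
  have hn : 0 < n := by
    have : (0 : ℝ) < n := lt_of_le_of_lt (le_trans (Nat.cast_nonneg _) hd) hx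
    exact_mod_cast this
  have hVd : FiniteDimensional ℂ V.1 := FiniteDimensional.of_finrank_pos (by rw [V.2]; exact hn)
  have h1 := finrank_inf_orthogonal V.1 W
  have h2 : Module.finrank ℂ W < n := by exact_mod_cast hd.trans_lt hx
  rw [V.2] at h1
  have h3 : V.1 ⊓ Wᗮ ≠ ⊥ := by
    intro h
    rw [h, finrank_bot] at h1
    omega
  obtain ⟨u, huV, hu0⟩ := Submodule.exists_mem_ne_zero_of_ne_bot h3
  have hn1 := norm_normalize hu0
  have h4 := Submodule.smul_mem _ ((‖u‖⁻¹ : ℝ) : ℂ) huV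
  refine (ciInf_le (bddBelow_form K V.1) ⟨_, h4.1, hn1⟩).trans ?_
  have := hu _ h4.2
  rwa [hn1, one_pow, mul_one] at this

lemma le_posEig (K : E →L[ℂ] E) {n : ℕ} {y l : ℝ} (hn : 0 < n) (hy : (n : ℝ) ≤ y)
    (h : LB (fun u => (inner ℂ (K u) u).re) y l) : l ≤ posEig K n := by
  obtain ⟨V, hV, hd, hu⟩ := h
  have h1 : n ≤ Module.finrank ℂ V := by exact_mod_cast hy.trans hd
  obtain ⟨V', hV', hVd⟩ : ∃ V' : Submodule ℂ E, V' ≤ V ∧ Module.finrank ℂ V' = n := by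
    obtain ⟨f, hf⟩ := exists_linearIndependent_of_le_finrank h1
    have hf' : LinearIndependent ℂ fun i => (f i : E) := hf.map' V.subtype (by simp)
    refine ⟨Submodule.span ℂ (Set.range fun i => (f i : E)), ?_, ?_⟩
    · rw [Submodule.span_le]
      rintro _ ⟨i, rfl⟩
      exact (f i).2
    · rw [finrank_span_eq_card hf', Fintype.card_fin]
  have hne : Nonempty {x : E // x ∈ V' ∧ ‖x‖ = 1} := by
    have : V' ≠ ⊥ := by
      rintro rfl
      rw [finrank_bot] at hVd
      omega
    obtain ⟨u, huV, hu0⟩ := Submodule.exists_mem_ne_zero_of_ne_bot this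
    exact ⟨⟨_, Submodule.smul_mem _ _ huV, norm_normalize hu0⟩⟩
  refine le_ciSup_of_le ?_ (⟨V', hVd⟩ : {V : Submodule ℂ E // Module.finrank ℂ V = n}) ?_
  · refine ⟨‖K‖, ?_⟩
    rintro _ ⟨U, rfl⟩
    rcases isEmpty_or_nonempty {x : E // x ∈ U.1 ∧ ‖x‖ = 1} with hU | ⟨⟨x⟩⟩
    · simp only [Real.iInf_of_isEmpty]
      exact norm_nonneg _
    · exact (ciInf_le (bddBelow_form K U.1) x).trans (abs_le.1 (abs_re_inner_le K x.2.2)).2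
  · refine le_ciInf fun x => ?_
    simpa [x.2.2] using hu x.1 (hV' x.2.1)

section Gram

variable {ι : Type*} [Fintype ι]

lemma norm_sum_smul_sq [DecidableEq ι] (v : ι → E) (d : ι → ℝ) (a : ι → ℂ) :
    ‖∑ i, a i • v i‖ ^ 2 = ∑ i, d i * ‖a i‖ ^ 2 + (∑ i, ∑ j,
      (inner ℂ (v i) (v j) - if i = j then (d i : ℂ) else 0)
        * (starRingEnd ℂ) (a i) * a j).re := by
  have h1 : ((‖∑ i, a i • v i‖ ^ 2 : ℝ) : ℂ)
      = ∑ i, ∑ j, inner ℂ (v i) (v j) * (starRingEnd ℂ) (a i) * a j := by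
    push_cast
    refine (inner_self_eq_norm_sq_to_K (𝕜 := ℂ) (∑ i, a i • v i)).symm.trans ?_
    simp only [sum_inner, inner_sum, inner_smul_left, inner_smul_right]
    simp only [Finset.mul_sum]
    rw [Finset.sum_comm]
    exact Finset.sum_congr rfl fun i _ => Finset.sum_congr rfl fun j _ => by ring
  have h2 : ∑ i, ∑ j, (inner ℂ (v i) (v j) - if i = j then (d i : ℂ) else 0)
        * (starRingEnd ℂ) (a i) * a j = ((‖∑ i, a i • v i‖ ^ 2 : ℝ) : ℂ)
        - ((∑ i, d i * ‖a i‖ ^ 2 : ℝ) : ℂ) := by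
    rw [h1]
    push_cast
    rw [← Finset.sum_sub_distrib]
    refine Finset.sum_congr rfl fun i _ => ?_
    simp only [sub_mul, Finset.sum_sub_distrib, ite_mul, zero_mul, Finset.sum_ite_eq,
      Finset.mem_univ, if_true]
    rw [← Complex.conj_mul', mul_assoc]
  rw [h2, ← Complex.ofReal_sub, Complex.ofReal_re]
  ring

lemma gram_UB [DecidableEq ι] (M : ι → ι → ℂ) {δ Q : ℝ} (hδ : 0 < δ)
    (hQ : ∑ i, ∑ j, ‖M i j‖ ^ 2 ≤ Q) :
    UB (fun a : EuclideanSpace ℂ ι => (∑ i, ∑ j, M i j * (starRingEnd ℂ) (a i) * a j).re)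
      (Q / δ ^ 2) δ := by
  have := UB.of_hilbertSchmidt M (EuclideanSpace.basisFun ι ℂ).orthonormal hδ hQ
  refine this.mono (fun u => le_of_eq ?_) le_rfl le_rfl
  congr 1
  refine Finset.sum_congr rfl fun i _ => Finset.sum_congr rfl fun j _ => ?_
  rw [← inner_conj_symm u]
  simp [EuclideanSpace.inner_single_left]

/-- Upper bound for the form `∑ w_i |⟪v_i, u⟫|²` when the Gram matrix of `v` is close to
the diagonal matrix `d`. -/
lemma UB.of_gram [DecidableEq ι] (v : ι → E) (w d : ι → ℝ) {l δ Q : ℝ} (hw : ∀ i, 0 < w i)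
    (hl : 0 < l) (hδ : 0 < δ)
    (hQ : ∑ i, ∑ j, ‖inner ℂ (v i) (v j) - if i = j then (d i : ℂ) else 0‖ ^ 2 ≤ Q) :
    UB (fun u => ∑ i, w i * ‖inner ℂ (v i) u‖ ^ 2)
      ((Finset.univ.filter fun i => l / w i - δ < d i).card + Q / δ ^ 2) l := by
  classical
  obtain ⟨W, hW, hd, hu⟩ := gram_UB _ hδ hQ
  let L : EuclideanSpace ℂ ι →ₗ[ℂ] E :=
    { toFun := fun b => ∑ i, ((w i : ℂ) * b i) • v i
      map_add' := fun a b => by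
        simp only [PiLp.add_apply, mul_add, add_smul, Finset.sum_add_distrib]
      map_smul' := fun c b => by
        simp only [PiLp.smul_apply, smul_eq_mul, RingHom.id_apply, Finset.smul_sum, smul_smul]
        exact Finset.sum_congr rfl fun i _ => by rw [mul_left_comm] }
  set s := Finset.univ.filter fun i => l / w i - δ < d i with hs
  refine ⟨Submodule.span ℂ (s.image v : Finset E) ⊔ W.map L, inferInstance, ?_, fun u hU => ?_⟩
  · have h1 := Submodule.finrank_add_le_finrank_add_finrank
      (Submodule.span ℂ ((s.image v : Finset E) : Set E)) (W.map L)
    have h2 : Module.finrank ℂ (Submodule.span ℂ ((s.image v : Finset E) : Set E)) ≤ s.card :=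
      (finrank_span_finset_le_card _).trans Finset.card_image_le
    have h3 : Module.finrank ℂ (W.map L) ≤ Module.finrank ℂ W := Submodule.finrank_map_le _ _
    refine le_trans (Nat.cast_le.2 (h1.trans (add_le_add h2 h3))) ?_
    push_cast
    linarith
  · have hs0 : ∀ i ∈ s, inner ℂ (v i) u = 0 := fun i hi =>
      (Submodule.mem_orthogonal _ u).1 hU _ (Submodule.mem_sup_left
        (Submodule.subset_span (by simpa using ⟨i, hi, rfl⟩)))
    let a : EuclideanSpace ℂ ι := WithLp.toLp 2 fun i => (w i : ℂ) * inner ℂ (v i) u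
    have haW : a ∈ Wᗮ := by
      rw [Submodule.mem_orthogonal]
      intro b hb
      have := (Submodule.mem_orthogonal _ u).1 hU _ (Submodule.mem_sup_right
        (Submodule.mem_map_of_mem (f := L) hb))
      rw [← this]
      simp only [L, LinearMap.coe_mk, AddHom.coe_mk, sum_inner, inner_smul_left, map_mul,
        Complex.conj_ofReal, PiLp.inner_apply, a, RCLike.inner_apply]
      exact Finset.sum_congr rfl fun i _ => by ring
    have h1 := norm_sum_smul_sq v d a
    have h2 := hu a haW
    rw [EuclideanSpace.norm_sq_eq] at h2
    set q := ∑ i, w i * ‖inner ℂ (v i) u‖ ^ 2 with hq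
    have hq0 : 0 ≤ q := Finset.sum_nonneg fun i _ => by have := hw i; positivity
    have h3 : ‖∑ i, a i • v i‖ ^ 2 ≤ l * q := by
      calc _ ≤ ∑ i, d i * ‖a i‖ ^ 2 + δ * ∑ i, ‖a i‖ ^ 2 := by rw [h1]; gcongr
        _ = ∑ i, (d i + δ) * ‖a i‖ ^ 2 := by
            rw [Finset.mul_sum, ← Finset.sum_add_distrib]
            exact Finset.sum_congr rfl fun i _ => by ring
        _ ≤ ∑ i, l * (w i * ‖inner ℂ (v i) u‖ ^ 2) := by
            refine Finset.sum_le_sum fun i _ => ?_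
            have hai : ‖a i‖ ^ 2 = w i ^ 2 * ‖inner ℂ (v i) u‖ ^ 2 := by
              simp [a, mul_pow]
            rw [hai]
            by_cases hi : i ∈ s
            · simp [hs0 i hi]
            · have h4 : d i ≤ l / w i - δ := by simpa [hs] using hi
              have h5 : d i + δ ≤ l / w i := by linarith
              have hwi := hw i
              calc _ ≤ l / w i * (w i ^ 2 * ‖inner ℂ (v i) u‖ ^ 2) := by gcongr
                _ = _ := by field_simp
        _ = l * q := by rw [hq, Finset.mul_sum]
    have h4 : q ≤ ‖∑ i, a i • v i‖ * ‖u‖ := by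
      have : inner ℂ (∑ i, a i • v i) u = (q : ℂ) := by
        rw [hq]
        push_cast
        simp only [sum_inner, inner_smul_left, a, map_mul, Complex.conj_ofReal]
        refine Finset.sum_congr rfl fun i _ => ?_
        rw [← Complex.conj_mul']
        ring
      have h5 := norm_inner_le_norm (𝕜 := ℂ) (∑ i, a i • v i) u
      rw [this, Complex.norm_real, Real.norm_of_nonneg hq0] at h5
      exact h5
    have h5 : q ^ 2 ≤ l * q * ‖u‖ ^ 2 := by
      calc q ^ 2 ≤ (‖∑ i, a i • v i‖ * ‖u‖) ^ 2 := by gcongr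
        _ = ‖∑ i, a i • v i‖ ^ 2 * ‖u‖ ^ 2 := by ring
        _ ≤ _ := by gcongr
    change q ≤ l * ‖u‖ ^ 2
    rcases hq0.eq_or_lt with h | h
    · rw [← h]; positivity
    · have : q * q ≤ q * (l * ‖u‖ ^ 2) := by nlinarith
      exact le_of_mul_le_mul_left this h

/-- Lower bound for the form `∑ w_i |⟪v_i, u⟫|²` when the Gram matrix of `v` is close to
the diagonal matrix `d`. -/
lemma exists_subspace_of_gram [DecidableEq ι] (v : ι → E) (w d : ι → ℝ) {l δ Q : ℝ}
    (hw : ∀ i, 0 < w i) (hl : 0 < l) (hδ : 0 < δ)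
    (hQ : ∑ i, ∑ j, ‖inner ℂ (v i) (v j) - if i = j then (d i : ℂ) else 0‖ ^ 2 ≤ Q)
    (hd : ∀ i, l / w i + δ ≤ d i) :
    ∃ V : Submodule ℂ E, FiniteDimensional ℂ V ∧
      (Fintype.card ι : ℝ) - Q / δ ^ 2 ≤ (Module.finrank ℂ V : ℝ) ∧
      ∀ u ∈ V, l * ‖u‖ ^ 2 ≤ ∑ i, w i * ‖inner ℂ (v i) u‖ ^ 2 ∧
        ∃ a : ι → ℂ, u = ∑ i, a i • v i ∧ ∑ i, ‖a i‖ ^ 2 / w i ≤ ‖u‖ ^ 2 / l := by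
  obtain ⟨W, hW, hdW, hu⟩ := gram_UB
    (fun i j => -(inner ℂ (v i) (v j) - if i = j then (d i : ℂ) else 0)) hδ
    (Q := Q) (by simpa only [norm_neg] using hQ)
  let L : EuclideanSpace ℂ ι →ₗ[ℂ] E :=
    { toFun := fun b => ∑ i, b i • v i
      map_add' := fun a b => by
        simp only [PiLp.add_apply, add_smul, Finset.sum_add_distrib]
      map_smul' := fun c b => by
        simp only [PiLp.smul_apply, smul_eq_mul, RingHom.id_apply, Finset.smul_sum, smul_smul] }
  have key : ∀ a ∈ Wᗮ, l * ∑ i, ‖a i‖ ^ 2 / w i ≤ ‖L a‖ ^ 2 := by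
    intro a ha
    have h1 := norm_sum_smul_sq v d a
    have h2 := hu a ha
    rw [EuclideanSpace.norm_sq_eq] at h2
    simp only [neg_mul, Finset.sum_neg_distrib, Complex.neg_re] at h2
    calc l * ∑ i, ‖a i‖ ^ 2 / w i = ∑ i, l / w i * ‖a i‖ ^ 2 := by
          rw [Finset.mul_sum]
          exact Finset.sum_congr rfl fun i _ => by ring
      _ ≤ ∑ i, (d i - δ) * ‖a i‖ ^ 2 := by
          refine Finset.sum_le_sum fun i _ => ?_
          have : l / w i ≤ d i - δ := by linarith [hd i]
          gcongr
      _ = ∑ i, d i * ‖a i‖ ^ 2 - δ * ∑ i, ‖a i‖ ^ 2 := by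
          rw [Finset.mul_sum, ← Finset.sum_sub_distrib]
          exact Finset.sum_congr rfl fun i _ => by ring
      _ ≤ ‖∑ i, a i • v i‖ ^ 2 := by rw [h1]; linarith
      _ = _ := rfl
  refine ⟨Wᗮ.map L, inferInstance, ?_, ?_⟩
  · have h1 : Module.finrank ℂ (Wᗮ.map L) = Module.finrank ℂ Wᗮ := by
      rw [← LinearMap.range_domRestrict]
      refine LinearMap.finrank_range_of_inj ?_
      rw [← LinearMap.ker_eq_bot, LinearMap.ker_eq_bot']
      rintro ⟨a, ha⟩ h0
      have h0' : L a = 0 := h0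
      have h1 := key a ha
      rw [h0', norm_zero, zero_pow two_ne_zero] at h1
      have h2 : ∑ i, ‖a i‖ ^ 2 / w i ≤ 0 := by
        by_contra! hc
        have := mul_pos hl hc
        linarith
      have h3 : ∀ i ∈ Finset.univ, 0 ≤ ‖a i‖ ^ 2 / w i := fun i _ => by
        have := hw i
        positivity
      have h4 := (Finset.sum_eq_zero_iff_of_nonneg h3).1 (le_antisymm h2 (Finset.sum_nonneg h3))
      ext i
      have := h4 i (Finset.mem_univ _)
      simpa [(hw i).ne'] using this
    have h2 := Submodule.finrank_add_finrank_orthogonal W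
    rw [finrank_euclideanSpace] at h2
    rw [h1, ← h2]
    push_cast
    linarith
  · rintro _ ⟨a, ha, rfl⟩
    have h1 := key a ha
    have h2 : ∑ i, ‖a i‖ ^ 2 / w i ≤ ‖L a‖ ^ 2 / l := by
      rw [le_div_iff₀ hl]
      linarith
    refine ⟨?_, a, rfl, h2⟩
    set u := L a with hu'
    set q := ∑ i, w i * ‖inner ℂ (v i) u‖ ^ 2 with hq
    have hq0 : 0 ≤ q := Finset.sum_nonneg fun i _ => by have := hw i; positivity
    have h3 : ‖u‖ ^ 2 ≤ ∑ i, ‖a i‖ * ‖inner ℂ (v i) u‖ := by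
      have h4 : ((‖u‖ ^ 2 : ℝ) : ℂ) = ∑ i, (starRingEnd ℂ) (a i) * inner ℂ (v i) u := by
        push_cast
        refine (inner_self_eq_norm_sq_to_K (𝕜 := ℂ) u).symm.trans ?_
        nth_rewrite 1 [hu']
        simp only [L, LinearMap.coe_mk, AddHom.coe_mk, sum_inner, inner_smul_left]
      have h5 : ‖u‖ ^ 2 = ‖((‖u‖ ^ 2 : ℝ) : ℂ)‖ := by
        rw [Complex.norm_real, Real.norm_of_nonneg (by positivity)]
      rw [h5, h4]
      refine (norm_sum_le _ _).trans (Finset.sum_le_sum fun i _ => ?_)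
      rw [norm_mul, RCLike.norm_conj]
    have h6 : (∑ i, ‖a i‖ * ‖inner ℂ (v i) u‖) ^ 2 ≤ (∑ i, ‖a i‖ ^ 2 / w i) * q := by
      refine Finset.sum_sq_le_sum_mul_sum_of_sq_le_mul _ (fun i _ => ?_) (fun i _ => ?_)
        fun i _ => ?_
      · have := hw i; positivity
      · have := hw i; positivity
      · have := hw i
        exact le_of_eq (by field_simp)
    have h7 : (‖u‖ ^ 2) ^ 2 ≤ ‖u‖ ^ 2 / l * q := by
      calc (‖u‖ ^ 2) ^ 2 ≤ (∑ i, ‖a i‖ * ‖inner ℂ (v i) u‖) ^ 2 := by gcongr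
        _ ≤ _ := h6
        _ ≤ _ := by gcongr
    rcases (sq_nonneg ‖u‖).eq_or_lt with h | h
    · rw [← h]; simpa using hq0
    · have h8 : ‖u‖ ^ 2 * (l * ‖u‖ ^ 2) ≤ ‖u‖ ^ 2 * q := by
        rw [div_mul_eq_mul_div, le_div_iff₀ hl] at h7
        linarith
      exact le_of_mul_le_mul_left h8 h

end Gram

end HankelEig

namespace HankelEig

/-- The quadratic form of the truncated Hankel matrix with entries `e (j + l)`. -/
def hsum (e : ℕ → ℝ) (J : ℕ) (u : ℕ → ℂ) : ℝ :=
  (∑ j ∈ Finset.range J, ∑ l ∈ Finset.range J, (e (j + l) : ℂ) * (starRingEnd ℂ) (u j) * u l).re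

lemma hsum_add (e f : ℕ → ℝ) (J : ℕ) (u : ℕ → ℂ) :
    hsum (fun j => e j + f j) J u = hsum e J u + hsum f J u := by
  simp only [hsum, Complex.ofReal_add, add_mul, Finset.sum_add_distrib, Complex.add_re]

lemma hsum_sum {ι : Type*} (s : Finset ι) (e : ι → ℕ → ℝ) (J : ℕ) (u : ℕ → ℂ) :
    hsum (fun j => ∑ k ∈ s, e k j) J u = ∑ k ∈ s, hsum (e k) J u := by
  classical
  induction s using Finset.induction_on with
  | empty => simp [hsum]
  | insert a s ha ih => simp only [Finset.sum_insert ha, hsum_add, ih]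

lemma hsum_eq_of_support {e : ℕ → ℝ} {J₀ J : ℕ} (he : ∀ j, J₀ ≤ j → e j = 0) (u : ℕ → ℂ)
    (hJ : J₀ ≤ J) : hsum e J u = hsum e J₀ u := by
  have hsub : Finset.range J₀ ⊆ Finset.range J := Finset.range_subset_range.2 hJ
  unfold hsum
  congr 1
  symm
  calc _ = ∑ j ∈ Finset.range J₀, ∑ l ∈ Finset.range J,
        (e (j + l) : ℂ) * (starRingEnd ℂ) (u j) * u l := by
        refine Finset.sum_congr rfl fun j _ => Finset.sum_subset hsub fun l _ hl => ?_
        rw [he _ (by simp at hl; omega)]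
        simp
    _ = _ := by
        refine Finset.sum_subset hsub fun j _ hj => Finset.sum_eq_zero fun l _ => ?_
        rw [he _ (by simp at hj; omega)]
        simp

lemma hsum_eq_of_support' {e : ℕ → ℝ} {J₀ J : ℕ} {u : ℕ → ℂ} (hu : ∀ j, J₀ ≤ j → u j = 0)
    (hJ : J₀ ≤ J) : hsum e J u = hsum e J₀ u := by
  have hsub : Finset.range J₀ ⊆ Finset.range J := Finset.range_subset_range.2 hJ
  unfold hsum
  congr 1
  symm
  calc _ = ∑ j ∈ Finset.range J₀, ∑ l ∈ Finset.range J,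
        (e (j + l) : ℂ) * (starRingEnd ℂ) (u j) * u l := by
        refine Finset.sum_congr rfl fun j _ => Finset.sum_subset hsub fun l _ hl => ?_
        rw [hu l (by simpa using hl)]
        simp
    _ = _ := by
        refine Finset.sum_subset hsub fun j _ hj => Finset.sum_eq_zero fun l _ => ?_
        rw [hu j (by simpa using hj)]
        simp

lemma sum_norm_sq_le (u : ellTwo) (s : Finset ℕ) : ∑ j ∈ s, ‖u j‖ ^ 2 ≤ ‖u‖ ^ 2 := by
  have := lp.sum_rpow_le_norm_rpow (p := 2) (by norm_num) u s
  simpa using this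

lemma inv_sqrt_le (l : ℕ) : 1 / √((l : ℝ) + 1) ≤ 2 * (√((l : ℝ) + 1) - √l) := by
  have h1 : 0 < √((l : ℝ) + 1) := Real.sqrt_pos.2 (by positivity)
  have h2 : √(l : ℝ) ≤ √((l : ℝ) + 1) := Real.sqrt_le_sqrt (by linarith)
  have h3 : √((l : ℝ) + 1) ^ 2 = l + 1 := Real.sq_sqrt (by positivity)
  have h4 : √(l : ℝ) ^ 2 = l := Real.sq_sqrt (by positivity)
  have h5 := Real.sqrt_nonneg (l : ℝ)
  rw [div_le_iff₀ h1]
  nlinarith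

lemma sum_schur_le (j J : ℕ) :
    ∑ l ∈ Finset.range J, √((j : ℝ) + 1) / (√((l : ℝ) + 1) * ((j : ℝ) + l + 1)) ≤ 4 := by
  have ha : 0 < √((j : ℝ) + 1) := Real.sqrt_pos.2 (by positivity)
  have ha2 : √((j : ℝ) + 1) ^ 2 = j + 1 := Real.sq_sqrt (by positivity)
  suffices h : ∀ J : ℕ, (J ≤ j + 1 → ∑ l ∈ Finset.range J,
      √((j : ℝ) + 1) / (√((l : ℝ) + 1) * ((j : ℝ) + l + 1)) ≤ 2 * √J / √((j : ℝ) + 1)) ∧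
      (j + 1 ≤ J → ∑ l ∈ Finset.range J,
      √((j : ℝ) + 1) / (√((l : ℝ) + 1) * ((j : ℝ) + l + 1)) ≤ 4 - 2 * √((j : ℝ) + 1) / √J) by
    rcases le_total J (j + 1) with hJ | hJ
    · refine ((h J).1 hJ).trans ?_
      rw [div_le_iff₀ ha]
      have : √(J : ℝ) ≤ √((j : ℝ) + 1) := Real.sqrt_le_sqrt (by exact_mod_cast hJ)
      linarith
    · have : 0 ≤ 2 * √((j : ℝ) + 1) / √J := by positivity
      linarith [(h J).2 hJ]
  intro J
  induction J with
  | zero => simp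
  | succ n ih =>
    have hn : 0 < √((n : ℝ) + 1) := Real.sqrt_pos.2 (by positivity)
    have hn2 : √((n : ℝ) + 1) ^ 2 = n + 1 := Real.sq_sqrt (by positivity)
    have hA : n + 1 ≤ j + 1 → ∑ l ∈ Finset.range (n + 1),
        √((j : ℝ) + 1) / (√((l : ℝ) + 1) * ((j : ℝ) + l + 1))
          ≤ 2 * √((n : ℝ) + 1) / √((j : ℝ) + 1) := by
      intro h
      have h1 := ih.1 (by omega)
      have h2 := inv_sqrt_le n
      rw [Finset.sum_range_succ]
      have h3 : √((j : ℝ) + 1) / (√((n : ℝ) + 1) * ((j : ℝ) + n + 1))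
          ≤ (1 / √((n : ℝ) + 1)) / √((j : ℝ) + 1) := by
        rw [div_div, div_le_div_iff₀ (by positivity) (by positivity)]
        have : (0 : ℝ) ≤ n := by positivity
        nlinarith [mul_nonneg hn.le this]
      have h4 : (1 / √((n : ℝ) + 1)) / √((j : ℝ) + 1)
          ≤ 2 * (√((n : ℝ) + 1) - √n) / √((j : ℝ) + 1) := by gcongr
      calc _ ≤ 2 * √n / √((j : ℝ) + 1) + 2 * (√((n : ℝ) + 1) - √n) / √((j : ℝ) + 1) := by linarith
        _ = _ := by ring
    rw [Nat.cast_succ]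
    refine ⟨hA, fun h => ?_⟩
    rcases h.eq_or_lt with h | h
    · have h1 := hA h.ge
      have h2 : (j : ℝ) = n := by exact_mod_cast (show j = n by omega)
      rw [h2] at h1 ⊢
      refine h1.trans (le_of_eq ?_)
      field_simp
      norm_num
    · have h1 := ih.2 (by omega)
      have hn0 : 0 < √(n : ℝ) := Real.sqrt_pos.2 (by exact_mod_cast (show 0 < n by omega))
      have hn02 : √(n : ℝ) ^ 2 = n := Real.sq_sqrt (by positivity)
      have h2 := inv_sqrt_le n
      rw [Finset.sum_range_succ]
      have h3 : √((j : ℝ) + 1) / (√((n : ℝ) + 1) * ((j : ℝ) + n + 1))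
          ≤ 2 * √((j : ℝ) + 1) / √n - 2 * √((j : ℝ) + 1) / √((n : ℝ) + 1) := by
        have h4 : 2 * √((j : ℝ) + 1) / √n - 2 * √((j : ℝ) + 1) / √((n : ℝ) + 1)
            = √((j : ℝ) + 1) * (2 * (√((n : ℝ) + 1) - √n)) / (√n * √((n : ℝ) + 1)) := by
          field_simp
        have h5 : √(n : ℝ) ≤ √((n : ℝ) + 1) := Real.sqrt_le_sqrt (by linarith)
        rw [h4]
        calc _ ≤ √((j : ℝ) + 1) * (1 / √((n : ℝ) + 1)) / (√n * √((n : ℝ) + 1)) := by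
              rw [mul_one_div, div_div, div_le_div_iff₀ (by positivity) (by positivity)]
              have : √(n : ℝ) * √((n : ℝ) + 1) ≤ (j : ℝ) + n + 1 := by
                have : (0 : ℝ) ≤ j := by positivity
                nlinarith
              have h7 := mul_le_mul_of_nonneg_left this (mul_pos ha hn).le
              linarith
          _ ≤ _ := by gcongr
      linarith

/-- Hilbert's inequality. -/
lemma hsum_le_of_le {e : ℕ → ℝ} {c : ℝ} (hc : 0 ≤ c) (he : ∀ j, |e j| ≤ c / ((j : ℝ) + 1))
    (J : ℕ) (u : ellTwo) : |hsum e J u| ≤ 4 * c * ‖u‖ ^ 2 := by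
  have h1 : |hsum e J u| ≤ ∑ j ∈ Finset.range J, ∑ l ∈ Finset.range J,
      c / 2 * (‖u j‖ ^ 2 * (√((j : ℝ) + 1) / (√((l : ℝ) + 1) * ((j : ℝ) + l + 1)))
        + ‖u l‖ ^ 2 * (√((l : ℝ) + 1) / (√((j : ℝ) + 1) * ((l : ℝ) + j + 1)))) := by
    refine (Complex.abs_re_le_norm _).trans ((norm_sum_le _ _).trans
      (Finset.sum_le_sum fun j _ => (norm_sum_le _ _).trans (Finset.sum_le_sum fun l _ => ?_)))
    rw [norm_mul, norm_mul, Complex.norm_real, RCLike.norm_conj, Real.norm_eq_abs]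
    have h := he (j + l)
    push_cast at h
    have hj : 0 < √((j : ℝ) + 1) := Real.sqrt_pos.2 (by positivity)
    have hl : 0 < √((l : ℝ) + 1) := Real.sqrt_pos.2 (by positivity)
    calc _ ≤ c / ((j : ℝ) + l + 1) * ‖u j‖ * ‖u l‖ := by gcongr
      _ = c / ((j : ℝ) + l + 1) * (‖u j‖ * ‖u l‖) := by ring
      _ ≤ c / ((j : ℝ) + l + 1) * (1 / 2 * (‖u j‖ ^ 2 * (√((j : ℝ) + 1) / √((l : ℝ) + 1))
            + ‖u l‖ ^ 2 * (√((l : ℝ) + 1) / √((j : ℝ) + 1)))) := by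
          refine mul_le_mul_of_nonneg_left ?_ (by positivity)
          have key : 0 ≤ (‖u j‖ * √((j : ℝ) + 1) - ‖u l‖ * √((l : ℝ) + 1)) ^ 2
              / (√((j : ℝ) + 1) * √((l : ℝ) + 1)) := by positivity
          have e1 : (‖u j‖ * √((j : ℝ) + 1) - ‖u l‖ * √((l : ℝ) + 1)) ^ 2
              / (√((j : ℝ) + 1) * √((l : ℝ) + 1)) = ‖u j‖ ^ 2 * (√((j : ℝ) + 1) / √((l : ℝ) + 1))
            + ‖u l‖ ^ 2 * (√((l : ℝ) + 1) / √((j : ℝ) + 1)) - 2 * (‖u j‖ * ‖u l‖) := by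
            field_simp
            ring
          linarith
      _ = _ := by
          rw [show (l : ℝ) + j + 1 = (j : ℝ) + l + 1 by ring]
          field_simp
  refine h1.trans ?_
  have h2 : ∑ j ∈ Finset.range J, ∑ l ∈ Finset.range J,
      c / 2 * (‖u j‖ ^ 2 * (√((j : ℝ) + 1) / (√((l : ℝ) + 1) * ((j : ℝ) + l + 1))))
      ≤ c / 2 * 4 * ‖u‖ ^ 2 := by
    calc _ = ∑ j ∈ Finset.range J, c / 2 * (‖u j‖ ^ 2 * ∑ l ∈ Finset.range J,
          (√((j : ℝ) + 1) / (√((l : ℝ) + 1) * ((j : ℝ) + l + 1)))) := by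
          simp only [Finset.mul_sum]
      _ ≤ ∑ j ∈ Finset.range J, c / 2 * (‖u j‖ ^ 2 * 4) := by
          refine Finset.sum_le_sum fun j _ => ?_
          have := sum_schur_le j J
          gcongr
      _ = c / 2 * 4 * ∑ j ∈ Finset.range J, ‖u j‖ ^ 2 := by
          rw [Finset.mul_sum]
          exact Finset.sum_congr rfl fun j _ => by ring
      _ ≤ _ := by
          have := sum_norm_sq_le u (Finset.range J)
          gcongr
  simp only [mul_add (c / 2), Finset.sum_add_distrib]
  rw [Finset.sum_comm (f := fun (j l : ℕ) => c / 2 * (‖u l‖ ^ 2 * (√((l : ℝ) + 1)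
    / (√((j : ℝ) + 1) * ((l : ℝ) + j + 1)))))]
  linarith

end HankelEig

namespace HankelEig

/-- The root of unity `exp (2 π i r / L)`. -/
def zt (L r : ℕ) : ℂ := Complex.exp (((2 * Real.pi * r / L : ℝ) : ℂ) * Complex.I)

lemma norm_zt (L r : ℕ) : ‖zt L r‖ = 1 := Complex.norm_exp_ofReal_mul_I _

lemma zt_ne_zero (L r : ℕ) : zt L r ≠ 0 := Complex.exp_ne_zero _

lemma zt_conj (L r : ℕ) : (starRingEnd ℂ) (zt L r) = (zt L r)⁻¹ :=
  (Complex.inv_eq_conj (norm_zt L r)).symm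

lemma zt_pow_comm (L r j : ℕ) : zt L r ^ j = zt L j ^ r := by
  unfold zt
  rw [← Complex.exp_nat_mul, ← Complex.exp_nat_mul]
  congr 1
  push_cast
  ring

lemma zt_self {L : ℕ} (hL : L ≠ 0) (r : ℕ) : zt L r ^ L = 1 := by
  unfold zt
  rw [← Complex.exp_nat_mul, Complex.exp_eq_one_iff]
  refine ⟨r, ?_⟩
  have : (L : ℂ) ≠ 0 := by exact_mod_cast hL
  push_cast
  field_simp

lemma norm_zt_sub_one {L r : ℕ} (hL : L ≠ 0) (hr : r < L) :
    4 * (min r (L - r) : ℕ) / L ≤ ‖zt L r - 1‖ := by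
  have hL' : (0 : ℝ) < L := by positivity
  have h : ∀ x : ℝ, 0 ≤ x → x ≤ Real.pi / 2 → 2 / Real.pi * x ≤ Real.sin x :=
    fun x hx hx' => Real.mul_le_sin hx hx'
  have e : ‖zt L r - 1‖ = 2 * |Real.sin (Real.pi * r / L)| := by
    unfold zt
    rw [mul_comm, Complex.norm_exp_I_mul_ofReal_sub_one, norm_mul, Real.norm_eq_abs,
      Real.norm_eq_abs, abs_two]
    congr 3
    ring
  rw [e]
  have hpi := Real.pi_pos
  rcases le_total (2 * r) L with h2 | h2
  · have h2' : 2 * (r : ℝ) ≤ L := by exact_mod_cast h2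
    have h3 := h (Real.pi * r / L) (by positivity) (by
      rw [div_le_div_iff₀ hL' two_pos]; nlinarith)
    rw [Nat.min_eq_left (by omega)]
    have h4 : 2 / Real.pi * (Real.pi * r / L) = 2 * r / L := by field_simp
    rw [h4] at h3
    have := le_abs_self (Real.sin (Real.pi * r / L))
    calc _ = 2 * (2 * (r : ℝ) / L) := by ring
      _ ≤ _ := by linarith
  · have h2' : (L : ℝ) ≤ 2 * r := by exact_mod_cast h2
    have hr' : (r : ℝ) ≤ L := by exact_mod_cast hr.le
    have h3 := h (Real.pi * ((L : ℝ) - r) / L)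
      (div_nonneg (mul_nonneg hpi.le (by linarith)) hL'.le) (by
      rw [div_le_div_iff₀ hL' two_pos]; nlinarith)
    rw [Nat.min_eq_right (by omega), Nat.cast_sub hr.le]
    have h4 : 2 / Real.pi * (Real.pi * ((L : ℝ) - r) / L) = 2 * ((L : ℝ) - r) / L := by field_simp
    have h5 : Real.sin (Real.pi * ((L : ℝ) - r) / L) = Real.sin (Real.pi * r / L) := by
      rw [← Real.sin_pi_sub]
      congr 1
      field_simp
      ring
    rw [h4, h5] at h3
    have := le_abs_self (Real.sin (Real.pi * r / L))
    calc _ = 2 * (2 * ((L : ℝ) - r) / L) := by ring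
      _ ≤ _ := by linarith

lemma sum_zt {L : ℕ} (hL : L ≠ 0) {j l : ℕ} (hj : j < L) (hl : l < L) :
    ∑ r ∈ Finset.range L, zt L r ^ j * (zt L r)⁻¹ ^ l = if j = l then (L : ℂ) else 0 := by
  split_ifs with h
  · subst h
    have : ∀ r ∈ Finset.range L, zt L r ^ j * (zt L r)⁻¹ ^ j = 1 := fun r _ => by
      rw [← mul_pow, mul_inv_cancel₀ (zt_ne_zero L r), one_pow]
    rw [Finset.sum_congr rfl this]
    simp
  · have e : ∀ r, zt L r ^ j * (zt L r)⁻¹ ^ l = (zt L j * (zt L l)⁻¹) ^ r := fun r => by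
      rw [mul_pow, inv_pow, inv_pow, zt_pow_comm L r j, zt_pow_comm L r l]
    simp only [e]
    have h1 : zt L j * (zt L l)⁻¹ ≠ 1 := by
      intro h1
      rw [mul_inv_eq_one₀ (zt_ne_zero L l)] at h1
      unfold zt at h1
      rw [Complex.exp_eq_exp_iff_exists_int] at h1
      obtain ⟨n, hn⟩ := h1
      have hn2 : ((2 * Real.pi * j / L : ℝ) : ℂ) = ((2 * Real.pi * l / L + n * (2 * Real.pi) : ℝ) : ℂ) := by
        have hI := Complex.I_ne_zero
        refine mul_right_cancel₀ hI ?_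
        rw [hn]
        push_cast
        ring
      have hn3 := Complex.ofReal_injective hn2
      have hL' : (L : ℝ) ≠ 0 := by exact_mod_cast hL
      have hpi := Real.pi_pos.ne'
      field_simp at hn3
      have hn4 : (j : ℤ) = l + L * n := by
        have : (j : ℝ) = l + L * n := by linarith
        exact_mod_cast this
      have hn5 : (L : ℤ) ∣ (j : ℤ) - l := ⟨n, by linarith⟩
      have := Int.eq_zero_of_abs_lt_dvd hn5 (by rw [abs_lt]; constructor <;> omega)
      omega
    rw [geom_sum_eq h1, mul_pow, inv_pow, zt_self hL, zt_self hL]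
    simp

/-- The discrete Fourier transform of `f` on `[0, L)`. -/
def dF (L : ℕ) (f : ℕ → ℂ) (r : ℕ) : ℂ := ∑ j ∈ Finset.range L, f j * (zt L r)⁻¹ ^ j

lemma dF_inv {L : ℕ} (hL : L ≠ 0) (f : ℕ → ℂ) {j : ℕ} (hj : j < L) :
    f j = (L : ℂ)⁻¹ * ∑ r ∈ Finset.range L, dF L f r * zt L r ^ j := by
  have : ∑ r ∈ Finset.range L, dF L f r * zt L r ^ j = L * f j := by
    simp only [dF, Finset.sum_mul]
    rw [Finset.sum_comm]
    calc _ = ∑ l ∈ Finset.range L, f l *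
          ∑ r ∈ Finset.range L, zt L r ^ j * (zt L r)⁻¹ ^ l := by
          refine Finset.sum_congr rfl fun l _ => ?_
          rw [Finset.mul_sum]
          exact Finset.sum_congr rfl fun r _ => by ring
      _ = ∑ l ∈ Finset.range L, f l * if j = l then (L : ℂ) else 0 :=
          Finset.sum_congr rfl fun l hl => by rw [sum_zt hL hj (Finset.mem_range.1 hl)]
      _ = _ := by
          simp [hj, mul_comm]
  have hL' : (L : ℂ) ≠ 0 := by exact_mod_cast hL
  rw [this, inv_mul_cancel_left₀ hL']

lemma dF_parseval {L : ℕ} (hL : L ≠ 0) (f : ℕ → ℂ) :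
    ∑ r ∈ Finset.range L, ‖dF L f r‖ ^ 2 = L * ∑ j ∈ Finset.range L, ‖f j‖ ^ 2 := by
  have h : ((∑ r ∈ Finset.range L, ‖dF L f r‖ ^ 2 : ℝ) : ℂ)
      = ((L * ∑ j ∈ Finset.range L, ‖f j‖ ^ 2 : ℝ) : ℂ) := by
    push_cast
    calc ∑ r ∈ Finset.range L, (‖dF L f r‖ : ℂ) ^ 2
        = ∑ r ∈ Finset.range L, ∑ j ∈ Finset.range L,
            (starRingEnd ℂ) (f j) * (dF L f r * zt L r ^ j) := by
          refine Finset.sum_congr rfl fun r _ => ?_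
          rw [← Complex.mul_conj']
          nth_rewrite 2 [dF]
          simp only [map_sum, map_mul, map_pow, map_inv₀, zt_conj, inv_inv, Finset.mul_sum]
          exact Finset.sum_congr rfl fun j _ => by ring
      _ = ∑ j ∈ Finset.range L, (starRingEnd ℂ) (f j) * (L * f j) := by
          rw [Finset.sum_comm]
          refine Finset.sum_congr rfl fun j hj => ?_
          rw [← Finset.mul_sum]
          congr 1
          have hL' : (L : ℂ) ≠ 0 := by exact_mod_cast hL
          rw [dF_inv hL f (Finset.mem_range.1 hj), mul_inv_cancel_left₀ hL']
      _ = _ := by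
          rw [Finset.mul_sum]
          refine Finset.sum_congr rfl fun j _ => ?_
          rw [← Complex.conj_mul']
          ring
  exact_mod_cast h

lemma dF_diff {L : ℕ} (f : ℕ → ℂ) (h0 : f 0 = 0) (hL : f L = 0) (r : ℕ) :
    dF L (fun j => f (j + 1) - f j) r = (zt L r - 1) * dF L f r := by
  have h1 : ∑ j ∈ Finset.range L, f (j + 1) * (zt L r)⁻¹ ^ j = zt L r * dF L f r := by
    have h2 := Finset.sum_range_succ (fun j => f j * (zt L r)⁻¹ ^ j) L
    rw [Finset.sum_range_succ', hL, h0] at h2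
    simp only [zero_mul, add_zero] at h2
    rw [dF, ← h2, Finset.mul_sum]
    refine Finset.sum_congr rfl fun j _ => ?_
    have := zt_ne_zero L r
    rw [pow_succ]
    field_simp
  simp only [dF, sub_mul, Finset.sum_sub_distrib, one_mul] at h1 ⊢
  rw [h1]

end HankelEig

namespace HankelEig

lemma iterDiff_succ' (f : ℕ → ℝ) (m : ℕ) :
    iterDiff f (m + 1) = iterDiff (fun j => f (j + 1) - f j) m := by
  induction m with
  | zero => rfl
  | succ m ih =>
    funext j
    change iterDiff f (m + 1) (j + 1) - iterDiff f (m + 1) j = _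
    rw [ih]
    rfl

lemma iterDiff_shift (f : ℕ → ℝ) (m j : ℕ) :
    iterDiff (fun j => f (j + 1)) m j = iterDiff f m (j + 1) := by
  induction m generalizing j with
  | zero => rfl
  | succ m ih =>
    change iterDiff (fun j => f (j + 1)) m (j + 1) - iterDiff (fun j => f (j + 1)) m j = _
    rw [ih, ih]
    rfl

lemma iterDiff_add (f g : ℕ → ℝ) (m j : ℕ) :
    iterDiff (fun j => f j + g j) m j = iterDiff f m j + iterDiff g m j := by
  induction m generalizing j with
  | zero => rfl
  | succ m ih =>
    change iterDiff (fun j => f j + g j) m (j + 1) - iterDiff (fun j => f j + g j) m j = _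
    rw [ih, ih]
    change _ = (iterDiff f m (j + 1) - iterDiff f m j) + (iterDiff g m (j + 1) - iterDiff g m j)
    ring

lemma iterDiff_const_mul (c : ℝ) (f : ℕ → ℝ) (m j : ℕ) :
    iterDiff (fun j => c * f j) m j = c * iterDiff f m j := by
  induction m generalizing j with
  | zero => rfl
  | succ m ih =>
    change iterDiff (fun j => c * f j) m (j + 1) - iterDiff (fun j => c * f j) m j = _
    rw [ih, ih]
    change _ = c * (iterDiff f m (j + 1) - iterDiff f m j)
    ring

lemma iterDiff_eq_zero {f : ℕ → ℝ} {m j : ℕ} (h : ∀ i ≤ m, f (j + i) = 0) :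
    iterDiff f m j = 0 := by
  induction m generalizing j with
  | zero => exact h 0 le_rfl
  | succ m ih =>
    change iterDiff f m (j + 1) - iterDiff f m j = 0
    rw [ih fun i hi => ?_, ih fun i hi => h i (by omega), sub_zero]
    have := h (1 + i) (by omega)
    rwa [← add_assoc] at this

lemma abs_iterDiff_mul_le {r : ℝ} {S : ℕ} (hr : 0 ≤ r) (m : ℕ) {f g : ℕ → ℝ} {A B : ℝ}
    (hA : 0 ≤ A) (hB : 0 ≤ B)
    (hf : ∀ i ≤ m, ∀ j ≥ S, |iterDiff f i j| ≤ A * r ^ i)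
    (hg : ∀ i ≤ m, ∀ j ≥ S, |iterDiff g i j| ≤ B * r ^ i) :
    ∀ j ≥ S, |iterDiff (fun j => f j * g j) m j| ≤ 2 ^ m * (A * B) * r ^ m := by
  induction m generalizing f g A B with
  | zero =>
    intro j hj
    have h1 := hf 0 le_rfl j hj
    have h2 := hg 0 le_rfl j hj
    simp only [pow_zero, mul_one, one_mul, iterDiff] at h1 h2 ⊢
    rw [abs_mul]
    gcongr
  | succ m ih =>
    intro j hj
    have e : (fun j => f (j + 1) * g (j + 1) - f j * g j)
        = fun j => (fun j => f (j + 1) - f j) j * (fun j => g (j + 1)) j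
          + f j * (fun j => g (j + 1) - g j) j := by
      funext j
      ring
    rw [iterDiff_succ', e, iterDiff_add]
    have h1 := ih (f := fun j => f (j + 1) - f j) (g := fun j => g (j + 1)) (A := A * r) (B := B)
      (by positivity) hB (fun i hi j hj => by
        rw [← iterDiff_succ', mul_assoc, ← pow_succ']
        exact hf (i + 1) (by omega) j hj) (fun i hi j hj => by
        rw [iterDiff_shift]
        exact hg i (by omega) (j + 1) (by omega)) j hj
    have h2 := ih (f := f) (g := fun j => g (j + 1) - g j) (A := A) (B := B * r)
      hA (by positivity) (fun i hi j hj => hf i (by omega) j hj) (fun i hi j hj => by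
        rw [← iterDiff_succ', mul_assoc, ← pow_succ']
        exact hg (i + 1) (by omega) j hj) j hj
    refine (abs_add_le _ _).trans ((add_le_add h1 h2).trans (le_of_eq ?_))
    ring

lemma abs_iterDiff_comp_le {h : ℝ} (hh : 0 ≤ h) (m : ℕ) {φ : ℝ → ℝ} {C : ℝ}
    (hφ : ContDiff ℝ (⊤ : ℕ∞) φ) (hC : ∀ x, |iteratedDeriv m φ x| ≤ C) (j : ℕ) :
    |iterDiff (fun j : ℕ => φ (j * h)) m j| ≤ C * h ^ m := by
  induction m generalizing φ C with
  | zero => simpa [iterDiff] using hC (j * h)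
  | succ m ih =>
    have e : (fun j : ℕ => φ ((j + 1 : ℕ) * h) - φ (j * h))
        = fun j : ℕ => (fun x => φ (x + h) - φ x) (j * h) := by
      funext j
      push_cast
      ring_nf
    rw [iterDiff_succ', e, pow_succ', ← mul_assoc]
    have hφ' : ContDiff ℝ (⊤ : ℕ∞) fun x => φ (x + h) := hφ.comp (by fun_prop)
    refine ih (hφ'.sub hφ) fun x => ?_
    have hm : ((m : ℕ∞) : WithTop ℕ∞) ≤ ((⊤ : ℕ∞) : WithTop ℕ∞) := by
      exact_mod_cast le_top
    have e2 : iteratedDeriv m (fun x => φ (x + h) - φ x) x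
        = iteratedDeriv m φ (x + h) - iteratedDeriv m φ x := by
      have := iteratedDeriv_fun_sub (n := m) (x := x) (f := fun x => φ (x + h)) (g := φ)
        (hφ'.contDiffAt.of_le hm) (hφ.contDiffAt.of_le hm)
      rw [this, iteratedDeriv_comp_add_const]
    rw [e2]
    have hd : Differentiable ℝ (iteratedDeriv m φ) :=
      hφ.differentiable_iteratedDeriv m (by exact_mod_cast WithTop.coe_lt_top m)
    have := Convex.norm_image_sub_le_of_norm_deriv_le (f := iteratedDeriv m φ) (s := Set.univ)
      (x := x) (y := x + h) (C := C) (fun y _ => hd y) (fun y _ => by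
        rw [← iteratedDeriv_succ]
        exact hC y) convex_univ (Set.mem_univ _) (Set.mem_univ _)
    simpa [abs_of_nonneg hh] using this

/-- A smooth cut-off function, `0` on `(-∞, 1]` and `1` on `[2, ∞)`. -/
def cut (x : ℝ) : ℝ := Real.smoothTransition (x - 1)

lemma cut_contDiff : ContDiff ℝ (⊤ : ℕ∞) cut :=
  Real.smoothTransition.contDiff.comp (by fun_prop)

lemma cut_zero {x : ℝ} (hx : x ≤ 1) : cut x = 0 :=
  Real.smoothTransition.zero_of_nonpos (by linarith)

lemma cut_one {x : ℝ} (hx : 2 ≤ x) : cut x = 1 :=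
  Real.smoothTransition.one_of_one_le (by linarith)

lemma exists_bound_cut (m : ℕ) : ∃ C, 0 ≤ C ∧ ∀ x, |iteratedDeriv m cut x| ≤ C := by
  have hc : Continuous (iteratedDeriv m cut) :=
    cut_contDiff.continuous_iteratedDeriv m (by exact_mod_cast le_top)
  obtain ⟨C, hC⟩ := (isCompact_Icc (a := (1 : ℝ)) (b := 2)).exists_bound_of_continuousOn
    hc.continuousOn
  refine ⟨max C 1, by positivity, fun x => ?_⟩
  have hconst : ∀ c : ℝ, |c| ≤ 1 → |iteratedDeriv m (fun _ : ℝ => c) x| ≤ 1 := by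
    intro c hc
    rw [iteratedDeriv_const]
    split_ifs <;> simp [hc]
  rcases lt_or_ge x 1 with h | h
  · have : cut =ᶠ[nhds x] fun _ => 0 := by
      filter_upwards [gt_mem_nhds h] with y hy using cut_zero hy.le
    rw [this.iteratedDeriv_eq]
    exact (hconst 0 (by simp)).trans (le_max_right _ _)
  · rcases le_or_gt x 2 with h2 | h2
    · exact (hC x ⟨h, h2⟩).trans (le_max_left _ _)
    · have : cut =ᶠ[nhds x] fun _ => 1 := by
        filter_upwards [lt_mem_nhds h2] with y hy using cut_one hy.le
      rw [this.iteratedDeriv_eq]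
      exact (hconst 1 (by simp)).trans (le_max_right _ _)

lemma dF_iterDiff {L N : ℕ} {f : ℕ → ℝ} (h0 : ∀ j < N, f j = 0) (hL : ∀ j ≥ L, f j = 0) (r : ℕ) :
    dF L (fun j => ((iterDiff f N j : ℝ) : ℂ)) r = (zt L r - 1) ^ N * dF L (fun j => (f j : ℂ)) r := by
  induction N with
  | zero => simp [iterDiff]
  | succ N ih =>
    rw [pow_succ', mul_assoc, ← ih fun j hj => h0 j (by omega), ← dF_diff]
    · simp [iterDiff]
    · exact_mod_cast iterDiff_eq_zero fun i hi => h0 _ (by omega)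
    · exact_mod_cast iterDiff_eq_zero fun i hi => hL _ (by omega)

/-- The finitely supported vector with coordinates `a j`, `j < J`. -/
def fv (J : ℕ) (a : ℕ → ℂ) : ellTwo := ∑ j ∈ Finset.range J, lp.single 2 j (a j)

lemma inner_fv (J : ℕ) (a : ℕ → ℂ) (u : ellTwo) :
    inner ℂ (fv J a) u = ∑ j ∈ Finset.range J, (starRingEnd ℂ) (a j) * u j := by
  simp only [fv, sum_inner]
  refine Finset.sum_congr rfl fun j _ => ?_
  rw [lp.inner_single_left]
  simp [mul_comm]

lemma fv_apply (J : ℕ) (a : ℕ → ℂ) (j : ℕ) : fv J a j = if j < J then a j else 0 := by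
  have : fv J a j = ∑ i ∈ Finset.range J, (lp.single 2 i (a i) : ellTwo) j := by
    simp only [fv]
    rw [lp.coeFn_sum, Finset.sum_apply]
  rw [this]
  simp only [lp.single_apply, Pi.single_apply]
  simp

lemma norm_fv_sq (J : ℕ) (a : ℕ → ℂ) : ‖fv J a‖ ^ 2 = ∑ j ∈ Finset.range J, ‖a j‖ ^ 2 := by
  have h : ((‖fv J a‖ ^ 2 : ℝ) : ℂ) = ((∑ j ∈ Finset.range J, ‖a j‖ ^ 2 : ℝ) : ℂ) := by
    push_cast
    refine (inner_self_eq_norm_sq_to_K (𝕜 := ℂ) (fv J a)).symm.trans ?_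
    rw [inner_fv]
    refine Finset.sum_congr rfl fun j hj => ?_
    rw [fv_apply, if_pos (Finset.mem_range.1 hj), Complex.conj_mul']
  exact_mod_cast h

end HankelEig

namespace HankelEig

lemma sum_Ico_inv_pow_le {N m : ℕ} (hN : 1 ≤ N) (hm : 1 ≤ m) (R : ℕ) :
    ∑ r ∈ Finset.Ico m R, 1 / (r : ℝ) ^ (2 * N) ≤ 2 * m / (m : ℝ) ^ (2 * N) := by
  have hm0 : (0 : ℝ) < m := by exact_mod_cast hm
  have h1 : ∀ R, m ≤ R → ∑ r ∈ Finset.Ico m R, 1 / (r : ℝ) ^ 2 ≤ (2 : ℝ) / (m : ℝ) - (2 : ℝ) / (R : ℝ) := by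
    intro R hR
    induction R, hR using Nat.le_induction with
    | base => simp
    | succ R hR ih =>
      rw [Finset.sum_Ico_succ_top hR]
      have hR0 : (1 : ℝ) ≤ R := by exact_mod_cast hm.trans hR
      have : 1 / (R : ℝ) ^ 2 ≤ (2 : ℝ) / (R : ℝ) - (2 : ℝ) / ((R + 1 : ℕ) : ℝ) := by
        push_cast
        rw [div_sub_div _ _ (by positivity) (by positivity), div_le_div_iff₀ (by positivity)
          (by positivity)]
        nlinarith [pow_nonneg (zero_le_one.trans hR0) 3]
      linarith
  have h2 : ∑ r ∈ Finset.Ico m R, 1 / (r : ℝ) ^ 2 ≤ (2 : ℝ) / (m : ℝ) := by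
    rcases le_total m R with h | h
    · have : (0 : ℝ) ≤ (2 : ℝ) / (R : ℝ) := by positivity
      linarith [h1 R h]
    · rw [Finset.Ico_eq_empty (by omega)]
      simp only [Finset.sum_empty]
      positivity
  calc _ ≤ ∑ r ∈ Finset.Ico m R, 1 / (m : ℝ) ^ (2 * N - 2) * (1 / (r : ℝ) ^ 2) := by
        refine Finset.sum_le_sum fun r hr => ?_
        have hr' : (m : ℝ) ≤ r := by exact_mod_cast (Finset.mem_Ico.1 hr).1
        have hr0 : (0 : ℝ) < r := hm0.trans_le hr'
        rw [show 2 * N = (2 * N - 2) + 2 by omega, pow_add, ← one_div_mul_one_div,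
          Nat.add_sub_cancel]
        gcongr
    _ ≤ 1 / (m : ℝ) ^ (2 * N - 2) * (2 / m) := by
        rw [← Finset.mul_sum]
        gcongr
    _ = _ := by
        conv_rhs => rw [show 2 * N = (2 * N - 2) + 2 by omega, pow_add]
        field_simp

lemma sum_min_le {L N m : ℕ} (hN : 1 ≤ N) (hm : 1 ≤ m) :
    ∑ r ∈ (Finset.range L).filter (fun r => m ≤ min r (L - r)),
      1 / ((min r (L - r) : ℕ) : ℝ) ^ (2 * N) ≤ 4 * m / (m : ℝ) ^ (2 * N) := by
  have h := sum_Ico_inv_pow_le hN hm (L + 1)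
  have h1 : ∀ r ∈ (Finset.range L).filter (fun r => m ≤ min r (L - r)),
      1 / ((min r (L - r) : ℕ) : ℝ) ^ (2 * N)
        ≤ 1 / (r : ℝ) ^ (2 * N) + 1 / ((L - r : ℕ) : ℝ) ^ (2 * N) := by
    intro r _
    rcases le_total r (L - r) with h | h
    · rw [Nat.min_eq_left h]
      exact le_add_of_nonneg_right (by positivity)
    · rw [Nat.min_eq_right h]
      exact le_add_of_nonneg_left (by positivity)
  have h2 : ∑ r ∈ (Finset.range L).filter (fun r => m ≤ min r (L - r)), 1 / (r : ℝ) ^ (2 * N)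
      ≤ ∑ r ∈ Finset.Ico m (L + 1), 1 / (r : ℝ) ^ (2 * N) := by
    refine Finset.sum_le_sum_of_subset_of_nonneg (fun r hr => ?_) fun _ _ _ => by positivity
    simp only [Finset.mem_filter, Finset.mem_range, le_min_iff] at hr
    simp only [Finset.mem_Ico]
    omega
  have h3 : ∑ r ∈ (Finset.range L).filter (fun r => m ≤ min r (L - r)),
      1 / ((L - r : ℕ) : ℝ) ^ (2 * N) ≤ ∑ r ∈ Finset.Ico m (L + 1), 1 / (r : ℝ) ^ (2 * N) := by
    rw [← Finset.sum_image (f := fun s : ℕ => 1 / (s : ℝ) ^ (2 * N)) (g := fun r => L - r)]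
    · refine Finset.sum_le_sum_of_subset_of_nonneg (fun s hs => ?_) fun _ _ _ => by positivity
      simp only [Finset.mem_image, Finset.mem_filter, Finset.mem_range, le_min_iff] at hs
      obtain ⟨r, hr, rfl⟩ := hs
      simp only [Finset.mem_Ico]
      omega
    · intro r hr s hs h
      simp only [Finset.coe_filter, Finset.mem_range, Set.mem_ofPred_eq] at hr hs h
      omega
  refine (Finset.sum_le_sum h1).trans ?_
  rw [Finset.sum_add_distrib]
  calc _ ≤ 2 * m / (m : ℝ) ^ (2 * N) + 2 * m / (m : ℝ) ^ (2 * N) := by linarith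
    _ = _ := by ring

lemma card_min_lt_le (L m : ℕ) :
    ((Finset.range L).filter fun r => ¬ m ≤ min r (L - r)).card ≤ 2 * m := by
  have : (Finset.range L).filter (fun r => ¬ m ≤ min r (L - r))
      ⊆ Finset.range m ∪ Finset.Ico (L - m) L := by
    intro r hr
    simp only [Finset.mem_filter, Finset.mem_range, le_min_iff, not_and_or] at hr
    simp only [Finset.mem_union, Finset.mem_range, Finset.mem_Ico]
    omega
  refine (Finset.card_le_card this).trans ((Finset.card_union_le _ _).trans ?_)
  simp only [Finset.card_range, Nat.card_Ico]
  omega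

/-- Spectral estimate for a Hankel form supported in a dyadic block. -/
lemma FT_block {P N m : ℕ} {f : ℕ → ℝ} {D ω : ℝ} (hP : 1 ≤ P) (hN : 1 ≤ N) (hNP : N ≤ P)
    (hm : 1 ≤ m) (hω : |ω| = 1) (hD : 0 ≤ D) (hf0 : ∀ j ≤ P, f j = 0)
    (hf1 : ∀ j ≥ 4 * P, f j = 0) (hf : ∀ j, |iterDiff f N j| ≤ D) :
    FT (fun u : ellTwo => hsum (fun j => ω ^ j * f j) (4 * P) u)
      (2 * m) (8 * P * (2 * P) ^ N * D * √m / (m : ℝ) ^ N) := by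
  set L := 8 * P with hL
  have hL0 : L ≠ 0 := by omega
  have hLr : (0 : ℝ) < L := by positivity
  set c : ℕ → ℂ := fun r => (L : ℂ)⁻¹ * dF L (fun j => (f j : ℂ)) r with hc
  set a : ℕ → ellTwo := fun r => fv (4 * P) fun j => (ω * zt L r) ^ j with ha
  set b : ℕ → ellTwo := fun r => fv (4 * P) fun j => (starRingEnd ℂ) ((ω * zt L r) ^ j) with hb
  have hform : ∀ u : ellTwo, hsum (fun j => ω ^ j * f j) (4 * P) u
      = ∑ r ∈ Finset.range L, (c r * inner ℂ u (a r) * inner ℂ (b r) u).re := by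
    intro u
    rw [← Complex.re_sum, hsum]
    congr 1
    have h1 : ∀ r, c r * inner ℂ u (a r) * inner ℂ (b r) u
        = ∑ j ∈ Finset.range (4 * P), ∑ l ∈ Finset.range (4 * P),
          (ω : ℂ) ^ (j + l) * (c r * zt L r ^ (j + l)) * (starRingEnd ℂ) (u j) * u l := by
      intro r
      rw [← inner_conj_symm u, ha, hb]
      simp only [inner_fv, map_sum, map_mul, Complex.conj_conj]
      rw [mul_assoc, Finset.sum_mul_sum, Finset.mul_sum]
      refine Finset.sum_congr rfl fun j _ => ?_
      rw [Finset.mul_sum]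
      refine Finset.sum_congr rfl fun l _ => ?_
      rw [pow_add, pow_add, mul_pow, mul_pow]
      ring
    simp only [h1]
    refine Eq.trans (Finset.sum_congr rfl fun j hj => ?_) Finset.sum_comm
    refine Eq.trans (Finset.sum_congr rfl fun l hl => ?_) Finset.sum_comm
    rw [← Finset.sum_mul, ← Finset.sum_mul, ← Finset.mul_sum]
    have hjl : j + l < L := by
      simp only [Finset.mem_range] at hj hl
      omega
    have h2 := dF_inv hL0 (fun j => (f j : ℂ)) hjl
    rw [Finset.mul_sum] at h2
    simp only [hc, mul_assoc] at h2 ⊢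
    rw [← h2]
    push_cast
    ring
  have hna : ∀ r, ‖a r‖ ^ 2 = 4 * P := by
    intro r
    rw [ha]
    simp only [norm_fv_sq, norm_pow, norm_mul, norm_zt, Complex.norm_real, Real.norm_eq_abs, hω]
    simp
  have hnb : ∀ r, ‖b r‖ ^ 2 = 4 * P := by
    intro r
    rw [hb]
    simp only [norm_fv_sq, norm_pow, norm_mul, norm_zt, Complex.norm_real, Real.norm_eq_abs, hω,
      RCLike.norm_conj]
    simp
  have hab : ∀ r, ‖a r‖ * ‖b r‖ = 4 * P := by
    intro r
    have h1 : ‖a r‖ = ‖b r‖ := by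
      rw [← sq_eq_sq₀ (norm_nonneg _) (norm_nonneg _), hna, hnb]
    rw [← h1, ← sq, hna]
  set S := (Finset.range L).filter fun r => m ≤ min r (L - r) with hS
  set S' := (Finset.range L).filter fun r => ¬ m ≤ min r (L - r) with hS'
  have hsmall : UB (fun u : ellTwo => ∑ r ∈ S', (c r * inner ℂ u (a r) * inner ℂ (b r) u).re)
      S'.card 0 := UB.of_finite S' b fun u hu => by
    refine le_of_eq (Finset.sum_eq_zero fun r hr => ?_)
    rw [hu r hr]
    simp
  have hbig := Tr.of_nuclear S c a b
  have hmr : (0 : ℝ) < m := by exact_mod_cast hm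
  have hτ : ∑ r ∈ S, ‖c r‖ * ‖a r‖ * ‖b r‖ ≤ 8 * P * (2 * P) ^ N * D * √m / (m : ℝ) ^ N := by
    have h1 : ∀ r ∈ S, ‖c r‖ * ‖a r‖ * ‖b r‖ ≤ (2 * P) ^ N / 2 *
        (‖dF L (fun j => ((iterDiff f N j : ℝ) : ℂ)) r‖
          * (1 / ((min r (L - r) : ℕ) : ℝ) ^ N)) := by
      intro r hr
      rw [hS, Finset.mem_filter, Finset.mem_range] at hr
      have hρ : (0 : ℝ) < (min r (L - r) : ℕ) := by exact_mod_cast hm.trans hr.2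
      have h2 := norm_zt_sub_one hL0 hr.1
      rw [mul_assoc, hab, dF_iterDiff (fun j hj => hf0 j (by omega)) (fun j hj => hf1 j (by omega)),
        hc]
      simp only [norm_mul, norm_inv, norm_pow, Complex.norm_natCast]
      have h3 : (4 * ((min r (L - r) : ℕ) : ℝ) / L) ^ N ≤ ‖zt L r - 1‖ ^ N := by gcongr
      have hLP : (L : ℝ) = 8 * P := by rw [hL]; push_cast; ring
      have hP0 : (0 : ℝ) < P := by exact_mod_cast hP
      have h4 : 1 ≤ (2 * P) ^ N * ‖zt L r - 1‖ ^ N * (1 / ((min r (L - r) : ℕ) : ℝ) ^ N) := by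
        calc (1 : ℝ) = (2 * P) ^ N * (4 * ((min r (L - r) : ℕ) : ℝ) / L) ^ N
              * (1 / ((min r (L - r) : ℕ) : ℝ) ^ N) := by
              rw [← mul_pow, one_div, ← inv_pow, ← mul_pow, hLP]
              field_simp
              norm_num
          _ ≤ _ := by gcongr
      have h5 : (L : ℝ)⁻¹ * ‖dF L (fun j => (f j : ℂ)) r‖ * (4 * P)
          = ‖dF L (fun j => (f j : ℂ)) r‖ / 2 * 1 := by
        rw [hLP]
        field_simp
        ring
      rw [h5]
      calc _ ≤ ‖dF L (fun j => (f j : ℂ)) r‖ / 2 *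
            ((2 * P) ^ N * ‖zt L r - 1‖ ^ N * (1 / ((min r (L - r) : ℕ) : ℝ) ^ N)) := by gcongr
        _ = _ := by ring
    have h2 : ∑ r ∈ S, ‖dF L (fun j => ((iterDiff f N j : ℝ) : ℂ)) r‖
          * (1 / ((min r (L - r) : ℕ) : ℝ) ^ N) ≤ (L * D) * (2 * √m / (m : ℝ) ^ N) := by
      refine abs_le_of_sq_le_sq' ?_ (by positivity) |>.2
      calc _ ≤ (∑ r ∈ S, ‖dF L (fun j => ((iterDiff f N j : ℝ) : ℂ)) r‖ ^ 2) *
            ∑ r ∈ S, (1 / ((min r (L - r) : ℕ) : ℝ) ^ N) ^ 2 :=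
            Finset.sum_mul_sq_le_sq_mul_sq _ _ _
        _ ≤ (L * D) ^ 2 * (4 * m / (m : ℝ) ^ (2 * N)) := by
            gcongr
            · calc _ ≤ ∑ r ∈ Finset.range L, ‖dF L (fun j => ((iterDiff f N j : ℝ) : ℂ)) r‖ ^ 2 :=
                    Finset.sum_le_sum_of_subset_of_nonneg (Finset.filter_subset _ _)
                      fun _ _ _ => by positivity
                _ = L * ∑ j ∈ Finset.range L, ‖((iterDiff f N j : ℝ) : ℂ)‖ ^ 2 :=
                    dF_parseval hL0 _
                _ ≤ L * ∑ j ∈ Finset.range L, D ^ 2 := by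
                    gcongr with j _
                    rw [Complex.norm_real]
                    exact hf j
                _ = _ := by simp; ring
            · refine le_trans (le_of_eq ?_) (sum_min_le (L := L) hN hm)
              refine Finset.sum_congr rfl fun r _ => ?_
              rw [div_pow, one_pow, ← pow_mul, mul_comm N 2]
        _ = _ := by
            rw [mul_pow (L * D : ℝ), div_pow, mul_pow (2 : ℝ), Real.sq_sqrt hmr.le, ← pow_mul, mul_comm N 2]
            norm_num
    calc _ ≤ ∑ r ∈ S, (2 * P) ^ N / 2 * (‖dF L (fun j => ((iterDiff f N j : ℝ) : ℂ)) r‖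
          * (1 / ((min r (L - r) : ℕ) : ℝ) ^ N)) := Finset.sum_le_sum h1
      _ ≤ (2 * P) ^ N / 2 * ((L * D) * (2 * √m / (m : ℝ) ^ N)) := by
          rw [← Finset.mul_sum]
          gcongr
      _ = _ := by
          rw [hL]
          push_cast
          ring
  refine ⟨_, fun u => ∑ r ∈ S, (c r * inner ℂ u (a r) * inner ℂ (b r) u).re, fun u => ?_,
    hsmall.mono (fun _ => le_rfl) ?_ le_rfl,
    ⟨hbig.1, fun k v hv => (hbig.2 k v hv).trans hτ⟩⟩
  · beta_reduce
    rw [hform, add_comm, ← Finset.sum_filter_add_sum_filter_not (Finset.range L)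
      fun r => m ≤ min r (L - r)]
  · exact_mod_cast card_min_lt_le L m

end HankelEig

namespace HankelEig

lemma sum_Ico_rpow_neg_le {θ : ℝ} (h0 : 0 ≤ θ) (h1 : θ < 1) (n : ℕ) :
    ∑ k ∈ Finset.Ico 1 n, (k : ℝ) ^ (-θ) ≤ (n : ℝ) ^ (1 - θ) / (1 - θ) := by
  have hθ : 0 < 1 - θ := by linarith
  have key : ∀ n : ℕ, ∑ k ∈ Finset.range n, ((k + 1 : ℕ) : ℝ) ^ (-θ)
      ≤ (n : ℝ) ^ (1 - θ) / (1 - θ) := by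
    intro n
    induction n with
    | zero => simp [Real.zero_rpow hθ.ne']
    | succ n ih =>
      rw [Finset.sum_range_succ]
      have hn : (0 : ℝ) < ((n + 1 : ℕ) : ℝ) := by positivity
      have hb := rpow_one_add_le_one_add_mul_self (s := -1 / ((n + 1 : ℕ) : ℝ)) (p := 1 - θ)
        (by rw [le_div_iff₀ hn]; push_cast; linarith [n.cast_nonneg (α := ℝ)]) hθ.le (by linarith)
      have h2 : 1 + -1 / ((n + 1 : ℕ) : ℝ) = (n : ℝ) / ((n + 1 : ℕ) : ℝ) := by
        field_simp
        push_cast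
        ring
      rw [h2, Real.div_rpow (by positivity) hn.le, div_le_iff₀ (by positivity)] at hb
      have h3 : ((n + 1 : ℕ) : ℝ) ^ (1 - θ) = ((n + 1 : ℕ) : ℝ) * ((n + 1 : ℕ) : ℝ) ^ (-θ) := by
        rw [sub_eq_add_neg, Real.rpow_add hn, Real.rpow_one]
      have h4 : (1 - θ) * ((n + 1 : ℕ) : ℝ) ^ (-θ)
          ≤ ((n + 1 : ℕ) : ℝ) ^ (1 - θ) - (n : ℝ) ^ (1 - θ) := by
        have : (1 + (1 - θ) * (-1 / ((n + 1 : ℕ) : ℝ))) * ((n + 1 : ℕ) : ℝ) ^ (1 - θ)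
            = ((n + 1 : ℕ) : ℝ) ^ (1 - θ) - (1 - θ) * ((n + 1 : ℕ) : ℝ) ^ (-θ) := by
          rw [h3]
          field_simp
          ring
        linarith
      rw [le_div_iff₀ hθ] at ih ⊢
      linarith
  rcases Nat.eq_zero_or_pos n with rfl | hn
  · simp only [Nat.zero_le, Finset.Ico_eq_empty_of_le, Finset.sum_empty]
    positivity
  · rw [Finset.sum_Ico_eq_sum_range]
    calc _ = ∑ k ∈ Finset.range (n - 1), ((k + 1 : ℕ) : ℝ) ^ (-θ) := by simp [add_comm]
      _ ≤ _ := key _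
      _ ≤ _ := by
        gcongr
        omega

/-- The dyadic piece of the sequence `e` at scale `2 ^ k`. -/
def dy (e : ℕ → ℝ) (k j : ℕ) : ℝ :=
  e j * (cut (j * ((2 : ℝ) ^ k)⁻¹) - cut (j * ((2 : ℝ) ^ (k + 1))⁻¹))

lemma cut_nat_zero {k j : ℕ} (h : j ≤ 2 ^ k) : cut (j * ((2 : ℝ) ^ k)⁻¹) = 0 := by
  refine cut_zero ?_
  rw [← div_eq_mul_inv, div_le_one (by positivity)]
  exact_mod_cast h

lemma cut_nat_one {k j : ℕ} (h : 2 * 2 ^ k ≤ j) : cut (j * ((2 : ℝ) ^ k)⁻¹) = 1 := by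
  refine cut_one ?_
  rw [← div_eq_mul_inv, le_div_iff₀ (by positivity)]
  exact_mod_cast h

lemma FT_dyadic {α : ℝ} (hα : 0 < α) {N : ℕ} (hN : 1 ≤ N) : ∃ C, 0 ≤ C ∧
    ∀ (e : ℕ → ℝ) (δ ω : ℝ) (k : ℕ), 0 ≤ δ → |ω| = 1 → 2 ≤ k → 2 * N ≤ 2 ^ k →
      (∀ m ≤ N, ∀ j ≥ 2 ^ (k - 1),
        |iterDiff e m j| ≤ δ * (j : ℝ) ^ (-1 - (m : ℝ)) * Real.log j ^ (-α)) →
      ∀ m : ℕ, 1 ≤ m → FT (fun u : ellTwo => hsum (fun j => ω ^ j * dy e k j) (4 * 2 ^ k) u) (2 * m)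
        (C * δ * (k : ℝ) ^ (-α) * (√m / (m : ℝ) ^ N)) := by
  choose c hc0 hc using exists_bound_cut
  set B := ∑ m ∈ Finset.range (N + 1), c m with hB
  have hB0 : 0 ≤ B := Finset.sum_nonneg fun m _ => hc0 m
  have hcB : ∀ m ≤ N, c m ≤ B := fun m hm =>
    Finset.single_le_sum (f := c) (fun m _ => hc0 m) (by simp; omega)
  have hlog2 := Real.log_pos one_lt_two
  refine ⟨8 * 4 ^ N * 2 ^ (N + 2) * B * (Real.log 2 / 2) ^ (-α), by positivity, ?_⟩
  intro e δ ω k hδ hω hk hNk he m hm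
  obtain ⟨k, rfl⟩ : ∃ k', k = k' + 1 := ⟨k - 1, by omega⟩
  simp only [Nat.add_sub_cancel] at he
  set S : ℕ := 2 ^ k with hS
  have hP : 2 ^ (k + 1) = 2 * S := by rw [hS]; ring
  have hS1 : 2 ≤ S := by
    calc 2 = 2 ^ 1 := rfl
      _ ≤ S := Nat.pow_le_pow_right (by norm_num) (by omega)
  have hSr : (2 : ℝ) ≤ S := by exact_mod_cast hS1
  have hS0 : (0 : ℝ) < S := by linarith
  have hlogS : 0 < Real.log S := Real.log_pos (by linarith)
  set A := δ * (S : ℝ)⁻¹ * Real.log S ^ (-α) with hA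
  have hA0 : 0 ≤ A := by positivity
  have he' : ∀ i ≤ N, ∀ j ≥ S, |iterDiff e i j| ≤ A * ((S : ℝ)⁻¹) ^ i := by
    intro i hi j hj
    have hj' : (S : ℝ) ≤ j := by exact_mod_cast hj
    have hj0 : (0 : ℝ) < j := hS0.trans_le hj'
    refine (he i hi j hj).trans ?_
    have h1 : (j : ℝ) ^ (-1 - (i : ℝ)) ≤ (S : ℝ)⁻¹ * ((S : ℝ)⁻¹) ^ i := by
      rw [← pow_succ', inv_pow, ← Real.rpow_natCast, ← Real.rpow_neg hS0.le]
      calc _ ≤ (S : ℝ) ^ (-1 - (i : ℝ)) :=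
            Real.rpow_le_rpow_of_nonpos hS0 hj' (by linarith [i.cast_nonneg (α := ℝ)])
        _ = _ := by push_cast; ring_nf
    have h2 : Real.log j ^ (-α) ≤ Real.log S ^ (-α) :=
      Real.rpow_le_rpow_of_nonpos hlogS (Real.log_le_log hS0 hj') (by linarith)
    calc _ ≤ δ * ((S : ℝ)⁻¹ * ((S : ℝ)⁻¹) ^ i) * Real.log S ^ (-α) := by gcongr
      _ = _ := by rw [hA]; ring
  have hΦ : ∀ i ≤ N, ∀ k', k ≤ k' → ∀ j,
      |iterDiff (fun j : ℕ => cut (j * ((2 : ℝ) ^ k')⁻¹)) i j| ≤ B * ((S : ℝ)⁻¹) ^ i := by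
    intro i hi k' hk' j
    refine (abs_iterDiff_comp_le (by positivity) i cut_contDiff (hc i) j).trans ?_
    have := hcB i hi
    rw [hS]
    push_cast
    gcongr
    norm_num
  have hg : ∀ i ≤ N, ∀ j ≥ S, |iterDiff (fun j : ℕ => cut (j * ((2 : ℝ) ^ (k + 1))⁻¹)
      - cut (j * ((2 : ℝ) ^ (k + 1 + 1))⁻¹)) i j| ≤ (2 * B) * ((S : ℝ)⁻¹) ^ i := by
    intro i hi j _
    have h1 := hΦ i hi (k + 1) (by omega) j
    have h2 := hΦ i hi (k + 1 + 1) (by omega) j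
    have h3 : iterDiff (fun j : ℕ => cut (j * ((2 : ℝ) ^ (k + 1))⁻¹)
        - cut (j * ((2 : ℝ) ^ (k + 1 + 1))⁻¹)) i j
        = iterDiff (fun j : ℕ => cut (j * ((2 : ℝ) ^ (k + 1))⁻¹)) i j
          + (-1) * iterDiff (fun j : ℕ => cut (j * ((2 : ℝ) ^ (k + 1 + 1))⁻¹)) i j := by
      rw [← iterDiff_const_mul, ← iterDiff_add]
      congr 1
      funext j
      ring
    rw [h3]
    refine (abs_add_le _ _).trans ?_
    rw [abs_mul, abs_neg, abs_one, one_mul]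
    linarith
  have hf0 : ∀ j ≤ 2 ^ (k + 1), dy e (k + 1) j = 0 := by
    intro j hj
    rw [dy, cut_nat_zero hj, cut_nat_zero (hj.trans (Nat.pow_le_pow_right (by norm_num) (by omega)))]
    simp
  have hf1 : ∀ j ≥ 4 * 2 ^ (k + 1), dy e (k + 1) j = 0 := by
    intro j hj
    rw [dy, cut_nat_one (k := k + 1) (by omega), cut_nat_one (by rw [pow_succ 2 (k + 1)]; omega)]
    simp
  have hD : ∀ j, |iterDiff (dy e (k + 1)) N j| ≤ 2 ^ N * (A * (2 * B)) * ((S : ℝ)⁻¹) ^ N := by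
    intro j
    rcases lt_or_ge j S with hj | hj
    · rw [iterDiff_eq_zero fun i hi => hf0 _ (by omega), abs_zero]
      positivity
    · exact abs_iterDiff_mul_le (by positivity) N hA0 (by positivity) he' hg j hj
  have hblock := FT_block (P := 2 ^ (k + 1)) (f := dy e (k + 1)) (N := N) (m := m) (ω := ω)
    (D := 2 ^ N * (A * (2 * B)) * ((S : ℝ)⁻¹) ^ N) Nat.one_le_two_pow hN (by omega) hm hω
    (by positivity) hf0 hf1 hD
  obtain ⟨q₁, q₂, hq, h1, h2, h3⟩ := hblock
  refine ⟨q₁, q₂, hq, h1, h2, fun n v hv => (h3 n v hv).trans ?_⟩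
  have hlog : Real.log S ^ (-α) ≤ (Real.log 2 / 2) ^ (-α) * ((k + 1 : ℕ) : ℝ) ^ (-α) := by
    rw [← Real.mul_rpow (by positivity) (by positivity)]
    refine Real.rpow_le_rpow_of_nonpos (by positivity) ?_ (by linarith)
    rw [hS]
    push_cast
    rw [Real.log_pow]
    have : (1 : ℝ) ≤ k := by exact_mod_cast (by omega : 1 ≤ k)
    nlinarith
  calc _ = 8 * 4 ^ N * 2 ^ (N + 2) * B * δ * Real.log S ^ (-α) * (√m / (m : ℝ) ^ N) := by
        rw [hA]
        have : ((2 ^ (k + 1) : ℕ) : ℝ) = 2 * S := by exact_mod_cast hP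
        rw [this, inv_pow, mul_pow, mul_pow, pow_add 2 N 2, show (4 : ℝ) = 2 * 2 by norm_num, mul_pow]
        field_simp
    _ ≤ 8 * 4 ^ N * 2 ^ (N + 2) * B * δ * ((Real.log 2 / 2) ^ (-α) * ((k + 1 : ℕ) : ℝ) ^ (-α))
          * (√m / (m : ℝ) ^ N) := by gcongr
    _ = _ := by ring

end HankelEig

namespace HankelEig

lemma FT_finite (e : ℕ → ℝ) (J : ℕ) : FT (fun u : ellTwo => hsum e J u) J 0 := by
  refine ⟨fun u => hsum e J u, fun _ => 0, by simp, ?_, by simp, by simp⟩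
  have := UB.of_finite (E := ellTwo) (Finset.range J) (fun j => lp.single 2 j (1 : ℂ))
    (q := fun u => hsum e J u) fun u hu => by
      refine le_of_eq ?_
      rw [hsum]
      rw [Finset.sum_eq_zero, Complex.zero_re]
      intro j hj
      refine Finset.sum_eq_zero fun l _ => ?_
      have := hu j hj
      rw [lp.inner_single_left] at this
      have h0 : u j = 0 := by simpa using this
      rw [h0]
      simp
  simpa using this

lemma one_sub_cut_eq {k₀ n : ℕ} (h : k₀ ≤ n) (e : ℕ → ℝ) (j : ℕ) :
    e j * (1 - cut (j * ((2 : ℝ) ^ n)⁻¹))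
      = e j * (1 - cut (j * ((2 : ℝ) ^ k₀)⁻¹)) + ∑ k ∈ Finset.Ico k₀ n, dy e k j := by
  induction n, h using Nat.le_induction with
  | base => simp
  | succ n hn ih =>
    rw [Finset.sum_Ico_succ_top hn, ← add_assoc, ← ih, dy]
    ring

lemma FT_smooth {α : ℝ} (hα : 1 / 2 ≤ α) {N : ℕ} (hN : 1 ≤ N) (hαN : α < N) : ∃ C, 0 ≤ C ∧
    ∀ (e : ℕ → ℝ) (δ ω : ℝ) (k₀ n : ℕ), 0 ≤ δ → |ω| = 1 → 2 ≤ k₀ → k₀ ≤ n → 2 * N ≤ 2 ^ k₀ →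
      (∀ m ≤ N, ∀ j ≥ 2 ^ (k₀ - 1),
        |iterDiff e m j| ≤ δ * (j : ℝ) ^ (-1 - (m : ℝ)) * Real.log j ^ (-α)) →
      FT (fun u : ellTwo =>
        hsum (fun j => ω ^ j * (e j * (1 - cut (j * ((2 : ℝ) ^ n)⁻¹)))) (2 * 2 ^ n) u)
        (2 * 2 ^ k₀ + C * n) (C * δ * (n * (n : ℝ) ^ (-α))) := by
  obtain ⟨C, hC0, hC⟩ := FT_dyadic (α := α) (by linarith) hN
  have hNr : (1 : ℝ) ≤ N := by exact_mod_cast hN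
  set θ := (α - 1 / 2) / (N - 1 / 2) with hθ
  have hθ0 : 0 ≤ θ := div_nonneg (by linarith) (by linarith)
  have hθ1 : θ < 1 := by
    rw [hθ, div_lt_one (by linarith)]
    linarith
  have hθN : θ * (N - 1 / 2) = α - 1 / 2 := div_mul_cancel₀ _ (by linarith)
  refine ⟨2 / (1 - θ) + C * 2 ^ ((N : ℝ) - 1 / 2) * 2, ?_, ?_⟩
  · have : 0 < 1 - θ := by linarith
    positivity
  intro e δ ω k₀ n hδ hω hk₀ hkn hNk he
  have hn0 : (0 : ℝ) < n := by exact_mod_cast (by omega : 0 < n)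
  have hθ' : 0 < 1 - θ := by linarith
  set M : ℕ → ℕ := fun k => ⌊((n : ℝ) / k) ^ θ⌋₊ with hM
  have hsub : Finset.Ico k₀ n ⊆ Finset.Ico 1 n := Finset.Ico_subset_Ico_left (by omega)
  have hk : ∀ k ∈ Finset.Ico 1 n, (0 : ℝ) < k ∧ (1 : ℝ) ≤ (n : ℝ) / k := by
    intro k hk
    rw [Finset.mem_Ico] at hk
    have h0 : (0 : ℝ) < k := by exact_mod_cast hk.1
    refine ⟨h0, (one_le_div h0).2 (by exact_mod_cast hk.2.le)⟩
  have hM1 : ∀ k ∈ Finset.Ico 1 n, 1 ≤ M k := fun k hk' =>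
    Nat.le_floor (by simpa using Real.one_le_rpow (hk k hk').2 hθ0)
  have hM2 : ∀ k ∈ Finset.Ico 1 n, (M k : ℝ) ≤ (n : ℝ) ^ θ * (k : ℝ) ^ (-θ) := by
    intro k hk'
    refine (Nat.floor_le (by positivity)).trans (le_of_eq ?_)
    rw [Real.div_rpow hn0.le (hk k hk').1.le, Real.rpow_neg (hk k hk').1.le, div_eq_mul_inv]
  have hM3 : ∀ k ∈ Finset.Ico 1 n, ((n : ℝ) / k) ^ θ / 2 ≤ M k := by
    intro k hk'
    have h1 := Nat.lt_floor_add_one (((n : ℝ) / k) ^ θ)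
    have h2 : (1 : ℝ) ≤ M k := by exact_mod_cast hM1 k hk'
    change _ < (M k : ℝ) + 1 at h1
    linarith
  have hMt : ∀ k ∈ Finset.Ico 1 n, (k : ℝ) ^ (-α) * (√(M k) / (M k : ℝ) ^ N)
      ≤ 2 ^ ((N : ℝ) - 1 / 2) * ((n : ℝ) ^ (-(α - 1 / 2)) * (k : ℝ) ^ (-(1 / 2 : ℝ))) := by
    intro k hk'
    obtain ⟨h0, h1⟩ := hk k hk'
    have hMp : (0 : ℝ) < M k := by exact_mod_cast hM1 k hk'
    have e1 : √(M k) / (M k : ℝ) ^ N = (M k : ℝ) ^ (-((N : ℝ) - 1 / 2)) := by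
      rw [Real.sqrt_eq_rpow, ← Real.rpow_natCast, ← Real.rpow_sub hMp]
      ring_nf
    have e2 : (M k : ℝ) ^ (-((N : ℝ) - 1 / 2))
        ≤ (((n : ℝ) / k) ^ θ / 2) ^ (-((N : ℝ) - 1 / 2)) :=
      Real.rpow_le_rpow_of_nonpos (by positivity) (hM3 k hk') (by linarith)
    have e3 : (((n : ℝ) / k) ^ θ / 2) ^ (-((N : ℝ) - 1 / 2))
        = 2 ^ ((N : ℝ) - 1 / 2) * ((n : ℝ) ^ (-(α - 1 / 2)) * (k : ℝ) ^ (α - 1 / 2)) := by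
      rw [Real.div_rpow (by positivity) zero_le_two, ← Real.rpow_mul (by positivity), mul_neg, hθN,
        Real.rpow_neg zero_le_two, div_inv_eq_mul, Real.div_rpow hn0.le h0.le, Real.rpow_neg h0.le,
        div_inv_eq_mul]
      ring
    calc _ ≤ (k : ℝ) ^ (-α) * (2 ^ ((N : ℝ) - 1 / 2) * ((n : ℝ) ^ (-(α - 1 / 2))
          * (k : ℝ) ^ (α - 1 / 2))) := by
          rw [e1, ← e3]
          gcongr
      _ = 2 ^ ((N : ℝ) - 1 / 2) * ((n : ℝ) ^ (-(α - 1 / 2))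
          * ((k : ℝ) ^ (-α) * (k : ℝ) ^ (α - 1 / 2))) := by ring
      _ = _ := by
          rw [← Real.rpow_add h0]
          ring_nf
  have h1 := FT_finite (fun j => ω ^ j * (e j * (1 - cut (j * ((2 : ℝ) ^ k₀)⁻¹)))) (2 * 2 ^ k₀)
  have h2 := FT.sum (Finset.Ico k₀ n) fun k hk' =>
    hC e δ ω k hδ hω (hk₀.trans (Finset.mem_Ico.1 hk').1)
      (hNk.trans (Nat.pow_le_pow_right (by norm_num) (Finset.mem_Ico.1 hk').1))
      (fun m hm j hj => he m hm j ((Nat.pow_le_pow_right (by norm_num)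
        (Nat.sub_le_sub_right (Finset.mem_Ico.1 hk').1 1)).trans hj)) (M k) (hM1 k (hsub hk'))
  obtain ⟨q₁, q₂, hq, h3, h4, h5⟩ := h1.add h2
  refine ⟨q₁, q₂, fun u => ?_, h3.mono (fun _ => le_rfl) ?_ le_rfl,
    h4, fun m v hv => (h5 m v hv).trans ?_⟩
  · refine le_trans (le_of_eq ?_) (hq u)
    have e1 : (fun j : ℕ => ω ^ j * (e j * (1 - cut (j * ((2 : ℝ) ^ n)⁻¹))))
        = fun j : ℕ => ω ^ j * (e j * (1 - cut (j * ((2 : ℝ) ^ k₀)⁻¹)))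
          + ∑ k ∈ Finset.Ico k₀ n, ω ^ j * dy e k j := by
      funext j
      rw [one_sub_cut_eq hkn, mul_add, Finset.mul_sum]
    have e2 : hsum (fun j : ℕ => ω ^ j * (e j * (1 - cut (j * ((2 : ℝ) ^ n)⁻¹)))) (2 * 2 ^ n) u
        = hsum (fun j : ℕ => ω ^ j * (e j * (1 - cut (j * ((2 : ℝ) ^ n)⁻¹)))) (4 * 2 ^ n) u :=
      (hsum_eq_of_support (fun j hj => by rw [cut_nat_one hj]; simp) u (by omega)).symm
    beta_reduce
    rw [e2, e1, hsum_add, hsum_sum]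
    have hpow : ∀ k ≤ n, 2 ^ k ≤ 2 ^ n := fun k hk => Nat.pow_le_pow_right (by norm_num) hk
    congr 1
    · exact hsum_eq_of_support (fun j hj => by rw [cut_nat_one hj]; simp) u
        (by have := hpow k₀ hkn; omega)
    · refine Finset.sum_congr rfl fun k hk' => ?_
      refine hsum_eq_of_support (fun j hj => ?_) u (by
        have := hpow k (Finset.mem_Ico.1 hk').2.le
        omega)
      rw [dy, cut_nat_one (k := k) (by omega), cut_nat_one (by rw [pow_succ 2 k]; omega)]
      simp
  · have e1 : ∑ k ∈ Finset.Ico k₀ n, 2 * (M k : ℝ) ≤ 2 / (1 - θ) * n := by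
      calc _ ≤ ∑ k ∈ Finset.Ico 1 n, 2 * (M k : ℝ) :=
            Finset.sum_le_sum_of_subset_of_nonneg hsub fun _ _ _ => by positivity
        _ ≤ ∑ k ∈ Finset.Ico 1 n, 2 * ((n : ℝ) ^ θ * (k : ℝ) ^ (-θ)) := by
            refine Finset.sum_le_sum fun k hk' => ?_
            have := hM2 k hk'
            gcongr
        _ ≤ 2 * ((n : ℝ) ^ θ * ((n : ℝ) ^ (1 - θ) / (1 - θ))) := by
            rw [← Finset.mul_sum, ← Finset.mul_sum]
            have := sum_Ico_rpow_neg_le hθ0 hθ1 n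
            gcongr
        _ = 2 / (1 - θ) * ((n : ℝ) ^ θ * (n : ℝ) ^ (1 - θ)) := by ring
        _ = _ := by
            rw [← Real.rpow_add hn0]
            simp
    have e2 : 0 ≤ C * 2 ^ ((N : ℝ) - 1 / 2) * 2 * n := by positivity
    push_cast
    linarith
  · rw [zero_add]
    have e1 := sum_Ico_rpow_neg_le (θ := 1 / 2) (by norm_num) (by norm_num) n
    calc _ ≤ ∑ k ∈ Finset.Ico 1 n, C * δ * (k : ℝ) ^ (-α) * (√(M k) / (M k : ℝ) ^ N) :=
          Finset.sum_le_sum_of_subset_of_nonneg hsub fun _ _ _ => by positivity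
      _ ≤ ∑ k ∈ Finset.Ico 1 n, C * δ * 2 ^ ((N : ℝ) - 1 / 2) * (n : ℝ) ^ (-(α - 1 / 2))
            * (k : ℝ) ^ (-(1 / 2 : ℝ)) := by
          refine Finset.sum_le_sum fun k hk' => ?_
          have := mul_le_mul_of_nonneg_left (hMt k hk') (mul_nonneg hC0 hδ)
          linarith
      _ ≤ C * δ * 2 ^ ((N : ℝ) - 1 / 2) * (n : ℝ) ^ (-(α - 1 / 2))
            * ((n : ℝ) ^ (1 - 1 / 2 : ℝ) / (1 - 1 / 2)) := by
          rw [← Finset.mul_sum]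
          gcongr
      _ = C * 2 ^ ((N : ℝ) - 1 / 2) * 2 * δ * ((n : ℝ) ^ (-(α - 1 / 2)) * (n : ℝ) ^ (1 - 1 / 2 : ℝ)) := by
          ring
      _ = C * 2 ^ ((N : ℝ) - 1 / 2) * 2 * δ * (n * (n : ℝ) ^ (-α)) := by
          have : (n : ℝ) * (n : ℝ) ^ (-α) = (n : ℝ) ^ (1 - α) := by
            rw [sub_eq_add_neg, Real.rpow_add hn0, Real.rpow_one]
          rw [← Real.rpow_add hn0, this]
          ring_nf
      _ ≤ _ := by
          have : 0 ≤ 2 / (1 - θ) := by positivity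
          gcongr
          linarith

end HankelEig

namespace HankelEig

/-- The iterated differences of `e` of order `m ≤ N` are `o(j⁻¹⁻ᵐ (log j)⁻ᵅ)`. -/
def Cls (α : ℝ) (N : ℕ) (e : ℕ → ℝ) : Prop :=
  ∀ m ≤ N, ∀ δ : ℝ, 0 < δ →
    ∀ᶠ j : ℕ in atTop, |iterDiff e m j| ≤ δ * (j : ℝ) ^ (-1 - (m : ℝ)) * Real.log j ^ (-α)

lemma Cls.exists_forall {α : ℝ} {N : ℕ} {e : ℕ → ℝ} (h : Cls α N e) {δ : ℝ} (hδ : 0 < δ) :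
    ∃ j₀ : ℕ, ∀ m ≤ N, ∀ j ≥ j₀,
      |iterDiff e m j| ≤ δ * (j : ℝ) ^ (-1 - (m : ℝ)) * Real.log j ^ (-α) := by
  have : ∀ᶠ j : ℕ in atTop, ∀ m ∈ Finset.range (N + 1),
      |iterDiff e m j| ≤ δ * (j : ℝ) ^ (-1 - (m : ℝ)) * Real.log j ^ (-α) :=
    (Filter.eventually_all_finset _).2 fun m hm => h m (by simp at hm; omega) δ hδ
  obtain ⟨j₀, hj⟩ := eventually_atTop.1 this
  exact ⟨j₀, fun m hm j hj' => hj j hj' m (by simp; omega)⟩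

lemma abs_le_of_two_pow_le {α δ : ℝ} (hα : 0 < α) (hδ : 0 ≤ δ) {e : ℕ → ℝ} {n j : ℕ} (hn : 1 ≤ n)
    (hj : 2 ^ n ≤ j)
    (he : |e j| ≤ δ * (j : ℝ) ^ (-1 - ((0 : ℕ) : ℝ)) * Real.log j ^ (-α)) :
    |e j| ≤ 2 * (Real.log 2) ^ (-α) * δ * (n : ℝ) ^ (-α) / ((j : ℝ) + 1) := by
  have hn0 : (0 : ℝ) < n := by exact_mod_cast hn
  have hj1 : (1 : ℝ) ≤ j := by exact_mod_cast Nat.one_le_two_pow.trans hj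
  have hlog2 := Real.log_pos one_lt_two
  have h1 : Real.log j ^ (-α) ≤ (Real.log 2) ^ (-α) * (n : ℝ) ^ (-α) := by
    rw [← Real.mul_rpow hlog2.le hn0.le]
    refine Real.rpow_le_rpow_of_nonpos (by positivity) ?_ (by linarith)
    rw [mul_comm, ← Real.log_pow]
    exact Real.log_le_log (by positivity) (by exact_mod_cast hj)
  have h2 : (j : ℝ) ^ (-1 - ((0 : ℕ) : ℝ)) ≤ 2 / ((j : ℝ) + 1) := by
    rw [Nat.cast_zero, sub_zero, Real.rpow_neg_one, inv_eq_one_div,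
      div_le_div_iff₀ (by positivity) (by positivity)]
    linarith
  calc _ ≤ _ := he
    _ ≤ δ * (2 / ((j : ℝ) + 1)) * ((Real.log 2) ^ (-α) * (n : ℝ) ^ (-α)) := by gcongr
    _ = _ := by ring

lemma exists_approx_smooth {α : ℝ} (hα : 1 / 2 ≤ α) {N : ℕ} (hN : 1 ≤ N) (hαN : α < N)
    {e : ℕ → ℝ} (he : Cls α N e) {ω : ℝ} (hω : |ω| = 1) :
    ∃ C, 0 ≤ C ∧ ∀ δ, 0 < δ → ∀ᶠ n : ℕ in atTop, ∃ (f : ℕ → ℝ) (J : ℕ), (∀ j, J ≤ j → f j = 0) ∧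
      UB (fun u : ellTwo => hsum (fun j => ω ^ j * f j) J u) (C * n) (δ * (n : ℝ) ^ (-α)) ∧
      ∀ j, |e j - f j| ≤ δ * (n : ℝ) ^ (-α) / ((j : ℝ) + 1) := by
  obtain ⟨C, hC0, hC⟩ := FT_smooth hα hN hαN
  refine ⟨1 + C + C, by positivity, fun δ hδ => ?_⟩
  have hlog2 := Real.log_pos one_lt_two
  set c := 2 * (Real.log 2) ^ (-α) with hc
  have hc0 : 0 < c := by positivity
  set δ' := min δ (δ / c) with hδ'
  have hδ'0 : 0 < δ' := lt_min hδ (by positivity)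
  obtain ⟨j₀, hj₀⟩ := he.exists_forall hδ'0
  set k₀ := j₀ + 2 * N + 2 with hk₀
  have hpow : k₀ - 1 < 2 ^ (k₀ - 1) := Nat.lt_two_pow_self
  have hpow' : k₀ < 2 ^ k₀ := Nat.lt_two_pow_self
  filter_upwards [eventually_ge_atTop (max k₀ (2 * 2 ^ k₀))] with n hn
  have hn1 : k₀ ≤ n := (le_max_left _ _).trans hn
  have hn2 : 2 * 2 ^ k₀ ≤ n := (le_max_right _ _).trans hn
  have hn0 : (0 : ℝ) < n := by exact_mod_cast (by omega : 0 < n)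
  refine ⟨fun j => e j * (1 - cut (j * ((2 : ℝ) ^ n)⁻¹)), 2 * 2 ^ n,
    fun j hj => by beta_reduce; rw [cut_nat_one hj]; simp, ?_, fun j => ?_⟩
  · have h := (hC e δ' ω k₀ n hδ'0.le hω (by omega) hn1 (by omega)
      fun m hm j hj => hj₀ m hm j (by omega)).toUB (l := δ * (n : ℝ) ^ (-α)) (by positivity)
    refine h.mono (fun _ => le_rfl) ?_ le_rfl
    have h1 : C * δ' * (n * (n : ℝ) ^ (-α)) / (δ * (n : ℝ) ^ (-α)) ≤ C * n := by
      rw [div_le_iff₀ (by positivity)]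
      have : δ' ≤ δ := min_le_left _ _
      calc _ ≤ C * δ * (n * (n : ℝ) ^ (-α)) := by gcongr
        _ = _ := by ring
    have h2 : (2 : ℝ) * 2 ^ k₀ ≤ n := by exact_mod_cast hn2
    linarith
  · rw [show e j - e j * (1 - cut (j * ((2 : ℝ) ^ n)⁻¹)) = e j * cut (j * ((2 : ℝ) ^ n)⁻¹) by ring]
    rcases le_total j (2 ^ n) with hj | hj
    · rw [cut_nat_zero hj, mul_zero, abs_zero]
      positivity
    · have hjn : n < 2 ^ n := Nat.lt_two_pow_self
      have h1 := abs_le_of_two_pow_le (by linarith) hδ'0.le (by omega) hj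
        (hj₀ 0 (Nat.zero_le _) j (by omega))
      have h2 : |cut (j * ((2 : ℝ) ^ n)⁻¹)| ≤ 1 := abs_le.2
        ⟨by linarith [Real.smoothTransition.nonneg (j * ((2 : ℝ) ^ n)⁻¹ - 1), show
          cut (j * ((2 : ℝ) ^ n)⁻¹) = Real.smoothTransition (j * ((2 : ℝ) ^ n)⁻¹ - 1) from rfl],
          Real.smoothTransition.le_one _⟩
      have h3 : c * δ' ≤ δ := by
        calc _ ≤ c * (δ / c) := by
              gcongr
              exact min_le_right _ _
          _ = δ := by field_simp
      rw [abs_mul]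
      calc _ ≤ |e j| * 1 := by gcongr
        _ ≤ c * δ' * (n : ℝ) ^ (-α) / ((j : ℝ) + 1) := by rw [mul_one]; exact h1
        _ ≤ _ := by gcongr

lemma sum_sum_add_le {F : ℕ → ℝ} (hF : ∀ m, 0 ≤ F m) {J : ℕ} (h0 : ∀ m, J ≤ m → F m = 0) :
    ∑ i ∈ Finset.range J, ∑ j ∈ Finset.range J, F (i + j)
      ≤ ∑ m ∈ Finset.range J, ((m : ℝ) + 1) * F m := by
  have h1 : ∀ i, ∑ j ∈ Finset.range J, F (i + j)
      ≤ ∑ m ∈ Finset.range J, if i ≤ m then F m else 0 := by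
    intro i
    rw [← Finset.sum_filter]
    have e1 : ∑ j ∈ Finset.range J, F (i + j) = ∑ m ∈ Finset.Ico i (i + J), F m := by
      rw [Finset.sum_Ico_eq_sum_range, Nat.add_sub_cancel_left]
    rw [e1, ← Finset.sum_filter_add_sum_filter_not (Finset.Ico i (i + J)) fun m => m < J,
      Finset.sum_eq_zero (s := Finset.filter (fun m => ¬ m < J) _), add_zero]
    · refine Finset.sum_le_sum_of_subset_of_nonneg (fun m hm => ?_) fun m _ _ => hF m
      simp only [Finset.mem_filter, Finset.mem_Ico, Finset.mem_range] at hm ⊢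
      omega
    · intro m hm
      exact h0 m (by simpa using (Finset.mem_filter.1 hm).2)
  refine (Finset.sum_le_sum fun i _ => h1 i).trans ?_
  rw [Finset.sum_comm]
  refine Finset.sum_le_sum fun m _ => ?_
  rw [← Finset.sum_filter, Finset.sum_const, nsmul_eq_mul]
  have : (Finset.filter (fun i => i ≤ m) (Finset.range J)).card ≤ m + 1 := by
    calc _ ≤ (Finset.range (m + 1)).card := Finset.card_le_card fun i hi => by
          simp only [Finset.mem_filter, Finset.mem_range] at hi ⊢
          omega
      _ = _ := by simp
  have : ((Finset.filter (fun i => i ≤ m) (Finset.range J)).card : ℝ) ≤ (m : ℝ) + 1 := by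
    exact_mod_cast this
  exact mul_le_mul_of_nonneg_right this (hF m)

lemma UB_hsum_hilbertSchmidt {f : ℕ → ℝ} {J : ℕ} (h0 : ∀ m, J ≤ m → f m = 0) {l Q : ℝ}
    (hl : 0 < l) (hQ : ∑ m ∈ Finset.range J, ((m : ℝ) + 1) * f m ^ 2 ≤ Q) :
    UB (fun u : ellTwo => hsum f J u) (Q / l ^ 2) l := by
  set b : Fin J → ellTwo := fun i => lp.single 2 (i : ℕ) (1 : ℂ) with hb
  have hbi : ∀ i (u : ellTwo), inner ℂ (b i) u = u i := by
    intro i u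
    rw [hb, lp.inner_single_left]
    simp
  have hbo : Orthonormal ℂ b := by
    rw [orthonormal_iff_ite]
    intro i j
    rw [hbi, hb, lp.single_apply, Pi.single_apply]
    simp [Fin.val_inj]
  have h := UB.of_hilbertSchmidt (fun i j : Fin J => ((f (i + j) : ℝ) : ℂ)) hbo hl (Q := Q) (by
    refine le_trans (le_of_eq ?_) ((sum_sum_add_le (F := fun m => f m ^ 2)
      (fun m => sq_nonneg _) fun m hm => by simp [h0 m hm]).trans hQ)
    rw [← Fin.sum_univ_eq_sum_range (fun i => ∑ j ∈ Finset.range J, f (i + j) ^ 2)]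
    refine Finset.sum_congr rfl fun i _ => ?_
    rw [← Fin.sum_univ_eq_sum_range (fun j => f (i + j) ^ 2)]
    simp)
  refine h.mono (fun u => le_of_eq ?_) le_rfl le_rfl
  rw [hsum, ← Fin.sum_univ_eq_sum_range
    (fun j => ∑ l ∈ Finset.range J, (f (j + l) : ℂ) * (starRingEnd ℂ) (u j) * u l)]
  congr 1
  refine Finset.sum_congr rfl fun i _ => ?_
  rw [← Fin.sum_univ_eq_sum_range (fun l => (f (i + l) : ℂ) * (starRingEnd ℂ) (u i) * u l)]
  refine Finset.sum_congr rfl fun j _ => ?_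
  rw [hbi, ← inner_conj_symm, hbi]

lemma sum_Ico_two_pow_le {F G : ℕ → ℝ} {k₀ : ℕ}
    (h : ∀ k ≥ k₀, ∀ m ∈ Finset.Ico (2 ^ k) (2 ^ (k + 1)), F m ≤ (2 ^ k)⁻¹ * G k) {n : ℕ}
    (hn : k₀ ≤ n) :
    ∑ m ∈ Finset.Ico (2 ^ k₀) (2 ^ n), F m ≤ ∑ k ∈ Finset.Ico k₀ n, G k := by
  induction n, hn using Nat.le_induction with
  | base => simp
  | succ n hn ih =>
    rw [Finset.sum_Ico_succ_top hn, ← Finset.sum_Ico_consecutive F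
      (Nat.pow_le_pow_right (by norm_num) hn : 2 ^ k₀ ≤ 2 ^ n)
      (Nat.pow_le_pow_right (by norm_num) n.le_succ)]
    refine add_le_add ih ((Finset.sum_le_sum fun m hm => h n hn m hm).trans (le_of_eq ?_))
    rw [Finset.sum_const, Nat.card_Ico, nsmul_eq_mul, pow_succ, Nat.mul_two, Nat.add_sub_cancel]
    push_cast
    field_simp

lemma exists_approx_sharp {α : ℝ} (hα : 0 < α) (hα2 : α < 1 / 2)
    {e : ℕ → ℝ} (he : Cls α 0 e) {ω : ℝ} (hω : |ω| = 1) :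
    ∃ C, 0 ≤ C ∧ ∀ δ, 0 < δ → ∀ᶠ n : ℕ in atTop, ∃ (f : ℕ → ℝ) (J : ℕ), (∀ j, J ≤ j → f j = 0) ∧
      UB (fun u : ellTwo => hsum (fun j => ω ^ j * f j) J u) (C * n) (δ * (n : ℝ) ^ (-α)) ∧
      ∀ j, |e j - f j| ≤ δ * (n : ℝ) ^ (-α) / ((j : ℝ) + 1) := by
  have hlog2 := Real.log_pos one_lt_two
  set c := 2 * (Real.log 2) ^ (-α) with hc
  have hc0 : 0 < c := by positivity
  refine ⟨1 + 1 / (1 - 2 * α), ?_, fun δ hδ => ?_⟩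
  · have : 0 < 1 - 2 * α := by linarith
    positivity
  set δ' := δ / c with hδ'
  have hδ'0 : 0 < δ' := by positivity
  obtain ⟨j₀, hj₀⟩ := he.exists_forall hδ'0
  set k₀ := j₀ + 1 with hk₀
  have hpow : k₀ < 2 ^ k₀ := Nat.lt_two_pow_self
  set C₀ := ∑ m ∈ Finset.range (2 ^ k₀), ((m : ℝ) + 1) * e m ^ 2 with hC₀
  have hC₀' : 0 ≤ C₀ := Finset.sum_nonneg fun _ _ => by positivity
  have hlim : Tendsto (fun n : ℕ => (n : ℝ) ^ (1 - 2 * α)) atTop atTop :=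
    (tendsto_rpow_atTop (by linarith)).comp tendsto_natCast_atTop_atTop
  filter_upwards [eventually_ge_atTop k₀, hlim.eventually_ge_atTop (C₀ / δ ^ 2)] with n hn hn2
  have hn0 : (0 : ℝ) < n := by exact_mod_cast (by omega : 0 < n)
  have hα' : 0 < 1 - 2 * α := by linarith
  refine ⟨fun j => if j < 2 ^ n then e j else 0, 2 ^ n, fun j hj => if_neg (by omega), ?_,
    fun j => ?_⟩
  · set Q := C₀ + δ ^ 2 * ((n : ℝ) ^ (1 - 2 * α) / (1 - 2 * α)) with hQ
    have h := UB_hsum_hilbertSchmidt (f := fun j => ω ^ j * if j < 2 ^ n then e j else 0)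
      (J := 2 ^ n) (fun j hj => by rw [if_neg (by omega), mul_zero])
      (l := δ * (n : ℝ) ^ (-α)) (Q := Q) (by positivity) (by
        have e1 : ∑ m ∈ Finset.range (2 ^ n), ((m : ℝ) + 1) * (ω ^ m * if m < 2 ^ n then e m else 0) ^ 2
            = C₀ + ∑ m ∈ Finset.Ico ((2 : ℕ) ^ k₀) (2 ^ n), ((m : ℝ) + 1) * e m ^ 2 := by
          rw [hC₀, Finset.sum_range_add_sum_Ico _ (Nat.pow_le_pow_right (by norm_num) hn)]
          refine Finset.sum_congr rfl fun m hm => ?_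
          rw [if_pos (Finset.mem_range.1 hm), mul_pow, ← sq_abs (ω ^ m), abs_pow, hω]
          simp
        rw [e1]
        have e2 := sum_Ico_two_pow_le (F := fun m => ((m : ℝ) + 1) * e m ^ 2)
          (G := fun k => δ ^ 2 * (k : ℝ) ^ (-(2 * α))) (k₀ := k₀) (fun k hk m hm => by
            rw [Finset.mem_Ico] at hm
            have hk' : k < 2 ^ k := Nat.lt_two_pow_self
            have hk0 : (0 : ℝ) < k := by exact_mod_cast (by omega : 0 < k)
            have h1 := abs_le_of_two_pow_le hα hδ'0.le (by omega) hm.1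
              (hj₀ 0 le_rfl m (by omega))
            have h2 : 2 * (Real.log 2) ^ (-α) * δ' = δ := by
              rw [hδ', hc]
              field_simp
            rw [h2] at h1
            have hm2 : (2 : ℝ) ^ k ≤ (m : ℝ) + 1 := by
              have : (2 : ℝ) ^ k ≤ m := by exact_mod_cast hm.1
              linarith
            rw [← sq_abs]
            calc ((m : ℝ) + 1) * |e m| ^ 2
                ≤ ((m : ℝ) + 1) * (δ * (k : ℝ) ^ (-α) / ((m : ℝ) + 1)) ^ 2 := by
                  gcongr
                  exact h1
              _ = ((m : ℝ) + 1)⁻¹ * (δ ^ 2 * ((k : ℝ) ^ (-α)) ^ 2) := by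
                  field_simp
              _ ≤ (2 ^ k)⁻¹ * (δ ^ 2 * ((k : ℝ) ^ (-α)) ^ 2) := by gcongr
              _ = _ := by
                  rw [← Real.rpow_natCast ((k : ℝ) ^ (-α)), ← Real.rpow_mul hk0.le]
                  norm_num
                  ring_nf
                  simp) hn
        have e3 := sum_Ico_rpow_neg_le (θ := 2 * α) (by linarith) (by linarith) n
        have e4 : ∑ k ∈ Finset.Ico k₀ n, δ ^ 2 * (k : ℝ) ^ (-(2 * α))
            ≤ ∑ k ∈ Finset.Ico 1 n, δ ^ 2 * (k : ℝ) ^ (-(2 * α)) :=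
          Finset.sum_le_sum_of_subset_of_nonneg (Finset.Ico_subset_Ico_left (by omega))
            fun _ _ _ => by positivity
        simp only [← Finset.mul_sum] at e2 e4
        have e5 := mul_le_mul_of_nonneg_left e3 (sq_nonneg δ)
        rw [hQ]
        linarith)
    refine h.mono (fun _ => le_rfl) ?_ le_rfl
    rw [div_le_iff₀ (by positivity), hQ]
    rw [div_le_iff₀ (by positivity)] at hn2
    have e1 : n * ((n : ℝ) ^ (-α)) ^ 2 = (n : ℝ) ^ (1 - 2 * α) := by
      rw [← Real.rpow_natCast ((n : ℝ) ^ (-α)), ← Real.rpow_mul hn0.le, sub_eq_add_neg,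
        Real.rpow_add hn0, Real.rpow_one]
      congr 2
      push_cast
      ring
    calc _ ≤ (n : ℝ) ^ (1 - 2 * α) * δ ^ 2 + δ ^ 2 * ((n : ℝ) ^ (1 - 2 * α) / (1 - 2 * α)) := by
          linarith
      _ = _ := by
          rw [mul_pow, ← e1]
          ring
  · beta_reduce
    rcases lt_or_ge j (2 ^ n) with hj | hj
    · rw [if_pos hj, sub_self, abs_zero]
      positivity
    · rw [if_neg (not_lt.2 hj), sub_zero]
      have hjn : n < 2 ^ n := Nat.lt_two_pow_self
      have h1 := abs_le_of_two_pow_le hα hδ'0.le (by omega) hj (hj₀ 0 le_rfl j (by omega))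
      have h2 : 2 * (Real.log 2) ^ (-α) * δ' = δ := by
        rw [hδ', hc]
        field_simp
      rwa [h2] at h1

/-- A Hankel form whose sequence lies in the error class is negligible. -/
lemma exists_approx {α : ℝ} (hα : 0 < α) {e : ℕ → ℝ} (he : Cls α (Nal α) e) {ω : ℝ}
    (hω : |ω| = 1) {δ : ℝ} (hδ : 0 < δ) :
    ∀ᶠ n : ℕ in atTop, ∃ (f : ℕ → ℝ) (J : ℕ), (∀ j, J ≤ j → f j = 0) ∧
      UB (fun u : ellTwo => hsum (fun j => ω ^ j * f j) J u) (δ * n) (δ * (n : ℝ) ^ (-α)) ∧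
      ∀ j, |e j - f j| ≤ δ * (n : ℝ) ^ (-α) / ((j : ℝ) + 1) := by
  obtain ⟨C, hC0, hC⟩ : ∃ C, 0 ≤ C ∧ ∀ δ, 0 < δ → ∀ᶠ n : ℕ in atTop,
      ∃ (f : ℕ → ℝ) (J : ℕ), (∀ j, J ≤ j → f j = 0) ∧
      UB (fun u : ellTwo => hsum (fun j => ω ^ j * f j) J u) (C * n) (δ * (n : ℝ) ^ (-α)) ∧
      ∀ j, |e j - f j| ≤ δ * (n : ℝ) ^ (-α) / ((j : ℝ) + 1) := by
    rcases lt_or_ge α (1 / 2) with h | h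
    · rw [Nal, if_pos h] at he
      exact exists_approx_sharp hα h he hω
    · rw [Nal, if_neg (not_lt.2 h)] at he
      exact exists_approx_smooth h (by omega) (by exact_mod_cast Nat.lt_floor_add_one α) he hω
  set ε := δ / (C + 1) with hε
  have hε0 : 0 < ε := by positivity
  have h1 := hC (δ * (ε / 2) ^ α) (by positivity)
  have hfl : Tendsto (fun n : ℕ => ⌊ε * (n : ℝ)⌋₊) atTop atTop :=
    tendsto_nat_floor_atTop.comp (tendsto_natCast_atTop_atTop.const_mul_atTop hε0)
  filter_upwards [hfl.eventually h1, hfl.eventually_ge_atTop 1, eventually_ge_atTop 1]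
    with n ⟨f, J, hf, hU, hd⟩ hn hn1
  set n' := ⌊ε * (n : ℝ)⌋₊ with hn'
  have hn0 : (0 : ℝ) < n := by exact_mod_cast hn1
  have hle : (n' : ℝ) ≤ ε * n := Nat.floor_le (by positivity)
  have hge : ε / 2 * n ≤ n' := by
    have := Nat.lt_floor_add_one (ε * (n : ℝ))
    have h2 : (1 : ℝ) ≤ n' := by exact_mod_cast hn
    rw [← hn'] at this
    linarith
  have hpow : δ * (ε / 2) ^ α * (n' : ℝ) ^ (-α) ≤ δ * (n : ℝ) ^ (-α) := by
    calc _ ≤ δ * (ε / 2) ^ α * (ε / 2 * n) ^ (-α) := by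
          gcongr ?_ * ?_
          exact Real.rpow_le_rpow_of_nonpos (by positivity) hge (by linarith)
      _ = _ := by
          rw [Real.mul_rpow (by positivity) hn0.le, Real.rpow_neg (by positivity : 0 ≤ ε / 2)]
          field_simp
  refine ⟨f, J, hf, hU.mono (fun _ => le_rfl) ?_ hpow, fun j => (hd j).trans (by gcongr)⟩
  calc C * n' ≤ C * (ε * n) := by gcongr
    _ = δ * n * (C / (C + 1)) := by rw [hε]; ring
    _ ≤ δ * n * 1 := by
        gcongr
        rw [div_le_one (by positivity)]
        linarith
    _ = _ := mul_one _

end HankelEig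

namespace HankelEig

lemma inv_cosh_le (x : ℝ) : (Real.cosh x)⁻¹ ≤ 2 * Real.exp (-|x|) := by
  rw [Real.exp_neg, ← div_eq_mul_inv, inv_eq_one_div, div_le_div_iff₀ (Real.cosh_pos x) (Real.exp_pos _),
    ← Real.cosh_abs, Real.cosh_eq]
  linarith [Real.exp_pos (-|x|)]

lemma integral_exp_neg_abs : ∫ x : ℝ, Real.exp (-|x|) = 2 := by
  rw [integral_comp_abs (f := fun x => Real.exp (-x)), integral_exp_neg_Ioi_zero, mul_one]

lemma integrable_exp_neg_abs : Integrable fun x : ℝ => Real.exp (-|x|) :=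
  Integrable.of_integral_ne_zero (by rw [integral_exp_neg_abs]; exact two_ne_zero)

lemma integrable_exp_neg_abs_sub (t : ℝ) : Integrable fun s : ℝ => Real.exp (-|s - t|) :=
  integrable_exp_neg_abs.comp_sub_right t

lemma integral_exp_neg_abs_sub (t : ℝ) : ∫ s : ℝ, Real.exp (-|s - t|) = 2 := by
  rw [integral_sub_right_eq_self fun s => Real.exp (-|s|), integral_exp_neg_abs]

variable {E : Type*} [NormedAddCommGroup E] [InnerProductSpace ℂ E]

/-- A family of unit vectors whose Gram matrix is `1 / cosh (s - t)`. -/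
def SechFamily (kv : ℝ → E) : Prop :=
  ∀ s t, inner ℂ (kv s) (kv t) = (((Real.cosh (s - t))⁻¹ : ℝ) : ℂ)

namespace SechFamily

variable {kv : ℝ → E} (hk : SechFamily kv)
include hk

lemma norm_eq (s : ℝ) : ‖kv s‖ = 1 := by
  have h := hk s s
  rw [inner_self_eq_norm_sq_to_K] at h
  have h2 : ‖kv s‖ ^ 2 = 1 := by
    have : ((‖kv s‖ ^ 2 : ℝ) : ℂ) = ((1 : ℝ) : ℂ) := by
      rw [Complex.ofReal_pow]
      simpa using h
    exact_mod_cast this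
  exact (pow_eq_one_iff_of_nonneg (norm_nonneg _) two_ne_zero).1 h2

lemma continuous : Continuous kv := by
  refine continuous_iff_continuousAt.2 fun t => ?_
  rw [ContinuousAt, tendsto_iff_norm_sub_tendsto_zero]
  have h : ∀ s, ‖kv s - kv t‖ ^ 2 = 2 - 2 * (Real.cosh (s - t))⁻¹ := by
    intro s
    rw [@norm_sub_sq ℂ, hk.norm_eq, hk.norm_eq, hk s t]
    simp only [RCLike.re_to_complex, Complex.ofReal_re]
    ring
  have h1 : Tendsto (fun s => ‖kv s - kv t‖ ^ 2) (nhds t) (nhds 0) := by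
    simp_rw [h]
    have hc : Continuous fun s : ℝ => 2 - 2 * (Real.cosh (s - t))⁻¹ :=
      continuous_const.sub (continuous_const.mul
        ((Real.continuous_cosh.comp (continuous_id.sub continuous_const)).inv₀
          fun s => (Real.cosh_pos _).ne'))
    have := hc.tendsto t
    simpa using this
  have h2 := (Real.continuous_sqrt.tendsto 0).comp h1
  simpa [Function.comp_def, Real.sqrt_sq] using h2

lemma continuous_inner (u : E) : Continuous fun s => inner ℂ (kv s) u :=
  hk.continuous.inner continuous_const

variable [CompleteSpace E]

lemma intervalIntegral_le (u : E) {R : ℝ} (hR : 0 ≤ R) :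
    ∫ s in (-R)..R, ‖inner ℂ (kv s) u‖ ^ 2 ≤ 4 * ‖u‖ ^ 2 := by
  set F := fun s => inner ℂ (kv s) u with hF
  have hFc : Continuous F := hk.continuous_inner u
  have hRR : -R ≤ R := by linarith
  set Q := ∫ s in (-R)..R, ‖F s‖ ^ 2 with hQ
  have hQ0 : 0 ≤ Q := intervalIntegral.integral_nonneg hRR fun _ _ => by positivity
  set v := ∫ s in (-R)..R, F s • kv s with hv
  have hvc : Continuous fun s => F s • kv s := hFc.smul hk.continuous
  have inner_v : ∀ x : E, inner ℂ x v = ∫ s in (-R)..R, F s * inner ℂ x (kv s) := by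
    intro x
    have := ((innerSL ℂ x).intervalIntegral_comp_comm (hvc.intervalIntegrable (-R) R)
      (μ := volume)).symm
    simpa [hv] using this
  have h1 : inner ℂ u v = (Q : ℂ) := by
    rw [inner_v, hQ, ← intervalIntegral.integral_ofReal]
    congr 1
    funext s
    rw [← inner_conj_symm, Complex.mul_conj, Complex.normSq_eq_norm_sq]
  have h2 : ‖v‖ ^ 2 ≤ 4 * Q := by
    have hkv : ∀ s, ‖inner ℂ (kv s) v‖ ≤ ∫ t in (-R)..R, ‖F t‖ * (2 * Real.exp (-|s - t|)) := by
      intro s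
      rw [inner_v]
      refine intervalIntegral.norm_integral_le_of_norm_le hRR (ae_of_all _ fun t _ => ?_)
        (Continuous.intervalIntegrable (by fun_prop) _ _)
      rw [norm_mul, hk s t, Complex.norm_real, Real.norm_of_nonneg (by positivity)]
      gcongr
      exact inv_cosh_le _
    have e1 : ‖v‖ ^ 2 = ‖inner ℂ v v‖ := by
      rw [inner_self_eq_norm_sq_to_K]
      simp
    have hG : ∀ s t, ‖F s‖ * (‖F t‖ * (2 * Real.exp (-|s - t|)))
        ≤ ‖F s‖ ^ 2 * Real.exp (-|s - t|) + ‖F t‖ ^ 2 * Real.exp (-|s - t|) := by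
      intro s t
      nlinarith [mul_nonneg (sq_nonneg (‖F s‖ - ‖F t‖)) (Real.exp_pos (-|s - t|)).le]
    have hone : ∀ t, ∫ s in (-R)..R, Real.exp (-|s - t|) ≤ 2 := by
      intro t
      rw [intervalIntegral.integral_of_le hRR, ← integral_exp_neg_abs_sub t]
      exact setIntegral_le_integral (integrable_exp_neg_abs_sub t)
        (ae_of_all _ fun s => (Real.exp_pos _).le)
    have hA : ∫ s in (-R)..R, ∫ t in (-R)..R, ‖F s‖ ^ 2 * Real.exp (-|s - t|) ≤ 2 * Q := by
      rw [hQ, ← intervalIntegral.integral_const_mul]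
      refine intervalIntegral.integral_mono_on hRR ?_ ?_ fun s _ => ?_
      · exact (intervalIntegral.continuous_parametric_intervalIntegral_of_continuous'
          (by fun_prop) _ _).intervalIntegrable _ _
      · exact Continuous.intervalIntegrable (by fun_prop) _ _
      · rw [intervalIntegral.integral_const_mul, mul_comm]
        gcongr
        simpa only [abs_sub_comm] using hone s
    have hB : ∫ s in (-R)..R, ∫ t in (-R)..R, ‖F t‖ ^ 2 * Real.exp (-|s - t|) ≤ 2 * Q := by
      have := intervalIntegral_integral_swap (a := -R) (b := R) (μ := volume.restrict (Ioc (-R) R))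
        (f := fun s t => ‖F t‖ ^ 2 * Real.exp (-|s - t|)) (by
          rw [uIoc_of_le hRR, Measure.prod_restrict]
          have hc : Continuous (Function.uncurry fun s t : ℝ => ‖F t‖ ^ 2 * Real.exp (-|s - t|)) := by
            unfold Function.uncurry
            fun_prop
          exact (hc.continuousOn.integrableOn_compact (isCompact_Icc.prod isCompact_Icc)).mono_set
            (prod_mono Ioc_subset_Icc_self Ioc_subset_Icc_self))
      simp only [intervalIntegral.integral_of_le hRR] at this ⊢ hA
      rw [this]
      simpa only [abs_sub_comm] using hA
    rw [e1, inner_v]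
    have hc2 : Continuous fun s : ℝ => ∫ t in (-R)..R, ‖F t‖ * (2 * Real.exp (-|s - t|)) :=
      intervalIntegral.continuous_parametric_intervalIntegral_of_continuous' (by fun_prop) _ _
    calc ‖∫ s in (-R)..R, F s * inner ℂ v (kv s)‖
        ≤ ∫ s in (-R)..R, ‖F s‖ * ∫ t in (-R)..R, ‖F t‖ * (2 * Real.exp (-|s - t|)) := by
          refine intervalIntegral.norm_integral_le_of_norm_le hRR (ae_of_all _ fun s _ => ?_)
            ((hFc.norm.mul hc2).intervalIntegrable _ _)
          rw [norm_mul, norm_inner_symm v]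
          gcongr
          exact hkv s
      _ ≤ ∫ s in (-R)..R, ((∫ t in (-R)..R, ‖F s‖ ^ 2 * Real.exp (-|s - t|)) +
            ∫ t in (-R)..R, ‖F t‖ ^ 2 * Real.exp (-|s - t|)) := by
          refine intervalIntegral.integral_mono_on hRR ((hFc.norm.mul hc2).intervalIntegrable _ _)
            (Continuous.intervalIntegrable (Continuous.add
              (intervalIntegral.continuous_parametric_intervalIntegral_of_continuous' (by fun_prop) _ _)
              (intervalIntegral.continuous_parametric_intervalIntegral_of_continuous' (by fun_prop) _ _))
              _ _) fun s _ => ?_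
          rw [← intervalIntegral.integral_const_mul, ← intervalIntegral.integral_add
            (Continuous.intervalIntegrable (by fun_prop) _ _)
            (Continuous.intervalIntegrable (by fun_prop) _ _)]
          exact intervalIntegral.integral_mono_on hRR (Continuous.intervalIntegrable (by fun_prop) _ _)
            (Continuous.intervalIntegrable (by fun_prop) _ _) fun t _ => hG s t
      _ ≤ 4 * Q := by
          rw [intervalIntegral.integral_add
            ((intervalIntegral.continuous_parametric_intervalIntegral_of_continuous'
              (by fun_prop) _ _).intervalIntegrable _ _)
            ((intervalIntegral.continuous_parametric_intervalIntegral_of_continuous'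
              (by fun_prop) _ _).intervalIntegrable _ _)]
          linarith
  have h3 : Q ≤ ‖u‖ * ‖v‖ := by
    have := norm_inner_le_norm (𝕜 := ℂ) u v
    rwa [h1, Complex.norm_real, Real.norm_of_nonneg hQ0] at this
  by_contra! h
  have hQpos : 0 < Q := lt_of_le_of_lt (by positivity) h
  have h4 : Q ^ 2 ≤ ‖u‖ ^ 2 * (4 * Q) := by
    calc Q ^ 2 ≤ (‖u‖ * ‖v‖) ^ 2 := by gcongr
      _ = ‖u‖ ^ 2 * ‖v‖ ^ 2 := mul_pow _ _ _
      _ ≤ _ := by gcongr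
  nlinarith

lemma integrable (u : E) : Integrable fun s => ‖inner ℂ (kv s) u‖ ^ 2 := by
  refine integrable_of_intervalIntegral_norm_bounded (4 * ‖u‖ ^ 2) (l := atTop)
    (a := fun n : ℕ => -(n : ℝ)) (b := fun n : ℕ => (n : ℝ)) (fun n => ?_)
    (tendsto_neg_atTop_atBot.comp tendsto_natCast_atTop_atTop) tendsto_natCast_atTop_atTop
    (Eventually.of_forall fun n => ?_)
  · exact (((hk.continuous_inner u).norm.pow 2).continuousOn.integrableOn_compact
      isCompact_Icc).mono_set Ioc_subset_Icc_self
  · simpa using hk.intervalIntegral_le u n.cast_nonneg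

lemma integral_le (u : E) : ∫ s, ‖inner ℂ (kv s) u‖ ^ 2 ≤ 4 * ‖u‖ ^ 2 :=
  le_of_tendsto' (intervalIntegral_tendsto_integral (hk.integrable u)
    (tendsto_neg_atTop_atBot.comp tendsto_natCast_atTop_atTop) tendsto_natCast_atTop_atTop)
    fun n : ℕ => hk.intervalIntegral_le u n.cast_nonneg

end SechFamily

end HankelEig

namespace HankelEig

lemma sigmoid_two_mul (s : ℝ) : Real.sigmoid (2 * s) = Real.exp (s - Real.log (2 * Real.cosh s)) := by
  rw [Real.exp_sub, Real.exp_log (by positivity), Real.sigmoid_def, inv_eq_one_div,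
    div_eq_div_iff (by positivity) (by positivity), Real.cosh_eq, mul_add, ← Real.exp_add]
  ring_nf

lemma betaIntegral_eq_cosh (u v : ℂ) : Complex.betaIntegral u v =
    2 * ∫ s : ℝ, Complex.exp (s * (u - v) - (u + v) * Real.log (2 * Real.cosh s)) := by
  set g : ℝ → ℂ := fun x => (x : ℂ) ^ (u - 1) * (1 - (x : ℂ)) ^ (v - 1) with hg
  set f : ℝ → ℝ := fun s => Real.sigmoid (2 * s) with hf
  set f' : ℝ → ℝ := fun s => 2 * (Real.sigmoid (2 * s) * (1 - Real.sigmoid (2 * s))) with hf'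
  have hd : ∀ s ∈ (univ : Set ℝ), HasDerivWithinAt f (f' s) univ s := by
    intro s _
    have := (Real.hasDerivAt_sigmoid (2 * s)).comp s ((hasDerivAt_id s).const_mul 2)
    refine (this.congr_deriv ?_).hasDerivWithinAt
    rw [hf']
    ring
  have hinj : InjOn f univ := fun a _ b _ hab => by
    have := Real.sigmoid_injective hab
    linarith
  have himg : f '' univ = Ioo 0 1 := by
    rw [image_univ, ← Real.range_sigmoid]
    ext x
    constructor
    · rintro ⟨s, rfl⟩
      exact ⟨2 * s, rfl⟩
    · rintro ⟨s, rfl⟩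
      exact ⟨s / 2, by simp only [hf]; congr 1; ring⟩
  have h := integral_image_eq_integral_abs_deriv_smul MeasurableSet.univ hd hinj g
  rw [himg, setIntegral_univ] at h
  rw [Complex.betaIntegral, intervalIntegral.integral_of_le zero_le_one,
    integral_Ioc_eq_integral_Ioo, h, ← integral_const_mul]
  congr 1
  funext s
  have h1 : 1 - Real.sigmoid (2 * s) = Real.exp (-s - Real.log (2 * Real.cosh s)) := by
    rw [← Real.sigmoid_neg, ← mul_neg, sigmoid_two_mul, Real.cosh_neg]
  have h2 : ∀ (a : ℝ) (z : ℂ), ((Real.exp a : ℝ) : ℂ) ^ z = Complex.exp (a * z) := by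
    intro a z
    rw [Complex.cpow_def_of_ne_zero (by exact_mod_cast (Real.exp_pos a).ne'),
      ← Complex.ofReal_log (Real.exp_pos a).le, Real.log_exp]
  have h3 : |f' s| = 2 * (Real.exp (s - Real.log (2 * Real.cosh s)) *
      Real.exp (-s - Real.log (2 * Real.cosh s))) := by
    rw [← h1, ← sigmoid_two_mul, hf']
    exact abs_of_nonneg (by
      have := Real.sigmoid_nonneg (2 * s)
      have := Real.sigmoid_le_one (2 * s)
      have : 0 ≤ 1 - Real.sigmoid (2 * s) := by linarith
      positivity)
  have h4 : (1 : ℂ) - (f s : ℂ) = ((1 - Real.sigmoid (2 * s) : ℝ) : ℂ) := by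
    simp [hf]
  rw [h3, hg]
  simp only
  rw [h4, h1, show f s = _ from sigmoid_two_mul s, h2, h2, Complex.real_smul, ← Real.exp_add,
    Complex.ofReal_mul, Complex.ofReal_exp, mul_assoc, ← Complex.exp_add, ← Complex.exp_add]
  push_cast
  congr 2
  ring

/-- The Fourier transform of `1 / cosh`. -/
lemma integral_inv_cosh_mul_exp (ξ : ℝ) :
    ∫ s : ℝ, (((Real.cosh s)⁻¹ : ℝ) : ℂ) * Complex.exp (-(Complex.I * ξ * s)) =
      ((Real.pi / Real.cosh (Real.pi * ξ / 2) : ℝ) : ℂ) := by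
  have h := betaIntegral_eq_cosh (1 / 2 - Complex.I * ξ / 2) (1 - (1 / 2 - Complex.I * ξ / 2))
  have h1 := Complex.Gamma_mul_Gamma_eq_betaIntegral (s := 1 / 2 - Complex.I * ξ / 2)
    (t := 1 - (1 / 2 - Complex.I * ξ / 2)) (by simp) (by simp; norm_num)
  rw [Complex.Gamma_mul_Gamma_one_sub, show (1 / 2 - Complex.I * ξ / 2) +
    (1 - (1 / 2 - Complex.I * ξ / 2)) = (1 : ℂ) by ring, Complex.Gamma_one, one_mul, h] at h1
  have h2 : Complex.sin (Real.pi * (1 / 2 - Complex.I * ξ / 2)) =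
      ((Real.cosh (Real.pi * ξ / 2) : ℝ) : ℂ) := by
    rw [show (Real.pi : ℂ) * (1 / 2 - Complex.I * ξ / 2)
      = Real.pi / 2 - ((Real.pi * ξ / 2 : ℝ) : ℂ) * Complex.I by push_cast; ring,
      Complex.sin_pi_div_two_sub, Complex.cos_mul_I, Complex.ofReal_cosh]
  rw [h2] at h1
  rw [Complex.ofReal_div, h1, ← integral_const_mul]
  congr 1
  funext s
  rw [show (1 / 2 - Complex.I * ξ / 2) + (1 - (1 / 2 - Complex.I * ξ / 2)) = (1 : ℂ) by ring,
    one_mul, Complex.exp_sub, ← Complex.ofReal_exp, Real.exp_log (by positivity)]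
  have : (Real.cosh s : ℂ) ≠ 0 := by exact_mod_cast (Real.cosh_pos s).ne'
  push_cast at this ⊢
  field_simp
  congr 1
  ring

lemma integral_cosh_rpow {c : ℝ} (hc : 0 < c) :
    ∫ s : ℝ, Real.cosh s ^ (-c) =
      Real.Gamma (c / 2) * Real.Gamma (1 / 2) / Real.Gamma (c / 2 + 1 / 2) := by
  have h := betaIntegral_eq_cosh ((c / 2 : ℝ) : ℂ) ((c / 2 : ℝ) : ℂ)
  have h1 := Complex.Gamma_mul_Gamma_eq_betaIntegral (s := ((c / 2 : ℝ) : ℂ))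
    (t := ((c / 2 : ℝ) : ℂ)) (by rw [Complex.ofReal_re]; positivity)
      (by rw [Complex.ofReal_re]; positivity)
  have h2 : ∫ s : ℝ, Complex.exp (s * (((c / 2 : ℝ) : ℂ) - ((c / 2 : ℝ) : ℂ)) -
      (((c / 2 : ℝ) : ℂ) + ((c / 2 : ℝ) : ℂ)) * Real.log (2 * Real.cosh s)) =
      ((2 ^ (-c) * ∫ s : ℝ, Real.cosh s ^ (-c) : ℝ) : ℂ) := by
    rw [← integral_const_mul, ← integral_complex_ofReal]
    congr 1
    funext s
    rw [← Real.mul_rpow (by norm_num) (Real.cosh_pos s).le,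
      Real.rpow_def_of_pos (by positivity), Complex.ofReal_exp]
    congr 1
    push_cast
    ring
  rw [h, h2, ← Complex.ofReal_add, Complex.Gamma_ofReal, Complex.Gamma_ofReal,
    show c / 2 + c / 2 = c by ring] at h1
  have h3 : Real.Gamma (c / 2) * Real.Gamma (c / 2) =
      Real.Gamma c * (2 * (2 ^ (-c) * ∫ s : ℝ, Real.cosh s ^ (-c))) := by exact_mod_cast h1
  have h4 := Real.Gamma_mul_Gamma_add_half (c / 2)
  rw [show 2 * (c / 2) = c by ring, sub_eq_add_neg, Real.rpow_add two_pos, Real.rpow_one] at h4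
  have hg := Real.Gamma_pos_of_pos hc
  have hg1 := Real.Gamma_pos_of_pos (half_pos hc)
  have hg2 := Real.Gamma_pos_of_pos (show 0 < c / 2 + 1 / 2 by positivity)
  rw [Real.Gamma_one_half_eq, eq_div_iff hg2.ne']
  refine mul_left_cancel₀ hg1.ne' ?_
  calc _ = (∫ s : ℝ, Real.cosh s ^ (-c)) * (Real.Gamma (c / 2) * Real.Gamma (c / 2 + 1 / 2)) := by
        ring
    _ = (Real.Gamma c * (2 * (2 ^ (-c) * ∫ s : ℝ, Real.cosh s ^ (-c)))) * √Real.pi := by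
        rw [h4]
        ring
    _ = _ := by
        rw [← h3]
        ring

/-- The spectral density of the kernel `1 / cosh`. -/
def cF (x : ℝ) : ℝ := Real.pi / Real.cosh (Real.pi ^ 2 * x)

lemma cF_pos (x : ℝ) : 0 < cF x := div_pos Real.pi_pos (Real.cosh_pos _)

lemma cF_neg (x : ℝ) : cF (-x) = cF x := by
  rw [cF, cF, mul_neg, Real.cosh_neg]

lemma antitoneOn_cF : AntitoneOn cF (Ici 0) := by
  intro x hx y hy hxy
  have hx' : (0 : ℝ) ≤ x := hx
  unfold cF
  refine div_le_div_of_nonneg_left Real.pi_pos.le (Real.cosh_pos _) ?_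
  rw [Real.cosh_le_cosh, abs_of_nonneg (by positivity),
    abs_of_nonneg (mul_nonneg (by positivity) (hx'.trans hxy))]
  gcongr

lemma integral_inv_cosh_mul_exp_two_pi (x : ℝ) :
    ∫ s : ℝ, (((Real.cosh s)⁻¹ : ℝ) : ℂ) * Complex.exp (-(2 * Real.pi * Complex.I * x * s)) =
      (cF x : ℂ) := by
  have h := integral_inv_cosh_mul_exp (2 * Real.pi * x)
  rw [show Real.pi * (2 * Real.pi * x) / 2 = Real.pi ^ 2 * x by ring] at h
  rw [cF, ← h]
  congr 1
  funext s
  congr 2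
  push_cast
  ring

/-- The integral of `cF ^ (1 / α)` over the half-line. -/
def cInt (α : ℝ) : ℝ := ∫ x in Ioi (0 : ℝ), cF x ^ (1 / α)

lemma cF_rpow {a : ℝ} (x : ℝ) :
    cF x ^ a = Real.pi ^ a * Real.cosh (Real.pi ^ 2 * x) ^ (-a) := by
  rw [cF, Real.div_rpow Real.pi_pos.le (Real.cosh_pos _).le, Real.rpow_neg (Real.cosh_pos _).le,
    div_eq_mul_inv]

lemma two_mul_integral_cF_rpow {a : ℝ} (ha : 0 < a) : 2 * ∫ x in Ioi (0 : ℝ), cF x ^ a =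
    Real.pi ^ a * ((Real.pi ^ 2)⁻¹ *
      (Real.Gamma (a / 2) * Real.Gamma (1 / 2) / Real.Gamma (a / 2 + 1 / 2))) := by
  have h1 := integral_comp_abs (f := fun x => cF x ^ a)
  rw [← h1, ← integral_cosh_rpow ha]
  have h2 := Measure.integral_comp_mul_left (fun s => Real.cosh s ^ (-a)) (Real.pi ^ 2)
  rw [abs_of_pos (by positivity), smul_eq_mul] at h2
  rw [← h2, ← integral_const_mul]
  congr 1
  funext x
  rcases abs_choice x with h | h <;> simp only [h, cF_neg, cF_rpow]

lemma two_mul_integral_cF : 2 * ∫ x in Ioi (0 : ℝ), cF x = 1 := by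
  have h := two_mul_integral_cF_rpow one_pos
  simp only [Real.rpow_one] at h
  rw [h, Real.Gamma_one_half_eq, show (1 : ℝ) / 2 + 1 / 2 = 1 by norm_num, Real.Gamma_one,
    div_one, Real.mul_self_sqrt Real.pi_pos.le]
  field_simp

lemma integrableOn_cF_rpow {a : ℝ} (ha : 0 < a) : IntegrableOn (fun x => cF x ^ a) (Ioi 0) := by
  refine Integrable.of_integral_ne_zero fun h => ?_
  have h1 := two_mul_integral_cF_rpow ha
  have hg1 := Real.Gamma_pos_of_pos (half_pos ha)
  have hg2 := Real.Gamma_pos_of_pos (show 0 < a / 2 + 1 / 2 by positivity)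
  have hg3 := Real.Gamma_pos_of_pos (show (0 : ℝ) < 1 / 2 by positivity)
  rw [h, mul_zero] at h1
  have : 0 < Real.pi ^ a * ((Real.pi ^ 2)⁻¹ *
      (Real.Gamma (a / 2) * Real.Gamma (1 / 2) / Real.Gamma (a / 2 + 1 / 2))) := by positivity
  linarith

lemma cInt_pos {α : ℝ} (hα : 0 < α) : 0 < cInt α := by
  have h1 := two_mul_integral_cF_rpow (one_div_pos.2 hα)
  have hg1 := Real.Gamma_pos_of_pos (half_pos (one_div_pos.2 hα))
  have hg2 := Real.Gamma_pos_of_pos (show 0 < 1 / α / 2 + 1 / 2 by positivity)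
  have hg3 := Real.Gamma_pos_of_pos (show (0 : ℝ) < 1 / 2 by positivity)
  have : 0 < 2 * cInt α := by
    rw [cInt, h1]
    positivity
  linarith

lemma cInt_rpow {α : ℝ} (hα : 0 < α) : cInt α ^ α = tauC α := by
  have h1 := two_mul_integral_cF_rpow (one_div_pos.2 hα)
  have hg1 := Real.Gamma_pos_of_pos (half_pos (one_div_pos.2 hα))
  have hg2 := Real.Gamma_pos_of_pos (show 0 < 1 / α / 2 + 1 / 2 by positivity)
  have hg3 := Real.Gamma_pos_of_pos (show (0 : ℝ) < 1 / 2 by positivity)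
  rw [show 1 / α / 2 = 1 / (2 * α) by field_simp] at h1 hg1 hg2
  have h2 : cInt α = 2⁻¹ * (Real.pi ^ (1 / α) * ((Real.pi ^ 2)⁻¹ *
      (Real.Gamma (1 / (2 * α)) * Real.Gamma (1 / 2) / Real.Gamma (1 / (2 * α) + 1 / 2)))) := by
    rw [← h1, cInt]
    ring
  have hp := Real.pi_pos
  rw [h2, Real.mul_rpow (by positivity) (by positivity), Real.mul_rpow (by positivity)
    (by positivity), Real.mul_rpow (by positivity) (by positivity), ← Real.rpow_mul hp.le,
    one_div_mul_cancel hα.ne', Real.rpow_one, tauC, Real.inv_rpow two_pos.le, ← Real.rpow_neg two_pos.le,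
    Real.inv_rpow (by positivity), ← Real.rpow_natCast, ← Real.rpow_mul hp.le, ← Real.rpow_neg hp.le,
    sub_eq_add_neg, Real.rpow_add hp, Real.rpow_one]
  push_cast
  rw [neg_mul_eq_neg_mul]
  ring_nf

end HankelEig

namespace HankelEig

lemma setIntegral_Ioi_exp_neg_abs_sub {b t : ℝ} (h : t ≤ b) :
    ∫ s in Ioi b, Real.exp (-|s - t|) = Real.exp (-|t - b|) := by
  rw [setIntegral_congr_fun (g := fun s => Real.exp t * Real.exp (-s)) measurableSet_Ioi
    fun s hs => ?_, integral_const_mul, integral_exp_neg_Ioi, ← Real.exp_add, abs_of_nonpos (by linarith)]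
  · ring_nf
  · have : b < s := hs
    simp only
    rw [abs_of_nonneg (by linarith), ← Real.exp_add]
    ring_nf

lemma setIntegral_Iic_exp_neg_abs_sub {a t : ℝ} (h : a ≤ t) :
    ∫ s in Iic a, Real.exp (-|s - t|) = Real.exp (-|t - a|) := by
  rw [setIntegral_congr_fun (g := fun s => Real.exp (-t) * Real.exp s) measurableSet_Iic
    fun s hs => ?_, integral_const_mul, integral_exp_Iic, ← Real.exp_add, abs_of_nonneg (by linarith)]
  · ring_nf
  · have : s ≤ a := hs
    simp only
    rw [abs_of_nonpos (by linarith), ← Real.exp_add]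
    ring_nf

lemma continuous_inv_cosh_sub (t : ℝ) : Continuous fun s : ℝ => (Real.cosh (s - t))⁻¹ :=
  (Real.continuous_cosh.comp (continuous_id.sub continuous_const)).inv₀
    fun _ => (Real.cosh_pos _).ne'

lemma integrable_inv_cosh_sub (t : ℝ) : Integrable fun s : ℝ => (Real.cosh (s - t))⁻¹ :=
  ((integrable_exp_neg_abs_sub t).const_mul 2).mono' (continuous_inv_cosh_sub t).aestronglyMeasurable
    (ae_of_all _ fun s => by
      rw [Real.norm_of_nonneg (inv_nonneg.2 (Real.cosh_pos _).le)]
      exact inv_cosh_le _)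

lemma setIntegral_inv_cosh_le {A : Set ℝ} (t : ℝ) :
    ∫ s in A, (Real.cosh (s - t))⁻¹ ≤ 2 * ∫ s in A, Real.exp (-|s - t|) := by
  rw [← integral_const_mul]
  exact integral_mono (integrable_inv_cosh_sub t).integrableOn
    ((integrable_exp_neg_abs_sub t).const_mul 2).integrableOn fun s => inv_cosh_le _

lemma setIntegral_Ioc_inv_cosh_le {a b t : ℝ} (ht : t ∉ Ioc a b) :
    ∫ s in Ioc a b, (Real.cosh (s - t))⁻¹ ≤ 2 * (Real.exp (-|t - a|) + Real.exp (-|t - b|)) := by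
  refine (setIntegral_inv_cosh_le t).trans ?_
  gcongr
  have hn : ∀ A : Set ℝ, 0 ≤ᵐ[volume.restrict A] fun s : ℝ => Real.exp (-|s - t|) :=
    fun A => ae_of_all _ fun s => (Real.exp_pos _).le
  rcases lt_or_ge a t with h | h
  · have hb : b ≤ t := by
      by_contra! hb
      exact ht ⟨h, hb.le⟩
    have h1 := setIntegral_mono_set (s := Ioc a b) (integrable_exp_neg_abs_sub t).integrableOn (hn (Iic b))
      (HasSubset.Subset.eventuallyLE Ioc_subset_Iic_self)
    rw [setIntegral_Iic_exp_neg_abs_sub hb] at h1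
    linarith [Real.exp_pos (-|t - a|)]
  · have h1 := setIntegral_mono_set (s := Ioc a b) (integrable_exp_neg_abs_sub t).integrableOn (hn (Ioi a))
      (HasSubset.Subset.eventuallyLE Ioc_subset_Ioi_self)
    rw [setIntegral_Ioi_exp_neg_abs_sub h] at h1
    linarith [Real.exp_pos (-|t - b|)]

lemma setIntegral_compl_Ioc_inv_cosh_le {a b t : ℝ} (ht : t ∈ Ioc a b) :
    ∫ s in (Ioc a b)ᶜ, (Real.cosh (s - t))⁻¹ ≤
      2 * (Real.exp (-|t - a|) + Real.exp (-|t - b|)) := by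
  refine (setIntegral_inv_cosh_le t).trans ?_
  gcongr
  have hc : (Ioc a b)ᶜ = Iic a ∪ Ioi b := by
    ext x
    simp only [mem_compl_iff, mem_Ioc, mem_union, mem_Iic, mem_Ioi, not_and_or, not_lt, not_le]
  have hdisj : Disjoint (Iic a) (Ioi b) := by
    rw [Set.disjoint_left]
    intro x hx hx'
    have h1 : x ≤ a := hx
    have h2 : b < x := hx'
    linarith [ht.1, ht.2]
  rw [hc, setIntegral_union hdisj measurableSet_Ioi
    (integrable_exp_neg_abs_sub t).integrableOn (integrable_exp_neg_abs_sub t).integrableOn,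
    setIntegral_Iic_exp_neg_abs_sub ht.1.le, setIntegral_Ioi_exp_neg_abs_sub ht.2]

/-- The normalised exponential on an interval of length `T`. -/
def eE (T : ℝ) (k : ℤ) (t : ℝ) : ℂ :=
  (((√T)⁻¹ : ℝ) : ℂ) * Complex.exp ((2 * Real.pi * (k / T) * t : ℝ) * Complex.I)

lemma continuous_eE (T : ℝ) (k : ℤ) : Continuous (eE T k) := by
  unfold eE
  fun_prop

lemma norm_eE (T : ℝ) (k : ℤ) (t : ℝ) : ‖eE T k t‖ = (√T)⁻¹ := by
  rw [eE, norm_mul, Complex.norm_exp_ofReal_mul_I, mul_one, Complex.norm_real,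
    Real.norm_of_nonneg (by positivity)]

lemma conj_eE (T : ℝ) (k : ℤ) (t : ℝ) : (starRingEnd ℂ) (eE T k t) = eE T (-k) t := by
  rw [eE, map_mul, Complex.conj_ofReal, ← Complex.exp_conj, eE, map_mul, Complex.conj_I,
    Complex.conj_ofReal]
  congr 2
  push_cast
  ring

lemma integral_eE_mul_conj {T : ℝ} (hT : 0 < T) (a : ℝ) (k l : ℤ) :
    ∫ t in a..(a + T), eE T k t * (starRingEnd ℂ) (eE T l t) = if k = l then 1 else 0 := by
  have h : ∀ t : ℝ, eE T k t * (starRingEnd ℂ) (eE T l t) =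
      ((T⁻¹ : ℝ) : ℂ) * Complex.exp ((2 * Real.pi * ((k - l : ℤ) / T) * Complex.I) * t) := by
    intro t
    have hs : (((√T)⁻¹ : ℝ) : ℂ) * (((√T)⁻¹ : ℝ) : ℂ) = ((T⁻¹ : ℝ) : ℂ) := by
      rw [← Complex.ofReal_mul, ← mul_inv, Real.mul_self_sqrt hT.le]
    rw [conj_eE, eE, eE, mul_mul_mul_comm, hs, ← Complex.exp_add]
    congr 2
    push_cast
    ring
  simp_rw [h]
  rw [intervalIntegral.integral_const_mul]
  have hTc : (T : ℂ) ≠ 0 := by exact_mod_cast hT.ne'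
  split_ifs with hkl
  · subst hkl
    simp [hTc]
  · have hkl' : ((k - l : ℤ) : ℂ) ≠ 0 := by exact_mod_cast sub_ne_zero.2 hkl
    have hp : (Real.pi : ℂ) ≠ 0 := by exact_mod_cast Real.pi_ne_zero
    have hc : (2 * Real.pi * ((k - l : ℤ) / T) * Complex.I : ℂ) ≠ 0 := by
      simp only [ne_eq, mul_eq_zero, div_eq_zero_iff, not_or]
      exact ⟨⟨⟨two_ne_zero, hp⟩, hkl', hTc⟩, Complex.I_ne_zero⟩
    rw [integral_exp_mul_complex hc]
    have : Complex.exp (2 * Real.pi * ((k - l : ℤ) / T) * Complex.I * ((a + T : ℝ) : ℂ)) =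
        Complex.exp (2 * Real.pi * ((k - l : ℤ) / T) * Complex.I * a) := by
      rw [show (2 * Real.pi * ((k - l : ℤ) / T) * Complex.I * ((a + T : ℝ) : ℂ) : ℂ) =
        2 * Real.pi * ((k - l : ℤ) / T) * Complex.I * a +
          ((k - l : ℤ) : ℂ) * (2 * Real.pi * Complex.I) by
        push_cast
        field_simp, Complex.exp_add, Complex.exp_int_mul_two_pi_mul_I, mul_one]
    rw [this, sub_self, zero_div, mul_zero]

/-- The full-line convolution of an exponential with `1 / cosh`. -/
lemma integral_conj_eE_mul_inv_cosh (T : ℝ) (k : ℤ) (t : ℝ) :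
    ∫ s : ℝ, (starRingEnd ℂ) (eE T k s) * (((Real.cosh (s - t))⁻¹ : ℝ) : ℂ) =
      (starRingEnd ℂ) (eE T k t) * cF (k / T) := by
  rw [← integral_inv_cosh_mul_exp_two_pi, ← integral_const_mul,
    ← integral_sub_right_eq_self (fun s : ℝ => (starRingEnd ℂ) (eE T k t) *
      ((((Real.cosh s)⁻¹ : ℝ) : ℂ) * Complex.exp (-(2 * Real.pi * Complex.I * ((k / T : ℝ) : ℂ) * s)))) t]
  congr 1
  funext s
  simp only [conj_eE]
  simp only [eE]
  have : ∀ a b d z c : ℂ, a = b + d → c * Complex.exp a * z = c * Complex.exp b * (z * Complex.exp d) := by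
    intro a b d z c h
    rw [h, Complex.exp_add]
    ring
  refine this _ _ _ _ _ ?_
  push_cast
  ring

variable {E : Type*} [NormedAddCommGroup E] [InnerProductSpace ℂ E] [CompleteSpace E]

/-- The left endpoint of the `i`-th block. -/
def lft (T : ℝ) (i : ℤ) : ℝ := i * T

/-- The `k`-th Fourier coefficient of `kv` on the `i`-th block of length `T`. -/
def vA (kv : ℝ → E) (T : ℝ) (p : ℤ × ℤ) : E := ∫ s in (lft T p.1)..(lft T p.1 + T), eE T p.2 s • kv s

/-- The pointwise error in the Gram matrix. -/
def bdE (T : ℝ) (i : ℤ) (t : ℝ) : ℝ :=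
  (√T)⁻¹ * (2 * (Real.exp (-|t - lft T i|) + Real.exp (-|t - (lft T i + T)|)))

lemma integrable_bdE (T : ℝ) (i : ℤ) : Integrable (bdE T i) :=
  (((integrable_exp_neg_abs_sub _).add (integrable_exp_neg_abs_sub _)).const_mul 2).const_mul _

lemma bdE_nonneg (T : ℝ) (i : ℤ) (t : ℝ) : 0 ≤ bdE T i t := by
  unfold bdE
  positivity

lemma integral_bdE (T : ℝ) (i : ℤ) : ∫ t, bdE T i t = 8 * (√T)⁻¹ := by
  unfold bdE
  rw [integral_const_mul, integral_const_mul, integral_add (integrable_exp_neg_abs_sub _)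
    (integrable_exp_neg_abs_sub _), integral_exp_neg_abs_sub, integral_exp_neg_abs_sub]
  ring

lemma inner_intervalIntegral (u : E) {f : ℝ → E} (hf : Continuous f) (a b : ℝ) :
    inner ℂ u (∫ s in a..b, f s) = ∫ s in a..b, inner ℂ u (f s) := by
  have := ((innerSL ℂ u).intervalIntegral_comp_comm (hf.intervalIntegrable a b)
    (μ := volume)).symm
  simpa using this

lemma disjoint_blocks {T : ℝ} (hT : 0 < T) {i j : ℤ} (h : i ≠ j) :
    Disjoint (Ioc (lft T i) (lft T i + T)) (Ioc (lft T j) (lft T j + T)) := by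
  rw [Set.disjoint_left]
  rintro x ⟨h1, h2⟩ ⟨h3, h4⟩
  unfold lft at *
  rcases lt_or_gt_of_ne h with h | h
  · have : (i : ℝ) + 1 ≤ j := by exact_mod_cast h
    nlinarith
  · have : (j : ℝ) + 1 ≤ i := by exact_mod_cast h
    nlinarith

namespace SechFamily

variable {kv : ℝ → E} (hk : SechFamily kv)
include hk

lemma continuous_eE_smul (T : ℝ) (k : ℤ) : Continuous fun s => eE T k s • kv s :=
  (continuous_eE T k).smul hk.continuous

lemma inner_vA_right (T : ℝ) (p : ℤ × ℤ) (u : E) :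
    inner ℂ u (vA kv T p) = ∫ s in (lft T p.1)..(lft T p.1 + T), eE T p.2 s * inner ℂ u (kv s) := by
  rw [vA, inner_intervalIntegral u (hk.continuous_eE_smul T p.2)]
  simp_rw [inner_smul_right]

lemma inner_vA_left (T : ℝ) (p : ℤ × ℤ) (u : E) :
    inner ℂ (vA kv T p) u =
      ∫ s in (lft T p.1)..(lft T p.1 + T), (starRingEnd ℂ) (eE T p.2 s) * inner ℂ (kv s) u := by
  rw [← inner_conj_symm, hk.inner_vA_right, intervalIntegral, intervalIntegral, map_sub,
    ← integral_conj, ← integral_conj]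
  simp_rw [map_mul, inner_conj_symm]

lemma norm_inner_vA_kv_sub_le {T : ℝ} (hT : 0 < T) (p : ℤ × ℤ) (t : ℝ) :
    ‖inner ℂ (vA kv T p) (kv t) - (if t ∈ Ioc (lft T p.1) (lft T p.1 + T) then
      (starRingEnd ℂ) (eE T p.2 t) * cF (p.2 / T) else 0)‖ ≤ bdE T p.1 t := by
  obtain ⟨i, k⟩ := p
  simp only
  rw [hk.inner_vA_left, intervalIntegral.integral_of_le (by linarith)]
  simp only
  simp_rw [hk _ t]
  set I := Ioc (lft T i) (lft T i + T)
  set f := fun s : ℝ => (starRingEnd ℂ) (eE T k s) * (((Real.cosh (s - t))⁻¹ : ℝ) : ℂ) with hf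
  have hfn : ∀ s, ‖f s‖ = (√T)⁻¹ * (Real.cosh (s - t))⁻¹ := by
    intro s
    rw [hf, norm_mul, RCLike.norm_conj, norm_eE, Complex.norm_real,
      Real.norm_of_nonneg (inv_nonneg.2 (Real.cosh_pos _).le)]
  have hfi : Integrable f := by
    refine ((integrable_inv_cosh_sub t).const_mul (√T)⁻¹).mono' ?_ (ae_of_all _ fun s => (hfn s).le)
    exact (((RCLike.continuous_conj.comp (continuous_eE T k)).mul
      (Complex.continuous_ofReal.comp (continuous_inv_cosh_sub t)))).aestronglyMeasurable
  have hle : ∀ A : Set ℝ, ‖∫ s in A, f s‖ ≤ (√T)⁻¹ * ∫ s in A, (Real.cosh (s - t))⁻¹ := by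
    intro A
    refine (norm_integral_le_integral_norm _).trans (le_of_eq ?_)
    simp_rw [hfn]
    rw [integral_const_mul]
  split_ifs with h
  · rw [← integral_conj_eE_mul_inv_cosh, ← integral_add_compl (s := I) measurableSet_Ioc hfi,
      sub_add_cancel_left, norm_neg]
    refine (hle _).trans ?_
    unfold bdE
    gcongr
    exact setIntegral_compl_Ioc_inv_cosh_le h
  · rw [sub_zero]
    refine (hle _).trans ?_
    unfold bdE
    gcongr
    exact setIntegral_Ioc_inv_cosh_le h

lemma norm_gram_sub_le {T : ℝ} (hT : 0 < T) (p r : ℤ × ℤ) :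
    ‖inner ℂ (vA kv T p) (vA kv T r) - (if p = r then (cF (p.2 / T) : ℂ) else 0)‖ ≤
      (√T)⁻¹ * ∫ t in Ioc (lft T r.1) (lft T r.1 + T), bdE T p.1 t := by
  obtain ⟨i, k⟩ := p
  obtain ⟨j, l⟩ := r
  simp only
  have hle : lft T j ≤ lft T j + T := by linarith
  have h1 : (if (i, k) = (j, l) then (cF (k / T) : ℂ) else 0) =
      ∫ t in Ioc (lft T j) (lft T j + T), eE T l t * (if t ∈ Ioc (lft T i) (lft T i + T) then
      (starRingEnd ℂ) (eE T k t) * cF (k / T) else 0) := by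
    by_cases hij : i = j
    · subst hij
      rw [setIntegral_congr_fun (g := fun t => eE T l t * (starRingEnd ℂ) (eE T k t) * cF (k / T))
        measurableSet_Ioc fun t ht => by simp only [if_pos ht, mul_assoc], integral_mul_const,
        ← intervalIntegral.integral_of_le hle, integral_eE_mul_conj hT]
      by_cases hkl : k = l
      · simp [hkl]
      · simp [hkl, Ne.symm hkl]
    · rw [if_neg (by simp [hij])]
      refine (setIntegral_eq_zero_of_forall_eq_zero fun t ht => ?_).symm
      rw [if_neg fun ht' => Set.disjoint_left.1 (disjoint_blocks hT hij) ht' ht, mul_zero]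
  have hmeas : AEStronglyMeasurable (fun t => eE T l t * (if t ∈ Ioc (lft T i) (lft T i + T) then
      (starRingEnd ℂ) (eE T k t) * cF (k / T) else 0)) (volume.restrict (Ioc (lft T j) (lft T j + T))) := by
    refine (continuous_eE T l).aestronglyMeasurable.mul (Measurable.aestronglyMeasurable ?_)
    exact Measurable.ite measurableSet_Ioc
      (((RCLike.continuous_conj.comp (continuous_eE T k)).measurable).mul_const _) measurable_const
  rw [h1, hk.inner_vA_right]
  simp only
  rw [intervalIntegral.integral_of_le hle, ← integral_sub]
  · rw [← integral_const_mul]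
    refine norm_integral_le_of_norm_le ((integrable_bdE T i).const_mul _).integrableOn
      (ae_of_all _ fun t => ?_)
    rw [← mul_sub, norm_mul, norm_eE]
    gcongr
    exact hk.norm_inner_vA_kv_sub_le hT (i, k) t
  · exact (((continuous_eE T l).mul (continuous_const.inner hk.continuous)).continuousOn.integrableOn_compact
      isCompact_Icc).mono_set Ioc_subset_Icc_self
  · refine Integrable.mono' (g := fun _ => (√T)⁻¹ * ((√T)⁻¹ * |cF (k / T)|))
      (integrable_const _) hmeas (ae_of_all _ fun t => ?_)
    rw [norm_mul, norm_eE]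
    gcongr
    split_ifs
    · rw [norm_mul, RCLike.norm_conj, norm_eE, Complex.norm_real, Real.norm_eq_abs]
    · rw [norm_zero]
      positivity

lemma norm_vA_sq_ge {T : ℝ} (hT : 0 < T) (p : ℤ × ℤ) :
    cF (p.2 / T) - 8 / T ≤ ‖vA kv T p‖ ^ 2 := by
  have h := hk.norm_gram_sub_le hT p p
  rw [if_pos rfl, inner_self_eq_norm_sq_to_K] at h
  have h2 : ∫ t in Ioc (lft T p.1) (lft T p.1 + T), bdE T p.1 t ≤ 8 * (√T)⁻¹ := by
    rw [← integral_bdE T p.1]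
    exact setIntegral_le_integral (integrable_bdE T p.1) (ae_of_all _ fun t => bdE_nonneg T p.1 t)
  have h3 : (√T)⁻¹ * (8 * (√T)⁻¹) = 8 / T := by
    rw [mul_left_comm, ← mul_inv, Real.mul_self_sqrt hT.le, div_eq_mul_inv]
  have h4 : ‖((‖vA kv T p‖ ^ 2 - cF (p.2 / T) : ℝ) : ℂ)‖ ≤ 8 / T := by
    rw [← h3]
    refine le_trans (le_of_eq ?_) (h.trans (by gcongr))
    congr 1
    push_cast
    rfl
  rw [Complex.norm_real, Real.norm_eq_abs] at h4
  linarith [(abs_le.1 h4).1]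

lemma sum_gram_sq_le {T : ℝ} (hT : 0 < T) (p : ℤ × ℤ) (B A : Finset ℤ) :
    ∑ r ∈ B ×ˢ A, ‖inner ℂ (vA kv T p) (vA kv T r) - (if p = r then (cF (p.2 / T) : ℂ) else 0)‖ ^ 2
      ≤ A.card * (64 / T ^ 2) := by
  set G := fun j : ℤ => ∫ t in Ioc (lft T j) (lft T j + T), bdE T p.1 t with hG
  have hG0 : ∀ j, 0 ≤ G j := fun j => integral_nonneg fun t => bdE_nonneg T p.1 t
  have h1 : ∑ j ∈ B, G j ≤ 8 * (√T)⁻¹ := by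
    rw [← integral_bdE T p.1, hG, ← integral_biUnion_finset B (fun _ _ => measurableSet_Ioc)
      (fun i _ j _ hij => disjoint_blocks hT hij) fun j _ => (integrable_bdE T p.1).integrableOn]
    exact setIntegral_le_integral (integrable_bdE T p.1) (ae_of_all _ fun t => bdE_nonneg T p.1 t)
  have h2 : ∑ j ∈ B, G j ^ 2 ≤ (8 * (√T)⁻¹) ^ 2 :=
    (Finset.sum_sq_le_sq_sum_of_nonneg fun j _ => hG0 j).trans
      (by gcongr; exact Finset.sum_nonneg fun j _ => hG0 j)
  calc _ ≤ ∑ r ∈ B ×ˢ A, (√T)⁻¹ ^ 2 * G r.1 ^ 2 := by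
        refine Finset.sum_le_sum fun r _ => ?_
        rw [← mul_pow]
        gcongr
        exact hk.norm_gram_sub_le hT p r
    _ = A.card * ((√T)⁻¹ ^ 2 * ∑ j ∈ B, G j ^ 2) := by
        rw [Finset.sum_product]
        simp only [Finset.sum_const, nsmul_eq_mul]
        rw [← Finset.mul_sum, ← Finset.mul_sum]
    _ ≤ A.card * ((√T)⁻¹ ^ 2 * (8 * (√T)⁻¹) ^ 2) := by gcongr
    _ = _ := by
        rw [mul_pow, inv_pow, Real.sq_sqrt hT.le]
        field_simp
        norm_num

end SechFamily

end HankelEig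

namespace HankelEig

section

variable {H : Type*} [NormedAddCommGroup H] [InnerProductSpace ℂ H]

/-- Bessel's identity for vector-valued functions on an interval. -/
lemma integral_norm_sub_sum_sq [CompleteSpace H] {ι : Type*} [DecidableEq ι] (A : Finset ι)
    (φ : ι → ℝ → ℂ) (hφ : ∀ k, Continuous (φ k)) {a b : ℝ}
    (hφo : ∀ k l, ∫ s in a..b, φ k s * (starRingEnd ℂ) (φ l s) = if k = l then 1 else 0)
    {f : ℝ → H} (hf : Continuous f) :
    ∫ s in a..b, ‖f s - ∑ k ∈ A, φ k s • ∫ t in a..b, (starRingEnd ℂ) (φ k t) • f t‖ ^ 2 =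
      (∫ s in a..b, ‖f s‖ ^ 2) -
        ∑ k ∈ A, ‖∫ t in a..b, (starRingEnd ℂ) (φ k t) • f t‖ ^ 2 := by
  let c := fun k => ∫ t in a..b, (starRingEnd ℂ) (φ k t) • f t
  have hcφ : ∀ k, Continuous fun s => (starRingEnd ℂ) (φ k s) :=
    fun k => RCLike.continuous_conj.comp (hφ k)
  have hS : Continuous fun s => ∑ k ∈ A, φ k s • c k :=
    continuous_finsetSum _ fun k _ => (hφ k).smul continuous_const
  have hre : ∀ g : ℝ → ℂ, Continuous g → ∫ s in a..b, (g s).re = (∫ s in a..b, g s).re := by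
    intro g hg
    exact Complex.reCLM.intervalIntegral_comp_comm (hg.intervalIntegrable a b)
  have h1 : ∫ s in a..b, inner ℂ (∑ k ∈ A, φ k s • c k) (f s) = ((∑ k ∈ A, ‖c k‖ ^ 2 : ℝ) : ℂ) := by
    simp_rw [sum_inner]
    rw [intervalIntegral.integral_finsetSum]
    · rw [Complex.ofReal_sum]
      refine Finset.sum_congr rfl fun k _ => ?_
      have : ∀ s, inner ℂ (φ k s • c k) (f s) = inner ℂ (c k) ((starRingEnd ℂ) (φ k s) • f s) := by
        intro s
        rw [inner_smul_left, inner_smul_right]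
      simp_rw [this]
      rw [← inner_intervalIntegral (c k) (f := fun s => (starRingEnd ℂ) (φ k s) • f s)
        ((hcφ k).smul hf)]
      change inner ℂ (c k) (c k) = _
      rw [inner_self_eq_norm_sq_to_K]
      push_cast
      rfl
    · intro k _
      exact (((hφ k).smul continuous_const).inner hf).intervalIntegrable a b
  have h2 : ∫ s in a..b, inner ℂ (∑ k ∈ A, φ k s • c k) (∑ k ∈ A, φ k s • c k) =
      ((∑ k ∈ A, ‖c k‖ ^ 2 : ℝ) : ℂ) := by
    simp_rw [sum_inner, inner_sum]
    rw [intervalIntegral.integral_finsetSum]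
    · rw [Complex.ofReal_sum]
      refine Finset.sum_congr rfl fun k hk => ?_
      rw [intervalIntegral.integral_finsetSum]
      · have : ∀ l, ∫ s in a..b, inner ℂ (φ k s • c k) (φ l s • c l) =
            (if l = k then 1 else 0) * inner ℂ (c k) (c l) := by
          intro l
          rw [← hφo l k, ← intervalIntegral.integral_mul_const]
          congr 1
          funext s
          rw [inner_smul_left, inner_smul_right]
          ring
        simp_rw [this]
        simp only [ite_mul, one_mul, zero_mul, Finset.sum_ite_eq', hk, if_true]
        rw [inner_self_eq_norm_sq_to_K]
        push_cast
        rfl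
      · intro l _
        exact (((hφ k).smul continuous_const).inner
          ((hφ l).smul continuous_const)).intervalIntegrable a b
    · intro k _
      exact (continuous_finsetSum _ fun l _ => ((hφ k).smul continuous_const).inner
          ((hφ l).smul continuous_const)).intervalIntegrable a b
  have h3 : ∀ s, ‖f s - ∑ k ∈ A, φ k s • c k‖ ^ 2 = ‖f s‖ ^ 2 -
      2 * (inner ℂ (∑ k ∈ A, φ k s • c k) (f s)).re +
      (inner ℂ (∑ k ∈ A, φ k s • c k) (∑ k ∈ A, φ k s • c k)).re := by
    intro s
    have := inner_self_eq_norm_sq (𝕜 := ℂ) (∑ k ∈ A, φ k s • c k)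
    rw [RCLike.re_eq_complex_re] at this
    rw [norm_sub_rev, norm_sub_sq (𝕜 := ℂ), this, RCLike.re_eq_complex_re]
    ring
  change ∫ s in a..b, ‖f s - ∑ k ∈ A, φ k s • c k‖ ^ 2 =
    (∫ s in a..b, ‖f s‖ ^ 2) - ∑ k ∈ A, ‖c k‖ ^ 2
  simp_rw [h3]
  have i1 : IntervalIntegrable (fun s => ‖f s‖ ^ 2) volume a b :=
    (hf.norm.pow 2).intervalIntegrable a b
  have c2 : Continuous fun s => inner ℂ (∑ k ∈ A, φ k s • c k) (f s) := hS.inner hf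
  have c3 : Continuous fun s => inner ℂ (∑ k ∈ A, φ k s • c k) (∑ k ∈ A, φ k s • c k) := hS.inner hS
  have i2 : IntervalIntegrable (fun s => 2 * (inner ℂ (∑ k ∈ A, φ k s • c k) (f s)).re) volume a b :=
    (continuous_const.mul (Complex.continuous_re.comp c2)).intervalIntegrable a b
  have i3 : IntervalIntegrable (fun s =>
      (inner ℂ (∑ k ∈ A, φ k s • c k) (∑ k ∈ A, φ k s • c k)).re) volume a b :=
    (Complex.continuous_re.comp c3).intervalIntegrable a b
  rw [intervalIntegral.integral_add (i1.sub i2) i3, intervalIntegral.integral_sub i1 i2,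
    intervalIntegral.integral_const_mul, hre _ c2, hre _ c3, h1, h2, Complex.ofReal_re]
  ring

lemma Tr.const_mul {q : H → ℝ} {τ : ℝ} (h : Tr q τ) {c : ℝ} (hc : 0 ≤ c) :
    Tr (fun u => c * q u) (c * τ) := by
  refine ⟨fun a u => by simp only [h.1]; ring, fun m v hv => ?_⟩
  rw [← Finset.mul_sum]
  exact mul_le_mul_of_nonneg_left (h.2 m v hv) hc

lemma Tr.sum {ι : Type*} (s : Finset ι) {q : ι → H → ℝ} {τ : ι → ℝ} (h : ∀ i ∈ s, Tr (q i) (τ i)) :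
    Tr (fun u => ∑ i ∈ s, q i u) (∑ i ∈ s, τ i) := by
  refine ⟨fun a u => ?_, fun m v hv => ?_⟩
  · rw [Finset.mul_sum]
    exact Finset.sum_congr rfl fun i hi => (h i hi).1 a u
  · rw [Finset.sum_comm]
    exact Finset.sum_le_sum fun i hi => (h i hi).2 m v hv

lemma Tr.integral {κ : ℝ → H} {a b : ℝ} (hab : a ≤ b) (hκ : Continuous κ) :
    Tr (fun u => ∫ s in a..b, ‖inner ℂ (κ s) u‖ ^ 2) (∫ s in a..b, ‖κ s‖ ^ 2) := by
  have hc : ∀ u, Continuous fun s => ‖inner ℂ (κ s) u‖ ^ 2 :=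
    fun u => (hκ.inner continuous_const).norm.pow 2
  refine ⟨fun c u => ?_, fun m v hv => ?_⟩
  · simp only
    rw [← intervalIntegral.integral_const_mul]
    congr 1
    funext s
    rw [inner_smul_right, norm_mul, mul_pow]
  · rw [← intervalIntegral.integral_finsetSum fun i _ => (hc (v i)).intervalIntegrable a b]
    refine intervalIntegral.integral_mono_on hab
      ((continuous_finsetSum _ fun i _ => hc (v i)).intervalIntegrable a b)
      ((hκ.norm.pow 2).intervalIntegrable a b) fun s _ => ?_
    simp_rw [norm_inner_symm (κ s)]
    exact hv.sum_inner_products_le (κ s)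

end

variable {E : Type*} [NormedAddCommGroup E] [InnerProductSpace ℂ E] [CompleteSpace E]

/-- The part of `kv s` on the `i`-th block that is not captured by the frequencies in `A`. -/
def rmd (kv : ℝ → E) (T : ℝ) (A : Finset ℤ) (i : ℤ) (s : ℝ) : E :=
  kv s - ∑ k ∈ A, (starRingEnd ℂ) (eE T k s) • vA kv T (i, k)

namespace SechFamily

variable {kv : ℝ → E} (hk : SechFamily kv)
include hk

lemma continuous_rmd (T : ℝ) (A : Finset ℤ) (i : ℤ) : Continuous (rmd kv T A i) := by
  unfold rmd
  exact hk.continuous.sub (continuous_finsetSum _ fun k _ =>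
    (RCLike.continuous_conj.comp (continuous_eE T k)).smul continuous_const)

lemma integral_norm_rmd_sq {T : ℝ} (hT : 0 < T) (A : Finset ℤ) (i : ℤ) :
    ∫ s in (lft T i)..(lft T i + T), ‖rmd kv T A i s‖ ^ 2 = T - ∑ k ∈ A, ‖vA kv T (i, k)‖ ^ 2 := by
  have h := integral_norm_sub_sum_sq A (fun k s => (starRingEnd ℂ) (eE T k s))
    (fun k => RCLike.continuous_conj.comp (continuous_eE T k)) (a := lft T i) (b := lft T i + T)
    (fun k l => by
      simp_rw [Complex.conj_conj, mul_comm ((starRingEnd ℂ) _)]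
      rw [integral_eE_mul_conj hT]
      simp only [eq_comm]) hk.continuous
  simp only [Complex.conj_conj] at h
  refine h.trans ?_
  congr 1
  simp_rw [hk.norm_eq]
  simp

lemma integral_norm_inner_sq_eq {T : ℝ} (hT : 0 < T) (A : Finset ℤ) (i : ℤ) (u : E) :
    ∫ s in (lft T i)..(lft T i + T), ‖inner ℂ (kv s) u‖ ^ 2 =
      ∑ k ∈ A, ‖inner ℂ (vA kv T (i, k)) u‖ ^ 2 +
        ∫ s in (lft T i)..(lft T i + T), ‖inner ℂ (rmd kv T A i s) u‖ ^ 2 := by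
  have h := integral_norm_sub_sum_sq A (eE T) (continuous_eE T) (a := lft T i) (b := lft T i + T)
    (fun k l => integral_eE_mul_conj hT _ k l) (hk.continuous.inner (continuous_const (y := u)) (𝕜 := ℂ))
  have h2 : ∀ k, ∫ t in (lft T i)..(lft T i + T), (starRingEnd ℂ) (eE T k t) • inner ℂ (kv t) u =
      inner ℂ (vA kv T (i, k)) u := fun k => (hk.inner_vA_left T (i, k) u).symm
  simp_rw [h2] at h
  have h3 : ∀ s, inner ℂ (rmd kv T A i s) u =
      inner ℂ (kv s) u - ∑ k ∈ A, eE T k s • inner ℂ (vA kv T (i, k)) u := by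
    intro s
    rw [rmd, inner_sub_left, sum_inner]
    simp_rw [inner_smul_left, Complex.conj_conj, smul_eq_mul]
  simp_rw [h3, h]
  ring

end SechFamily

end HankelEig

namespace HankelEig

/-- The blocks `i` with `a ≤ i < b` or `a ≤ -1 - i < b`. -/
def blk (a b : ℕ) : Finset ℤ :=
  (Finset.Ico a b).map ⟨Int.ofNat, fun _ _ h => Int.ofNat.inj h⟩ ∪
    (Finset.Ico a b).map ⟨Int.negSucc, fun _ _ h => Int.negSucc.inj h⟩

lemma sum_blk {M : Type*} [AddCommMonoid M] (a b : ℕ) (f : ℤ → M) :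
    ∑ i ∈ blk a b, f i =
      ∑ m ∈ Finset.Ico a b, f (Int.ofNat m) + ∑ m ∈ Finset.Ico a b, f (Int.negSucc m) := by
  rw [blk, Finset.sum_union, Finset.sum_map, Finset.sum_map]
  · rfl
  · rw [Finset.disjoint_left]
    intro x hx hx'
    simp only [Finset.mem_map] at hx hx'
    obtain ⟨m, -, rfl⟩ := hx
    obtain ⟨m', -, h⟩ := hx'
    cases h

lemma card_blk (a b : ℕ) : (blk a b).card = 2 * (b - a) := by
  have := sum_blk a b (fun _ => 1)
  simp only [Finset.sum_const, smul_eq_mul, mul_one, Nat.card_Ico] at this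
  omega

lemma sum_even_le {f : ℝ → ℝ} (hf : AntitoneOn f (Ici 0)) (hf0 : ∀ x, 0 ≤ f x)
    (he : ∀ x, f (-x) = f x) (hi : IntegrableOn f (Ioi 0)) {T : ℝ} (hT : 0 < T) (K : ℕ) :
    ∑ k ∈ Finset.Icc (-(K : ℤ)) K, f (k / T) ≤ f 0 + 2 * (T * ∫ x in Ioi 0, f x) := by
  have hg : AntitoneOn (fun x => f (x / T)) (Icc 0 (0 + (K : ℝ))) := fun x hx y hy hxy =>
    hf (div_nonneg hx.1 hT.le) (div_nonneg hy.1 hT.le) (by gcongr)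
  have h1 := hg.sum_le_integral
  have h2 : ∫ x in (0 : ℝ)..(0 + K), f (x / T) ≤ T * ∫ x in Ioi 0, f x := by
    rw [intervalIntegral.integral_comp_div _ hT.ne', smul_eq_mul, zero_div,
      intervalIntegral.integral_of_le (by positivity)]
    gcongr
    · exact ae_of_all _ fun x => hf0 x
    · exact Ioc_subset_Ioi_self
  rw [Finset.sum_Icc_of_even_eq_range (f := fun k : ℤ => f (k / T))
    (fun k => by push_cast; rw [neg_div, he]), Finset.sum_range_succ']
  simp only [zero_add] at h1 h2
  push_cast at h1 h2 ⊢
  simp only [zero_div, nsmul_eq_mul]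
  push_cast
  linarith

lemma le_sum_even {f : ℝ → ℝ} (hf : AntitoneOn f (Ici 0)) (hf0 : ∀ x, 0 ≤ f x)
    (he : ∀ x, f (-x) = f x) (hi : IntegrableOn f (Ioi 0)) {T : ℝ} (hT : 0 < T) (K : ℕ)
    {X : ℝ} (hK : X * T ≤ K + 1) :
    2 * (T * ∫ x in Ioc 0 X, f x) - f 0 ≤ ∑ k ∈ Finset.Icc (-(K : ℤ)) K, f (k / T) := by
  have hg : AntitoneOn (fun x => f (x / T)) (Icc 0 (0 + ((K + 1 : ℕ) : ℝ))) := fun x hx y hy hxy =>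
    hf (div_nonneg hx.1 hT.le) (div_nonneg hy.1 hT.le) (by gcongr)
  have h1 := hg.integral_le_sum
  have h2 : T * ∫ x in Ioc 0 X, f x ≤ ∫ x in (0 : ℝ)..(0 + ((K + 1 : ℕ) : ℝ)), f (x / T) := by
    rw [intervalIntegral.integral_comp_div _ hT.ne', smul_eq_mul, zero_div,
      intervalIntegral.integral_of_le (by positivity)]
    refine mul_le_mul_of_nonneg_left (setIntegral_mono_set (hi.mono_set Ioc_subset_Ioi_self)
      (ae_of_all _ fun x => hf0 x) (Ioc_subset_Ioc_right ?_).eventuallyLE) hT.le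
    rw [zero_add, le_div_iff₀ hT]
    exact_mod_cast hK
  rw [Finset.sum_Icc_of_even_eq_range (f := fun k : ℤ => f (k / T))
    (fun k => by push_cast; rw [neg_div, he])]
  simp only [zero_add] at h1 h2
  push_cast at h1 h2 ⊢
  simp only [zero_div, nsmul_eq_mul]
  push_cast
  linarith

lemma antitoneOn_cF_rpow {a : ℝ} (ha : 0 ≤ a) : AntitoneOn (fun x => cF x ^ a) (Ici 0) :=
  fun _ hx y hy hxy => Real.rpow_le_rpow (cF_pos y).le (antitoneOn_cF hx hy hxy) ha

lemma cF_zero : cF 0 = Real.pi := by simp [cF]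

lemma sum_cF_rpow_le {α : ℝ} (hα : 0 < α) {T : ℝ} (hT : 0 < T) (K : ℕ) :
    ∑ k ∈ Finset.Icc (-(K : ℤ)) K, cF (k / T) ^ (1 / α) ≤
      Real.pi ^ (1 / α) + 2 * (T * cInt α) := by
  have := sum_even_le (antitoneOn_cF_rpow (one_div_pos.2 hα).le)
    (fun x => Real.rpow_nonneg (cF_pos x).le _) (fun x => by rw [cF_neg])
    (integrableOn_cF_rpow (one_div_pos.2 hα)) hT K
  rwa [cF_zero] at this

/-- The tail of the integral of `cF`. -/
def cTail (X : ℝ) : ℝ := 1 - 2 * ∫ x in Ioc 0 X, cF x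

lemma tendsto_cTail : Tendsto cTail atTop (nhds 0) := by
  have h1 : IntegrableOn cF (Ioi 0) := by simpa using integrableOn_cF_rpow one_pos
  have h := (intervalIntegral_tendsto_integral_Ioi 0 h1 tendsto_id).const_mul 2
  rw [two_mul_integral_cF] at h
  have h2 := (tendsto_const_nhds (x := (1 : ℝ))).sub h
  rw [sub_self] at h2
  refine h2.congr' ?_
  filter_upwards [eventually_ge_atTop 0] with X hX
  rw [cTail, id, intervalIntegral.integral_of_le hX]

lemma sub_sum_cF_le {T : ℝ} (hT : 0 < T) (K : ℕ) {X : ℝ} (hK : X * T ≤ K + 1) :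
    T - ∑ k ∈ Finset.Icc (-(K : ℤ)) K, cF (k / T) ≤ T * cTail X + Real.pi := by
  have h1 : IntegrableOn cF (Ioi 0) := by simpa using integrableOn_cF_rpow one_pos
  have := le_sum_even antitoneOn_cF (fun x => (cF_pos x).le) cF_neg h1 hT K hK
  rw [cF_zero] at this
  unfold cTail
  linarith

/-- The block `i` lies to the right of `0` (weight `a`) or to the left (weight `b`). -/
def sd (a b : ℝ) : ℤ → ℝ
  | Int.ofNat _ => a
  | Int.negSucc _ => b

/-- Distance of the block from the origin. -/
def mI : ℤ → ℕ
  | Int.ofNat m => m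
  | Int.negSucc m => m

lemma mem_blk {a b : ℕ} {i : ℤ} : i ∈ blk a b ↔ a ≤ mI i ∧ mI i < b := by
  rw [blk, Finset.mem_union, Finset.mem_map, Finset.mem_map]
  cases i with
  | ofNat m =>
    refine ⟨fun h => ?_, fun h => Or.inl ⟨m, Finset.mem_Ico.2 h, rfl⟩⟩
    rcases h with ⟨x, hx, hxm⟩ | ⟨x, hx, hxm⟩
    · cases hxm
      exact Finset.mem_Ico.1 hx
    · cases hxm
  | negSucc m =>
    refine ⟨fun h => ?_, fun h => Or.inr ⟨m, Finset.mem_Ico.2 h, rfl⟩⟩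
    rcases h with ⟨x, hx, hxm⟩ | ⟨x, hx, hxm⟩
    · cases hxm
    · cases hxm
      exact Finset.mem_Ico.1 hx

variable {E : Type*} [NormedAddCommGroup E] [InnerProductSpace ℂ E] [CompleteSpace E]

omit [CompleteSpace E] in
lemma Tr.toUB {q : E → ℝ} {τ l : ℝ} (h : Tr q τ) (hl : 0 < l) : UB q (τ / l) l :=
  UB.of_trace hl h.1 h.2

namespace SechFamily

variable {kv : ℝ → E} (hk : SechFamily kv)
include hk

lemma gram_blocks_le {T : ℝ} (hT : 0 < T) (B A : Finset ℤ) (S : Finset (ℤ × ℤ))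
    (hS : S ⊆ B ×ˢ A) :
    ∑ i : S, ∑ j : S, ‖inner ℂ (vA kv T i) (vA kv T j) -
      if i = j then ((cF ((i : ℤ × ℤ).2 / T) : ℝ) : ℂ) else 0‖ ^ 2 ≤ B.card * A.card * (A.card * (64 / T ^ 2)) := by
  calc _ = ∑ p ∈ S, ∑ r ∈ S, ‖inner ℂ (vA kv T p) (vA kv T r) -
      (if p = r then (cF (p.2 / T) : ℂ) else 0)‖ ^ 2 := by
        rw [← Finset.sum_coe_sort S]
        refine Finset.sum_congr rfl fun i _ => ?_
        rw [← Finset.sum_coe_sort S]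
        refine Finset.sum_congr rfl fun j _ => ?_
        simp only [Subtype.ext_iff]
    _ ≤ ∑ p ∈ B ×ˢ A, ∑ r ∈ B ×ˢ A, ‖inner ℂ (vA kv T p) (vA kv T r) -
      (if p = r then (cF (p.2 / T) : ℂ) else 0)‖ ^ 2 := by
        refine (Finset.sum_le_sum fun p _ => Finset.sum_le_sum_of_subset_of_nonneg hS
          fun _ _ _ => by positivity).trans (Finset.sum_le_sum_of_subset_of_nonneg hS
          fun _ _ _ => Finset.sum_nonneg fun _ _ => by positivity)
    _ ≤ ∑ p ∈ B ×ˢ A, (A.card * (64 / T ^ 2) : ℝ) :=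
        Finset.sum_le_sum fun p _ => hk.sum_gram_sq_le hT p B A
    _ = _ := by
        rw [Finset.sum_const, Finset.card_product, nsmul_eq_mul]
        push_cast
        rfl

lemma UB_blocks {T : ℝ} (hT : 0 < T) (B A : Finset ℤ) (w : ℤ → ℝ) (hw : ∀ i ∈ B, 0 < w i)
    {l l' δ : ℝ} (hl : 0 < l) (hl' : 0 < l') (hδ : 0 < δ) :
    UB (fun u => ∑ i ∈ B, w i * ∫ s in (lft T i)..(lft T i + T), ‖inner ℂ (kv s) u‖ ^ 2)
      ((∑ k ∈ A, ((B.filter fun i => l / w i - δ < cF (k / T)).card : ℝ)) +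
        B.card * A.card * (A.card * (64 / T ^ 2)) / δ ^ 2 +
        (∑ i ∈ B, w i * (T - ∑ k ∈ A, (cF (k / T) - 8 / T))) / l') (l + l') := by
  set S := B ×ˢ A with hS
  have h1 := UB.of_gram (fun i : S => vA kv T i) (fun i : S => w (i : ℤ × ℤ).1)
    (fun i : S => cF ((i : ℤ × ℤ).2 / T)) (fun i => hw _ (Finset.mem_product.1 i.2).1) hl hδ
    (hk.gram_blocks_le hT B A S hS.le)
  have h2 : Tr (fun u => ∑ i ∈ B, w i *
      ∫ s in (lft T i)..(lft T i + T), ‖inner ℂ (rmd kv T A i s) u‖ ^ 2)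
      (∑ i ∈ B, w i * (T - ∑ k ∈ A, ‖vA kv T (i, k)‖ ^ 2)) := by
    refine Tr.sum B fun i hi => ?_
    rw [← hk.integral_norm_rmd_sq hT A i]
    exact (Tr.integral (by linarith) (hk.continuous_rmd T A i)).const_mul (hw i hi).le
  have h3 := h2.toUB hl'
  refine (h1.add h3).mono (fun u => ?_) ?_ le_rfl
  · refine le_of_eq ?_
    rw [Finset.sum_coe_sort S (fun p => w p.1 * ‖inner ℂ (vA kv T p) u‖ ^ 2), hS,
      Finset.sum_product, ← Finset.sum_add_distrib]
    refine Finset.sum_congr rfl fun i _ => ?_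
    rw [hk.integral_norm_inner_sq_eq hT A i u, mul_add, Finset.mul_sum]
  · refine add_le_add (add_le_add ?_ le_rfl) (div_le_div_of_nonneg_right ?_ hl'.le)
    · rw [← Nat.cast_sum, Nat.cast_le]
      rw [← Finset.card_map (Function.Embedding.subtype _)]
      calc _ ≤ (S.filter fun p => l / w p.1 - δ < cF (p.2 / T)).card := by
            refine Finset.card_le_card fun p hp => ?_
            simp only [Finset.mem_map, Finset.mem_filter, Finset.mem_univ, true_and] at hp
            obtain ⟨a, ha, rfl⟩ := hp
            exact Finset.mem_filter.2 ⟨a.2, ha⟩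
        _ = _ := by
            rw [Finset.card_filter, hS, Finset.sum_product_right]
            simp only [Finset.card_filter]
    · refine Finset.sum_le_sum fun i hi => ?_
      have := (hw i hi).le
      gcongr with k _
      exact hk.norm_vA_sq_ge hT (i, k)

end SechFamily

end HankelEig

namespace HankelEig

lemma card_filter_lt_le {α κ μ c δ η T : ℝ} {n a b : ℕ} (hα : 0 < α) (hκ : 0 < κ) (hμ : 0 < μ)
    (hc : 0 < c) (hη : 0 < η) (hδ : δ ≤ η * c) (hT : 0 < T) (hn : 0 < n) (ha : 0 < a) :
    (((Finset.Ico a b).filter fun m : ℕ =>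
      μ * (n : ℝ) ^ (-α) / (κ * (2 * (m * T)) ^ (-α)) - δ < c).card : ℝ) ≤
      n / (2 * T) * ((1 + η) * κ * c / μ) ^ (1 / α) + 1 := by
  set z := n / (2 * T) * ((1 + η) * κ * c / μ) ^ (1 / α) with hz
  have hn' : (0 : ℝ) < n := by exact_mod_cast hn
  have hz0 : 0 ≤ z := by positivity
  have h1 : ((Finset.Ico a b).filter fun m : ℕ =>
      μ * (n : ℝ) ^ (-α) / (κ * (2 * (m * T)) ^ (-α)) - δ < c) ⊆ Finset.range ⌈z⌉₊ := by
    intro m hm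
    obtain ⟨hm1, hm2⟩ := Finset.mem_filter.1 hm
    have hm0 : (0 : ℝ) < m := by exact_mod_cast ha.trans_le (Finset.mem_Ico.1 hm1).1
    rw [Finset.mem_range, Nat.lt_ceil]
    have h2 : μ * (n : ℝ) ^ (-α) / (κ * (2 * (m * T)) ^ (-α)) =
        μ / κ * (2 * (m * T) / n) ^ α := by
      rw [Real.div_rpow (by positivity) hn'.le, Real.rpow_neg hn'.le, Real.rpow_neg (by positivity)]
      field_simp
    rw [h2] at hm2
    have h3 : (2 * (m * T) / n) ^ α < (1 + η) * κ * c / μ := by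
      rw [lt_div_iff₀ hμ]
      have : μ / κ * (2 * (m * T) / n) ^ α < (1 + η) * c := by linarith
      rw [div_mul_eq_mul_div, div_lt_iff₀ hκ] at this
      linarith
    have h4 : 2 * (m * T) / n < ((1 + η) * κ * c / μ) ^ (1 / α) := by
      have := Real.rpow_lt_rpow (by positivity) h3 (one_div_pos.2 hα)
      rwa [← Real.rpow_mul (by positivity), mul_one_div_cancel hα.ne', Real.rpow_one] at this
    rw [div_lt_iff₀ hn'] at h4
    rw [hz, div_mul_eq_mul_div, lt_div_iff₀ (by positivity)]
    linarith
  calc _ ≤ ((⌈z⌉₊ : ℕ) : ℝ) := by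
        have := Finset.card_le_card h1
        rw [Finset.card_range] at this
        exact_mod_cast this
    _ ≤ z + 1 := (Nat.ceil_lt_add_one hz0).le

lemma card_filter_blk (a b : ℕ) (p : ℤ → Prop) [DecidablePred p] :
    ((blk a b).filter p).card = ((Finset.Ico a b).filter fun m : ℕ => p (Int.ofNat m)).card +
      ((Finset.Ico a b).filter fun m : ℕ => p (Int.negSucc m)).card := by
  simp only [Finset.card_filter]
  exact sum_blk a b _

/-- The weight of the `i`-th block. -/
def wt (α T κp κm : ℝ) (i : ℤ) : ℝ := sd κp κm i * (2 * (mI i * T)) ^ (-α)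

variable {E : Type*} [NormedAddCommGroup E] [InnerProductSpace ℂ E] [CompleteSpace E]

/-- The count of relevant modes, per unit `n`. -/
def cnt (α κp κm μ : ℝ) : ℝ := (1 / μ) ^ (1 / α) * (κp ^ (1 / α) + κm ^ (1 / α)) * cInt α

lemma sd_pos {a b : ℝ} (ha : 0 < a) (hb : 0 < b) (i : ℤ) : 0 < sd a b i := by
  cases i <;> assumption

lemma sd_le {a b : ℝ} (ha : 0 < a) (hb : 0 < b) (i : ℤ) : sd a b i ≤ a + b := by
  cases i <;> simp only [sd] <;> linarith

lemma sum_card_filter_le {α κp κm μ η δ T : ℝ} {n a b K : ℕ} (hα : 0 < α) (hκp : 0 < κp)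
    (hκm : 0 < κm) (hμ : 0 < μ) (hη : 0 < η)
    (hδ : ∀ k ∈ Finset.Icc (-(K : ℤ)) K, δ ≤ η * cF (k / T)) (hT : 0 < T) (hn : 0 < n) (ha : 0 < a) :
    ∑ k ∈ Finset.Icc (-(K : ℤ)) K, (((blk a b).filter fun i =>
      μ * (n : ℝ) ^ (-α) / wt α T κp κm i - δ < cF (k / T)).card : ℝ) ≤
      n * ((1 + η) ^ (1 / α) * cnt α κp κm μ) + n * ((1 + η) ^ (1 / α) * (1 / μ) ^ (1 / α) *
        (κp ^ (1 / α) + κm ^ (1 / α)) * Real.pi ^ (1 / α) / 2) / T + 2 * (2 * K + 1) := by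
  have h1 : ∀ k ∈ Finset.Icc (-(K : ℤ)) K, (((blk a b).filter fun i =>
      μ * (n : ℝ) ^ (-α) / wt α T κp κm i - δ < cF (k / T)).card : ℝ) ≤
      n / (2 * T) * ((1 + η) ^ (1 / α) * (1 / μ) ^ (1 / α) *
        (κp ^ (1 / α) + κm ^ (1 / α))) * cF (k / T) ^ (1 / α) + 2 := by
    intro k hk
    rw [card_filter_blk]
    have hp := card_filter_lt_le (b := b) hα hκp hμ (cF_pos (k / T)) hη (hδ k hk) hT hn ha
    have hm := card_filter_lt_le (b := b) hα hκm hμ (cF_pos (k / T)) hη (hδ k hk) hT hn ha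
    have hr : ∀ κ : ℝ, 0 < κ → ((1 + η) * κ * cF (k / T) / μ) ^ (1 / α) =
        (1 + η) ^ (1 / α) * κ ^ (1 / α) * cF (k / T) ^ (1 / α) * (1 / μ) ^ (1 / α) := by
      intro κ hκ
      have := cF_pos (k / T)
      rw [← mul_one_div _ μ, Real.mul_rpow (by positivity) (by positivity),
        Real.mul_rpow (by positivity) (by positivity), Real.mul_rpow (by positivity) (by positivity)]
    rw [hr κp hκp] at hp
    rw [hr κm hκm] at hm
    push_cast
    refine (add_le_add hp hm).trans (le_of_eq ?_)
    ring
  refine (Finset.sum_le_sum h1).trans ?_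
  rw [Finset.sum_add_distrib, ← Finset.mul_sum, Finset.sum_const, Int.card_Icc, nsmul_eq_mul]
  have hK : (((K : ℤ) + 1 - -(K : ℤ)).toNat : ℝ) = 2 * K + 1 := by
    have : ((K : ℤ) + 1 - -(K : ℤ)).toNat = 2 * K + 1 := by omega
    rw [this]
    push_cast
    ring
  rw [hK]
  have h2 := sum_cF_rpow_le hα hT K
  have h3 : 0 ≤ n / (2 * T) * ((1 + η) ^ (1 / α) * (1 / μ) ^ (1 / α) *
        (κp ^ (1 / α) + κm ^ (1 / α))) := by positivity
  have h4 := mul_le_mul_of_nonneg_left h2 h3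
  have h5 : n / (2 * T) * ((1 + η) ^ (1 / α) * (1 / μ) ^ (1 / α) *
        (κp ^ (1 / α) + κm ^ (1 / α))) * (Real.pi ^ (1 / α) + 2 * (T * cInt α)) =
      n * ((1 + η) ^ (1 / α) * cnt α κp κm μ) + n * ((1 + η) ^ (1 / α) * (1 / μ) ^ (1 / α) *
        (κp ^ (1 / α) + κm ^ (1 / α)) * Real.pi ^ (1 / α) / 2) / T := by
    unfold cnt
    field_simp
    ring
  linarith

namespace SechFamily

variable {kv : ℝ → E} (hk : SechFamily kv)
include hk

lemma UB_main_explicit {α κp κm μ μ₁ η ε M X T : ℝ} {n : ℕ} (hα : 0 < α) (hκp : 0 < κp)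
    (hκm : 0 < κm) (hμ : 0 < μ) (hμ₁ : 0 < μ₁) (hη : 0 < η) (hε : 0 < ε) (hM : 0 < M) (hX : 0 < X)
    (hT : 1 ≤ T) (hn : 0 < n) :
    UB (fun u => ∑ i ∈ blk ⌈ε * n / T⌉₊ ⌈M * n / T⌉₊, wt α T κp κm i *
        ∫ s in (lft T i)..(lft T i + T), ‖inner ℂ (kv s) u‖ ^ 2)
      (n * ((1 + η) ^ (1 / α) * cnt α κp κm μ + 2 * M * (κp + κm) * (2 * ε) ^ (-α) / μ₁ * |cTail X| +
        ((1 + η) ^ (1 / α) * (1 / μ) ^ (1 / α) *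
          (κp ^ (1 / α) + κm ^ (1 / α)) * Real.pi ^ (1 / α) / 2 +
          128 * M * (2 * X + 1) ^ 2 / (η * cF X) ^ 2 +
          2 * M * (κp + κm) * (2 * ε) ^ (-α) / μ₁ * (Real.pi + 8 * (2 * X + 1))) / T) +
        (2 * (2 * X + 1) * T + 128 * (2 * X + 1) ^ 2 / (η * cF X) ^ 2 +
          2 * (κp + κm) * (2 * ε) ^ (-α) / μ₁ * (T * |cTail X| + (Real.pi + 8 * (2 * X + 1)))))
      (μ * (n : ℝ) ^ (-α) + μ₁ * (n : ℝ) ^ (-α)) := by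
  have hT0 : 0 < T := by linarith
  have hn' : (0 : ℝ) < n := by exact_mod_cast hn
  set K := ⌊X * T⌋₊ with hK
  set a := ⌈ε * n / T⌉₊ with ha
  set b := ⌈M * n / T⌉₊ with hb
  set A := Finset.Icc (-(K : ℤ)) K with hA
  set c₀ := cF X
  have hc₀ : 0 < c₀ := cF_pos X
  have hKle : (K : ℝ) ≤ X * T := Nat.floor_le (by positivity)
  have hKge : X * T ≤ K + 1 := (Nat.lt_floor_add_one _).le
  have ha0 : 0 < a := Nat.ceil_pos.2 (by positivity)
  have haε : ε * n ≤ a * T := by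
    rw [← div_le_iff₀ hT0]
    exact Nat.le_ceil _
  have hmT : ∀ i ∈ blk a b, ε * n ≤ mI i * T := by
    intro i hi
    have : (a : ℝ) ≤ mI i := by exact_mod_cast (mem_blk.1 hi).1
    exact haε.trans (by gcongr)
  have hw0 : ∀ i ∈ blk a b, 0 < wt α T κp κm i := by
    intro i hi
    have h1 := hmT i hi
    have : 0 < ε * n := by positivity
    exact mul_pos (sd_pos hκp hκm i) (Real.rpow_pos_of_pos (by linarith) _)
  have hw1 : ∀ i ∈ blk a b, wt α T κp κm i ≤ (κp + κm) * ((2 * ε) ^ (-α) * (n : ℝ) ^ (-α)) := by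
    intro i hi
    have h1 := hmT i hi
    have : 0 < ε * n := by positivity
    rw [← Real.mul_rpow (by positivity) hn'.le]
    refine mul_le_mul (sd_le hκp hκm i) (Real.rpow_le_rpow_of_nonpos (by positivity) (by linarith)
      (by linarith)) (Real.rpow_nonneg (by linarith) _) (by positivity)
  have hAc : (A.card : ℝ) = 2 * K + 1 := by
    have : A.card = 2 * K + 1 := by
      rw [hA, Int.card_Icc]
      omega
    rw [this]
    push_cast
    ring
  have hAc' : (A.card : ℝ) ≤ (2 * X + 1) * T := by
    rw [hAc]
    nlinarith
  have hBc : ((blk a b).card : ℝ) ≤ 2 * (M * n / T + 1) := by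
    have h1 : ((blk a b).card : ℝ) ≤ 2 * b := by
      have : (blk a b).card ≤ 2 * b := by
        rw [card_blk]
        omega
      exact_mod_cast this
    have h2 : (b : ℝ) < M * n / T + 1 := Nat.ceil_lt_add_one (by positivity)
    linarith
  have hδ : ∀ k ∈ A, η * c₀ ≤ η * cF (k / T) := by
    intro k hk'
    have habs : |(k : ℝ)| ≤ K := by
      rw [abs_le]
      exact ⟨by exact_mod_cast (Finset.mem_Icc.1 hk').1, by exact_mod_cast (Finset.mem_Icc.1 hk').2⟩
    have h1 : cF (k / T) = cF (|(k : ℝ)| / T) := by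
      rcases abs_choice (k : ℝ) with h | h
      · rw [h]
      · rw [h, neg_div, cF_neg]
    rw [h1]
    refine mul_le_mul_of_nonneg_left (antitoneOn_cF (div_nonneg (abs_nonneg _) hT0.le) hX.le ?_) hη.le
    rw [div_le_iff₀ hT0]
    exact habs.trans hKle
  have h0 := hk.UB_blocks hT0 (blk a b) A (wt α T κp κm) hw0
    (l := μ * (n : ℝ) ^ (-α)) (l' := μ₁ * (n : ℝ) ^ (-α)) (δ := η * c₀) (by positivity)
    (by positivity) (by positivity)
  refine h0.mono (fun _ => le_rfl) ?_ le_rfl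
  have h1 := sum_card_filter_le (b := b) hα hκp hκm hμ hη hδ hT0 hn ha0
  have h2 : ((blk a b).card * A.card * (A.card * (64 / T ^ 2)) / (η * c₀) ^ 2 : ℝ) ≤
      2 * (M * n / T + 1) * ((2 * X + 1) * T) * ((2 * X + 1) * T * (64 / T ^ 2)) / (η * c₀) ^ 2 := by
    gcongr
  have h3 : (∑ i ∈ blk a b, wt α T κp κm i * (T - ∑ k ∈ A, (cF (k / T) - 8 / T))) /
      (μ₁ * (n : ℝ) ^ (-α)) ≤ 2 * (M * n / T + 1) *
        ((κp + κm) * ((2 * ε) ^ (-α) * (n : ℝ) ^ (-α)) * (T * |cTail X| + (Real.pi + 8 * (2 * X + 1)))) /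
        (μ₁ * (n : ℝ) ^ (-α)) := by
    have hD : T - ∑ k ∈ A, (cF (k / T) - 8 / T) ≤ T * |cTail X| + (Real.pi + 8 * (2 * X + 1)) := by
      rw [Finset.sum_sub_distrib, Finset.sum_const, nsmul_eq_mul]
      have h4 := sub_sum_cF_le hT0 K hKge
      have h5 : T * cTail X ≤ T * |cTail X| := by
        gcongr
        exact le_abs_self _
      have h6 : (A.card : ℝ) * (8 / T) ≤ 8 * (2 * X + 1) := by
        calc (A.card : ℝ) * (8 / T) ≤ (2 * X + 1) * T * (8 / T) := by gcongr
          _ = _ := by field_simp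
      linarith
    gcongr
    calc _ ≤ ∑ i ∈ blk a b, ((κp + κm) * ((2 * ε) ^ (-α) * (n : ℝ) ^ (-α)) *
            (T * |cTail X| + (Real.pi + 8 * (2 * X + 1)))) := by
          refine Finset.sum_le_sum fun i hi => ?_
          have := (hw0 i hi).le
          refine (mul_le_mul_of_nonneg_left hD this).trans
            (mul_le_mul_of_nonneg_right (hw1 i hi) (by positivity))
      _ = (blk a b).card * _ := by rw [Finset.sum_const, nsmul_eq_mul]
      _ ≤ _ := by gcongr
  refine (add_le_add (add_le_add h1 h2) h3).trans ?_
  have h4 : 2 * (2 * (K : ℝ) + 1) ≤ 2 * (2 * X + 1) * T := by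
    rw [← hAc, mul_assoc]
    gcongr
  refine (add_le_add (add_le_add (add_le_add le_rfl h4) le_rfl) le_rfl).trans (le_of_eq ?_)
  have hnα : (n : ℝ) ^ (-α) ≠ 0 := (Real.rpow_pos_of_pos hn' _).ne'
  field_simp
  ring

lemma UB_main {α κp κm μ μ₁ ε M γ : ℝ} (hα : 0 < α) (hκp : 0 < κp)
    (hκm : 0 < κm) (hμ : 0 < μ) (hμ₁ : 0 < μ₁) (hε : 0 < ε) (hM : 0 < M) (hγ : 0 < γ) :
    ∃ T : ℝ, 1 ≤ T ∧ ∀ᶠ n : ℕ in atTop,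
    UB (fun u => ∑ i ∈ blk ⌈ε * n / T⌉₊ ⌈M * n / T⌉₊, wt α T κp κm i *
        ∫ s in (lft T i)..(lft T i + T), ‖inner ℂ (kv s) u‖ ^ 2)
      ((cnt α κp κm μ + γ) * n) (μ * (n : ℝ) ^ (-α) + μ₁ * (n : ℝ) ^ (-α)) := by
  have h1 : ∀ᶠ η : ℝ in nhdsWithin 0 (Ioi 0),
      (1 + η) ^ (1 / α) * cnt α κp κm μ < cnt α κp κm μ + γ / 4 := by
    have : Tendsto (fun η : ℝ => (1 + η) ^ (1 / α) * cnt α κp κm μ) (nhdsWithin 0 (Ioi 0))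
        (nhds ((1 + 0) ^ (1 / α) * cnt α κp κm μ)) := by
      refine Tendsto.mul_const _ (Tendsto.mono_left ?_ nhdsWithin_le_nhds)
      exact ((continuous_const.add continuous_id).tendsto 0).rpow_const (Or.inl (by norm_num))
    rw [add_zero, Real.one_rpow, one_mul] at this
    exact this.eventually_lt_const (by linarith)
  obtain ⟨η, hη1, hη⟩ := (h1.and self_mem_nhdsWithin).exists
  have hη : 0 < η := hη
  have h2 : ∀ᶠ X : ℝ in atTop,
      2 * M * (κp + κm) * (2 * ε) ^ (-α) / μ₁ * |cTail X| < γ / 4 := by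
    have := tendsto_cTail.abs.const_mul (2 * M * (κp + κm) * (2 * ε) ^ (-α) / μ₁)
    rw [abs_zero, mul_zero] at this
    exact this.eventually_lt_const (by linarith)
  obtain ⟨X, hX1, hX⟩ := (h2.and (eventually_gt_atTop 0)).exists
  have h3 : ∀ C : ℝ, ∀ᶠ T : ℝ in atTop, C / T < γ / 4 := fun C =>
    (tendsto_const_nhds.div_atTop tendsto_id).eventually_lt_const (by linarith)
  obtain ⟨T, hT1, hT⟩ := ((h3 ((1 + η) ^ (1 / α) * (1 / μ) ^ (1 / α) *
          (κp ^ (1 / α) + κm ^ (1 / α)) * Real.pi ^ (1 / α) / 2 +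
          128 * M * (2 * X + 1) ^ 2 / (η * cF X) ^ 2 +
          2 * M * (κp + κm) * (2 * ε) ^ (-α) / μ₁ * (Real.pi + 8 * (2 * X + 1)))).and
          (eventually_ge_atTop 1)).exists
  refine ⟨T, hT, ?_⟩
  set C := (2 * (2 * X + 1) * T + 128 * (2 * X + 1) ^ 2 / (η * cF X) ^ 2 +
          2 * (κp + κm) * (2 * ε) ^ (-α) / μ₁ * (T * |cTail X| + (Real.pi + 8 * (2 * X + 1)))) with hC
  filter_upwards [eventually_gt_atTop 0,
    (tendsto_natCast_atTop_atTop (R := ℝ)).eventually_ge_atTop (C / (γ / 4))] with n hn hnC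
  refine (hk.UB_main_explicit hα hκp hκm hμ hμ₁ hη hε hM hX hT hn).mono (fun _ => le_rfl) ?_ le_rfl
  rw [← hC]
  rw [div_le_iff₀ (by linarith)] at hnC
  have hn' : (0 : ℝ) ≤ n := n.cast_nonneg
  have h5 := mul_le_mul_of_nonneg_left (add_le_add (add_le_add hη1.le hX1.le) hT1.le) hn'
  linarith

end SechFamily

end HankelEig

namespace HankelEig

lemma le_card_filter {α κ μ c δ η θ T : ℝ} {n a b : ℕ} (hα : 0 < α) (hμ : 0 < μ)
    (hc : 0 < c) (hη : η < 1) (hθ : 0 < θ) (hδ : δ ≤ η * c) (hT : 0 < T) (hn : 0 < n)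
    (hb : n / (2 * T) * ((1 - η) * θ * max κ 0 * c / μ) ^ (1 / α) ≤ b) :
    n / (2 * T) * ((1 - η) * θ * max κ 0 * c / μ) ^ (1 / α) - 1 - a ≤
    (((Finset.Ico a b).filter fun m : ℕ => 0 < κ ∧
      μ * (n : ℝ) ^ (-α) / (θ * κ * (2 * ((m + 1) * T)) ^ (-α)) + δ ≤ c).card : ℝ) := by
  set z := n / (2 * T) * ((1 - η) * θ * max κ 0 * c / μ) ^ (1 / α) with hz
  have hn' : (0 : ℝ) < n := by exact_mod_cast hn
  rcases le_or_gt κ 0 with hκ | hκ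
  · have : z = 0 := by
      rw [hz, max_eq_right hκ, mul_zero, zero_mul, zero_div,
        Real.zero_rpow (one_div_pos.2 hα).ne', mul_zero]
    rw [this]
    have h1 : (0 : ℝ) ≤ a := a.cast_nonneg
    have h2 : (0 : ℝ) ≤ (((Finset.Ico a b).filter fun m : ℕ => 0 < κ ∧
      μ * (n : ℝ) ^ (-α) / (θ * κ * (2 * ((m + 1) * T)) ^ (-α)) + δ ≤ c).card : ℝ) := Nat.cast_nonneg _
    linarith
  have h1η : 0 < 1 - η := by linarith
  rw [max_eq_left hκ.le] at hz
  have hz0 : 0 ≤ z := by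
    rw [hz]
    positivity
  have h1 : Finset.Ico a ⌊z⌋₊ ⊆ ((Finset.Ico a b).filter fun m : ℕ => 0 < κ ∧
      μ * (n : ℝ) ^ (-α) / (θ * κ * (2 * ((m + 1) * T)) ^ (-α)) + δ ≤ c) := by
    intro m hm
    obtain ⟨hm1, hm2⟩ := Finset.mem_Ico.1 hm
    have hmz : (m : ℝ) + 1 ≤ z := by
      have : ((m + 1 : ℕ) : ℝ) ≤ z := (Nat.le_floor_iff hz0).1 hm2
      push_cast at this
      exact this
    have hmb : m < b := by
      have : (m : ℝ) < b := by linarith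
      exact_mod_cast this
    refine Finset.mem_filter.2 ⟨Finset.mem_Ico.2 ⟨hm1, hmb⟩, hκ, ?_⟩
    have h2 : μ * (n : ℝ) ^ (-α) / (θ * κ * (2 * ((m + 1) * T)) ^ (-α)) =
        μ / (θ * κ) * (2 * ((m + 1) * T) / n) ^ α := by
      rw [Real.div_rpow (by positivity) hn'.le, Real.rpow_neg hn'.le, Real.rpow_neg (by positivity)]
      field_simp
    rw [h2]
    have h4 : 2 * ((m + 1) * T) / n ≤ ((1 - η) * θ * κ * c / μ) ^ (1 / α) := by
      rw [div_le_iff₀ hn']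
      rw [hz, div_mul_eq_mul_div, le_div_iff₀ (by positivity)] at hmz
      linarith
    have h3 : (2 * ((m + 1) * T) / n) ^ α ≤ (1 - η) * θ * κ * c / μ := by
      have := Real.rpow_le_rpow (by positivity) h4 hα.le
      rwa [← Real.rpow_mul (by positivity), one_div_mul_cancel hα.ne', Real.rpow_one] at this
    have h5 : μ / (θ * κ) * (2 * ((m + 1) * T) / n) ^ α ≤ (1 - η) * c := by
      calc _ ≤ μ / (θ * κ) * ((1 - η) * θ * κ * c / μ) := by gcongr
        _ = _ := by field_simp
    linarith
  have h2 := Finset.card_le_card h1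
  rw [Nat.card_Ico] at h2
  have h3 : z < ⌊z⌋₊ + 1 := Nat.lt_floor_add_one z
  have h4 : (⌊z⌋₊ : ℝ) - a ≤ ((⌊z⌋₊ - a : ℕ) : ℝ) := by
    have : ((⌊z⌋₊ : ℕ) : ℝ) ≤ ((⌊z⌋₊ - a + a : ℕ) : ℝ) := by exact_mod_cast (by omega)
    push_cast at this
    linarith
  have h5 : ((⌊z⌋₊ - a : ℕ) : ℝ) ≤ _ := Nat.cast_le.2 h2
  linarith

/-- The lower weight of the `i`-th block. -/
def wl (α T θ κp κm : ℝ) (i : ℤ) : ℝ := θ * sd κp κm i * (2 * ((mI i + 1) * T)) ^ (-α)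

/-- `t` lies on a half-line where the model symbol is not positive. -/
def Inact (κp κm t : ℝ) : Prop := (0 < t ∧ κp ≤ 0) ∨ (t < 0 ∧ κm ≤ 0)

lemma bdE_le_of_inact {κp κm T t : ℝ} {i : ℤ} (hT : 1 ≤ T) (hi : 0 < sd κp κm i)
    (ht : Inact κp κm t) : bdE T i t ≤ 4 * (Real.exp (-|t|) * Real.exp (-(mI i * T))) := by
  have h1 : mI i * T + |t| ≤ |t - lft T i| ∧ mI i * T + |t| ≤ |t - (lft T i + T)| := by
    cases i with
    | ofNat m =>
      simp only [sd] at hi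
      rcases ht with ht | ht
      · linarith [ht.2]
      · have hm : (0 : ℝ) ≤ m * T := by positivity
        simp only [mI, lft, Int.ofNat_eq_natCast, Int.cast_natCast]
        rw [abs_of_neg ht.1, abs_of_nonpos (a := t - m * T) (by linarith),
          abs_of_nonpos (a := t - (m * T + T)) (by linarith)]
        constructor <;> linarith
    | negSucc m =>
      simp only [sd] at hi
      rcases ht with ht | ht
      · have hm : (0 : ℝ) ≤ m * T := by positivity
        simp only [mI, lft, Int.cast_negSucc]
        push_cast
        rw [abs_of_pos ht.1, abs_of_nonneg (a := t - -(m + 1) * T) (by linarith),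
          abs_of_nonneg (a := t - (-(m + 1) * T + T)) (by linarith)]
        constructor <;> linarith
      · linarith [ht.2]
  have h2 : (√T)⁻¹ ≤ 1 := inv_le_one_of_one_le₀ (Real.one_le_sqrt.2 hT)
  rw [← Real.exp_add]
  unfold bdE
  calc _ ≤ 1 * (2 * (Real.exp (-|t| + -(mI i * T)) + Real.exp (-|t| + -(mI i * T)))) := by
        gcongr <;> linarith
    _ = _ := by ring

lemma not_mem_block_of_inact {κp κm T t : ℝ} {i : ℤ} (hT : 1 ≤ T) (hi : 0 < sd κp κm i)
    (hm : 0 < mI i) (ht : Inact κp κm t) : t ∉ Ioc (lft T i) (lft T i + T) := by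
  rintro ⟨h1, h2⟩
  cases i with
  | ofNat m =>
    simp only [sd] at hi
    simp only [lft, Int.ofNat_eq_natCast, Int.cast_natCast] at h1
    have hm : (0 : ℝ) ≤ m * T := by positivity
    rcases ht with ht | ht
    · linarith [ht.2]
    · linarith [ht.1]
  | negSucc m =>
    simp only [sd] at hi
    simp only [lft, Int.cast_negSucc] at h2
    push_cast at h2
    have hm : (0 : ℝ) ≤ m * T := by positivity
    rcases ht with ht | ht
    · linarith [ht.1]
    · linarith [ht.2]

lemma le_sum_card_filter {α κp κm μ η δ θ T X : ℝ} {n a b K : ℕ} (hα : 0 < α)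
    (hμ : 0 < μ) (hη : η < 1) (hθ : 0 < θ)
    (hδ : ∀ k ∈ Finset.Icc (-(K : ℤ)) K, δ ≤ η * cF (k / T)) (hT : 0 < T) (hn : 0 < n)
    (hX : X * T ≤ K + 1)
    (hbp : ∀ k : ℤ, n / (2 * T) * ((1 - η) * θ * max κp 0 * cF (k / T) / μ) ^ (1 / α) ≤ b)
    (hbm : ∀ k : ℤ, n / (2 * T) * ((1 - η) * θ * max κm 0 * cF (k / T) / μ) ^ (1 / α) ≤ b) :
    n * (((1 - η) * θ) ^ (1 / α) * ((1 / μ) ^ (1 / α) *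
      (max κp 0 ^ (1 / α) + max κm 0 ^ (1 / α))) *
      ((∫ x in Ioc 0 X, cF x ^ (1 / α)) - Real.pi ^ (1 / α) / (2 * T))) - 2 * (2 * K + 1) * (1 + a) ≤
    ∑ k ∈ Finset.Icc (-(K : ℤ)) K, (((blk a b).filter fun i => 0 < sd κp κm i ∧
      μ * (n : ℝ) ^ (-α) / wl α T θ κp κm i + δ ≤ cF (k / T)).card : ℝ) := by
  have h1η : 0 < 1 - η := by linarith
  have h1 : ∀ k ∈ Finset.Icc (-(K : ℤ)) K,
      n / (2 * T) * (((1 - η) * θ) ^ (1 / α) * ((1 / μ) ^ (1 / α) *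
        (max κp 0 ^ (1 / α) + max κm 0 ^ (1 / α)))) * cF (k / T) ^ (1 / α) - 2 * (1 + a) ≤
      (((blk a b).filter fun i => 0 < sd κp κm i ∧
      μ * (n : ℝ) ^ (-α) / wl α T θ κp κm i + δ ≤ cF (k / T)).card : ℝ) := by
    intro k hk
    rw [card_filter_blk]
    have hp := le_card_filter (a := a) hα hμ (cF_pos (k / T)) hη hθ (hδ k hk) hT hn (hbp k)
    have hm := le_card_filter (a := a) hα hμ (cF_pos (k / T)) hη hθ (hδ k hk) hT hn (hbm k)
    have hr : ∀ κ : ℝ, 0 ≤ κ → ((1 - η) * θ * κ * cF (k / T) / μ) ^ (1 / α) =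
        ((1 - η) * θ) ^ (1 / α) * κ ^ (1 / α) * cF (k / T) ^ (1 / α) * (1 / μ) ^ (1 / α) := by
      intro κ hκ
      have := cF_pos (k / T)
      rw [← mul_one_div _ μ, Real.mul_rpow (by positivity) (by positivity),
        Real.mul_rpow (by positivity) (by positivity), Real.mul_rpow (by positivity) (by positivity)]
    rw [hr _ (le_max_right _ _)] at hp hm
    push_cast
    refine le_trans (le_of_eq ?_) (add_le_add hp hm)
    ring
  refine le_trans ?_ (Finset.sum_le_sum h1)
  rw [Finset.sum_sub_distrib, ← Finset.mul_sum, Finset.sum_const, Int.card_Icc, nsmul_eq_mul]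
  have hK : (((K : ℤ) + 1 - -(K : ℤ)).toNat : ℝ) = 2 * K + 1 := by
    have : ((K : ℤ) + 1 - -(K : ℤ)).toNat = 2 * K + 1 := by omega
    rw [this]
    push_cast
    ring
  rw [hK]
  have h2 := le_sum_even (antitoneOn_cF_rpow (one_div_pos.2 hα).le)
    (fun x => Real.rpow_nonneg (cF_pos x).le _) (fun x => by rw [cF_neg])
    (integrableOn_cF_rpow (one_div_pos.2 hα)) hT K hX
  rw [cF_zero] at h2
  have h3 : 0 ≤ n / (2 * T) * (((1 - η) * θ) ^ (1 / α) * ((1 / μ) ^ (1 / α) *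
        (max κp 0 ^ (1 / α) + max κm 0 ^ (1 / α)))) := by positivity
  have h4 := mul_le_mul_of_nonneg_left h2 h3
  have h5 : n / (2 * T) * (((1 - η) * θ) ^ (1 / α) * ((1 / μ) ^ (1 / α) *
        (max κp 0 ^ (1 / α) + max κm 0 ^ (1 / α)))) *
        (2 * (T * ∫ x in Ioc 0 X, cF x ^ (1 / α)) - Real.pi ^ (1 / α)) =
      n * (((1 - η) * θ) ^ (1 / α) * ((1 / μ) ^ (1 / α) *
      (max κp 0 ^ (1 / α) + max κm 0 ^ (1 / α))) *
      ((∫ x in Ioc 0 X, cF x ^ (1 / α)) - Real.pi ^ (1 / α) / (2 * T))) := by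
    field_simp
  linarith

variable {E : Type*} [NormedAddCommGroup E] [InnerProductSpace ℂ E] [CompleteSpace E]

namespace SechFamily

variable {kv : ℝ → E} (hk : SechFamily kv)
include hk

lemma sum_norm_inner_vA_sq_le {T : ℝ} (hT : 0 < T) (A : Finset ℤ) (i : ℤ) (u : E) :
    ∑ k ∈ A, ‖inner ℂ (vA kv T (i, k)) u‖ ^ 2 ≤
      ∫ s in (lft T i)..(lft T i + T), ‖inner ℂ (kv s) u‖ ^ 2 := by
  rw [hk.integral_norm_inner_sq_eq hT A i u]
  have : 0 ≤ ∫ s in (lft T i)..(lft T i + T), ‖inner ℂ (rmd kv T A i s) u‖ ^ 2 :=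
    intervalIntegral.integral_nonneg (by linarith) fun s _ => by positivity
  linarith

/-- A subspace on which the part of the model form on positive blocks is large, consisting of
vectors that are exponentially small on the inactive half-line. -/
lemma exists_subspace_blocks {α κp κm T θ δ l : ℝ} {a b : ℕ} (A : Finset ℤ) (hθ : 0 < θ)
    (hT : 1 ≤ T) (hl : 0 < l) (hδ : 0 < δ) (ha : 0 < a) :
    ∃ V : Submodule ℂ E, FiniteDimensional ℂ V ∧
      ∑ k ∈ A, (((blk a b).filter fun i => 0 < sd κp κm i ∧
        l / wl α T θ κp κm i + δ ≤ cF (k / T)).card : ℝ) -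
        (blk a b).card * A.card * (A.card * (64 / T ^ 2)) / δ ^ 2 ≤ Module.finrank ℂ V ∧
      ∀ u ∈ V, l * ‖u‖ ^ 2 ≤ ∑ i ∈ (blk a b).filter fun i => 0 < sd κp κm i, wl α T θ κp κm i *
          ∫ s in (lft T i)..(lft T i + T), ‖inner ℂ (kv s) u‖ ^ 2 ∧
        ∀ t, Inact κp κm t → ‖inner ℂ (kv t) u‖ ^ 2 ≤
          (∑ i ∈ (blk a b).filter fun i => 0 < sd κp κm i, wl α T θ κp κm i) * A.card *
            (4 * (Real.exp (-|t|) * Real.exp (-(a * T)))) ^ 2 * (‖u‖ ^ 2 / l) := by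
  classical
  have hT0 : 0 < T := by linarith
  set B := (blk a b).filter fun i => 0 < sd κp κm i with hB
  set w := wl α T θ κp κm with hw
  set S := (B ×ˢ A).filter fun p => l / w p.1 + δ ≤ cF (p.2 / T) with hS
  have hBm : ∀ i ∈ B, a ≤ mI i := fun i hi => (mem_blk.1 (Finset.mem_filter.1 hi).1).1
  have hBs : ∀ i ∈ B, 0 < sd κp κm i := fun i hi => (Finset.mem_filter.1 hi).2
  have hw0 : ∀ i ∈ B, 0 < w i := fun i hi =>
    mul_pos (mul_pos hθ (hBs i hi)) (Real.rpow_pos_of_pos (by positivity) _)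
  have hSB : ∀ p ∈ S, p.1 ∈ B := fun p hp => (Finset.mem_product.1 (Finset.mem_filter.1 hp).1).1
  obtain ⟨V, hV, hdim, hu⟩ := exists_subspace_of_gram (fun i : S => vA kv T i)
    (fun i : S => w (i : ℤ × ℤ).1) (fun i : S => cF ((i : ℤ × ℤ).2 / T))
    (fun i => hw0 _ (hSB i i.2)) hl hδ
    (hk.gram_blocks_le hT0 (blk a b) A S ((Finset.filter_subset _ _).trans
      (Finset.product_subset_product (Finset.filter_subset _ _) le_rfl)))
    (fun i => (Finset.mem_filter.1 i.2).2)
  refine ⟨V, hV, ?_, fun u huV => ?_⟩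
  · refine le_trans (le_of_eq ?_) hdim
    congr 1
    rw [Fintype.card_coe, ← Nat.cast_sum]
    congr 1
    rw [hS, Finset.card_filter, Finset.sum_product_right]
    refine Finset.sum_congr rfl fun k _ => ?_
    rw [← Finset.card_filter, hB, Finset.filter_filter]
  · obtain ⟨h1, c, hc, hcs⟩ := hu u huV
    refine ⟨h1.trans ?_, fun t ht => ?_⟩
    · rw [Finset.sum_coe_sort S (fun p => w p.1 * ‖inner ℂ (vA kv T p) u‖ ^ 2)]
      calc _ ≤ ∑ p ∈ B ×ˢ A, w p.1 * ‖inner ℂ (vA kv T p) u‖ ^ 2 :=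
            Finset.sum_le_sum_of_subset_of_nonneg (Finset.filter_subset _ _) fun p hp _ =>
              mul_nonneg (hw0 _ (Finset.mem_product.1 hp).1).le (by positivity)
        _ ≤ _ := by
            rw [Finset.sum_product]
            refine Finset.sum_le_sum fun i hi => ?_
            simp only
            rw [← Finset.mul_sum]
            exact mul_le_mul_of_nonneg_left (hk.sum_norm_inner_vA_sq_le hT0 A i u) (hw0 i hi).le
    · have h2 : ∀ p : S, ‖inner ℂ (kv t) (vA kv T p)‖ ≤
          4 * (Real.exp (-|t|) * Real.exp (-(a * T))) := by
        intro p
        have hpB := hSB p p.2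
        have h3 := hk.norm_inner_vA_kv_sub_le hT0 p t
        have h4 : 0 < mI (p : ℤ × ℤ).1 := ha.trans_le (hBm _ hpB)
        rw [if_neg (not_mem_block_of_inact hT (hBs _ hpB) h4 ht), sub_zero, norm_inner_symm] at h3
        refine h3.trans ((bdE_le_of_inact hT (hBs _ hpB) ht).trans ?_)
        have h5 : (a : ℝ) ≤ mI (p : ℤ × ℤ).1 := by exact_mod_cast hBm _ hpB
        gcongr
      set D := 4 * (Real.exp (-|t|) * Real.exp (-(a * T))) with hD
      have hD0 : 0 ≤ D := by positivity
      have h3 : ‖inner ℂ (kv t) u‖ ≤ (∑ p : S, ‖c p‖) * D := by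
        rw [hc, inner_sum, Finset.sum_mul]
        refine (norm_sum_le _ _).trans (Finset.sum_le_sum fun p _ => ?_)
        rw [inner_smul_right, norm_mul]
        exact mul_le_mul_of_nonneg_left (h2 p) (norm_nonneg _)
      have h4 : (∑ p : S, ‖c p‖) ^ 2 ≤ (∑ p : S, ‖c p‖ ^ 2 / w (p : ℤ × ℤ).1) *
          ∑ p : S, w (p : ℤ × ℤ).1 := by
        refine Finset.sum_sq_le_sum_mul_sum_of_sq_le_mul _ (fun p _ => ?_) (fun p _ => ?_)
          fun p _ => ?_
        · exact div_nonneg (by positivity) (hw0 _ (hSB p p.2)).le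
        · exact (hw0 _ (hSB p p.2)).le
        · exact (div_mul_cancel₀ _ (hw0 _ (hSB p p.2)).ne').ge
      have h5 : ∑ p : S, w (p : ℤ × ℤ).1 ≤ (∑ i ∈ B, w i) * A.card := by
        rw [Finset.sum_coe_sort S (fun p => w p.1)]
        calc _ ≤ ∑ p ∈ B ×ˢ A, w p.1 :=
              Finset.sum_le_sum_of_subset_of_nonneg (Finset.filter_subset _ _) fun p hp _ =>
                (hw0 _ (Finset.mem_product.1 hp).1).le
          _ = _ := by
              rw [Finset.sum_product, Finset.sum_mul]
              refine Finset.sum_congr rfl fun i _ => ?_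
              simp only [Finset.sum_const, nsmul_eq_mul, mul_comm]
      have h6 : 0 ≤ ∑ p : S, w (p : ℤ × ℤ).1 :=
        Finset.sum_nonneg fun p _ => (hw0 _ (hSB p p.2)).le
      calc _ ≤ ((∑ p : S, ‖c p‖) * D) ^ 2 := by gcongr
        _ = (∑ p : S, ‖c p‖) ^ 2 * D ^ 2 := by ring
        _ ≤ ((∑ p : S, ‖c p‖ ^ 2 / w (p : ℤ × ℤ).1) * ∑ p : S, w (p : ℤ × ℤ).1) * D ^ 2 := by gcongr
        _ ≤ (‖u‖ ^ 2 / l * ((∑ i ∈ B, w i) * A.card)) * D ^ 2 := by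
            refine mul_le_mul_of_nonneg_right (mul_le_mul hcs h5 h6 (by positivity)) (by positivity)
        _ = _ := by ring

end SechFamily

end HankelEig

namespace HankelEig

lemma cF_le_pi (x : ℝ) : cF x ≤ Real.pi := by
  unfold cF
  exact div_le_self Real.pi_pos.le (Real.one_le_cosh _)

lemma wl_le {α T θ κp κm : ℝ} (hα : 0 < α) (hT : 1 ≤ T) (hθ : 0 < θ) (hθ1 : θ ≤ 1) (i : ℤ) :
    wl α T θ κp κm i ≤ |κp| + |κm| := by
  have h1 : sd κp κm i ≤ |κp| + |κm| := by
    cases i with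
    | ofNat m => exact (le_abs_self κp).trans (le_add_of_nonneg_right (abs_nonneg _))
    | negSucc m => exact (le_abs_self κm).trans (le_add_of_nonneg_left (abs_nonneg _))
  have h2 : (1 : ℝ) ≤ 2 * (((mI i : ℝ) + 1) * T) := by
    have : (0 : ℝ) ≤ mI i := Nat.cast_nonneg _
    nlinarith
  have h3 := Real.rpow_le_one_of_one_le_of_nonpos h2 (by linarith : -α ≤ 0)
  have h4 : 0 ≤ (2 * (((mI i : ℝ) + 1) * T)) ^ (-α) := Real.rpow_nonneg (by linarith) _
  have h5 : 0 ≤ |κp| + |κm| := by positivity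
  unfold wl
  calc θ * sd κp κm i * (2 * (((mI i : ℝ) + 1) * T)) ^ (-α)
      ≤ θ * (|κp| + |κm|) * (2 * (((mI i : ℝ) + 1) * T)) ^ (-α) := by gcongr
    _ ≤ 1 * (|κp| + |κm|) * 1 := by gcongr
    _ = _ := by ring

lemma card_blk_le {M T : ℝ} {n a : ℕ} (hM : 0 < M) (hT : 0 < T) :
    ((blk a ⌈M * n / T⌉₊).card : ℝ) ≤ 2 * (M * n / T + 1) := by
  have h1 : ((blk a ⌈M * n / T⌉₊).card : ℝ) ≤ 2 * ⌈M * n / T⌉₊ := by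
    have : (blk a ⌈M * n / T⌉₊).card ≤ 2 * ⌈M * n / T⌉₊ := by
      rw [card_blk]
      omega
    exact_mod_cast this
  have h2 : (⌈M * n / T⌉₊ : ℝ) < M * n / T + 1 := Nat.ceil_lt_add_one (by positivity)
  linarith

lemma tendsto_rpow_mul_exp_nat (p : ℝ) {ε : ℝ} (hε : 0 < ε) :
    Tendsto (fun n : ℕ => (n : ℝ) ^ p * Real.exp (-(ε * n))) atTop (nhds 0) := by
  have := (tendsto_rpow_mul_exp_neg_mul_atTop_nhds_zero p ε hε).comp
    (tendsto_natCast_atTop_atTop (R := ℝ))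
  simpa [Function.comp_def] using this

variable {E : Type*} [NormedAddCommGroup E] [InnerProductSpace ℂ E] [CompleteSpace E]

namespace SechFamily

variable {kv : ℝ → E} (hk : SechFamily kv)
include hk

lemma exists_subspace_explicit {α κp κm μ η θ ε M X T : ℝ} {n : ℕ} (hα : 0 < α)
    (hμ : 0 < μ) (hη : 0 < η) (hη1 : η < 1) (hθ : 0 < θ) (hθ1 : θ ≤ 1) (hε : 0 < ε) (hX : 0 < X)
    (hT : 1 ≤ T) (hn : 0 < n) (hM : 0 < M)
    (hMκ : ((max κp 0 + max κm 0) * Real.pi / μ) ^ (1 / α) ≤ M) :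
    ∃ V : Submodule ℂ E, FiniteDimensional ℂ V ∧
      n * ((((1 - η) * θ) ^ (1 / α) * ((1 / μ) ^ (1 / α) *
        (max κp 0 ^ (1 / α) + max κm 0 ^ (1 / α)))) * (∫ x in Ioc 0 X, cF x ^ (1 / α)) -
        2 * (2 * X + 1) * ε - ((((1 - η) * θ) ^ (1 / α) * ((1 / μ) ^ (1 / α) *
        (max κp 0 ^ (1 / α) + max κm 0 ^ (1 / α)))) * Real.pi ^ (1 / α) / 2 +
          128 * M * (2 * X + 1) ^ 2 / (η * cF X) ^ 2) / T) -
        (4 * (2 * X + 1) * T + 128 * (2 * X + 1) ^ 2 / (η * cF X) ^ 2) ≤ Module.finrank ℂ V ∧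
      ∀ u ∈ V, μ * (n : ℝ) ^ (-α) * ‖u‖ ^ 2 ≤
        ∑ i ∈ (blk ⌈ε * n / T⌉₊ ⌈M * n / T⌉₊).filter fun i => 0 < sd κp κm i, wl α T θ κp κm i *
          ∫ s in (lft T i)..(lft T i + T), ‖inner ℂ (kv s) u‖ ^ 2 ∧
        ∀ t, Inact κp κm t → ‖inner ℂ (kv t) u‖ ^ 2 ≤
          (32 * (M + 1) * (|κp| + |κm|) * ((2 * X + 1) * T) / μ) *
            ((n : ℝ) ^ (1 + α) * Real.exp (-(2 * ε * n))) * (Real.exp (-(2 * |t|)) * ‖u‖ ^ 2) := by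
  have hT0 : 0 < T := by linarith
  have hn' : (0 : ℝ) < n := by exact_mod_cast hn
  set K := ⌊X * T⌋₊ with hK
  set a := ⌈ε * n / T⌉₊ with ha
  set b := ⌈M * n / T⌉₊ with hb
  set A := Finset.Icc (-(K : ℤ)) K with hA
  have hc₀ : 0 < cF X := cF_pos X
  have hKle : (K : ℝ) ≤ X * T := Nat.floor_le (by positivity)
  have hKge : X * T ≤ K + 1 := (Nat.lt_floor_add_one _).le
  have ha0 : 0 < a := Nat.ceil_pos.2 (by positivity)
  have haε : ε * n ≤ a * T := by
    rw [← div_le_iff₀ hT0]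
    exact Nat.le_ceil _
  have hAc : (A.card : ℝ) = 2 * K + 1 := by
    have : A.card = 2 * K + 1 := by
      rw [hA, Int.card_Icc]
      omega
    rw [this]
    push_cast
    ring
  have hAc' : (A.card : ℝ) ≤ (2 * X + 1) * T := by
    rw [hAc]
    nlinarith
  have hBc : ((blk a b).card : ℝ) ≤ 2 * (M * n / T + 1) := card_blk_le hM hT0
  have hδ : ∀ k ∈ A, η * cF X ≤ η * cF (k / T) := by
    intro k hk'
    have habs : |(k : ℝ)| ≤ K := by
      rw [abs_le]
      exact ⟨by exact_mod_cast (Finset.mem_Icc.1 hk').1, by exact_mod_cast (Finset.mem_Icc.1 hk').2⟩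
    have h1 : cF (k / T) = cF (|(k : ℝ)| / T) := by
      rcases abs_choice (k : ℝ) with h | h
      · rw [h]
      · rw [h, neg_div, cF_neg]
    rw [h1]
    refine mul_le_mul_of_nonneg_left (antitoneOn_cF (div_nonneg (abs_nonneg _) hT0.le) hX.le ?_) hη.le
    rw [div_le_iff₀ hT0]
    exact habs.trans hKle
  have h1η : 0 < 1 - η := by linarith
  have hbκ : ∀ κ : ℝ, max κ 0 ≤ max κp 0 + max κm 0 → ∀ k : ℤ,
      n / (2 * T) * ((1 - η) * θ * max κ 0 * cF (k / T) / μ) ^ (1 / α) ≤ b := by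
    intro κ hκ k
    have h0 : 0 ≤ max κ 0 := le_max_right _ _
    have h1 : (1 - η) * θ * max κ 0 * cF (k / T) / μ ≤ (max κp 0 + max κm 0) * Real.pi / μ := by
      have h2 : (1 - η) * θ ≤ 1 := mul_le_one₀ (by linarith) hθ.le hθ1
      have := cF_le_pi (k / T)
      have := (cF_pos (k / T)).le
      calc _ ≤ 1 * (max κp 0 + max κm 0) * Real.pi / μ := by gcongr
        _ = _ := by ring
    have h3 : ((1 - η) * θ * max κ 0 * cF (k / T) / μ) ^ (1 / α) ≤ M := by
      have := (cF_pos (k / T)).le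
      exact (Real.rpow_le_rpow (by positivity) h1 (by positivity)).trans hMκ
    calc _ ≤ n / (2 * T) * M := by gcongr
      _ ≤ n / T * M := by
          gcongr
          linarith
      _ = M * n / T := by ring
      _ ≤ b := Nat.le_ceil _
  obtain ⟨V, hV, hdim, hu⟩ := hk.exists_subspace_blocks (α := α) (κp := κp) (κm := κm) (b := b)
    (l := μ * (n : ℝ) ^ (-α)) (δ := η * cF X) A hθ hT (by positivity) (by positivity) ha0
  refine ⟨V, hV, ?_, fun u huV => ⟨(hu u huV).1, fun t ht => ((hu u huV).2 t ht).trans ?_⟩⟩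
  · refine le_trans ?_ hdim
    have h1 := le_sum_card_filter (α := α) (μ := μ) (δ := η * cF X) (n := n) (a := a)
      hα hμ hη1 hθ hδ hT0 hn hKge
      (hbκ κp (le_add_of_nonneg_right (le_max_right _ _)))
      (hbκ κm (le_add_of_nonneg_left (le_max_right _ _)))
    have h2 : ((blk a b).card * A.card * (A.card * (64 / T ^ 2)) / (η * cF X) ^ 2 : ℝ) ≤
        2 * (M * n / T + 1) * ((2 * X + 1) * T) * ((2 * X + 1) * T * (64 / T ^ 2)) /
          (η * cF X) ^ 2 := by
      gcongr
    have h3 : 2 * (2 * (K : ℝ) + 1) * (1 + a) ≤ 2 * ((2 * X + 1) * T) * (1 + (ε * n / T + 1)) := by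
      have h5 : (a : ℝ) ≤ ε * n / T + 1 := (Nat.ceil_lt_add_one (by positivity)).le
      rw [← hAc]
      gcongr
    refine le_trans (le_of_eq ?_) (sub_le_sub (sub_le_sub le_rfl h3 |>.trans h1) h2)
    field_simp
    ring
  · have h1 : ∑ i ∈ (blk a b).filter fun i => 0 < sd κp κm i, wl α T θ κp κm i ≤
        2 * (M + 1) * n * (|κp| + |κm|) := by
      have hn1 : (1 : ℝ) ≤ n := by exact_mod_cast hn
      have h5 : M * n / T ≤ M * n := div_le_self (by positivity) hT
      calc _ ≤ ∑ i ∈ (blk a b).filter fun i => 0 < sd κp κm i, (|κp| + |κm|) :=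
            Finset.sum_le_sum fun i _ => wl_le hα hT hθ hθ1 i
        _ = ((blk a b).filter fun i => 0 < sd κp κm i).card * (|κp| + |κm|) := by
            rw [Finset.sum_const, nsmul_eq_mul]
        _ ≤ (blk a b).card * (|κp| + |κm|) := by
            gcongr
            exact Finset.filter_subset _ _
        _ ≤ _ := by
            refine mul_le_mul_of_nonneg_right ?_ (by positivity)
            linarith
    have h2 : (4 * (Real.exp (-|t|) * Real.exp (-(a * T)))) ^ 2 ≤
        16 * (Real.exp (-(2 * |t|)) * Real.exp (-(2 * ε * n))) := by
      have : (4 * (Real.exp (-|t|) * Real.exp (-(a * T)))) ^ 2 =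
          16 * (Real.exp (-(2 * |t|)) * Real.exp (-(2 * (a * T)))) := by
        rw [mul_pow, mul_pow, ← Real.exp_nat_mul, ← Real.exp_nat_mul]
        congr 3
        · norm_num
        · push_cast
          ring_nf
        · push_cast
          ring_nf
      rw [this]
      have h5 : Real.exp (-(2 * (a * T))) ≤ Real.exp (-(2 * ε * n)) :=
        Real.exp_le_exp.2 (by linarith)
      gcongr
    have h3 : ‖u‖ ^ 2 / (μ * (n : ℝ) ^ (-α)) = (n : ℝ) ^ α * ‖u‖ ^ 2 / μ := by
      rw [Real.rpow_neg hn'.le]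
      field_simp
    rw [h3]
    calc _ ≤ 2 * (M + 1) * n * (|κp| + |κm|) * ((2 * X + 1) * T) *
          (16 * (Real.exp (-(2 * |t|)) * Real.exp (-(2 * ε * n)))) * ((n : ℝ) ^ α * ‖u‖ ^ 2 / μ) := by
          gcongr
      _ = _ := by
          rw [Real.rpow_add hn', Real.rpow_one]
          ring

lemma exists_subspace_main {α κp κm μ y : ℝ} (hα : 0 < α) (hμ : 0 < μ)
    (hy : y < cnt α (max κp 0) (max κm 0) μ) :
    ∃ θ ε M T : ℝ, 0 < θ ∧ θ < 1 ∧ 0 < ε ∧ 0 < M ∧ 1 ≤ T ∧ ∀ ν > 0, ∀ᶠ n : ℕ in atTop,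
    ∃ V : Submodule ℂ E, FiniteDimensional ℂ V ∧ y * n ≤ Module.finrank ℂ V ∧
      ∀ u ∈ V, μ * (n : ℝ) ^ (-α) * ‖u‖ ^ 2 ≤
        ∑ i ∈ (blk ⌈ε * n / T⌉₊ ⌈M * n / T⌉₊).filter fun i => 0 < sd κp κm i, wl α T θ κp κm i *
          ∫ s in (lft T i)..(lft T i + T), ‖inner ℂ (kv s) u‖ ^ 2 ∧
        ∀ t, Inact κp κm t → ‖inner ℂ (kv t) u‖ ^ 2 ≤
          ν * (n : ℝ) ^ (-α) * (Real.exp (-(2 * |t|)) * ‖u‖ ^ 2) := by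
  set c₀ := (1 / μ) ^ (1 / α) * (max κp 0 ^ (1 / α) + max κm 0 ^ (1 / α)) with hc₀
  set γ := (cnt α (max κp 0) (max κm 0) μ - y) / 6 with hγ
  have hγ0 : 0 < γ := by
    rw [hγ]
    linarith
  have hcnt : cnt α (max κp 0) (max κm 0) μ = c₀ * cInt α := rfl
  have h1 : ∀ᶠ η : ℝ in nhdsWithin 0 (Ioi 0), y + 5 * γ < ((1 - η) * (1 - η)) ^ (1 / α) * (c₀ * cInt α) := by
    have : Tendsto (fun η : ℝ => ((1 - η) * (1 - η)) ^ (1 / α) * (c₀ * cInt α)) (nhdsWithin 0 (Ioi 0))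
        (nhds (((1 - 0) * (1 - 0)) ^ (1 / α) * (c₀ * cInt α))) := by
      refine Tendsto.mul_const _ (Tendsto.mono_left ?_ nhdsWithin_le_nhds)
      have h : Continuous fun η : ℝ => (1 - η) * (1 - η) := by fun_prop
      exact (h.tendsto 0).rpow_const (Or.inl (by norm_num))
    rw [sub_zero, mul_one, Real.one_rpow, one_mul] at this
    exact this.eventually_const_lt (by rw [← hcnt, hγ]; linarith)
  obtain ⟨η, ⟨hη1, hη⟩, hη2⟩ := ((h1.and self_mem_nhdsWithin).and
    (eventually_nhdsWithin_of_eventually_nhds (eventually_lt_nhds (zero_lt_one' ℝ)))).exists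
  have hη : 0 < η := hη
  set c₁ := ((1 - η) * (1 - η)) ^ (1 / α) * c₀ with hc₁
  have h2 : ∀ᶠ X : ℝ in atTop, y + 4 * γ < c₁ * ∫ x in Ioc 0 X, cF x ^ (1 / α) := by
    have h3 : Tendsto (fun X : ℝ => ∫ x in Ioc 0 X, cF x ^ (1 / α)) atTop (nhds (cInt α)) := by
      have := intervalIntegral_tendsto_integral_Ioi 0
        (integrableOn_cF_rpow (a := 1 / α) (by positivity)) tendsto_id
      refine this.congr' ?_
      filter_upwards [eventually_ge_atTop 0] with X hX
      exact intervalIntegral.integral_of_le hX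
    refine (h3.const_mul c₁).eventually_const_lt ?_
    have : c₁ * cInt α = ((1 - η) * (1 - η)) ^ (1 / α) * (c₀ * cInt α) := by
      rw [hc₁]
      ring
    linarith
  obtain ⟨X, hX1, hX⟩ := (h2.and (eventually_gt_atTop 0)).exists
  set ε := γ / (2 * (2 * X + 1)) with hε
  have hε0 : 0 < ε := by positivity
  have hεγ : 2 * (2 * X + 1) * ε = γ := by
    rw [hε]
    field_simp
  set M := ((max κp 0 + max κm 0) * Real.pi / μ) ^ (1 / α) + 1 with hM
  have hM0 : 0 < M := by positivity
  obtain ⟨T, hT1, hT⟩ := (((tendsto_const_nhds (x := c₁ * Real.pi ^ (1 / α) / 2 +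
          128 * M * (2 * X + 1) ^ 2 / (η * cF X) ^ 2)).div_atTop
          tendsto_id).eventually_lt_const hγ0 |>.and (eventually_ge_atTop (1 : ℝ))).exists
  refine ⟨1 - η, ε, M, T, by linarith, by linarith, hε0, hM0, hT, fun ν hν => ?_⟩
  set C := 4 * (2 * X + 1) * T + 128 * (2 * X + 1) ^ 2 / (η * cF X) ^ 2 with hC
  set D := 32 * (M + 1) * (|κp| + |κm|) * ((2 * X + 1) * T) / μ with hD
  have h4 : ∀ᶠ n : ℕ in atTop, D * ((n : ℝ) ^ (1 + α + α) * Real.exp (-(2 * ε * n))) < ν := by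
    have := (tendsto_rpow_mul_exp_nat (1 + α + α) (ε := 2 * ε) (by positivity)).const_mul D
    rw [mul_zero] at this
    exact this.eventually_lt_const hν
  filter_upwards [eventually_gt_atTop 0, h4,
    (tendsto_natCast_atTop_atTop (R := ℝ)).eventually_ge_atTop (C / γ)] with n hn hnD hnC
  have hn' : (0 : ℝ) < n := by exact_mod_cast hn
  obtain ⟨V, hV, hdim, hu⟩ := hk.exists_subspace_explicit (κp := κp) (κm := κm) hα hμ hη hη2
    (by linarith : 0 < 1 - η) (by linarith) hε0 hX hT hn hM0 (by rw [hM]; linarith)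
  refine ⟨V, hV, le_trans ?_ hdim, fun u huV => ⟨(hu u huV).1, fun t ht =>
    ((hu u huV).2 t ht).trans ?_⟩⟩
  · rw [← hc₀, ← hc₁, ← hC, hεγ]
    rw [div_le_iff₀ hγ0] at hnC
    simp only [id] at hT1
    have : (n : ℝ) * (y + 2 * γ) ≤ n * (c₁ * (∫ x in Ioc 0 X, cF x ^ (1 / α)) - γ -
        (c₁ * Real.pi ^ (1 / α) / 2 + 128 * M * (2 * X + 1) ^ 2 / (η * cF X) ^ 2) / T) := by
      gcongr
      linarith
    have h6 : 0 < n * γ := by positivity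
    linarith
  · refine mul_le_mul_of_nonneg_right ?_ (by positivity)
    have h5 : D * ((n : ℝ) ^ (1 + α) * Real.exp (-(2 * ε * n))) =
        D * ((n : ℝ) ^ (1 + α + α) * Real.exp (-(2 * ε * n))) * (n : ℝ) ^ (-α) := by
      rw [Real.rpow_add hn' (1 + α) α, Real.rpow_neg hn'.le]
      field_simp
    rw [← hD, h5]
    gcongr

end SechFamily

end HankelEig

namespace HankelEig

/-- Weights on the half-line `[1, ∞)` behaving like `(2 s) ^ (-α)`. -/
structure ModelWeight (α C : ℝ) (ρ : ℝ → ℝ) : Prop where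
  measurable : Measurable ρ
  eq_zero : ∀ s < 1, ρ s = 0
  nonneg : ∀ s, 0 ≤ ρ s
  le : ∀ s, 1 ≤ s → ρ s ≤ C * s ^ (-α)
  tendsto : Tendsto (fun s => ρ s * (2 * s) ^ α) atTop (nhds 1)

/-- The index of the block containing `s`. -/
def bi (T s : ℝ) : ℤ := ⌈s / T⌉ - 1

lemma mem_block_iff {T : ℝ} (hT : 0 < T) (s : ℝ) (i : ℤ) :
    s ∈ Ioc (lft T i) (lft T i + T) ↔ bi T s = i := by
  have : bi T s = i ↔ ⌈s / T⌉ = i + 1 := by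
    unfold bi
    omega
  rw [this, Int.ceil_eq_iff, mem_Ioc, lft, lt_div_iff₀ hT, div_le_iff₀ hT]
  push_cast
  rw [add_sub_cancel_right, add_mul, one_mul]

lemma bi_spec {T : ℝ} (hT : 0 < T) (s : ℝ) :
    mI (bi T s) * T ≤ |s| ∧ |s| ≤ (mI (bi T s) + 1) * T ∧
      ∀ κp κm, sd κp κm (bi T s) = if 0 < s then κp else κm := by
  obtain ⟨h1, h2⟩ := (mem_block_iff hT s (bi T s)).2 rfl
  unfold lft at h1 h2
  generalize bi T s = i at h1 h2
  cases i with
  | ofNat m =>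
    have hm : ((Int.ofNat m : ℤ) : ℝ) = m := rfl
    rw [hm] at h1 h2
    have hs : 0 < s := lt_of_le_of_lt (by positivity) h1
    rw [abs_of_pos hs]
    exact ⟨h1.le, by simp only [mI]; linarith, fun _ _ => by rw [if_pos hs]; rfl⟩
  | negSucc m =>
    have hm : ((Int.negSucc m : ℤ) : ℝ) = -(m + 1) := by
      push_cast
      ring
    rw [hm] at h1 h2
    have hs : s ≤ 0 := by
      have : (0 : ℝ) ≤ m * T := by positivity
      linarith
    rw [abs_of_nonpos hs]
    refine ⟨by simp only [mI]; linarith, by simp only [mI]; linarith, fun _ _ => ?_⟩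
    rw [if_neg (not_lt.2 hs)]
    rfl

lemma measurable_bi (T : ℝ) : Measurable (bi T) := by
  unfold bi
  exact (Int.measurable_ceil.comp (measurable_id.div_const T)).sub_const 1

lemma sum_block_integral {T : ℝ} (hT : 0 < T) (B : Finset ℤ) (w : ℤ → ℝ) {f : ℝ → ℝ}
    (hf : Integrable f) :
    ∑ i ∈ B, w i * ∫ s in (lft T i)..(lft T i + T), f s =
      ∫ s, (if bi T s ∈ B then w (bi T s) else 0) * f s := by
  have h1 : ∀ i, w i * ∫ s in (lft T i)..(lft T i + T), f s =
      ∫ s, (Ioc (lft T i) (lft T i + T)).indicator (fun s => w i * f s) s := by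
    intro i
    rw [integral_indicator measurableSet_Ioc, intervalIntegral.integral_of_le (by linarith),
      integral_const_mul]
  simp only [h1]
  rw [← integral_finsetSum]
  · refine integral_congr_ae (Eventually.of_forall fun s => ?_)
    simp only [indicator_apply, mem_block_iff hT s]
    rw [Finset.sum_ite_eq]
    split_ifs <;> simp
  · intro i _
    exact (hf.const_mul (w i)).indicator measurableSet_Ioc

/-- The symbol of the model form. -/
def sg (ρ : ℝ → ℝ) (κp κm s : ℝ) : ℝ := κp * ρ s + κm * ρ (-s)

namespace ModelWeight

variable {α C : ℝ} {ρ : ℝ → ℝ} (hρ : ModelWeight α C ρ)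
include hρ

lemma sg_eq {T : ℝ} (hT : 0 < T) (κp κm s : ℝ) :
    sg ρ κp κm s = sd κp κm (bi T s) * ρ |s| := by
  rw [(bi_spec hT s).2.2, sg]
  split_ifs with h
  · rw [abs_of_pos h, hρ.eq_zero (-s) (by linarith), mul_zero, add_zero]
  · rw [abs_of_nonpos (not_lt.1 h), hρ.eq_zero s (by linarith), mul_zero, zero_add]

lemma C_nonneg : 0 ≤ C := by
  have h1 := (hρ.nonneg 1).trans (hρ.le 1 le_rfl)
  simpa using h1

lemma le_const (hα : 0 < α) (s : ℝ) : ρ s ≤ C := by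
  rcases lt_or_ge s 1 with h | h
  · rw [hρ.eq_zero s h]
    exact hρ.C_nonneg
  · calc ρ s ≤ C * s ^ (-α) := hρ.le s h
      _ ≤ C * 1 := by
          have := hρ.C_nonneg
          gcongr
          exact Real.rpow_le_one_of_one_le_of_nonpos h (by linarith)
      _ = C := mul_one C

lemma measurable_sg (κp κm : ℝ) : Measurable (sg ρ κp κm) :=
  (hρ.measurable.const_mul κp).add ((hρ.measurable.comp measurable_neg).const_mul κm)

lemma abs_sg_le (hα : 0 < α) (κp κm s : ℝ) : |sg ρ κp κm s| ≤ (|κp| + |κm|) * C := by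
  unfold sg
  refine (abs_add_le _ _).trans ?_
  rw [abs_mul, abs_mul, abs_of_nonneg (hρ.nonneg s), abs_of_nonneg (hρ.nonneg (-s)), add_mul]
  have h1 := hρ.le_const hα s
  have h2 := hρ.le_const hα (-s)
  gcongr

lemma integrable_sg_mul (hα : 0 < α) (κp κm : ℝ) {f : ℝ → ℝ} (hf : Integrable f) :
    Integrable fun s => sg ρ κp κm s * f s :=
  hf.bdd_mul (c := (|κp| + |κm|) * C) (hρ.measurable_sg κp κm).aestronglyMeasurable
    (Eventually.of_forall fun s => hρ.abs_sg_le hα κp κm s)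

lemma eventually_le {δ : ℝ} (hδ : 0 < δ) : ∀ᶠ s in atTop, ρ s ≤ (1 + δ) * (2 * s) ^ (-α) := by
  filter_upwards [hρ.tendsto.eventually_lt_const (by linarith : (1 : ℝ) < 1 + δ),
    eventually_gt_atTop 0] with s hs hs0
  rw [Real.rpow_neg (by positivity), ← div_eq_mul_inv, le_div_iff₀ (by positivity)]
  exact hs.le

lemma eventually_ge {θ : ℝ} (hθ : θ < 1) : ∀ᶠ s in atTop, θ * (2 * s) ^ (-α) ≤ ρ s := by
  filter_upwards [hρ.tendsto.eventually_const_lt hθ,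
    eventually_gt_atTop 0] with s hs hs0
  rw [Real.rpow_neg (by positivity), ← div_eq_mul_inv, div_le_iff₀ (by positivity)]
  exact hs.le

end ModelWeight

variable {E : Type*} [NormedAddCommGroup E] [InnerProductSpace ℂ E] [CompleteSpace E]

omit [CompleteSpace E] in
lemma UB.const_mul {q : E → ℝ} {x l c : ℝ} (h : UB q x l) (hc : 0 ≤ c) :
    UB (fun u => c * q u) x (c * l) := by
  obtain ⟨W, hW, hd, hu⟩ := h
  exact ⟨W, hW, hd, fun u hw => by
    rw [mul_assoc]
    exact mul_le_mul_of_nonneg_left (hu u hw) hc⟩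

/-- The model quadratic form. -/
def mq (kv : ℝ → E) (ρ : ℝ → ℝ) (κp κm : ℝ) (u : E) : ℝ :=
  ∫ s, sg ρ κp κm s * ‖inner ℂ (kv s) u‖ ^ 2

/-- The low-energy part of the model form is negligible. -/
def LowUB (α : ℝ) (kv : ℝ → E) (ρ : ℝ → ℝ) : Prop :=
  ∀ γ > 0, ∀ l > 0, ∃ ε > 0, ∀ᶠ n : ℕ in atTop,
    UB (fun u => ∫ s : ℝ, (if |s| ≤ 2 * ε * n then ρ s + ρ (-s) else 0) * ‖inner ℂ (kv s) u‖ ^ 2)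
      (γ * n) (l * (n : ℝ) ^ (-α))

lemma tendsto_cnt_perturb {α κp κm μ : ℝ} (hα : 0 < α) (hμ : 0 < μ) (c : ℝ) :
    Tendsto (fun t : ℝ => cnt α ((max κp 0 + t) * (1 + t)) ((max κm 0 + t) * (1 + t)) (μ + c * t))
      (nhdsWithin 0 (Ioi 0)) (nhds (cnt α (max κp 0) (max κm 0) μ)) := by
  have h0 : Tendsto (fun t : ℝ => cnt α ((max κp 0 + t) * (1 + t)) ((max κm 0 + t) * (1 + t))
      (μ + c * t)) (nhds 0) (nhds (cnt α ((max κp 0 + 0) * (1 + 0)) ((max κm 0 + 0) * (1 + 0))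
      (μ + c * 0))) := by
    unfold cnt
    have hp : 0 ≤ 1 / α := by positivity
    have h1 : ∀ κ : ℝ, Tendsto (fun t : ℝ => ((max κ 0 + t) * (1 + t)) ^ (1 / α)) (nhds 0)
        (nhds (((max κ 0 + 0) * (1 + 0)) ^ (1 / α))) := by
      intro κ
      have h : Continuous fun t : ℝ => (max κ 0 + t) * (1 + t) := by fun_prop
      exact (h.tendsto 0).rpow_const (Or.inr hp)
    have h2 : Tendsto (fun t : ℝ => (1 / (μ + c * t)) ^ (1 / α)) (nhds 0)
        (nhds ((1 / (μ + c * 0)) ^ (1 / α))) := by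
      have h : Continuous fun t : ℝ => μ + c * t := by fun_prop
      exact (tendsto_const_nhds.div (h.tendsto 0) (by simpa using hμ.ne')).rpow_const (Or.inr hp)
    exact (h2.mul ((h1 κp).add (h1 κm))).mul_const _
  simp only [add_zero, mul_one, mul_zero] at h0
  exact h0.mono_left nhdsWithin_le_nhds

namespace SechFamily

variable {kv : ℝ → E} (hk : SechFamily kv)
include hk

lemma UB_mq {α C : ℝ} {ρ : ℝ → ℝ} (hα : 0 < α) (hρ : ModelWeight α C ρ) (hlow : LowUB α kv ρ)
    {κp κm μ x : ℝ} (hμ : 0 < μ) (hx : cnt α (max κp 0) (max κm 0) μ < x) :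
    ∀ᶠ n : ℕ in atTop, UB (mq kv ρ κp κm) (x * n) (μ * (n : ℝ) ^ (-α)) := by
  obtain ⟨t, ⟨ht1, ht2⟩, ht⟩ := ((((tendsto_cnt_perturb (κp := κp) (κm := κm) hα hμ (-3)).eventually_lt_const
    hx).and (eventually_nhdsWithin_of_eventually_nhds (eventually_lt_nhds
    (by positivity : 0 < μ / 3)))).and self_mem_nhdsWithin).exists
  have ht : 0 < t := ht
  have hC := hρ.C_nonneg
  set κp' := max κp 0 + t with hκp'
  set κm' := max κm 0 + t with hκm'
  have hκp0 : 0 < κp' := by positivity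
  have hκm0 : 0 < κm' := by positivity
  set γ := (x - cnt α (κp' * (1 + t)) (κm' * (1 + t)) (μ + -3 * t)) / 2 with hγ
  have hγ0 : 0 < γ := by
    rw [hγ]
    linarith
  set κM := κp' + κm' with hκM
  have hκM0 : 0 < κM := by positivity
  obtain ⟨ε, hε, hlow⟩ := hlow γ hγ0 (t / κM) (by positivity)
  obtain ⟨M, hM1, hM⟩ : ∃ M : ℝ, κM * C * M ^ (-α) * 4 < t ∧ 0 < M := by
    have h1 : Tendsto (fun M : ℝ => κM * C * M ^ (-α) * 4) atTop (nhds (κM * C * 0 * 4)) :=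
      ((tendsto_rpow_neg_atTop hα).const_mul _).mul_const _
    rw [mul_zero, zero_mul] at h1
    exact ((h1.eventually_lt_const ht).and (eventually_gt_atTop 0)).exists
  obtain ⟨T, hT, hmain⟩ := hk.UB_main (μ := μ + -3 * t) (μ₁ := t) (ε := ε) (M := M) (γ := γ) hα
    (mul_pos hκp0 (by linarith : 0 < 1 + t)) (mul_pos hκm0 (by linarith : 0 < 1 + t))
    (by linarith) ht hε hM hγ0
  have hT0 : 0 < T := by linarith
  obtain ⟨S₀, hS₀⟩ := eventually_atTop.1 (hρ.eventually_le ht)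
  have hnat := tendsto_natCast_atTop_atTop (R := ℝ)
  filter_upwards [hlow, hmain, eventually_gt_atTop 0, hnat.eventually_ge_atTop (T / ε),
    hnat.eventually_ge_atTop ((|S₀| + 1) / ε)] with n h1 h2 hn hn1 hn2
  have hn' : (0 : ℝ) < n := by exact_mod_cast hn
  rw [div_le_iff₀ hε] at hn1 hn2
  set a := ⌈ε * n / T⌉₊ with ha
  set b := ⌈M * n / T⌉₊ with hb
  have haT : a * T ≤ 2 * ε * n := by
    have h3 : (a : ℝ) ≤ ε * n / T + 1 := (Nat.ceil_lt_add_one (by positivity)).le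
    calc (a : ℝ) * T ≤ (ε * n / T + 1) * T := by gcongr
      _ = ε * n + T := by field_simp
      _ ≤ _ := by linarith
  have ha0 : (0 : ℝ) < a := by exact_mod_cast Nat.ceil_pos.2 (by positivity)
  have hbT : M * n ≤ b * T := by
    rw [← div_le_iff₀ hT0]
    exact Nat.le_ceil _
  set w := wt α T (κp' * (1 + t)) (κm' * (1 + t)) with hw
  have hw0 : ∀ i, 0 ≤ w i := fun i => mul_nonneg (sd_pos (mul_pos hκp0 (by linarith))
    (mul_pos hκm0 (by linarith)) i).le (Real.rpow_nonneg (by positivity) _)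
  have hpt : ∀ s, sg ρ κp κm s ≤ (if bi T s ∈ blk a b then w (bi T s) else 0) +
      κM * (if |s| ≤ 2 * ε * n then ρ s + ρ (-s) else 0) + κM * C * (M * n) ^ (-α) := by
    intro s
    have hp0 : 0 ≤ (if bi T s ∈ blk a b then w (bi T s) else 0) := by
      split_ifs
      exacts [hw0 _, le_rfl]
    have hp1 : 0 ≤ κM * C * (M * n) ^ (-α) := by positivity
    have hr0 := hρ.nonneg s
    have hr1 := hρ.nonneg (-s)
    by_cases hs : |s| ≤ 2 * ε * n
    · rw [if_pos hs]
      have h3 : sg ρ κp κm s ≤ κM * (ρ s + ρ (-s)) := by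
        have h4 : κp ≤ κM := by
          have := le_max_left κp 0
          linarith
        have h5 : κm ≤ κM := by
          have := le_max_left κm 0
          linarith
        rw [sg, mul_add]
        gcongr
      linarith
    · rw [if_neg hs, mul_zero, add_zero]
      push Not at hs
      obtain ⟨hb1, hb2, hb3⟩ := bi_spec hT0 s
      have hs1 : 1 ≤ |s| := by
        have := abs_nonneg S₀
        linarith
      rw [hρ.sg_eq hT0]
      set i := bi T s with hi
      have hsd : sd κp κm i ≤ sd κp' κm' i := by
        rw [hb3, hb3]
        split_ifs
        · exact (le_max_left κp 0).trans (by linarith)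
        · exact (le_max_left κm 0).trans (by linarith)
      have hai : a ≤ mI i := by
        have h3 : (a : ℝ) * T < (mI i + 1) * T := by linarith
        have h4 : (a : ℝ) < mI i + 1 := lt_of_mul_lt_mul_right h3 hT0.le
        have h5 : a < mI i + 1 := by exact_mod_cast h4
        omega
      have hai' : (a : ℝ) ≤ mI i := by exact_mod_cast hai
      by_cases hib : i ∈ blk a b
      · rw [if_pos hib]
        refine le_trans ?_ (le_add_of_nonneg_right hp1)
        have h6 : 0 < 2 * (mI i * T) := by
          have := mul_pos (ha0.trans_le hai') hT0
          positivity
        have h3 : ρ |s| ≤ (1 + t) * (2 * (mI i * T)) ^ (-α) := by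
          refine (hS₀ |s| ?_).trans ?_
          · have := le_abs_self S₀
            linarith
          · refine mul_le_mul_of_nonneg_left ?_ (by linarith)
            exact Real.rpow_le_rpow_of_nonpos h6 (by linarith) (by linarith)
        calc sd κp κm i * ρ |s| ≤ sd κp' κm' i * ρ |s| :=
              mul_le_mul_of_nonneg_right hsd (hρ.nonneg _)
          _ ≤ sd κp' κm' i * ((1 + t) * (2 * (mI i * T)) ^ (-α)) :=
              mul_le_mul_of_nonneg_left h3 (sd_pos hκp0 hκm0 i).le
          _ = w i := by
              rw [hw, wt, hb3, hb3]
              split_ifs <;> ring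
      · rw [if_neg hib, zero_add]
        have h3 : b ≤ mI i := by
          by_contra h
          exact hib (mem_blk.2 ⟨hai, not_le.1 h⟩)
        have h4 : (b : ℝ) ≤ mI i := by exact_mod_cast h3
        have h5 : M * n ≤ |s| := hbT.trans (le_trans (by gcongr) hb1)
        calc sd κp κm i * ρ |s| ≤ sd κp' κm' i * ρ |s| :=
              mul_le_mul_of_nonneg_right hsd (hρ.nonneg _)
          _ ≤ κM * (C * |s| ^ (-α)) :=
              mul_le_mul (sd_le hκp0 hκm0 i) (hρ.le _ hs1) (hρ.nonneg _) hκM0.le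
          _ ≤ κM * (C * (M * n) ^ (-α)) := by
              have := Real.rpow_le_rpow_of_nonpos (by positivity) h5 (by linarith : -α ≤ 0)
              gcongr
          _ = _ := by ring
  have h3 := h2.add (h1.const_mul hκM0.le) |>.add (UB.of_le (E := E)
    (q := fun u => κM * C * (M * n) ^ (-α) * ∫ s, ‖inner ℂ (kv s) u‖ ^ 2)
    (l := κM * C * (M * n) ^ (-α) * 4) (fun u => by
      have := hk.integral_le u
      rw [mul_assoc (κM * C * (M * n) ^ (-α))]
      gcongr))
  refine h3.mono (fun u => ?_) ?_ ?_
  · have hf := hk.integrable u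
    rw [sum_block_integral hT0 _ _ hf, ← integral_const_mul, ← integral_const_mul]
    have hm1 : Measurable fun s => if bi T s ∈ blk a b then w (bi T s) else 0 :=
      (measurable_from_top (f := fun i : ℤ => if i ∈ blk a b then w i else 0)).comp (measurable_bi T)
    have hI1 : Integrable fun s => (if bi T s ∈ blk a b then w (bi T s) else 0) *
        ‖inner ℂ (kv s) u‖ ^ 2 := by
      refine hf.bdd_mul (c := ∑ i ∈ blk a b, w i) hm1.aestronglyMeasurable
        (Eventually.of_forall fun s => ?_)
      split_ifs with h
      · rw [Real.norm_of_nonneg (hw0 _)]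
        exact Finset.single_le_sum (fun i _ => hw0 i) h
      · rw [norm_zero]
        exact Finset.sum_nonneg fun i _ => hw0 i
    have hI2 : Integrable fun s => κM * ((if |s| ≤ 2 * ε * n then ρ s + ρ (-s) else 0) *
        ‖inner ℂ (kv s) u‖ ^ 2) := by
      refine Integrable.const_mul ?_ _
      have h4 : ∀ s, ((if |s| ≤ 2 * ε * n then ρ s + ρ (-s) else 0) * ‖inner ℂ (kv s) u‖ ^ 2) =
          {s : ℝ | |s| ≤ 2 * ε * n}.indicator
            (fun s => sg ρ 1 1 s * ‖inner ℂ (kv s) u‖ ^ 2) s := by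
        intro s
        simp only [indicator_apply, mem_ofPred_eq, sg, one_mul]
        split_ifs <;> simp
      simp only [h4]
      exact (hρ.integrable_sg_mul hα 1 1 hf).indicator
        (measurableSet_le continuous_abs.measurable measurable_const)
    have hI3 : Integrable fun s => κM * C * (M * n) ^ (-α) * ‖inner ℂ (kv s) u‖ ^ 2 :=
      hf.const_mul _
    have hsum := integral_add (hI1.add hI2) hI3
    simp only [Pi.add_apply] at hsum
    rw [← integral_add hI1 hI2, ← hsum]
    refine integral_mono (hρ.integrable_sg_mul hα κp κm hf) ((hI1.add hI2).add hI3) fun s => ?_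
    have := mul_le_mul_of_nonneg_right (hpt s) (by positivity : 0 ≤ ‖inner ℂ (kv s) u‖ ^ 2)
    simp only [Pi.add_apply]
    linarith
  · rw [← hκp', ← hκm'] at *
    have h6 : γ + γ = x - cnt α (κp' * (1 + t)) (κm' * (1 + t)) (μ + -3 * t) := by
      rw [hγ]
      ring
    have : (cnt α (κp' * (1 + t)) (κm' * (1 + t)) (μ + -3 * t) + γ) * (n : ℝ) + γ * n + 0 =
        (cnt α (κp' * (1 + t)) (κm' * (1 + t)) (μ + -3 * t) + (γ + γ)) * n := by ring
    rw [this, h6]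
    exact le_of_eq (by ring)
  · rw [Real.mul_rpow hM.le hn'.le]
    have h6 : κM * (t / κM * (n : ℝ) ^ (-α)) = t * (n : ℝ) ^ (-α) := by
      field_simp
    rw [h6]
    have h7 : κM * C * M ^ (-α) * 4 * (n : ℝ) ^ (-α) ≤ t * (n : ℝ) ^ (-α) := by gcongr
    nlinarith

lemma LB_mq {α C : ℝ} {ρ : ℝ → ℝ} (hα : 0 < α) (hρ : ModelWeight α C ρ)
    {κp κm μ y : ℝ} (hμ : 0 < μ) (hy : y < cnt α (max κp 0) (max κm 0) μ) :
    ∀ᶠ n : ℕ in atTop, LB (mq kv ρ κp κm) (y * n) (μ * (n : ℝ) ^ (-α)) := by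
  obtain ⟨t, ht1, ht⟩ : ∃ t : ℝ, y < cnt α (max κp 0) (max κm 0) (μ + t) ∧ 0 < t := by
    have h1 : Tendsto (fun t : ℝ => cnt α (max κp 0) (max κm 0) (μ + t)) (nhdsWithin 0 (Ioi 0))
        (nhds (cnt α (max κp 0) (max κm 0) (μ + 0))) := by
      refine Tendsto.mono_left ?_ nhdsWithin_le_nhds
      have h : Continuous fun t : ℝ => μ + t := by fun_prop
      exact (((tendsto_const_nhds.div (h.tendsto 0) (by simpa using hμ.ne')).rpow_const
        (Or.inr (by positivity))).mul_const _).mul_const _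
    rw [add_zero] at h1
    exact ((h1.eventually_const_lt hy).and self_mem_nhdsWithin).exists
  have hC := hρ.C_nonneg
  obtain ⟨θ, ε, M, T, hθ, hθ1, hε, hM, hT, hmain⟩ :=
    hk.exists_subspace_main hα (by linarith : 0 < μ + t) ht1
  have hT0 : 0 < T := by linarith
  set D := (|κp| + |κm|) * C with hD
  have hD0 : 0 ≤ D := by positivity
  obtain ⟨S₀, hS₀⟩ := eventually_atTop.1 (hρ.eventually_ge hθ1)
  have hnat := tendsto_natCast_atTop_atTop (R := ℝ)
  filter_upwards [hmain (t / (D + 1)) (by positivity), eventually_gt_atTop 0,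
    hnat.eventually_ge_atTop ((|S₀| + 1) / ε)] with n h1 hn hn2
  obtain ⟨V, hV, hdim, hu⟩ := h1
  have hn' : (0 : ℝ) < n := by exact_mod_cast hn
  rw [div_le_iff₀ hε] at hn2
  refine ⟨V, hV, hdim, fun u huV => ?_⟩
  obtain ⟨h1, h2⟩ := hu u huV
  set a := ⌈ε * n / T⌉₊ with ha
  set b := ⌈M * n / T⌉₊ with hb
  set w := wl α T θ κp κm with hw
  set B := (blk a b).filter fun i => 0 < sd κp κm i with hB
  have haT : ε * n ≤ a * T := by
    rw [← div_le_iff₀ hT0]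
    exact Nat.le_ceil _
  have hpt : ∀ s, (if bi T s ∈ B then w (bi T s) else 0) ≤
      sg ρ κp κm s + {s | Inact κp κm s}.indicator (fun _ => D) s := by
    intro s
    have h3 : 0 ≤ {s | Inact κp κm s}.indicator (fun _ => D) s :=
      indicator_nonneg (fun _ _ => hD0) s
    obtain ⟨hb1, hb2, hb3⟩ := bi_spec hT0 s
    split_ifs with h
    · refine le_trans ?_ (le_add_of_nonneg_right h3)
      rw [hρ.sg_eq hT0]
      set i := bi T s with hi
      obtain ⟨h4, h5⟩ := Finset.mem_filter.1 h
      have h6 : (a : ℝ) ≤ mI i := by exact_mod_cast (mem_blk.1 h4).1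
      have h7 : ε * n ≤ |s| := haT.trans (le_trans (by gcongr) hb1)
      have h8 : 0 < |s| := lt_of_lt_of_le (by positivity) h7
      have h9 : θ * (2 * ((mI i + 1) * T)) ^ (-α) ≤ ρ |s| := by
        refine le_trans ?_ (hS₀ |s| ?_)
        · exact mul_le_mul_of_nonneg_left (Real.rpow_le_rpow_of_nonpos (by positivity)
            (by linarith) (by linarith)) hθ.le
        · have := le_abs_self S₀
          linarith
      calc w i = sd κp κm i * (θ * (2 * ((mI i + 1) * T)) ^ (-α)) := by
            rw [hw, wl]
            ring
        _ ≤ _ := mul_le_mul_of_nonneg_left h9 h5.le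
    · by_cases hs : Inact κp κm s
      · rw [indicator_of_mem (by exact hs)]
        have := neg_abs_le (sg ρ κp κm s)
        have := hρ.abs_sg_le hα κp κm s
        linarith
      · refine add_nonneg ?_ h3
        unfold Inact at hs
        push Not at hs
        rcases lt_trichotomy s 0 with h4 | h4 | h4
        · rw [sg, hρ.eq_zero s (by linarith), mul_zero, zero_add]
          exact mul_nonneg (hs.2 h4).le (hρ.nonneg _)
        · rw [sg, h4, neg_zero, hρ.eq_zero 0 zero_lt_one, mul_zero, mul_zero, add_zero]
        · rw [sg, hρ.eq_zero (-s) (by linarith), mul_zero, add_zero]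
          exact mul_nonneg (hs.1 h4).le (hρ.nonneg _)
  have hf := hk.integrable u
  rw [sum_block_integral hT0 _ _ hf] at h1
  have hms : MeasurableSet {s | Inact κp κm s} := by
    have : {s | Inact κp κm s} = ({s | 0 < s} ∩ {_s | κp ≤ 0}) ∪ ({s | s < 0} ∩ {_s | κm ≤ 0}) := rfl
    rw [this]
    exact (measurableSet_Ioi.inter (MeasurableSet.const _)).union
      (measurableSet_Iio.inter (MeasurableSet.const _))
  have hIi : Integrable fun s => {s | Inact κp κm s}.indicator (fun _ => D) s *
      ‖inner ℂ (kv s) u‖ ^ 2 := by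
    have : ∀ s, {s | Inact κp κm s}.indicator (fun _ => D) s * ‖inner ℂ (kv s) u‖ ^ 2 =
        {s | Inact κp κm s}.indicator (fun s => D * ‖inner ℂ (kv s) u‖ ^ 2) s := by
      intro s
      by_cases h : s ∈ {s | Inact κp κm s}
      · rw [indicator_of_mem h, indicator_of_mem h]
      · rw [indicator_of_notMem h, indicator_of_notMem h, zero_mul]
    simp only [this]
    exact (hf.const_mul D).indicator hms
  have hIs := hρ.integrable_sg_mul hα κp κm hf
  have hm1 : Measurable fun s => if bi T s ∈ B then w (bi T s) else 0 :=
    (measurable_from_top (f := fun i : ℤ => if i ∈ B then w i else 0)).comp (measurable_bi T)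
  have hI1 : Integrable fun s => (if bi T s ∈ B then w (bi T s) else 0) *
      ‖inner ℂ (kv s) u‖ ^ 2 := by
    refine hf.bdd_mul (c := ∑ i ∈ B, |w i|) hm1.aestronglyMeasurable
      (Eventually.of_forall fun s => ?_)
    split_ifs with h
    · exact Finset.single_le_sum (f := fun i => |w i|) (fun i _ => abs_nonneg _) h
    · rw [norm_zero]
      exact Finset.sum_nonneg fun i _ => abs_nonneg _
  have h3 : ∫ s, (if bi T s ∈ B then w (bi T s) else 0) * ‖inner ℂ (kv s) u‖ ^ 2 ≤
      mq kv ρ κp κm u + ∫ s, {s | Inact κp κm s}.indicator (fun _ => D) s *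
        ‖inner ℂ (kv s) u‖ ^ 2 := by
    rw [mq, ← integral_add hIs hIi]
    refine integral_mono hI1 (hIs.add hIi) fun s => ?_
    have := mul_le_mul_of_nonneg_right (hpt s) (by positivity : 0 ≤ ‖inner ℂ (kv s) u‖ ^ 2)
    simp only [Pi.add_apply]
    linarith
  have h4 : ∫ s, {s | Inact κp κm s}.indicator (fun _ => D) s * ‖inner ℂ (kv s) u‖ ^ 2 ≤
      t * (n : ℝ) ^ (-α) * ‖u‖ ^ 2 := by
    have hIe : Integrable fun s : ℝ => D * (t / (D + 1) * (n : ℝ) ^ (-α) * (Real.exp (-(2 * |s|)) * ‖u‖ ^ 2)) := by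
      refine (Integrable.const_mul (Integrable.mul_const ?_ _) _).const_mul _
      have := (integrable_exp_neg_abs.comp_mul_left' (two_ne_zero (α := ℝ)))
      simpa [abs_mul] using this
    have hval : ∫ s : ℝ, Real.exp (-(2 * |s|)) = 1 := by
      have := Measure.integral_comp_mul_left (fun x : ℝ => Real.exp (-|x|)) 2
      rw [integral_exp_neg_abs] at this
      simpa [abs_mul] using this
    calc _ ≤ ∫ s : ℝ, D * (t / (D + 1) * (n : ℝ) ^ (-α) * (Real.exp (-(2 * |s|)) * ‖u‖ ^ 2)) := by
          refine integral_mono hIi hIe fun s => ?_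
          by_cases h : s ∈ {s | Inact κp κm s}
          · rw [indicator_of_mem h]
            exact mul_le_mul_of_nonneg_left (h2 s h) hD0
          · rw [indicator_of_notMem h, zero_mul]
            positivity
      _ = D / (D + 1) * (t * (n : ℝ) ^ (-α) * ‖u‖ ^ 2) := by
          rw [integral_const_mul, integral_const_mul, integral_mul_const, hval]
          ring
      _ ≤ 1 * (t * (n : ℝ) ^ (-α) * ‖u‖ ^ 2) := by
          have : D / (D + 1) ≤ 1 := by
            rw [div_le_one (by positivity)]
            linarith
          gcongr
      _ = _ := one_mul _
  nlinarith

end SechFamily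

end HankelEig

namespace HankelEig

lemma inv_cosh_sub_mul (s t a : ℝ) :
    (Real.cosh (s - t))⁻¹ - (Real.cosh (s - a))⁻¹ * (Real.cosh (t - a))⁻¹ =
      Real.tanh (s - a) * Real.tanh (t - a) * (Real.cosh (s - t))⁻¹ := by
  have h : Real.cosh (s - t) = Real.cosh (s - a) * Real.cosh (t - a) -
      Real.sinh (s - a) * Real.sinh (t - a) := by
    rw [← Real.cosh_sub]
    ring_nf
  have h1 := (Real.cosh_pos (s - a)).ne'
  have h2 := (Real.cosh_pos (t - a)).ne'
  have h3 := (Real.cosh_pos (s - t)).ne'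
  rw [Real.tanh_eq_sinh_div_cosh, Real.tanh_eq_sinh_div_cosh]
  field_simp
  rw [h]
  ring

lemma continuous_tanh_real : Continuous Real.tanh := by
  have : Real.tanh = fun x => Real.sinh x / Real.cosh x := funext Real.tanh_eq_sinh_div_cosh
  rw [this]
  exact Real.continuous_sinh.div Real.continuous_cosh fun x => (Real.cosh_pos x).ne'

lemma strictMono_tanh : StrictMono Real.tanh := by
  intro x y h
  have h1 : Real.sinh (y - x) = Real.sinh y * Real.cosh x - Real.cosh y * Real.sinh x :=
    Real.sinh_sub y x
  have h2 : 0 < Real.sinh (y - x) := Real.sinh_pos_iff.2 (by linarith)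
  rw [Real.tanh_eq_sinh_div_cosh, Real.tanh_eq_sinh_div_cosh,
    div_lt_div_iff₀ (Real.cosh_pos x) (Real.cosh_pos y)]
  linarith

lemma tanh_abs_le {x : ℝ} (hx : |x| ≤ 1) : |Real.tanh x| ≤ Real.tanh 1 := by
  have hm := strictMono_tanh
  rw [abs_le] at hx ⊢
  rw [← Real.tanh_neg]
  exact ⟨hm.monotone hx.1, hm.monotone hx.2⟩

variable {E : Type*} [NormedAddCommGroup E] [InnerProductSpace ℂ E] [CompleteSpace E]

omit [CompleteSpace E] in
lemma FT.const_mul {q : E → ℝ} {x τ c : ℝ} (h : FT q x τ) (hc : 0 ≤ c) :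
    FT (fun u => c * q u) x (c * τ) := by
  obtain ⟨q₁, q₂, hq, h₁, h₂⟩ := h
  refine ⟨fun u => c * q₁ u, fun u => c * q₂ u, fun u => ?_, ?_, h₂.const_mul hc⟩
  · rw [← mul_add]
    exact mul_le_mul_of_nonneg_left (hq u) hc
  · have := h₁.const_mul hc
    rwa [mul_zero] at this

lemma exists_pow_bound {α r : ℝ} (hα : 0 < α) (hr : 0 ≤ r) (hr1 : r < 1) :
    ∃ C₁ : ℝ, 0 < C₁ ∧ ∀ (x : ℝ), 0 ≤ x → x ^ α * r ^ ⌈x ^ (1 / 2 : ℝ)⌉₊ ≤ C₁ := by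
  set p := ⌈2 * α⌉₊ with hp
  have h1 := tendsto_pow_const_mul_const_pow_of_abs_lt_one p (r := r) (by rwa [abs_of_nonneg hr])
  obtain ⟨C, hC⟩ := h1.bddAbove_range
  refine ⟨max C 1, by positivity, fun x hx => ?_⟩
  set k := ⌈x ^ (1 / 2 : ℝ)⌉₊ with hk
  have h2 : x ^ (1 / 2 : ℝ) ≤ k := Nat.le_ceil _
  rcases Nat.eq_zero_or_pos k with h0 | h0
  · rw [h0, Nat.cast_zero] at h2
    have h3 : x ^ (1 / 2 : ℝ) = 0 := le_antisymm h2 (by positivity)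
    have h4 : x = 0 := ((Real.rpow_eq_zero_iff_of_nonneg hx).1 h3).1
    rw [h4, Real.zero_rpow hα.ne', zero_mul]
    positivity
  · refine le_trans ?_ (le_max_left _ _)
    refine le_trans ?_ (hC ⟨k, rfl⟩)
    simp only
    refine mul_le_mul_of_nonneg_right ?_ (by positivity)
    have h3 : x ^ α = (x ^ (1 / 2 : ℝ)) ^ (2 * α) := by
      rw [← Real.rpow_mul hx]
      congr 1
      ring
    rw [h3]
    calc (x ^ (1 / 2 : ℝ)) ^ (2 * α) ≤ (k : ℝ) ^ (2 * α) :=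
          Real.rpow_le_rpow (by positivity) h2 (by positivity)
      _ ≤ (k : ℝ) ^ (p : ℝ) :=
          Real.rpow_le_rpow_of_exponent_le (by exact_mod_cast h0) (Nat.le_ceil _)
      _ = (k : ℝ) ^ p := Real.rpow_natCast _ _

namespace SechFamily

variable {kv : ℝ → E} (hk : SechFamily kv)
include hk

omit [CompleteSpace E] in
/-- Residuals of the family after projecting off finitely many members. -/
lemma exists_residual (a : ℕ → ℝ) (ha : Function.Injective a) (m : ℕ) :
    ∃ κ : ℝ → E, Continuous κ ∧
      (∀ s t, inner ℂ (κ s) (κ t) = (((∏ l ∈ Finset.range m, Real.tanh (s - a l)) *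
        (∏ l ∈ Finset.range m, Real.tanh (t - a l)) * (Real.cosh (s - t))⁻¹ : ℝ) : ℂ)) ∧
      ∀ u, (∀ l ∈ Finset.range m, inner ℂ (kv (a l)) u = 0) →
        ∀ s, inner ℂ (κ s) u = inner ℂ (kv s) u := by
  induction m with
  | zero => exact ⟨kv, hk.continuous, fun s t => by simpa using hk s t, fun _ _ _ => rfl⟩
  | succ m ih =>
    obtain ⟨κ, hc, hg, hu⟩ := ih
    set φ : ℝ → ℝ := fun s => ∏ l ∈ Finset.range m, Real.tanh (s - a l) with hφ
    have hφa : φ (a m) ≠ 0 := by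
      rw [hφ]
      simp only
      refine Finset.prod_ne_zero_iff.2 fun l hl => ?_
      have h1 : a m - a l ≠ 0 := sub_ne_zero.2 fun h =>
        (Finset.mem_range.1 hl).ne (ha h).symm
      intro h
      exact h1 (strictMono_tanh.injective (by rw [h, Real.tanh_zero]))
    have hφc : Continuous φ := by
      refine continuous_finsetProd _ fun l _ => continuous_tanh_real.comp (by fun_prop)
    set d : ℝ → ℝ := fun s => φ s / φ (a m) * (Real.cosh (s - a m))⁻¹ with hd
    have hdc : Continuous d := by
      refine (hφc.div_const _).mul (Continuous.inv₀ (Real.continuous_cosh.comp (by fun_prop)) ?_)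
      exact fun s => (Real.cosh_pos _).ne'
    refine ⟨fun s => κ s - (d s : ℂ) • κ (a m), ?_, fun s t => ?_, fun u hu' s => ?_⟩
    · exact hc.sub ((Complex.continuous_ofReal.comp hdc).smul continuous_const)
    · simp only [inner_sub_left, inner_sub_right, inner_smul_left, inner_smul_right, hg,
        Complex.conj_ofReal, Finset.prod_range_succ]
      norm_cast
      have h1 := inv_cosh_sub_mul s t (a m)
      have h2 : Real.cosh (a m - t) = Real.cosh (t - a m) := by rw [← Real.cosh_neg, neg_sub]
      rw [h2, sub_self, Real.cosh_zero, inv_one, mul_one]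
      change φ s * φ t * _ - d s * (φ (a m) * φ t * _) -
        d t * (φ s * φ (a m) * _ - d s * (φ (a m) * φ (a m))) =
        φ s * _ * (φ t * _) * _
      simp only [hd]
      field_simp
      field_simp at h1
      linear_combination (φ s * φ t) * h1
    · have h1 : ∀ l ∈ Finset.range m, inner ℂ (kv (a l)) u = 0 := fun l hl =>
        hu' l (Finset.mem_range.2 ((Finset.mem_range.1 hl).trans m.lt_succ_self))
      rw [inner_sub_left, inner_smul_left, hu u h1, hu u h1, hu' m (Finset.self_mem_range_succ m),
        mul_zero, sub_zero]

omit [CompleteSpace E] in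
lemma FT_unit_block (i : ℤ) (m : ℕ) :
    FT (fun u => ∫ s in (lft 1 i)..(lft 1 i + 1), ‖inner ℂ (kv s) u‖ ^ 2) m
      ((Real.tanh 1 ^ 2) ^ m) := by
  set a : ℕ → ℝ := fun l => i + 1 / (l + 1) with ha
  have hinj : Function.Injective a := by
    intro l l' h
    simp only [ha, add_right_inj, one_div, inv_inj] at h
    have h' : l + 1 = l' + 1 := by exact_mod_cast h
    omega
  obtain ⟨κ, hc, hg, hu⟩ := hk.exists_residual a hinj m
  refine ⟨fun u => (∫ s in (lft 1 i)..(lft 1 i + 1), ‖inner ℂ (kv s) u‖ ^ 2) -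
    ∫ s in (lft 1 i)..(lft 1 i + 1), ‖inner ℂ (κ s) u‖ ^ 2, fun u => ∫ s in (lft 1 i)..(lft 1 i + 1),
    ‖inner ℂ (κ s) u‖ ^ 2, fun u => by simp, ?_, ?_⟩
  · have := UB.of_finite (Finset.range m) (fun l => kv (a l)) (q := fun u =>
      (∫ s in (lft 1 i)..(lft 1 i + 1), ‖inner ℂ (kv s) u‖ ^ 2) -
      ∫ s in (lft 1 i)..(lft 1 i + 1), ‖inner ℂ (κ s) u‖ ^ 2) fun u h => by
        simp only [hu u h, sub_self, le_refl]
    rwa [Finset.card_range] at this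
  · have h1 := Tr.integral (a := lft 1 i) (b := lft 1 i + 1) (by linarith) hc
    refine ⟨h1.1, fun l v hv => (h1.2 l v hv).trans ?_⟩
    have h2 : ∀ s ∈ Icc (lft 1 i) (lft 1 i + 1), ‖κ s‖ ^ 2 ≤ (Real.tanh 1 ^ 2) ^ m := by
      intro s hs
      have h3 := inner_self_eq_norm_sq_to_K (𝕜 := ℂ) (κ s)
      rw [hg, sub_self, Real.cosh_zero, inv_one, mul_one] at h3
      have h4 : ‖κ s‖ ^ 2 = (∏ l ∈ Finset.range m, Real.tanh (s - a l)) *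
        (∏ l ∈ Finset.range m, Real.tanh (s - a l)) := by
        have h5 := congrArg Complex.re h3.symm
        rw [Complex.ofReal_re] at h5
        rw [← h5]
        norm_cast
      rw [h4, ← Finset.prod_mul_distrib]
      calc _ ≤ ∏ l ∈ Finset.range m, Real.tanh 1 ^ 2 := by
            refine Finset.prod_le_prod (fun l _ => mul_self_nonneg _) fun l _ => ?_
            rw [← sq, ← sq_abs]
            have h5 : |s - a l| ≤ 1 := by
              have h6 : (0 : ℝ) < 1 / (l + 1) := by positivity
              have h7 : (1 : ℝ) / (l + 1) ≤ 1 := by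
                rw [div_le_one (by positivity)]
                have : (0 : ℝ) ≤ l := l.cast_nonneg
                linarith
              simp only [lft, mul_one, mem_Icc] at hs
              simp only [ha]
              rw [abs_le]
              constructor <;> linarith [hs.1, hs.2]
            have := tanh_abs_le h5
            gcongr
        _ = _ := by rw [Finset.prod_const, Finset.card_range]
    calc _ ≤ ∫ s in (lft 1 i)..(lft 1 i + 1), (Real.tanh 1 ^ 2) ^ m := by
          refine intervalIntegral.integral_mono_on (by linarith) ?_ ?_ h2
          · exact (hc.norm.pow 2).intervalIntegrable _ _
          · exact intervalIntegrable_const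
      _ = _ := by simp

end SechFamily

end HankelEig

namespace HankelEig

variable {E : Type*} [NormedAddCommGroup E] [InnerProductSpace ℂ E] [CompleteSpace E]

lemma sum_ceil_sqrt_le (n : ℕ) {η : ℝ} (hη : 0 < η) (hη1 : η ≤ 1) (hn : 1 ≤ η ^ 2 * n) {L : ℕ}
    (hL : (L : ℝ) ≤ 3 * (η ^ 2 * n)) :
    ∑ i ∈ blk 0 L, (⌈((n : ℝ) / max 1 (mI i : ℝ)) ^ (1 / 2 : ℝ)⌉₊ : ℝ) ≤ 16 * η * n := by
  have hn0 : (0 : ℝ) ≤ n := n.cast_nonneg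
  have h1 : ∑ k ∈ Finset.Ico 0 L, (⌈((n : ℝ) / max 1 (k : ℝ)) ^ (1 / 2 : ℝ)⌉₊ : ℝ) ≤
      ∑ k ∈ Finset.Ico 0 L, (√n * (max 1 (k : ℝ)) ^ (-(1 / 2) : ℝ) + 1) := by
    refine Finset.sum_le_sum fun k _ => ?_
    have h0 : (0 : ℝ) ≤ max 1 (k : ℝ) := by positivity
    rw [Real.div_rpow hn0 h0, Real.sqrt_eq_rpow, Real.rpow_neg h0, ← div_eq_mul_inv]
    exact (Nat.ceil_lt_add_one (by positivity)).le
  have h2 : ∑ k ∈ Finset.Ico 0 L, (max 1 (k : ℝ)) ^ (-(1 / 2) : ℝ) ≤ 1 + 2 * √L := by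
    rcases Nat.eq_zero_or_pos L with h | h
    · rw [h]
      simp
    · rw [Finset.sum_eq_sum_Ico_succ_bot h, Nat.cast_zero, max_eq_left zero_le_one, Real.one_rpow,
        zero_add]
      gcongr
      have h3 := sum_Ico_rpow_neg_le (θ := 1 / 2) (by norm_num) (by norm_num) L
      rw [Real.sqrt_eq_rpow]
      calc _ = ∑ k ∈ Finset.Ico 1 L, (k : ℝ) ^ (-(1 / 2) : ℝ) := by
            refine Finset.sum_congr rfl fun k hk => ?_
            rw [max_eq_right (by exact_mod_cast (Finset.mem_Ico.1 hk).1)]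
        _ ≤ _ := h3
        _ = _ := by norm_num; ring
  have h4 : √n ≤ η * n := by
    rw [Real.sqrt_le_left (by positivity)]
    nlinarith
  have h5 : √L ≤ 2 * (η * √n) := by
    rw [Real.sqrt_le_left (by positivity), mul_pow, mul_pow, Real.sq_sqrt hn0]
    nlinarith
  have h6 : √n * √n = n := Real.mul_self_sqrt hn0
  have h7 : √n * √L ≤ 2 * (η * n) := by
    calc √n * √L ≤ √n * (2 * (η * √n)) := by gcongr
      _ = 2 * (η * (√n * √n)) := by ring
      _ = _ := by rw [h6]
  have h8 : η ^ 2 * n ≤ η * n := by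
    gcongr
    nlinarith
  rw [sum_blk]
  simp only [mI]
  have h9 : ∑ k ∈ Finset.Ico 0 L, (⌈((n : ℝ) / max 1 (k : ℝ)) ^ (1 / 2 : ℝ)⌉₊ : ℝ) ≤
      8 * (η * n) := by
    refine h1.trans ?_
    rw [Finset.sum_add_distrib, ← Finset.mul_sum, Finset.sum_const, Nat.card_Ico, Nat.sub_zero,
      nsmul_eq_mul, mul_one]
    have := mul_le_mul_of_nonneg_left h2 (Real.sqrt_nonneg n)
    linarith

  linarith

namespace SechFamily

variable {kv : ℝ → E} (hk : SechFamily kv)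
include hk

lemma lowUB {α C : ℝ} {ρ : ℝ → ℝ} (hα : 0 < α) (hρ : ModelWeight α C ρ) : LowUB α kv ρ := by
  intro γ hγ l hl
  have hC := hρ.C_nonneg
  obtain ⟨C₁, hC₁, hb⟩ := exists_pow_bound hα (sq_nonneg (Real.tanh 1)) (Real.tanh_sq_lt_one 1)
  set K := 16 + 6 * C * C₁ / l with hK
  have hK0 : 0 < K := by positivity
  set η := min 1 (γ / K) with hη
  have hη0 : 0 < η := by positivity
  have hη1 : η ≤ 1 := min_le_left _ _
  have hηK : η * K ≤ γ := by
    rw [← le_div_iff₀ hK0]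
    exact min_le_right _ _
  refine ⟨η ^ 2, by positivity, ?_⟩
  filter_upwards [(tendsto_natCast_atTop_atTop (R := ℝ)).eventually_ge_atTop (1 / η ^ 2),
    eventually_gt_atTop 0] with n hn hn0
  have hn0' : (0 : ℝ) < n := by exact_mod_cast hn0
  rw [div_le_iff₀' (by positivity)] at hn
  set L := ⌊2 * η ^ 2 * n⌋₊ + 1 with hL
  have hL3 : (L : ℝ) ≤ 3 * (η ^ 2 * n) := by
    rw [hL]
    push_cast
    have := Nat.floor_le (by positivity : 0 ≤ 2 * η ^ 2 * n)
    linarith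
  set w : ℤ → ℝ := fun i => C * (max 1 (mI i) : ℝ) ^ (-α) with hw
  have hw0 : ∀ i, 0 ≤ w i := fun i => by positivity
  have h1 := FT.sum (blk 0 L) fun i _ => (hk.FT_unit_block i
    ⌈((n : ℝ) / max 1 (mI i : ℝ)) ^ (1 / 2 : ℝ)⌉₊).const_mul (hw0 i)
  have hl' : 0 < l * (n : ℝ) ^ (-α) := by positivity
  refine (h1.toUB hl').mono (fun u => ?_) ?_ le_rfl
  · have hf := hk.integrable u
    rw [sum_block_integral one_pos _ _ hf]
    refine integral_mono_of_nonneg (Eventually.of_forall fun s => ?_) ?_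
      (Eventually.of_forall fun s => ?_)
    · refine mul_nonneg ?_ (by positivity)
      split_ifs
      exacts [add_nonneg (hρ.nonneg _) (hρ.nonneg _), le_rfl]
    · have hm1 : Measurable fun s => if bi 1 s ∈ blk 0 L then w (bi 1 s) else 0 :=
        (measurable_from_top (f := fun i : ℤ => if i ∈ blk 0 L then w i else 0)).comp
          (measurable_bi 1)
      refine hf.bdd_mul (c := ∑ i ∈ blk 0 L, w i) hm1.aestronglyMeasurable
        (Eventually.of_forall fun s => ?_)
      split_ifs with h
      · rw [Real.norm_of_nonneg (hw0 _)]
        exact Finset.single_le_sum (fun i _ => hw0 i) h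
      · rw [norm_zero]
        exact Finset.sum_nonneg fun i _ => hw0 i
    · refine mul_le_mul_of_nonneg_right ?_ (by positivity)
      by_cases hs : |s| ≤ 2 * η ^ 2 * n
      · rw [if_pos hs]
        obtain ⟨h2, -, h3⟩ := bi_spec one_pos s
        rw [mul_one] at h2
        have hmem : bi 1 s ∈ blk 0 L := by
          rw [mem_blk]
          exact ⟨Nat.zero_le _, Nat.lt_succ_of_le (Nat.le_floor (h2.trans hs))⟩
        rw [if_pos hmem]
        have h4 : ρ s + ρ (-s) = ρ |s| := by
          have := hρ.sg_eq one_pos 1 1 s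
          rw [h3, ite_self, one_mul, sg, one_mul, one_mul] at this
          exact this
        rw [h4]
        by_cases h5 : |s| < 1
        · rw [hρ.eq_zero _ h5]
          exact hw0 _
        · refine (hρ.le _ (not_lt.1 h5)).trans ?_
          refine mul_le_mul_of_nonneg_left ?_ hC
          exact Real.rpow_le_rpow_of_nonpos (by positivity) (max_le (not_lt.1 h5) h2)
            (by linarith)
      · rw [if_neg hs]
        split_ifs
        exacts [hw0 _, le_rfl]
  · have h2 := sum_ceil_sqrt_le n hη0 hη1 hn hL3
    have h3 : ∑ i ∈ blk 0 L, w i * (Real.tanh 1 ^ 2) ^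
        ⌈((n : ℝ) / max 1 (mI i : ℝ)) ^ (1 / 2 : ℝ)⌉₊ ≤
        ∑ i ∈ blk 0 L, (n : ℝ) ^ (-α) * (C * C₁) := by
      refine Finset.sum_le_sum fun i _ => ?_
      have h4 := hb ((n : ℝ) / max 1 (mI i : ℝ)) (by positivity)
      have h5 : w i = (n : ℝ) ^ (-α) * (C * ((n : ℝ) / max 1 (mI i : ℝ)) ^ α) := by
        have h6 : (n : ℝ) ^ (-α) * (n : ℝ) ^ α = 1 := by
          rw [← Real.rpow_add hn0', neg_add_cancel, Real.rpow_zero]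
        rw [Real.div_rpow hn0'.le (by positivity), hw]
        simp only
        rw [Real.rpow_neg (by positivity : (0 : ℝ) ≤ max 1 (mI i : ℝ))]
        linear_combination (-(C * (max 1 (mI i : ℝ) ^ α)⁻¹)) * h6
      rw [h5, mul_assoc, mul_assoc]
      gcongr
    rw [Finset.sum_const, card_blk, nsmul_eq_mul] at h3
    push_cast at h3
    have h4 : (∑ i ∈ blk 0 L, w i * (Real.tanh 1 ^ 2) ^
        ⌈((n : ℝ) / max 1 (mI i : ℝ)) ^ (1 / 2 : ℝ)⌉₊) / (l * (n : ℝ) ^ (-α)) ≤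
        6 * C * C₁ / l * (η * n) := by
      rw [div_le_iff₀ hl']
      refine h3.trans ?_
      have h5 : (L : ℝ) ≤ 3 * (η * n) := by
        refine hL3.trans ?_
        have : η ^ 2 ≤ η := by nlinarith
        gcongr
      calc _ = (n : ℝ) ^ (-α) * (C * C₁) * 2 * (L : ℝ) := by simp; ring
        _ ≤ (n : ℝ) ^ (-α) * (C * C₁) * 2 * (3 * (η * n)) := by gcongr
        _ = _ := by field_simp; ring
    calc _ ≤ 16 * η * n + 6 * C * C₁ / l * (η * n) := add_le_add h2 h4
      _ = η * K * n := by rw [hK]; ring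
      _ ≤ γ * n := by gcongr

end SechFamily

end HankelEig

namespace HankelEig

lemma memℓp_tanh (s : ℝ) :
    Memℓp (fun j : ℕ => ((Real.tanh s ^ j / Real.cosh s : ℝ) : ℂ)) 2 := by
  refine memℓp_gen ?_
  have h : ∀ j : ℕ, ‖((Real.tanh s ^ j / Real.cosh s : ℝ) : ℂ)‖ ^ (2 : ENNReal).toReal =
      (Real.tanh s ^ 2) ^ j * (1 / Real.cosh s) ^ 2 := by
    intro j
    rw [ENNReal.toReal_ofNat, Real.rpow_ofNat, Complex.norm_real, Real.norm_eq_abs, sq_abs]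
    ring
  simp only [h]
  exact (summable_geometric_of_lt_one (sq_nonneg _) (Real.tanh_sq_lt_one s)).mul_right _

/-- The vectors `(tanh s ^ j / cosh s)_j` of `ℓ²`. -/
def kvec (s : ℝ) : ellTwo := ⟨fun j => ((Real.tanh s ^ j / Real.cosh s : ℝ) : ℂ), memℓp_tanh s⟩

lemma kvec_apply (s : ℝ) (j : ℕ) :
    (kvec s : ℕ → ℂ) j = ((Real.tanh s ^ j / Real.cosh s : ℝ) : ℂ) := rfl

lemma sechFamily_kvec : SechFamily kvec := by
  intro s t
  have h1 : |Real.tanh s * Real.tanh t| < 1 := by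
    rw [abs_mul]
    exact mul_lt_one_of_nonneg_of_lt_one_left (abs_nonneg _) (Real.abs_tanh_lt_one s)
      (Real.abs_tanh_lt_one t).le
  have h2 := (hasSum_geometric_of_abs_lt_one h1).mul_left ((Real.cosh s)⁻¹ * (Real.cosh t)⁻¹)
  have h3 : (Real.cosh s)⁻¹ * (Real.cosh t)⁻¹ * (1 - Real.tanh s * Real.tanh t)⁻¹ =
      (Real.cosh (s - t))⁻¹ := by
    rw [Real.cosh_sub, ← mul_inv, ← mul_inv]
    congr 1
    have := (Real.cosh_pos s).ne'
    have := (Real.cosh_pos t).ne'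
    rw [Real.tanh_eq_sinh_div_cosh, Real.tanh_eq_sinh_div_cosh]
    field_simp
  rw [h3] at h2
  refine (lp.hasSum_inner (kvec s) (kvec t)).unique ?_
  suffices h4 : (fun j => inner ℂ ((kvec s : ℕ → ℂ) j) ((kvec t : ℕ → ℂ) j)) = fun j : ℕ =>
      (((Real.cosh s)⁻¹ * (Real.cosh t)⁻¹ * (Real.tanh s * Real.tanh t) ^ j : ℝ) : ℂ) by
    rw [h4]
    exact Complex.hasSum_ofReal.2 h2
  funext j
  rw [kvec_apply, kvec_apply, RCLike.inner_apply, Complex.conj_ofReal, ← Complex.ofReal_mul]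
  congr 1
  rw [mul_pow]
  ring

lemma norm_inner_kvec_sq {u : ellTwo} {J : ℕ} (hu : ∀ j, J ≤ j → (u : ℕ → ℂ) j = 0) (s : ℝ) :
    ‖inner ℂ (kvec s) u‖ ^ 2 =
      hsum (fun m => ((Real.cosh s)⁻¹ ^ 2 * Real.tanh s ^ m)) J u := by
  have h1 : inner ℂ (kvec s) u =
      ∑ j ∈ Finset.range J, (((Real.tanh s ^ j / Real.cosh s : ℝ) : ℂ)) * (u : ℕ → ℂ) j := by
    rw [lp.inner_eq_tsum, tsum_eq_sum (s := Finset.range J)]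
    · refine Finset.sum_congr rfl fun j _ => ?_
      rw [kvec_apply, RCLike.inner_apply, Complex.conj_ofReal, mul_comm]
    · intro j hj
      rw [hu j (by simpa using hj), inner_zero_right]
  have h2 : ((‖inner ℂ (kvec s) u‖ ^ 2 : ℝ) : ℂ) =
      (starRingEnd ℂ) (inner ℂ (kvec s) u) * inner ℂ (kvec s) u := by
    rw [mul_comm, Complex.mul_conj, Complex.normSq_eq_norm_sq]
  rw [← Complex.ofReal_re (‖inner ℂ (kvec s) u‖ ^ 2), h2, h1, map_sum, Finset.sum_mul_sum, hsum]
  congr 1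
  refine Finset.sum_congr rfl fun j _ => Finset.sum_congr rfl fun l _ => ?_
  rw [map_mul, Complex.conj_ofReal]
  push_cast
  ring

end HankelEig

namespace HankelEig

/-- The reciprocal of `Γ(1 + |t|)`. -/
def gI (t : ℝ) : ℝ := (Real.Gamma (1 + |t|))⁻¹

lemma gI_pos (t : ℝ) : 0 < gI t := inv_pos.2 (Real.Gamma_pos_of_pos (by positivity))

lemma gI_zero : gI 0 = 1 := by simp [gI]

lemma continuous_gI : Continuous gI := by
  refine Continuous.inv₀ ?_ fun t => (Real.Gamma_pos_of_pos (by positivity)).ne'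
  refine continuous_iff_continuousAt.2 fun t => ?_
  have h1 : ContinuousAt Real.Gamma (1 + |t|) := by
    refine (Real.differentiableAt_Gamma fun m => ?_).continuousAt
    have h2 : (0 : ℝ) < 1 + |t| := by positivity
    have h3 : (0 : ℝ) ≤ m := m.cast_nonneg
    intro h
    linarith
  exact ContinuousAt.comp (f := fun t : ℝ => 1 + |t|) h1 (by fun_prop)

lemma exists_gI_le : ∃ B : ℝ, 0 < B ∧ ∀ t, gI t ≤ B := by
  obtain ⟨x, hx, hmin⟩ := Real.exists_isMinOn_Gamma_Ioi
  have h0 : 0 < Real.Gamma x := Real.Gamma_pos_of_pos (by linarith [hx.1])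
  refine ⟨(Real.Gamma x)⁻¹, by positivity, fun t => ?_⟩
  have h1 : (1 + |t|) ∈ Ioi (0 : ℝ) := by
    simp only [mem_Ioi]
    positivity
  exact inv_anti₀ h0 (hmin h1)

/-- The function on `(0, ∞)` whose Laplace transform is `p⁻¹ (log p) ^ (-α)`. -/
def wG (α y : ℝ) : ℝ := (Real.Gamma α)⁻¹ * ∫ t in Ioi (0 : ℝ), t ^ (α - 1) * gI t * y ^ t

lemma wG_nonneg {α y : ℝ} (hα : 0 < α) (hy : 0 ≤ y) : 0 ≤ wG α y := by
  refine mul_nonneg (inv_nonneg.2 (Real.Gamma_pos_of_pos hα).le) ?_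
  refine setIntegral_nonneg measurableSet_Ioi fun t ht => ?_
  have := gI_pos t
  have h2 : (0 : ℝ) < t := ht
  positivity

lemma measurable_wG_kernel (α : ℝ) : Measurable fun p : ℝ × ℝ => p.2 ^ (α - 1) * gI p.2 * p.1 ^ p.2 :=
  ((measurable_snd.pow_const _).mul (continuous_gI.measurable.comp measurable_snd)).mul
    (measurable_fst.pow measurable_snd)

lemma measurable_wG (α : ℝ) : Measurable (wG α) := by
  refine Measurable.const_mul ?_ _
  exact ((measurable_wG_kernel α).stronglyMeasurable.integral_prod_right
    (ν := volume.restrict (Ioi (0 : ℝ)))).measurable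

lemma integrableOn_rpow_mul_exp {α X : ℝ} (hα : 0 < α) (hX : 0 < X) :
    IntegrableOn (fun t : ℝ => t ^ (α - 1) * Real.exp (-(X * t))) (Ioi 0) := by
  have := integrableOn_rpow_mul_exp_neg_mul_rpow (p := 1) (s := α - 1) (by linarith) one_pos hX
  simpa only [Real.rpow_one, neg_mul] using this

lemma exp_neg_rpow (X t : ℝ) : Real.exp (-X) ^ t = Real.exp (-(X * t)) := by
  rw [← Real.exp_mul, neg_mul]

lemma wG_exp_le {α : ℝ} (hα : 0 < α) {B : ℝ} (hB : ∀ t, gI t ≤ B) {X : ℝ} (hX : 0 < X) :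
    wG α (Real.exp (-X)) ≤ B * X ^ (-α) := by
  have hΓ := Real.Gamma_pos_of_pos hα
  have h1 : ∫ t in Ioi (0 : ℝ), t ^ (α - 1) * gI t * Real.exp (-X) ^ t ≤
      ∫ t in Ioi (0 : ℝ), B * (t ^ (α - 1) * Real.exp (-(X * t))) := by
    refine integral_mono_of_nonneg ?_ ((integrableOn_rpow_mul_exp hα hX).const_mul B) ?_
    · filter_upwards [ae_restrict_mem measurableSet_Ioi] with t ht
      have := gI_pos t
      have h2 : (0 : ℝ) < t := ht
      simp only [Pi.zero_apply]
      positivity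
    · filter_upwards [ae_restrict_mem measurableSet_Ioi] with t ht
      have h2 : (0 : ℝ) < t := ht
      have h3 := hB t
      rw [exp_neg_rpow]
      calc t ^ (α - 1) * gI t * Real.exp (-(X * t)) ≤ t ^ (α - 1) * B * Real.exp (-(X * t)) := by
            gcongr
        _ = _ := by ring
  rw [integral_const_mul, Real.integral_rpow_mul_exp_neg_mul_Ioi hα hX] at h1
  unfold wG
  calc _ ≤ (Real.Gamma α)⁻¹ * (B * ((1 / X) ^ α * Real.Gamma α)) := by gcongr
    _ = _ := by
      rw [one_div, Real.inv_rpow hX.le, Real.rpow_neg hX.le]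
      field_simp

lemma wG_exp_mul {α X : ℝ} (hX : 0 < X) :
    wG α (Real.exp (-X)) * X ^ α = (Real.Gamma α)⁻¹ *
      ∫ v in Ioi (0 : ℝ), v ^ (α - 1) * gI (v / X) * Real.exp (-v) := by
  have h1 := integral_comp_mul_left_Ioi (fun v : ℝ => v ^ (α - 1) * gI (v / X) * Real.exp (-v)) 0 hX
  rw [mul_zero, smul_eq_mul] at h1
  unfold wG
  have h2 : ∫ v in Ioi (0 : ℝ), v ^ (α - 1) * gI (v / X) * Real.exp (-v) =
      X * ∫ t in Ioi (0 : ℝ), (X * t) ^ (α - 1) * gI (X * t / X) * Real.exp (-(X * t)) := by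
    rw [h1]
    field_simp
  rw [h2, mul_assoc, ← integral_mul_const, ← integral_const_mul X]
  refine congrArg _ (setIntegral_congr_fun measurableSet_Ioi fun t ht => ?_)
  have ht : (0 : ℝ) < t := ht
  rw [exp_neg_rpow, Real.mul_rpow hX.le ht.le, mul_div_cancel_left₀ _ hX.ne',
    Real.rpow_sub hX, Real.rpow_one]
  field_simp

lemma tendsto_wG {α : ℝ} (hα : 0 < α) :
    Tendsto (fun X => wG α (Real.exp (-X)) * X ^ α) atTop (nhds 1) := by
  obtain ⟨B, hB0, hB⟩ := exists_gI_le
  have hΓ := Real.Gamma_pos_of_pos hα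
  have h1 : Tendsto (fun X => ∫ v in Ioi (0 : ℝ), v ^ (α - 1) * gI (v / X) * Real.exp (-v)) atTop
      (nhds (∫ v in Ioi (0 : ℝ), v ^ (α - 1) * 1 * Real.exp (-v))) := by
    refine tendsto_integral_filter_of_dominated_convergence
      (fun v => B * (v ^ (α - 1) * Real.exp (-(1 * v)))) ?_ ?_
      ((integrableOn_rpow_mul_exp hα one_pos).const_mul B) ?_
    · refine Eventually.of_forall fun X => Measurable.aestronglyMeasurable ?_
      exact ((measurable_id.pow_const _).mul (continuous_gI.measurable.comp
        (measurable_id.div_const X))).mul (Real.measurable_exp.comp measurable_neg)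
    · refine Eventually.of_forall fun X => ?_
      filter_upwards [ae_restrict_mem measurableSet_Ioi] with t ht
      have h2 : (0 : ℝ) < t := ht
      have h3 := hB (t / X)
      have h4 := gI_pos (t / X)
      rw [Real.norm_of_nonneg (by positivity), one_mul]
      calc t ^ (α - 1) * gI (t / X) * Real.exp (-t) ≤ t ^ (α - 1) * B * Real.exp (-t) := by
            gcongr
        _ = _ := by ring
    · refine Eventually.of_forall fun v => ?_
      refine Tendsto.mul_const _ (Tendsto.const_mul _ ?_)
      rw [← gI_zero]
      refine (continuous_gI.tendsto 0).comp ?_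
      exact tendsto_const_nhds.div_atTop tendsto_id
  have h2 : ∫ v in Ioi (0 : ℝ), v ^ (α - 1) * 1 * Real.exp (-v) = Real.Gamma α := by
    have := Real.integral_rpow_mul_exp_neg_mul_Ioi hα one_pos
    simpa using this
  rw [h2] at h1
  have h3 := h1.const_mul (Real.Gamma α)⁻¹
  rw [inv_mul_cancel₀ hΓ.ne'] at h3
  refine h3.congr' ?_
  filter_upwards [eventually_gt_atTop 0] with X hX
  exact (wG_exp_mul hX).symm

lemma laplace_wG {α p : ℝ} (hα : 0 < α) (hp : 1 < p) :
    IntegrableOn (fun y => Real.exp (-(p * y)) * wG α y) (Ioi 0) ∧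
      ∫ y in Ioi (0 : ℝ), Real.exp (-(p * y)) * wG α y = p⁻¹ * Real.log p ^ (-α) := by
  have hp0 : 0 < p := by linarith
  have hl : 0 < Real.log p := Real.log_pos hp
  have hΓ := Real.Gamma_pos_of_pos hα
  set f : ℝ × ℝ → ℝ := fun q => Real.exp (-(p * q.1)) * (q.2 ^ (α - 1) * gI q.2 * q.1 ^ q.2) with hf
  set ν := volume.restrict (Ioi (0 : ℝ)) with hν
  have hfm : Measurable f :=
    (Real.measurable_exp.comp (measurable_fst.const_mul p).neg).mul (measurable_wG_kernel α)
  have hinner : ∀ t ∈ Ioi (0 : ℝ), Integrable (fun y => f (y, t)) ν ∧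
      ∫ y, f (y, t) ∂ν = p⁻¹ * (t ^ (α - 1) * Real.exp (-(Real.log p * t))) := by
    intro t ht
    have ht : (0 : ℝ) < t := ht
    have h1 : ∀ y, f (y, t) = t ^ (α - 1) * gI t * (y ^ ((t + 1) - 1) * Real.exp (-(p * y))) := by
      intro y
      simp only [hf, add_sub_cancel_right]
      ring
    simp only [h1]
    refine ⟨(integrableOn_rpow_mul_exp (by linarith) hp0).const_mul _, ?_⟩
    rw [integral_const_mul, Real.integral_rpow_mul_exp_neg_mul_Ioi (by linarith) hp0, gI,
      abs_of_pos ht, add_comm 1 t]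
    have h2 : Real.Gamma (t + 1) ≠ 0 := (Real.Gamma_pos_of_pos (by linarith)).ne'
    rw [one_div, Real.inv_rpow hp0.le, Real.rpow_add hp0, Real.rpow_one, Real.exp_neg,
      Real.rpow_def_of_pos hp0]
    field_simp
  have hfi : Integrable f (ν.prod ν) := by
    rw [integrable_prod_iff' hfm.aestronglyMeasurable]
    refine ⟨?_, ?_⟩
    · filter_upwards [ae_restrict_mem measurableSet_Ioi] with t ht
      exact (hinner t ht).1
    · refine ((integrableOn_rpow_mul_exp hα hl).const_mul p⁻¹).congr ?_
      filter_upwards [ae_restrict_mem measurableSet_Ioi] with t ht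
      rw [← (hinner t ht).2]
      refine integral_congr_ae ?_
      filter_upwards [ae_restrict_mem measurableSet_Ioi] with y hy
      have hy : (0 : ℝ) < y := hy
      have ht : (0 : ℝ) < t := ht
      have := gI_pos t
      rw [Real.norm_of_nonneg (by simp only [hf]; positivity)]
  have h1 : ∀ y, ∫ t, f (y, t) ∂ν = Real.Gamma α * (Real.exp (-(p * y)) * wG α y) := by
    intro y
    simp only [hf, wG]
    rw [integral_const_mul]
    field_simp
    rfl
  have h2 := hfi.integral_prod_left
  have h3 := integral_integral_swap (f := fun y t => f (y, t)) hfi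
  simp only [h1] at h2 h3
  refine ⟨?_, ?_⟩
  · have := h2.const_mul (Real.Gamma α)⁻¹
    simp only [inv_mul_cancel_left₀ hΓ.ne'] at this
    exact this
  · rw [integral_const_mul] at h3
    rw [← mul_right_inj' hΓ.ne', h3]
    calc _ = ∫ t in Ioi (0 : ℝ), p⁻¹ * (t ^ (α - 1) * Real.exp (-(Real.log p * t))) :=
          setIntegral_congr_fun measurableSet_Ioi fun t ht => (hinner t ht).2
      _ = _ := by
          rw [integral_const_mul, Real.integral_rpow_mul_exp_neg_mul_Ioi hα hl, one_div,
            Real.inv_rpow hl.le, Real.rpow_neg hl.le]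
          ring

end HankelEig

namespace HankelEig

/-- `-log (tanh s)`. -/
def Yt (s : ℝ) : ℝ := -Real.log (Real.tanh s)

lemma tanh_pos {s : ℝ} (hs : 0 < s) : 0 < Real.tanh s := by
  have := strictMono_tanh hs
  rwa [Real.tanh_zero] at this

lemma exp_neg_Yt {s : ℝ} (hs : 0 < s) : Real.exp (-Yt s) = Real.tanh s := by
  rw [Yt, neg_neg, Real.exp_log (tanh_pos hs)]

lemma Yt_pos {s : ℝ} (hs : 0 < s) : 0 < Yt s := by
  have := Real.log_neg (tanh_pos hs) (Real.tanh_lt_one s)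
  rw [Yt]
  linarith

lemma tanh_eq_exp (s : ℝ) :
    Real.tanh s = (Real.exp (2 * s) - 1) / (Real.exp (2 * s) + 1) := by
  have h1 : Real.exp (2 * s) = Real.exp s ^ 2 := by rw [← Real.exp_nat_mul]; norm_num
  rw [Real.tanh_eq_sinh_div_cosh, Real.sinh_eq, Real.cosh_eq, Real.exp_neg, h1]
  have := Real.exp_pos s
  field_simp

lemma exp_le_Yt {s : ℝ} (hs : 1 ≤ s) : Real.exp (-(2 * s)) ≤ Yt s := by
  have h1 := Real.log_le_sub_one_of_pos (tanh_pos (by linarith : 0 < s))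
  have h2 : 1 - Real.tanh s = 2 / (Real.exp (2 * s) + 1) := by
    rw [tanh_eq_exp]
    have := Real.exp_pos (2 * s)
    field_simp
    ring
  have h3 : Real.exp (-(2 * s)) ≤ 2 / (Real.exp (2 * s) + 1) := by
    rw [Real.exp_neg, inv_eq_one_div, div_le_div_iff₀ (Real.exp_pos _) (by positivity)]
    have : 1 ≤ Real.exp (2 * s) := Real.one_le_exp (by linarith)
    linarith
  rw [Yt]
  linarith

lemma Yt_le {s : ℝ} (hs : 1 ≤ s) : Yt s ≤ 2 / (Real.exp (2 * s) - 1) := by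
  have h0 := tanh_pos (by linarith : 0 < s)
  have h1 := Real.log_le_sub_one_of_pos (inv_pos.2 h0)
  rw [Real.log_inv] at h1
  refine h1.trans (le_of_eq ?_)
  have h2 : 1 < Real.exp (2 * s) := Real.one_lt_exp_iff.2 (by linarith)
  rw [tanh_eq_exp, inv_div]
  have : Real.exp (2 * s) - 1 ≠ 0 := by linarith
  field_simp
  ring

lemma exp_two_mul_ge {s : ℝ} (hs : 1 ≤ s) : 2.7 * Real.exp s ≤ Real.exp (2 * s) := by
  have h1 : Real.exp 1 ≤ Real.exp s := Real.exp_le_exp.2 hs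
  have h2 : (2.7 : ℝ) ≤ Real.exp 1 := by linarith [Real.exp_one_gt_d9]
  rw [two_mul, Real.exp_add]
  nlinarith [Real.exp_pos s]

lemma Yt_le_exp_neg {s : ℝ} (hs : 1 ≤ s) : Yt s ≤ Real.exp (-s) := by
  refine (Yt_le hs).trans ?_
  have h1 := exp_two_mul_ge hs
  have h2 : Real.exp 1 ≤ Real.exp s := Real.exp_le_exp.2 hs
  have h3 : (2.7 : ℝ) ≤ Real.exp 1 := by linarith [Real.exp_one_gt_d9]
  rw [Real.exp_neg, inv_eq_one_div, div_le_div_iff₀ (by linarith) (Real.exp_pos _)]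
  linarith

lemma Yt_le_exp_neg_two {s : ℝ} (hs : 1 ≤ s) : Yt s ≤ 4 * Real.exp (-(2 * s)) := by
  refine (Yt_le hs).trans ?_
  have h1 := exp_two_mul_ge hs
  have h2 : Real.exp 1 ≤ Real.exp s := Real.exp_le_exp.2 hs
  have h3 : (2.7 : ℝ) ≤ Real.exp 1 := by linarith [Real.exp_one_gt_d9]
  rw [Real.exp_neg, ← div_eq_mul_inv, div_le_div_iff₀ (by linarith) (Real.exp_pos _)]
  linarith

/-- The weight of the model operator. -/
def rhoG (α s : ℝ) : ℝ := if s < 1 then 0 else wG α (Yt s) / Real.tanh s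

lemma measurable_Yt : Measurable Yt :=
  (Real.measurable_log.comp continuous_tanh_real.measurable).neg

lemma exp_neg_neg_log_Yt {s : ℝ} (hs : 0 < s) : Real.exp (-(-Real.log (Yt s))) = Yt s := by
  rw [neg_neg, Real.exp_log (Yt_pos hs)]

lemma le_neg_log_Yt {s : ℝ} (hs : 1 ≤ s) : s ≤ -Real.log (Yt s) := by
  have := Real.log_le_log (Yt_pos (by linarith)) (Yt_le_exp_neg hs)
  rw [Real.log_exp] at this
  linarith

lemma neg_log_Yt_le {s : ℝ} (hs : 1 ≤ s) : -Real.log (Yt s) ≤ 2 * s := by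
  have := Real.log_le_log (Real.exp_pos _) (exp_le_Yt hs)
  rw [Real.log_exp] at this
  linarith

lemma two_mul_le_neg_log_Yt {s : ℝ} (hs : 1 ≤ s) : 2 * s - Real.log 4 ≤ -Real.log (Yt s) := by
  have := Real.log_le_log (Yt_pos (by linarith)) (Yt_le_exp_neg_two hs)
  rw [Real.log_mul (by norm_num) (Real.exp_pos _).ne', Real.log_exp] at this
  linarith

lemma tendsto_neg_log_Yt : Tendsto (fun s => -Real.log (Yt s)) atTop atTop :=
  tendsto_atTop_mono' _ ((eventually_ge_atTop 1).mono fun _ h => le_neg_log_Yt h) tendsto_id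

lemma tendsto_Yt : Tendsto Yt atTop (nhds 0) := by
  refine squeeze_zero' ((eventually_gt_atTop 0).mono fun _ h => (Yt_pos h).le)
    ((eventually_ge_atTop 1).mono fun _ h => Yt_le_exp_neg h) ?_
  exact Real.tendsto_exp_neg_atTop_nhds_zero

lemma exists_modelWeight {α : ℝ} (hα : 0 < α) : ∃ C, ModelWeight α C (rhoG α) := by
  obtain ⟨B, hB0, hB⟩ := exists_gI_le
  have ht1 := tanh_pos one_pos
  refine ⟨B / Real.tanh 1, ⟨?_, fun s hs => if_pos hs, fun s => ?_, fun s hs => ?_, ?_⟩⟩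
  · refine Measurable.ite measurableSet_Iio measurable_const ?_
    exact ((measurable_wG α).comp measurable_Yt).div continuous_tanh_real.measurable
  · rw [rhoG]
    split_ifs with h
    · exact le_rfl
    · have h0 : 0 < s := by linarith
      exact div_nonneg (wG_nonneg hα (Yt_pos h0).le) (tanh_pos h0).le
  · have h0 : 0 < s := by linarith
    have h1 := le_neg_log_Yt hs
    rw [rhoG, if_neg (by linarith), ← exp_neg_neg_log_Yt h0]
    have h2 := wG_exp_le hα hB (X := -Real.log (Yt s)) (by linarith)
    have h3 : (-Real.log (Yt s)) ^ (-α) ≤ s ^ (-α) :=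
      Real.rpow_le_rpow_of_nonpos h0 h1 (by linarith)
    have h4 := strictMono_tanh.monotone hs
    rw [div_mul_eq_mul_div]
    refine div_le_div₀ (by positivity) (h2.trans ?_) ht1 h4
    gcongr
  · have h1 := (tendsto_wG hα).comp tendsto_neg_log_Yt
    have h2 : Tendsto Real.tanh atTop (nhds 1) := by
      have h3 : Tendsto (fun s => Real.exp (-Yt s)) atTop (nhds (Real.exp (-0))) :=
        (Real.continuous_exp.tendsto _).comp tendsto_Yt.neg
      rw [neg_zero, Real.exp_zero] at h3
      exact h3.congr' ((eventually_gt_atTop 0).mono fun _ h => exp_neg_Yt h)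
    have h3 : Tendsto (fun s => -Real.log (Yt s) / (2 * s)) atTop (nhds 1) := by
      have h4 : Tendsto (fun s : ℝ => 1 - Real.log 4 / (2 * s)) atTop (nhds (1 - 0)) :=
        tendsto_const_nhds.sub (tendsto_const_nhds.div_atTop
          (tendsto_id.const_mul_atTop two_pos))
      rw [sub_zero] at h4
      refine tendsto_of_tendsto_of_tendsto_of_le_of_le' h4 tendsto_const_nhds ?_ ?_
      · filter_upwards [eventually_ge_atTop 1] with s hs
        have := two_mul_le_neg_log_Yt hs
        have h0 : 0 < 2 * s := by linarith
        rw [le_div_iff₀ h0]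
        field_simp
        linarith
      · filter_upwards [eventually_ge_atTop 1] with s hs
        have := neg_log_Yt_le hs
        rw [div_le_one (by linarith)]
        exact this
    have h4 := (h1.div ((Real.continuousAt_rpow_const 1 α (Or.inl one_ne_zero)).tendsto.comp h3)
      (by simp)).div h2 one_ne_zero
    rw [Real.one_rpow, div_one, div_one] at h4
    refine h4.congr' ?_
    filter_upwards [eventually_ge_atTop 1] with s hs
    have h5 := le_neg_log_Yt hs
    have h0 : 0 < s := by linarith
    simp only [Function.comp_apply, Pi.div_apply]
    rw [rhoG, if_neg (by linarith), exp_neg_neg_log_Yt h0,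
      Real.div_rpow (by linarith) (by linarith)]
    have h6 : 0 < (-Real.log (Yt s)) ^ α := Real.rpow_pos_of_pos (by linarith) _
    have h7 := (tanh_pos h0).ne'
    field_simp

end HankelEig

namespace HankelEig

lemma hasDerivAt_tanh_real (s : ℝ) : HasDerivAt Real.tanh ((Real.cosh s)⁻¹ ^ 2) s := by
  have h1 : Real.tanh = fun x => Real.sinh x / Real.cosh x := funext Real.tanh_eq_sinh_div_cosh
  rw [h1]
  have h2 := (Real.hasDerivAt_sinh s).div (Real.hasDerivAt_cosh s) (Real.cosh_pos s).ne'
  convert! h2 using 1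
  have h3 := (Real.cosh_pos s).ne'
  field_simp
  linarith [Real.cosh_sq s]

lemma hasDerivAt_Yt {s : ℝ} (hs : 0 < s) :
    HasDerivAt Yt (-((Real.cosh s)⁻¹ ^ 2 / Real.tanh s)) s :=
  ((hasDerivAt_tanh_real s).log (tanh_pos hs).ne').neg

lemma injOn_Yt : InjOn Yt (Ioi 0) := by
  intro s hs t ht h
  apply strictMono_tanh.injective
  rw [← exp_neg_Yt hs, ← exp_neg_Yt ht, h]

lemma image_Yt : Yt '' Ioi 0 = Ioi 0 := by
  ext y
  constructor
  · rintro ⟨s, hs, rfl⟩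
    exact Yt_pos hs
  · intro hy
    have hy : (0 : ℝ) < y := hy
    have h1 : Real.exp (-y) < 1 := Real.exp_lt_one_iff.2 (by linarith)
    have h2 : 0 < Real.exp (-y) := Real.exp_pos _
    refine ⟨Real.artanh (Real.exp (-y)), Real.artanh_pos ⟨h2, h1⟩, ?_⟩
    rw [Yt, Real.tanh_artanh ⟨by linarith, h1⟩, Real.log_exp, neg_neg]

/-- The integrand of the moments. -/
def Fm (α : ℝ) (m : ℕ) (s : ℝ) : ℝ :=
  (Real.cosh s)⁻¹ ^ 2 * Real.tanh s ^ m * (wG α (Yt s) / Real.tanh s)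

lemma Fm_eq (α : ℝ) (m : ℕ) {s : ℝ} (hs : 0 < s) :
    |(-((Real.cosh s)⁻¹ ^ 2 / Real.tanh s))| • (Real.exp (-(m * Yt s)) * wG α (Yt s)) =
      Fm α m s := by
  have h1 := tanh_pos hs
  have h2 : Real.exp (-(m * Yt s)) = Real.tanh s ^ m := by
    rw [← exp_neg_Yt hs, ← Real.exp_nat_mul, mul_neg]
  rw [abs_neg, abs_of_nonneg (by positivity), h2, Fm, smul_eq_mul]
  ring

lemma integral_Fm {α : ℝ} (hα : 0 < α) {m : ℕ} (hm : 2 ≤ m) :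
    IntegrableOn (Fm α m) (Ioi 0) ∧
      ∫ s in Ioi (0 : ℝ), Fm α m s = (m : ℝ)⁻¹ * Real.log m ^ (-α) := by
  have hm1 : (1 : ℝ) < m := by exact_mod_cast hm
  obtain ⟨h1, h2⟩ := laplace_wG hα hm1
  have hd : ∀ s ∈ Ioi (0 : ℝ), HasDerivWithinAt Yt (-((Real.cosh s)⁻¹ ^ 2 / Real.tanh s))
      (Ioi 0) s := fun s hs => (hasDerivAt_Yt hs).hasDerivWithinAt
  have h3 := integrableOn_image_iff_integrableOn_abs_deriv_smul measurableSet_Ioi hd injOn_Yt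
    (fun y => Real.exp (-(m * y)) * wG α y)
  have h4 := integral_image_eq_integral_abs_deriv_smul measurableSet_Ioi hd injOn_Yt
    (fun y => Real.exp (-(m * y)) * wG α y)
  rw [image_Yt] at h3 h4
  refine ⟨(h3.1 h1).congr_fun (fun s hs => Fm_eq α m hs) measurableSet_Ioi, ?_⟩
  rw [← h2, h4]
  exact (setIntegral_congr_fun measurableSet_Ioi fun s hs => Fm_eq α m hs).symm

/-- The moments of the model weight. -/
def mom (α : ℝ) (m : ℕ) : ℝ := ∫ s, rhoG α s * ((Real.cosh s)⁻¹ ^ 2 * Real.tanh s ^ m)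

lemma exists_mom {α : ℝ} (hα : 0 < α) : ∃ K q : ℝ, 0 < q ∧ q < 1 ∧ ∀ m : ℕ, 2 ≤ m →
    |(m : ℝ)⁻¹ * Real.log m ^ (-α) - mom α m| ≤ K * q ^ m := by
  have hq := tanh_pos one_pos
  refine ⟨(∫ s in Ioo (0 : ℝ) 1, Fm α 2 s) / Real.tanh 1 ^ 2, Real.tanh 1, hq,
    Real.tanh_lt_one 1, fun m hm => ?_⟩
  obtain ⟨h1, h2⟩ := integral_Fm hα hm
  obtain ⟨h3, -⟩ := integral_Fm hα le_rfl
  have hU : Ioi (0 : ℝ) = Ioo 0 1 ∪ Ici 1 := by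
    ext s
    simp only [mem_Ioi, mem_union, mem_Ioo, mem_Ici]
    constructor
    · intro h
      rcases lt_or_ge s 1 with h' | h'
      exacts [Or.inl ⟨h, h'⟩, Or.inr h']
    · rintro (h | h)
      exacts [h.1, by linarith]
  have hs1 : Ioo (0 : ℝ) 1 ⊆ Ioi 0 := fun s hs => hs.1
  have hs2 : Ici (1 : ℝ) ⊆ Ioi 0 := fun s hs => one_pos.trans_le (mem_Ici.1 hs)
  have hdisj : Disjoint (Ioo (0 : ℝ) 1) (Ici 1) := by
    rw [Set.disjoint_left]
    intro s hs hs'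
    exact absurd hs.2 (not_lt.2 hs')
  have h4 : mom α m = ∫ s in Ici (1 : ℝ), Fm α m s := by
    rw [← integral_indicator measurableSet_Ici, mom]
    refine integral_congr_ae (Eventually.of_forall fun s => ?_)
    simp only [rhoG, indicator_apply, mem_Ici, Fm]
    by_cases h : s < 1
    · rw [if_pos h, if_neg (not_le.2 h), zero_mul]
    · rw [if_neg h, if_pos (not_lt.1 h)]
      ring
  rw [hU, setIntegral_union hdisj measurableSet_Ici (h1.mono_set hs1) (h1.mono_set hs2),
    ← h4] at h2
  have hnn : ∀ s ∈ Ioo (0 : ℝ) 1, 0 ≤ Fm α m s := by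
    intro s hs
    have := tanh_pos hs.1
    have := wG_nonneg hα (Yt_pos hs.1).le
    unfold Fm
    positivity
  rw [← h2, add_sub_cancel_right, abs_of_nonneg (setIntegral_nonneg measurableSet_Ioo hnn),
    div_mul_eq_mul_div, le_div_iff₀ (by positivity), ← integral_mul_const, ← integral_mul_const]
  refine setIntegral_mono_on ((h1.mono_set hs1).mul_const _) ((h3.mono_set hs1).mul_const _)
    measurableSet_Ioo fun s hs => ?_
  have ht := tanh_pos hs.1
  have hw := wG_nonneg hα (Yt_pos hs.1).le
  obtain ⟨k, rfl⟩ := Nat.exists_eq_add_of_le hm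
  have h5 : Real.tanh s ^ k ≤ Real.tanh 1 ^ k :=
    pow_le_pow_left₀ ht.le (strictMono_tanh.monotone hs.2.le) k
  unfold Fm
  calc _ = (Real.cosh s)⁻¹ ^ 2 * Real.tanh s ^ 2 * (wG α (Yt s) / Real.tanh s) *
        (Real.tanh s ^ k * Real.tanh 1 ^ 2) := by ring
    _ ≤ (Real.cosh s)⁻¹ ^ 2 * Real.tanh s ^ 2 * (wG α (Yt s) / Real.tanh s) *
        (Real.tanh 1 ^ k * Real.tanh 1 ^ 2) := by gcongr
    _ = _ := by ring

lemma abs_iterDiff_le_geometric {r : ℕ → ℝ} {K q : ℝ} {j₀ : ℕ} (hq : q ≤ 1)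
    (h : ∀ j, j₀ ≤ j → |r j| ≤ K * q ^ j) (m : ℕ) :
    ∀ j, j₀ ≤ j → |iterDiff r m j| ≤ 2 ^ m * K * q ^ j := by
  induction m with
  | zero =>
    intro j hj
    simpa [iterDiff] using h j hj
  | succ m ih =>
    intro j hj
    have h1 := ih j hj
    have h2 := ih (j + 1) (by omega)
    have h3 : 2 ^ m * K * q ^ (j + 1) ≤ 2 ^ m * K * q ^ j := by
      have h4 : 0 ≤ 2 ^ m * K * q ^ j := (abs_nonneg _).trans h1
      rw [pow_succ, ← mul_assoc]
      exact mul_le_of_le_one_right h4 hq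
    simp only [iterDiff]
    calc _ ≤ |iterDiff r m (j + 1)| + |iterDiff r m j| := abs_sub _ _
      _ ≤ 2 ^ m * K * q ^ j + 2 ^ m * K * q ^ j := add_le_add (h2.trans h3) h1
      _ = _ := by ring

lemma Cls.of_geometric {α : ℝ} (hα : 0 < α) (N : ℕ) {r : ℕ → ℝ} {K q : ℝ} {j₀ : ℕ} (hq0 : 0 < q)
    (hq : q < 1) (h : ∀ j, j₀ ≤ j → |r j| ≤ K * q ^ j) : Cls α N r := by
  intro m _ δ hδ
  set p := m + 1 + ⌈α⌉₊ with hp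
  have h1 := (tendsto_pow_const_mul_const_pow_of_abs_lt_one p (r := q)
    (by rwa [abs_of_nonneg hq0.le])).const_mul (2 ^ m * K)
  rw [mul_zero] at h1
  filter_upwards [h1.eventually_lt_const hδ, eventually_ge_atTop j₀, eventually_ge_atTop 2]
    with j h2 h3 h4
  have hj : (1 : ℝ) < j := by exact_mod_cast h4
  have hj0 : (0 : ℝ) < j := by linarith
  have hl : 0 < Real.log j := Real.log_pos hj
  refine (abs_iterDiff_le_geometric hq.le h m j h3).trans ?_
  have h5 : (j : ℝ) ^ (-(p : ℝ)) ≤ (j : ℝ) ^ (-1 - (m : ℝ)) * Real.log j ^ (-α) := by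
    have h6 : (j : ℝ) ^ (-(⌈α⌉₊ : ℝ)) ≤ Real.log j ^ (-α) := by
      calc (j : ℝ) ^ (-(⌈α⌉₊ : ℝ)) ≤ (j : ℝ) ^ (-α) :=
            Real.rpow_le_rpow_of_exponent_le hj.le (neg_le_neg (Nat.le_ceil _))
        _ ≤ _ := Real.rpow_le_rpow_of_nonpos hl (Real.log_le_self hj0.le) (by linarith)
    have h7 : -(p : ℝ) = (-1 - (m : ℝ)) + -(⌈α⌉₊ : ℝ) := by
      rw [hp]
      push_cast
      ring
    rw [h7, Real.rpow_add hj0]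
    gcongr
  have h8 : (j : ℝ) ^ p * (j : ℝ) ^ (-(p : ℝ)) = 1 := by
    rw [Real.rpow_neg hj0.le, Real.rpow_natCast]
    exact mul_inv_cancel₀ (by positivity)
  calc 2 ^ m * K * q ^ j = (2 ^ m * K * ((j : ℝ) ^ p * q ^ j)) * (j : ℝ) ^ (-(p : ℝ)) := by
        linear_combination (-(2 ^ m * K * q ^ j)) * h8
    _ ≤ δ * (j : ℝ) ^ (-(p : ℝ)) := by gcongr
    _ ≤ δ * ((j : ℝ) ^ (-1 - (m : ℝ)) * Real.log j ^ (-α)) := by gcongr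
    _ = _ := by ring

end HankelEig

namespace HankelEig

section Continuity

variable {E : Type*} [NormedAddCommGroup E] [InnerProductSpace ℂ E] [CompleteSpace E]

lemma abs_sq_sub_sq_le {a b c t : ℝ} (ha : 0 ≤ a) (hb : 0 ≤ b) (hc : |a - b| ≤ c) (ht : 0 < t) :
    |a ^ 2 - b ^ 2| ≤ (1 + 1 / t) * c ^ 2 + t * b ^ 2 := by
  have hc0 : 0 ≤ c := (abs_nonneg _).trans hc
  have h1 : 2 * b * c ≤ 1 / t * c ^ 2 + t * b ^ 2 := by
    have h2 : 1 / t * c ^ 2 + t * b ^ 2 - 2 * b * c = 1 / t * (c - t * b) ^ 2 := by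
      field_simp
      ring
    have h3 : 0 ≤ 1 / t * (c - t * b) ^ 2 := by positivity
    linarith
  obtain ⟨h2, h3⟩ := abs_le.1 hc
  rw [abs_le]
  constructor <;> nlinarith

lemma SechFamily.continuous_mq {kv : ℝ → E} (hk : SechFamily kv) {α C : ℝ} {ρ : ℝ → ℝ}
    (hα : 0 < α) (hρ : ModelWeight α C ρ) (κp κm : ℝ) : Continuous (mq kv ρ κp κm) := by
  set M := (|κp| + |κm|) * C with hM
  have hM0 : 0 ≤ M := mul_nonneg (by positivity) hρ.C_nonneg
  have key : ∀ u v : E, |mq kv ρ κp κm u - mq kv ρ κp κm v| ≤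
      4 * M * (‖u - v‖ ^ 2 + ‖u - v‖ + ‖u - v‖ * ‖v‖ ^ 2) := by
    intro u v
    rcases eq_or_ne u v with rfl | h
    · simp
    have hd : 0 < ‖u - v‖ := norm_pos_iff.2 (sub_ne_zero.2 h)
    set d := ‖u - v‖
    have hi := hρ.integrable_sg_mul hα κp κm (hk.integrable u)
    have hi' := hρ.integrable_sg_mul hα κp κm (hk.integrable v)
    have hI := ((hk.integrable (u - v)).const_mul (1 + 1 / d)).add ((hk.integrable v).const_mul d)
    calc |mq kv ρ κp κm u - mq kv ρ κp κm v|
        = ‖∫ s, (sg ρ κp κm s * ‖inner ℂ (kv s) u‖ ^ 2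
            - sg ρ κp κm s * ‖inner ℂ (kv s) v‖ ^ 2)‖ := by
          rw [integral_sub hi hi']
          rfl
      _ ≤ ∫ s, M * ((1 + 1 / d) * ‖inner ℂ (kv s) (u - v)‖ ^ 2
            + d * ‖inner ℂ (kv s) v‖ ^ 2) := by
          refine norm_integral_le_of_norm_le (hI.const_mul M) (ae_of_all _ fun s => ?_)
          rw [← mul_sub, Real.norm_eq_abs, abs_mul]
          refine mul_le_mul (hρ.abs_sg_le hα κp κm s) ?_ (abs_nonneg _) hM0
          refine abs_sq_sub_sq_le (norm_nonneg _) (norm_nonneg _) ?_ hd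
          rw [inner_sub_right]
          exact abs_norm_sub_norm_le _ _
      _ = M * ((1 + 1 / d) * (∫ s, ‖inner ℂ (kv s) (u - v)‖ ^ 2)
            + d * ∫ s, ‖inner ℂ (kv s) v‖ ^ 2) := by
          rw [integral_const_mul, integral_add ((hk.integrable (u - v)).const_mul _)
            ((hk.integrable v).const_mul _), integral_const_mul, integral_const_mul]
      _ ≤ M * ((1 + 1 / d) * (4 * d ^ 2) + d * (4 * ‖v‖ ^ 2)) := by
          have h1 := hk.integral_le (u - v)
          have h2 := hk.integral_le v
          gcongr
      _ = _ := by
          field_simp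
  refine continuous_iff_continuousAt.2 fun v => ?_
  rw [ContinuousAt, tendsto_iff_norm_sub_tendsto_zero]
  have h : Continuous fun u : E => 4 * M * (‖u - v‖ ^ 2 + ‖u - v‖ + ‖u - v‖ * ‖v‖ ^ 2) := by
    fun_prop
  have h0 := h.tendsto v
  simp only [sub_self, norm_zero] at h0
  refine squeeze_zero (fun u => norm_nonneg _) (fun u => key u v) (h0.trans (le_of_eq ?_))
  simp

end Continuity

lemma continuous_apply_ellTwo (j : ℕ) : Continuous fun u : ellTwo => u j :=
  (lp.evalCLM ℂ (fun _ : ℕ => ℂ) 2 j).continuous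

lemma continuous_hsum (e : ℕ → ℝ) (J : ℕ) : Continuous fun u : ellTwo => hsum e J u := by
  unfold hsum
  refine Complex.continuous_re.comp (continuous_finsetSum _ fun j _ =>
    continuous_finsetSum _ fun l _ => ?_)
  exact (continuous_const.mul (RCLike.continuous_conj.comp (continuous_apply_ellTwo j))).mul
    (continuous_apply_ellTwo l)

lemma continuous_form (G : ellTwo →L[ℂ] ellTwo) :
    Continuous fun u : ellTwo => (inner ℂ (G u) u).re :=
  Complex.continuous_re.comp (G.continuous.inner continuous_id)

/-- Closed conditions pass from finitely supported vectors to all vectors. -/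
lemma le_of_finite_support {f g : ellTwo → ℝ} (hf : Continuous f) (hg : Continuous g)
    (h : ∀ (J : ℕ) (u : ellTwo), (∀ j, J ≤ j → (u : ℕ → ℂ) j = 0) → f u ≤ g u) (u : ellTwo) :
    f u ≤ g u := by
  have h1 : Tendsto (fun J => ∑ j ∈ Finset.range J, lp.single 2 j (u j)) atTop (nhds u) :=
    (lp.hasSum_single (by norm_num) u).tendsto_sum_nat
  refine le_of_tendsto_of_tendsto' ((hf.tendsto u).comp h1) ((hg.tendsto u).comp h1) fun J => ?_
  refine h J _ fun j hj => ?_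
  have := fv_apply J (fun j => u j) j
  rw [fv, if_neg (not_lt.2 hj)] at this
  exact this

lemma form_eq_hsum {g : ℕ → ℝ} {G : ellTwo →L[ℂ] ellTwo}
    (hG : IsHankelD (fun j => ((g j : ℝ) : ℂ)) G) {J : ℕ} {u : ellTwo}
    (hu : ∀ j, J ≤ j → (u : ℕ → ℂ) j = 0) : (inner ℂ (G u) u).re = hsum g J u := by
  have h1 : ∀ j, (G u : ℕ → ℂ) j = ∑ k ∈ Finset.range J, (g (j + k) : ℂ) * (u : ℕ → ℂ) k := by
    intro j
    rw [hG u j]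
    refine tsum_eq_sum fun k hk => ?_
    rw [hu k (by simpa using hk), mul_zero]
  rw [lp.inner_eq_tsum, tsum_eq_sum (s := Finset.range J), hsum, Finset.sum_comm]
  · congr 1
    refine Finset.sum_congr rfl fun j _ => ?_
    rw [h1, RCLike.inner_apply, map_sum, Finset.mul_sum]
    refine Finset.sum_congr rfl fun k _ => ?_
    rw [map_mul, Complex.conj_ofReal, add_comm j k]
    ring
  · intro j hj
    rw [hu j (by simpa using hj), inner_zero_right]

lemma integrable_cosh_tanh (m : ℕ) :
    Integrable fun s => (Real.cosh s)⁻¹ ^ 2 * Real.tanh s ^ m := by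
  have h0 : Integrable fun s => (Real.cosh s)⁻¹ := by simpa using integrable_inv_cosh_sub 0
  refine h0.mono' ?_ (ae_of_all _ fun s => ?_)
  · have h1 : Continuous fun s => (Real.cosh s)⁻¹ := by simpa using continuous_inv_cosh_sub 0
    exact ((h1.pow 2).mul (continuous_tanh_real.pow m)).aestronglyMeasurable
  · have h1 : (Real.cosh s)⁻¹ ≤ 1 := inv_le_one_of_one_le₀ (Real.one_le_cosh s)
    have h2 : 0 ≤ (Real.cosh s)⁻¹ := inv_nonneg.2 (Real.cosh_pos s).le
    have h3 : ‖Real.tanh s ^ m‖ ≤ 1 := by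
      rw [norm_pow]
      exact pow_le_one₀ (norm_nonneg _) (Real.abs_tanh_lt_one s).le
    rw [norm_mul, Real.norm_of_nonneg (by positivity)]
    calc (Real.cosh s)⁻¹ ^ 2 * ‖Real.tanh s ^ m‖ ≤ (Real.cosh s)⁻¹ ^ 2 * 1 := by gcongr
      _ ≤ (Real.cosh s)⁻¹ := by nlinarith

lemma integral_sg_cosh_tanh {α : ℝ} (hα : 0 < α) (κp κm : ℝ) (m : ℕ) :
    ∫ s, sg (rhoG α) κp κm s * ((Real.cosh s)⁻¹ ^ 2 * Real.tanh s ^ m) =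
      (κp + (-1) ^ m * κm) * mom α m := by
  obtain ⟨C, hC⟩ := exists_modelWeight hα
  have h0 := integrable_cosh_tanh m
  have h1 : Integrable fun s => rhoG α s * ((Real.cosh s)⁻¹ ^ 2 * Real.tanh s ^ m) := by
    have := hC.integrable_sg_mul hα 1 0 h0
    simpa [sg] using this
  have h2 : ∀ s, sg (rhoG α) κp κm s * ((Real.cosh s)⁻¹ ^ 2 * Real.tanh s ^ m) =
      κp * (rhoG α s * ((Real.cosh s)⁻¹ ^ 2 * Real.tanh s ^ m)) + (-1) ^ m * κm *
        (rhoG α (-s) * ((Real.cosh (-s))⁻¹ ^ 2 * Real.tanh (-s) ^ m)) := by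
    intro s
    have h3 : ((-1 : ℝ) ^ m) * (-1) ^ m = 1 := by
      rw [← mul_pow]
      simp
    rw [sg, Real.cosh_neg, Real.tanh_neg, neg_pow]
    linear_combination (-κm * rhoG α (-s) * (Real.cosh s)⁻¹ ^ 2 * Real.tanh s ^ m) * h3
  simp_rw [h2]
  rw [integral_add (h1.const_mul _) (h1.comp_neg.const_mul _), integral_const_mul,
    integral_const_mul,
    integral_neg_eq_self (fun s => rhoG α s * ((Real.cosh s)⁻¹ ^ 2 * Real.tanh s ^ m)), mom]
  ring

lemma mq_eq_hsum {α : ℝ} (hα : 0 < α) (κp κm : ℝ) {J : ℕ} {u : ellTwo}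
    (hu : ∀ j, J ≤ j → (u : ℕ → ℂ) j = 0) :
    mq kvec (rhoG α) κp κm u = hsum (fun m => (κp + (-1) ^ m * κm) * mom α m) J u := by
  obtain ⟨C, hC⟩ := exists_modelWeight hα
  have hre : ∀ (e : ℕ → ℝ), hsum e J u = ∑ j ∈ Finset.range J, ∑ l ∈ Finset.range J,
      e (j + l) * ((starRingEnd ℂ) ((u : ℕ → ℂ) j) * (u : ℕ → ℂ) l).re := by
    intro e
    rw [hsum, Complex.re_sum]
    refine Finset.sum_congr rfl fun j _ => ?_
    rw [Complex.re_sum]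
    refine Finset.sum_congr rfl fun l _ => ?_
    rw [mul_assoc, Complex.re_ofReal_mul]
  have hi : ∀ m, Integrable fun s =>
      sg (rhoG α) κp κm s * ((Real.cosh s)⁻¹ ^ 2 * Real.tanh s ^ m) :=
    fun m => hC.integrable_sg_mul hα κp κm (integrable_cosh_tanh m)
  rw [hre, mq]
  simp only [norm_inner_kvec_sq hu, hre, Finset.mul_sum]
  simp only [← mul_assoc (sg _ _ _ _) ((Real.cosh _)⁻¹ ^ 2 * Real.tanh _ ^ _)]
  rw [integral_finsetSum _ fun j _ => integrable_finsetSum _ fun l _ => (hi _).mul_const _]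
  refine Finset.sum_congr rfl fun j _ => ?_
  rw [integral_finsetSum _ fun l _ => (hi _).mul_const _]
  refine Finset.sum_congr rfl fun l _ => ?_
  rw [integral_mul_const, integral_sg_cosh_tanh hα]

end HankelEig

namespace HankelEig

lemma Cls.add {α : ℝ} {N : ℕ} {e f : ℕ → ℝ} (he : Cls α N e) (hf : Cls α N f) :
    Cls α N fun j => e j + f j := by
  intro m hm δ hδ
  filter_upwards [he m hm (δ / 2) (half_pos hδ), hf m hm (δ / 2) (half_pos hδ)] with j h1 h2
  rw [iterDiff_add]
  refine (abs_add_le _ _).trans ((add_le_add h1 h2).trans (le_of_eq ?_))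
  ring

lemma Cls.const_mul {α : ℝ} {N : ℕ} {e : ℕ → ℝ} (he : Cls α N e) (c : ℝ) :
    Cls α N fun j => c * e j := by
  intro m hm δ hδ
  have hc : 0 < |c| + 1 := by positivity
  filter_upwards [he m hm (δ / (|c| + 1)) (by positivity)] with j h1
  rw [iterDiff_const_mul, abs_mul]
  calc |c| * |iterDiff e m j| ≤ (|c| + 1) * |iterDiff e m j| := by gcongr; linarith
    _ ≤ (|c| + 1) * (δ / (|c| + 1) * (j : ℝ) ^ (-1 - (m : ℝ)) * Real.log j ^ (-α)) := by gcongr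
    _ = _ := by field_simp

lemma Cls.of_isLittleO {α : ℝ} (hα : 0 < α) {N : ℕ} {e : ℕ → ℝ}
    (he : ∀ m : ℕ, m ≤ N → (fun j : ℕ => iterDiff e m j) =o[atTop]
        fun j : ℕ => (j : ℝ) ^ (-1 - (m : ℝ)) * (1 + Real.log j ^ 2) ^ (-α / 2)) :
    Cls α N e := by
  intro m hm δ hδ
  filter_upwards [(he m hm).def hδ, eventually_ge_atTop 2] with j h1 h2
  have hj : (1 : ℝ) < j := by exact_mod_cast h2
  have hl := Real.log_pos hj
  rw [Real.norm_eq_abs, Real.norm_of_nonneg (by positivity)] at h1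
  have h3 : (1 + Real.log j ^ 2) ^ (-α / 2) ≤ Real.log j ^ (-α) := by
    calc (1 + Real.log j ^ 2) ^ (-α / 2) ≤ (Real.log j ^ 2) ^ (-α / 2) :=
          Real.rpow_le_rpow_of_nonpos (by positivity) (by linarith) (by linarith)
      _ = Real.log j ^ (-α) := by
          rw [← Real.rpow_natCast, ← Real.rpow_mul hl.le]
          congr 1
          push_cast
          ring
  calc _ ≤ _ := h1
    _ ≤ δ * ((j : ℝ) ^ (-1 - (m : ℝ)) * Real.log j ^ (-α)) := by gcongr
    _ = _ := by ring

lemma remainder_UB {α : ℝ} (hα : 0 < α) {e e' f : ℕ → ℝ} (he : Cls α (Nal α) e)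
    (he' : Cls α (Nal α) e') (hf : ∀ j, 2 ≤ j → f j = 0) {R : ellTwo → ℝ} (hR : Continuous R)
    (hfin : ∀ (J : ℕ) (u : ellTwo), (∀ j, J ≤ j → (u : ℕ → ℂ) j = 0) →
      R u = hsum (fun j => e j + (-1) ^ j * e' j + f j) J u) {δ : ℝ} (hδ : 0 < δ) :
    ∀ᶠ n : ℕ in atTop, UB R (δ * n) (δ * (n : ℝ) ^ (-α)) := by
  set δ' := δ / 11 with hδ'
  have hδ'0 : 0 < δ' := by positivity
  have h2 : ∀ᶠ n : ℕ in atTop, 2 / δ' ≤ (n : ℝ) :=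
    tendsto_natCast_atTop_atTop.eventually_ge_atTop _
  filter_upwards [exists_approx hα he (ω := 1) (by simp) hδ'0,
    exists_approx hα he' (ω := -1) (by simp) hδ'0, h2, eventually_gt_atTop 0] with n h3 h4 h5 hn
  obtain ⟨f₁, J₁, hs₁, hU₁, hd₁⟩ := h3
  obtain ⟨f₂, J₂, hs₂, hU₂, hd₂⟩ := h4
  have hn' : (0 : ℝ) < n := by exact_mod_cast hn
  set ν := (n : ℝ) ^ (-α) with hν
  have hν0 : 0 < ν := Real.rpow_pos_of_pos hn' _
  have hU₃ := (FT_finite f 2).toUB (l := δ' * ν) (by positivity)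
  have hU₄ : UB (fun u : ellTwo => 8 * δ' * ν * ‖u‖ ^ 2) 0 (8 * δ' * ν) := UB.of_le fun u => le_rfl
  have hU := ((hU₁.add hU₂).add hU₃).add hU₄
  refine hU.mono (fun u => ?_) ?_ (le_of_eq ?_)
  · refine le_of_finite_support (g := fun u : ellTwo => hsum (fun j => 1 ^ j * f₁ j) J₁ u
      + hsum (fun j => (-1) ^ j * f₂ j) J₂ u + hsum f 2 u + 8 * δ' * ν * ‖u‖ ^ 2) hR ?_
      (fun J v hv => ?_) u
    · exact (((continuous_hsum _ _).add (continuous_hsum _ _)).add (continuous_hsum _ _)).add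
        (continuous_const.mul (continuous_norm.pow 2))
    · set J' := max (max J J₁) (max J₂ 2) with hJ'
      have e0 : R v = hsum (fun j => e j + (-1) ^ j * e' j + f j) J' v := by
        rw [hfin J v hv]
        exact (hsum_eq_of_support' hv (by omega)).symm
      have e1 : hsum (fun j => 1 ^ j * f₁ j) J₁ v = hsum (fun j => 1 ^ j * f₁ j) J' v :=
        (hsum_eq_of_support (fun j hj => by rw [hs₁ j hj, mul_zero]) v (by omega)).symm
      have e2 : hsum (fun j => (-1) ^ j * f₂ j) J₂ v = hsum (fun j => (-1) ^ j * f₂ j) J' v :=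
        (hsum_eq_of_support (fun j hj => by rw [hs₂ j hj, mul_zero]) v (by omega)).symm
      have e3 : hsum f 2 v = hsum f J' v := (hsum_eq_of_support hf v (by omega)).symm
      have e4 : (fun j => e j + (-1) ^ j * e' j + f j) = fun j => 1 ^ j * f₁ j + (-1) ^ j * f₂ j
          + f j + ((e j - f₁ j) + (-1) ^ j * (e' j - f₂ j)) := by
        funext j
        rw [one_pow]
        ring
      have e5 := hsum_le_of_le (c := 2 * δ' * ν) (by positivity)
        (e := fun j => (e j - f₁ j) + (-1) ^ j * (e' j - f₂ j)) (fun j => by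
          refine (abs_add_le _ _).trans ?_
          rw [abs_mul, abs_pow, abs_neg, abs_one, one_pow, one_mul]
          refine (add_le_add (hd₁ j) (hd₂ j)).trans (le_of_eq ?_)
          ring) J' v
      beta_reduce
      rw [e0, e1, e2, e3, e4, hsum_add, hsum_add, hsum_add]
      have := (abs_le.1 e5).2
      linarith
  · rw [div_le_iff₀ hδ'0] at h5
    have : δ = 11 * δ' := by rw [hδ']; ring
    rw [this, zero_div]
    push_cast
    nlinarith
  · rw [hδ']
    ring

end HankelEig

namespace HankelEig

lemma LB_zero (m : ℕ) : LB (fun _ : ellTwo => 0) m 0 := by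
  set b : Fin m → ellTwo := fun i => lp.single 2 (i : ℕ) (1 : ℂ) with hb
  have hbo : Orthonormal ℂ b := by
    rw [orthonormal_iff_ite]
    intro i j
    rw [hb, lp.inner_single_left, lp.single_apply, Pi.single_apply]
    simp [Fin.val_inj]
  refine ⟨Submodule.span ℂ (range b), FiniteDimensional.span_of_finite ℂ (finite_range b), ?_,
    fun u _ => by simp⟩
  rw [finrank_span_eq_card hbo.linearIndependent, Fintype.card_fin]

lemma mq_neg {E : Type*} [NormedAddCommGroup E] [InnerProductSpace ℂ E] [CompleteSpace E]
    (kv : ℝ → E) (ρ : ℝ → ℝ) (κp κm : ℝ) (u : E) : mq kv ρ (-κp) (-κm) u = -mq kv ρ κp κm u := by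
  rw [mq, mq, ← integral_neg]
  congr 1
  funext s
  simp only [sg]
  ring

lemma form_neg (G : ellTwo →L[ℂ] ellTwo) (u : ellTwo) :
    (inner ℂ ((-G) u) u).re = -(inner ℂ (G u) u).re := by
  simp

lemma IsHankelD.neg {g : ℕ → ℝ} {G : ellTwo →L[ℂ] ellTwo}
    (hG : IsHankelD (fun j => ((g j : ℝ) : ℂ)) G) :
    IsHankelD (fun j => (((-1 * g j : ℝ)) : ℂ)) (-G) := by
  intro u j
  have h : ((-G) u : ℕ → ℂ) j = -(G u : ℕ → ℂ) j := rfl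
  rw [h, hG u j, ← tsum_neg]
  congr 1
  funext k
  push_cast
  ring

/-- The hypotheses of the main theorem, with the symbol classes `Cls`. -/
structure HankelData (α κ κ' : ℝ) (g e e' : ℕ → ℝ) (G : ellTwo →L[ℂ] ellTwo) : Prop where
  rep : ∀ j : ℕ, 2 ≤ j →
    g j = (κ + (-1 : ℝ) ^ j * κ') * (j : ℝ)⁻¹ * Real.log j ^ (-α) + e j + (-1 : ℝ) ^ j * e' j
  cls : Cls α (Nal α) e
  cls' : Cls α (Nal α) e'
  hankel : IsHankelD (fun j => ((g j : ℝ) : ℂ)) G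

namespace HankelData

variable {α κ κ' : ℝ} {g e e' : ℕ → ℝ} {G : ellTwo →L[ℂ] ellTwo} (h : HankelData α κ κ' g e e' G)
include h

lemma neg : HankelData α (-κ) (-κ') (fun j => -1 * g j) (fun j => -1 * e j) (fun j => -1 * e' j)
    (-G) where
  rep j hj := by
    rw [h.rep j hj]
    ring
  cls := h.cls.const_mul _
  cls' := h.cls'.const_mul _
  hankel := IsHankelD.neg h.hankel

lemma UB_sub_mq (hα : 0 < α) {δ : ℝ} (hδ : 0 < δ) : ∀ᶠ n : ℕ in atTop,
    UB (fun u => (inner ℂ (G u) u).re - mq kvec (rhoG α) κ κ' u) (δ * n) (δ * (n : ℝ) ^ (-α)) := by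
  obtain ⟨C, hC⟩ := exists_modelWeight hα
  obtain ⟨K, q, hq0, hq1, hK⟩ := exists_mom hα
  have hr : Cls α (Nal α) fun j : ℕ => (j : ℝ)⁻¹ * Real.log j ^ (-α) - mom α j :=
    Cls.of_geometric hα _ hq0 hq1 hK
  set r := fun j : ℕ => (j : ℝ)⁻¹ * Real.log j ^ (-α) - mom α j with hrdef
  refine remainder_UB hα (h.cls.add (hr.const_mul κ)) (h.cls'.add (hr.const_mul κ'))
    (f := fun j => g j - (κ + (-1) ^ j * κ') * mom α j - (e j + κ * r j)
      - (-1) ^ j * (e' j + κ' * r j)) (fun j hj => ?_)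
    ((continuous_form G).sub (sechFamily_kvec.continuous_mq hα hC κ κ')) (fun J u hu => ?_) hδ
  · rw [h.rep j hj, hrdef]
    ring
  · rw [Pi.sub_apply, form_eq_hsum h.hankel hu, mq_eq_hsum hα κ κ' hu, sub_eq_iff_eq_add, ← hsum_add]
    congr 1
    funext j
    ring

lemma UB_form (hα : 0 < α) {μ x δ : ℝ} (hμ : 0 < μ) (hx : cnt α (max κ 0) (max κ' 0) μ < x)
    (hδ : 0 < δ) : ∀ᶠ n : ℕ in atTop,
    UB (fun u => (inner ℂ (G u) u).re) ((x + δ) * n) ((μ + δ) * (n : ℝ) ^ (-α)) := by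
  obtain ⟨C, hC⟩ := exists_modelWeight hα
  filter_upwards [h.UB_sub_mq hα hδ,
    sechFamily_kvec.UB_mq hα hC (sechFamily_kvec.lowUB hα hC) hμ hx] with n h1 h2
  refine (h2.add h1).mono (fun u => le_of_eq ?_) (le_of_eq ?_) (le_of_eq ?_) <;> ring

lemma LB_form (hα : 0 < α) {μ y δ : ℝ} (hμ : 0 < μ) (hy : y < cnt α (max κ 0) (max κ' 0) μ)
    (hδ : 0 < δ) : ∀ᶠ n : ℕ in atTop,
    LB (fun u => (inner ℂ (G u) u).re) ((y - δ) * n) ((μ - δ) * (n : ℝ) ^ (-α)) := by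
  obtain ⟨C, hC⟩ := exists_modelWeight hα
  filter_upwards [h.neg.UB_sub_mq hα hδ, sechFamily_kvec.LB_mq hα hC hμ hy] with n h1 h2
  have h3 := h2.sub h1
  rw [← sub_mul, ← sub_mul] at h3
  refine h3.mono (fun u => le_of_eq ?_) le_rfl le_rfl
  rw [form_neg, mq_neg]
  ring

lemma neg_le_posEig (hα : 0 < α) {δ : ℝ} (hδ : 0 < δ) :
    ∀ᶠ n : ℕ in atTop, -δ * (n : ℝ) ^ (-α) ≤ posEig G n := by
  have h1 := h.neg.UB_form hα (half_pos hδ) (lt_add_one _) (half_pos hδ)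
  filter_upwards [h1, eventually_gt_atTop 0] with n h2 hn
  set X := (cnt α (max (-κ) 0) (max (-κ') 0) (δ / 2) + 1 + δ / 2) * n
  have h3 := (LB_zero (n + ⌈X⌉₊)).sub h2
  rw [add_halves, zero_sub, ← neg_mul] at h3
  refine le_posEig G hn ?_ (h3.mono (fun u => le_of_eq ?_) le_rfl le_rfl)
  · have := Nat.le_ceil X
    push_cast
    linarith
  · rw [form_neg]
    ring

end HankelData

lemma cnt_eq {α a b μ : ℝ} (hα : 0 < α) (ha : 0 ≤ a) (hb : 0 ≤ b) (hμ : 0 < μ) :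
    cnt α a b μ = (tauC α * (a ^ (1 / α) + b ^ (1 / α)) ^ α / μ) ^ (1 / α) := by
  have hc := cInt_pos hα
  have hS : 0 ≤ a ^ (1 / α) + b ^ (1 / α) := by positivity
  rw [← cInt_rpow hα, ← Real.mul_rpow hc.le hS, div_eq_mul_inv,
    Real.mul_rpow (by positivity) (by positivity), ← Real.rpow_mul (by positivity),
    mul_one_div_cancel hα.ne', Real.rpow_one, cnt, one_div μ]
  ring

theorem HankelData.posEig_isLittleO {α κ κ' : ℝ} {g e e' : ℕ → ℝ} {G : ellTwo →L[ℂ] ellTwo}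
    (h : HankelData α κ κ' g e e' G) (hα : 0 < α) :
    (fun n : ℕ => posEig G n - tauC α * ((max κ 0) ^ (1 / α) + (max κ' 0) ^ (1 / α)) ^ α *
      (n : ℝ) ^ (-α)) =o[atTop] fun n : ℕ => (n : ℝ) ^ (-α) := by
  have hcnt : ∀ {μ : ℝ}, 0 < μ → cnt α (max κ 0) (max κ' 0) μ = _ := fun hμ =>
    cnt_eq hα (le_max_right κ 0) (le_max_right κ' 0) hμ
  set b := tauC α * ((max κ 0) ^ (1 / α) + (max κ' 0) ^ (1 / α)) ^ α with hb
  have hb0 : 0 ≤ b := by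
    rw [hb, ← cInt_rpow hα]
    have := (cInt_pos hα).le
    have h1 := le_max_right κ 0
    have h2 := le_max_right κ' 0
    positivity
  have hα' : 0 < 1 / α := by positivity
  refine isLittleO_iff.2 fun ε hε => ?_
  have upper : ∀ᶠ n : ℕ in atTop, posEig G n ≤ (b + ε) * (n : ℝ) ^ (-α) := by
    have hμ : 0 < b + ε / 2 := by positivity
    have h1 : cnt α (max κ 0) (max κ' 0) (b + ε / 2) < 1 := by
      rw [hcnt hμ]
      exact Real.rpow_lt_one (by positivity) ((div_lt_one hμ).2 (by linarith)) hα'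
    obtain ⟨x, hx, hx1⟩ := exists_between h1
    set δ := min ((1 - x) / 2) (ε / 2) with hδ
    have hδ0 : 0 < δ := lt_min (by linarith) (by positivity)
    have hδ1 : δ ≤ (1 - x) / 2 := min_le_left _ _
    have hδ2 : δ ≤ ε / 2 := min_le_right _ _
    filter_upwards [h.UB_form hα hμ hx hδ0, eventually_gt_atTop 0] with n h2 hn
    have hn' : (0 : ℝ) < n := by exact_mod_cast hn
    refine (posEig_le G (by positivity) ?_ h2).trans ?_
    · nlinarith
    · exact mul_le_mul_of_nonneg_right (by linarith) (by positivity)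
  have lower : ∀ᶠ n : ℕ in atTop, (b - ε) * (n : ℝ) ^ (-α) ≤ posEig G n := by
    rcases le_or_gt (b - ε / 2) 0 with hb' | hμ
    · filter_upwards [h.neg_le_posEig hα (half_pos hε)] with n h1
      refine le_trans ?_ h1
      gcongr
      linarith
    · have h1 : 1 < cnt α (max κ 0) (max κ' 0) (b - ε / 2) := by
        rw [hcnt hμ]
        exact Real.one_lt_rpow ((one_lt_div hμ).2 (by linarith)) hα'
      obtain ⟨y, hy1, hy⟩ := exists_between h1
      set δ := min (y - 1) (ε / 2) with hδ
      have hδ0 : 0 < δ := lt_min (by linarith) (by positivity)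
      have hδ1 : δ ≤ y - 1 := min_le_left _ _
      have hδ2 : δ ≤ ε / 2 := min_le_right _ _
      filter_upwards [h.LB_form hα hμ hy hδ0, eventually_gt_atTop 0] with n h2 hn
      have hn' : (0 : ℝ) < n := by exact_mod_cast hn
      refine le_trans ?_ (le_posEig G hn ?_ h2)
      · exact mul_le_mul_of_nonneg_right (by linarith) (by positivity)
      · nlinarith
  filter_upwards [upper, lower] with n h1 h2
  rw [Real.norm_eq_abs, Real.norm_of_nonneg (by positivity), abs_le]
  constructor <;> linarith

end HankelEig

/-- Theorem `cr.a3` of the paper.  For a real sequence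
`g(j) = (κ₁ + (-1)^j κ_{-1}) j^{-1} (log j)^{-α} + g̃₁(j) + (-1)^j g̃_{-1}(j)` (for `j ≥ 2`),
with error terms satisfying `g̃_{±1}^{(m)}(j) = o(j^{-1-m} ⟨log j⟩^{-α})` for `m ≤ N(α)`,
the eigenvalues of the discrete Hankel operator `G` obey
`λₙ^±(G) = b^± n^{-α} + o(n^{-α})` with `b^± = τ(α)((κ₁)_±^{1/α} + (κ_{-1})_±^{1/α})^α`. -/
theorem statement13 (α : ℝ) (hα : 0 < α) (κ1 κm1 : ℝ)
    (g e1 em1 : ℕ → ℝ)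
    (hrep : ∀ j : ℕ, 2 ≤ j →
      g j = (κ1 + (-1:ℝ)^j * κm1) * (j:ℝ)⁻¹ * Real.log j ^ (-α) + e1 j + (-1:ℝ)^j * em1 j)
    (he1 : ∀ m : ℕ, m ≤ Nal α →
      (fun j : ℕ => iterDiff e1 m j) =o[atTop]
        fun j : ℕ => (j:ℝ) ^ (-1 - (m:ℝ)) * (1 + Real.log j ^ 2) ^ (-α/2))
    (hem1 : ∀ m : ℕ, m ≤ Nal α →
      (fun j : ℕ => iterDiff em1 m j) =o[atTop]
        fun j : ℕ => (j:ℝ) ^ (-1 - (m:ℝ)) * (1 + Real.log j ^ 2) ^ (-α/2))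
    (G : ellTwo →L[ℂ] ellTwo) (hG : IsHankelD (fun j => ((g j : ℝ) : ℂ)) G)
    (bP bM : ℝ)
    (hbP : bP = tauC α * ((max κ1 0) ^ (1/α) + (max κm1 0) ^ (1/α)) ^ α)
    (hbM : bM = tauC α * ((max (-κ1) 0) ^ (1/α) + (max (-κm1) 0) ^ (1/α)) ^ α) :
    ((fun nn : ℕ => posEig G nn - bP * (nn:ℝ) ^ (-α)) =o[atTop] fun nn : ℕ => (nn:ℝ) ^ (-α)) ∧
    ((fun nn : ℕ => negEig G nn - bM * (nn:ℝ) ^ (-α)) =o[atTop] fun nn : ℕ => (nn:ℝ) ^ (-α)) := by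
  subst hbP hbM
  have h : HankelEig.HankelData α κ1 κm1 g e1 em1 G :=
    ⟨hrep, HankelEig.Cls.of_isLittleO hα he1, HankelEig.Cls.of_isLittleO hα hem1, hG⟩
  exact ⟨h.posEig_isLittleO hα, h.neg.posEig_isLittleO hα⟩
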